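/- Set η = β²(1 + σ). There exist constants C > 0 and ε₀ > 0 such that for every ε ∈ (0, ε₀) and every P = (P₁, …, P_ℓ) ∈ Γ_ε there exist a C² function φ : ℝ^N → ℝ with φ and |∇φ| square-integrable and real numbers α_{in} (1 ≤ i ≤ ℓ, 1 ≤ n ≤ N) such that: (a) ε²Δ(χw_P + φ) − V·(χw_P + φ) + f(χw_P + φ) = Σ_{i,n} α_{in}·Z_{P_i,n} pointwise on ℝ^N; (b) ∫_{ℝ^N} φ·Z_{P_i,n} dx = 0 for all i, n; (c) sup_{ℝ^N}|φ| ≤ C·ε^η; (d) ∫_{ℝ^N}(ε²|∇φ|² + V·φ²)dx ≤ C·ε^{N+2η}; (e) |α_{in}| ≤ C·ε^{1+η} for all i, n. -/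

import Mathlib

open MeasureTheory Filter Set Real

/-- Euclidean space `ℝ^N`. -/
abbrev Euc (N : ℕ) := EuclideanSpace ℝ (Fin N)

/-- The Laplacian on `ℝ^N`, as the sum of second directional derivatives
along the coordinate directions. -/
noncomputable def lap {N : ℕ} (u : Euc N → ℝ) (x : Euc N) : ℝ :=
  ∑ n : Fin N, lineDeriv ℝ (fun y => lineDeriv ℝ u y (EuclideanSpace.single n 1)) x
    (EuclideanSpace.single n 1)

namespace LS

/-- coordinate vector -/
noncomputable def ee {N : ℕ} (n : Fin N) : Euc N := EuclideanSpace.single n 1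

/-- partial derivative -/
noncomputable def pd {N : ℕ} (n : Fin N) (u : Euc N → ℝ) (x : Euc N) : ℝ := fderiv ℝ u x (ee n)

variable {N : ℕ}

lemma ee_apply (n m : Fin N) : (ee n : Euc N) m = if m = n then 1 else 0 := by
  simp [ee]

@[simp] lemma norm_ee (n : Fin N) : ‖(ee n : Euc N)‖ = 1 := by simp [ee]

lemma lineDeriv_eq_pd {u : Euc N → ℝ} {x : Euc N} (hu : DifferentiableAt ℝ u x) (n : Fin N) :
    lineDeriv ℝ u x (EuclideanSpace.single n 1) = pd n u x :=
  hu.lineDeriv_eq_fderiv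

lemma contDiff_pd {k l : WithTop ℕ∞} {u : Euc N → ℝ} (hu : ContDiff ℝ l u) (h : k + 1 ≤ l)
    (n : Fin N) : ContDiff ℝ k (pd n u) :=
  (hu.fderiv_right h).clm_apply contDiff_const

lemma c1_pd {u : Euc N → ℝ} (hu : ContDiff ℝ 2 u) (n : Fin N) : ContDiff ℝ 1 (pd n u) :=
  contDiff_pd hu (by norm_num) n

lemma c0_pd {u : Euc N → ℝ} (hu : ContDiff ℝ 1 u) (n : Fin N) : Continuous (pd n u) :=
  (contDiff_pd (k := 0) hu (by norm_num) n).continuous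

lemma dif1 {u : Euc N → ℝ} (hu : ContDiff ℝ 1 u) : Differentiable ℝ u :=
  hu.differentiable (by norm_num)

lemma dif2 {u : Euc N → ℝ} (hu : ContDiff ℝ 2 u) : Differentiable ℝ u :=
  hu.differentiable (by norm_num)

lemma c21 {u : Euc N → ℝ} (hu : ContDiff ℝ 2 u) : ContDiff ℝ 1 u := hu.of_le (by norm_num)

lemma difpd {u : Euc N → ℝ} (hu : ContDiff ℝ 2 u) (n : Fin N) : Differentiable ℝ (pd n u) :=
  dif1 (c1_pd hu n)

lemma lineDeriv_fun_eq {u : Euc N → ℝ} (hu : Differentiable ℝ u) (n : Fin N) :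
    (fun y => lineDeriv ℝ u y (EuclideanSpace.single n 1)) = pd n u :=
  funext fun y => lineDeriv_eq_pd (hu y) n

lemma lap_eq {u : Euc N → ℝ} (hu : ContDiff ℝ 2 u) (x : Euc N) :
    lap u x = ∑ n, pd n (pd n u) x := by
  unfold lap
  refine Finset.sum_congr rfl fun n _ => ?_
  rw [lineDeriv_fun_eq (dif2 hu) n, lineDeriv_eq_pd (difpd hu n x)]

lemma continuous_lap {u : Euc N → ℝ} (hu : ContDiff ℝ 2 u) : Continuous (lap u) := by
  rw [funext (lap_eq hu)]
  exact continuous_finsetSum _ fun n _ => c0_pd (c1_pd hu n) n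

lemma pd_add {u v : Euc N → ℝ} (hu : Differentiable ℝ u) (hv : Differentiable ℝ v) (n : Fin N) :
    pd n (fun x => u x + v x) = fun x => pd n u x + pd n v x := by
  funext x; unfold pd
  rw [show (fun x => u x + v x) = u + v from rfl, fderiv_add (hu x) (hv x)]; rfl

lemma pd_sub {u v : Euc N → ℝ} (hu : Differentiable ℝ u) (hv : Differentiable ℝ v) (n : Fin N) :
    pd n (fun x => u x - v x) = fun x => pd n u x - pd n v x := by
  funext x; unfold pd
  rw [show (fun x => u x - v x) = u - v from rfl, fderiv_sub (hu x) (hv x)]; rfl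

lemma pd_cmul {u : Euc N → ℝ} (hu : Differentiable ℝ u) (c : ℝ) (n : Fin N) :
    pd n (fun x => c * u x) = fun x => c * pd n u x := by
  funext x; unfold pd
  rw [fderiv_const_mul (hu x)]; rfl

lemma pd_const (c : ℝ) (n : Fin N) : pd n (fun _ : Euc N => c) = fun _ => 0 := by
  funext x; simp [pd]

lemma pd_mul {u v : Euc N → ℝ} (hu : Differentiable ℝ u) (hv : Differentiable ℝ v) (n : Fin N) :
    pd n (fun x => u x * v x) = fun x => u x * pd n v x + pd n u x * v x := by
  funext x; unfold pd
  rw [show (fun x => u x * v x) = u * v from rfl, fderiv_mul (hu x) (hv x)]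
  simp; ring

lemma pd_comp {F : ℝ → ℝ} {u : Euc N → ℝ} (hF : Differentiable ℝ F) (hu : Differentiable ℝ u)
    (n : Fin N) : pd n (fun x => F (u x)) = fun x => deriv F (u x) * pd n u x := by
  funext x; unfold pd
  have := (hF (u x)).hasDerivAt.comp_hasFDerivAt x (hu x).hasFDerivAt
  rw [show (fun x => F (u x)) = F ∘ u from rfl, this.fderiv]; simp

lemma pd_sum {ι : Type*} (s : Finset ι) {u : ι → Euc N → ℝ} (hu : ∀ i, Differentiable ℝ (u i))
    (n : Fin N) : pd n (fun x => ∑ i ∈ s, u i x) = fun x => ∑ i ∈ s, pd n (u i) x := by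
  funext x; unfold pd
  rw [fderiv_fun_sum fun i _ => hu i x]; simp

lemma pd_comp_aff {u : Euc N → ℝ} (hu : Differentiable ℝ u) (a : ℝ) (b : Euc N) (n : Fin N) :
    pd n (fun x => u (a • x + b)) = fun x => a * pd n u (a • x + b) := by
  funext x; unfold pd
  have h1 : HasFDerivAt (fun x : Euc N => a • x + b) (a • ContinuousLinearMap.id ℝ (Euc N)) x :=
    ((hasFDerivAt_id x).const_smul a).add_const b
  have := (hu (a • x + b)).hasFDerivAt.comp x h1
  rw [show (fun x => u (a • x + b)) = u ∘ (fun x : Euc N => a • x + b) from rfl, this.fderiv]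
  simp

lemma lap_add {u v : Euc N → ℝ} (hu : ContDiff ℝ 2 u) (hv : ContDiff ℝ 2 v) (x : Euc N) :
    lap (fun x => u x + v x) x = lap u x + lap v x := by
  rw [lap_eq (hu.add hv), lap_eq hu, lap_eq hv, ← Finset.sum_add_distrib]
  refine Finset.sum_congr rfl fun n _ => ?_
  rw [pd_add (dif2 hu) (dif2 hv), pd_add (difpd hu n) (difpd hv n)]

lemma lap_sub {u v : Euc N → ℝ} (hu : ContDiff ℝ 2 u) (hv : ContDiff ℝ 2 v) (x : Euc N) :
    lap (fun x => u x - v x) x = lap u x - lap v x := by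
  rw [lap_eq (hu.sub hv), lap_eq hu, lap_eq hv, ← Finset.sum_sub_distrib]
  refine Finset.sum_congr rfl fun n _ => ?_
  rw [pd_sub (dif2 hu) (dif2 hv), pd_sub (difpd hu n) (difpd hv n)]

lemma lap_cmul {u : Euc N → ℝ} (hu : ContDiff ℝ 2 u) (c : ℝ) (x : Euc N) :
    lap (fun x => c * u x) x = c * lap u x := by
  rw [lap_eq (contDiff_const.mul hu), lap_eq hu, Finset.mul_sum]
  refine Finset.sum_congr rfl fun n _ => ?_
  rw [pd_cmul (dif2 hu), pd_cmul (difpd hu n)]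

lemma lap_const (c : ℝ) (x : Euc N) : lap (fun _ : Euc N => c) x = 0 := by
  rw [lap_eq contDiff_const]; simp [pd_const]

lemma lap_neg {u : Euc N → ℝ} (hu : ContDiff ℝ 2 u) (x : Euc N) :
    lap (fun x => - u x) x = - lap u x := by
  have := lap_cmul hu (-1) x
  simpa using this

lemma lap_sum {ι : Type*} (s : Finset ι) {u : ι → Euc N → ℝ} (hu : ∀ i, ContDiff ℝ 2 (u i))
    (x : Euc N) : lap (fun x => ∑ i ∈ s, u i x) x = ∑ i ∈ s, lap (u i) x := by
  rw [lap_eq (ContDiff.sum fun i _ => hu i)]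
  simp_rw [fun i => lap_eq (hu i)]
  rw [Finset.sum_comm]
  refine Finset.sum_congr rfl fun n _ => ?_
  rw [pd_sum s (fun i => dif2 (hu i)), pd_sum s (fun i => difpd (hu i) n)]

lemma lap_mul {u v : Euc N → ℝ} (hu : ContDiff ℝ 2 u) (hv : ContDiff ℝ 2 v) (x : Euc N) :
    lap (fun x => u x * v x) x = u x * lap v x + 2 * (∑ n, pd n u x * pd n v x) + lap u x * v x := by
  rw [lap_eq (hu.mul hv), lap_eq hu, lap_eq hv, Finset.mul_sum, Finset.mul_sum, Finset.sum_mul,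
    ← Finset.sum_add_distrib, ← Finset.sum_add_distrib]
  refine Finset.sum_congr rfl fun n _ => ?_
  rw [pd_mul (dif2 hu) (dif2 hv), pd_add (u := fun x => u x * pd n v x) (v := fun x => pd n u x * v x)
    ((dif2 hu).mul (difpd hv n)) ((difpd hu n).mul (dif2 hv)),
    pd_mul (dif2 hu) (difpd hv n), pd_mul (difpd hu n) (dif2 hv)]
  ring

lemma lap_comp {F : ℝ → ℝ} {u : Euc N → ℝ} (hF : ContDiff ℝ 2 F) (hu : ContDiff ℝ 2 u)
    (x : Euc N) : lap (fun x => F (u x)) x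
      = deriv (deriv F) (u x) * (∑ n, pd n u x ^ 2) + deriv F (u x) * lap u x := by
  have hF1 : ContDiff ℝ 1 (deriv F) := by
    have := (contDiff_succ_iff_deriv (n := 1) (f := F)).1 (by simpa [one_add_one_eq_two] using hF)
    exact this.2.2
  rw [lap_eq (show ContDiff ℝ 2 (fun x => F (u x)) from hF.comp hu), lap_eq hu, Finset.mul_sum,
    Finset.mul_sum, ← Finset.sum_add_distrib]
  refine Finset.sum_congr rfl fun n _ => ?_
  have hd := hF1.differentiable (by norm_num)
  rw [pd_comp (hF.differentiable (by norm_num)) (dif2 hu),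
    pd_mul (u := fun x => deriv F (u x)) (hd.comp (dif2 hu)) (difpd hu n),
    pd_comp hd (dif2 hu)]
  ring

lemma contDiff_aff {k : WithTop ℕ∞} {u : Euc N → ℝ} (hu : ContDiff ℝ k u) (a : ℝ) (b : Euc N) :
    ContDiff ℝ k (fun x => u (a • x + b)) :=
  hu.comp (by fun_prop : ContDiff ℝ k fun x : Euc N => a • x + b)

lemma lap_aff {u : Euc N → ℝ} (hu : ContDiff ℝ 2 u) (a : ℝ) (b : Euc N) (x : Euc N) :
    lap (fun x => u (a • x + b)) x = a ^ 2 * lap u (a • x + b) := by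
  rw [lap_eq (contDiff_aff hu a b), lap_eq hu, Finset.mul_sum]
  refine Finset.sum_congr rfl fun n _ => ?_
  rw [pd_comp_aff (dif2 hu), pd_cmul (u := fun x => pd n u (a • x + b)) ((difpd hu n).comp
    (by fun_prop : Differentiable ℝ (fun x : Euc N => a • x + b))), pd_comp_aff (difpd hu n)]
  ring

lemma abs_pd_le (u : Euc N → ℝ) (x : Euc N) (n : Fin N) : |pd n u x| ≤ ‖fderiv ℝ u x‖ := by
  have := (fderiv ℝ u x).le_opNorm (ee n)
  simpa [pd] using this

lemma vec_eq_sum (v : Euc N) : v = ∑ n, v n • ee n := by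
  ext m
  simp [ee_apply]

lemma fderiv_apply_eq (u : Euc N → ℝ) (x v : Euc N) : fderiv ℝ u x v = ∑ n, v n * pd n u x := by
  conv_lhs => rw [vec_eq_sum v]
  simp [pd]

lemma norm_fderiv_sq (u : Euc N → ℝ) (x : Euc N) : ‖fderiv ℝ u x‖ ^ 2 = ∑ n, pd n u x ^ 2 := by
  set g : Euc N := WithLp.toLp 2 (fun n => pd n u x) with hg
  have h1 : fderiv ℝ u x = innerSL ℝ g := by
    ext v
    rw [fderiv_apply_eq]
    simp [hg, PiLp.inner_apply]
  rw [h1, innerSL_apply_norm, EuclideanSpace.norm_sq_eq]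
  simp [hg]

lemma norm_fderiv_le (u : Euc N → ℝ) (x : Euc N) : ‖fderiv ℝ u x‖ ≤ ∑ n, |pd n u x| := by
  refine ContinuousLinearMap.opNorm_le_bound _ (by positivity) fun v => ?_
  rw [fderiv_apply_eq, Finset.sum_mul]
  refine (Finset.abs_sum_le_sum_abs _ _).trans (Finset.sum_le_sum fun n _ => ?_)
  rw [abs_mul, mul_comm]
  gcongr
  exact PiLp.norm_apply_le v n

lemma pd_normsq (n : Fin N) : pd n (fun x : Euc N => ‖x‖ ^ 2) = fun x => 2 * x n := by
  funext x; unfold pd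
  have h := (hasStrictFDerivAt_norm_sq x).hasFDerivAt
  rw [h.fderiv]
  simp [ee, EuclideanSpace.inner_single_right]

lemma pd_coord (n m : Fin N) : pd n (fun x : Euc N => x m) = fun _ => if m = n then 1 else 0 := by
  funext x; unfold pd
  have h : HasFDerivAt (fun x : Euc N => x m) (EuclideanSpace.proj m : Euc N →L[ℝ] ℝ) x :=
    (EuclideanSpace.proj m : Euc N →L[ℝ] ℝ).hasFDerivAt
  rw [h.fderiv]
  simp [ee_apply]

lemma contDiff_coord {k : WithTop ℕ∞} (m : Fin N) : ContDiff ℝ k (fun x : Euc N => x m) :=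
  (EuclideanSpace.proj m : Euc N →L[ℝ] ℝ).contDiff

lemma lap_coord (m : Fin N) (x : Euc N) : lap (fun x : Euc N => x m) x = 0 := by
  rw [lap_eq (contDiff_coord m)]
  simp only [pd_coord, pd_const, Finset.sum_const_zero]

lemma lap_coordsq (m : Fin N) (x : Euc N) : lap (fun x : Euc N => x m ^ 2) x = 2 := by
  have h := lap_mul (contDiff_coord m) (contDiff_coord m) x
  simp only [← pow_two] at h
  rw [h, lap_coord]
  simp [pd_coord]

lemma contDiff_normsq {k : WithTop ℕ∞} : ContDiff ℝ k (fun x : Euc N => ‖x‖ ^ 2) :=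
  contDiff_norm_sq ℝ

lemma lap_normsq (x : Euc N) : lap (fun x : Euc N => ‖x‖ ^ 2) x = 2 * N := by
  rw [lap_eq contDiff_normsq]
  simp_rw [pd_normsq]
  have : ∀ n : Fin N, pd n (fun x : Euc N => 2 * x n) x = 2 := fun n => by
    rw [pd_cmul ((contDiff_coord (k := 1) n).differentiable (by norm_num)), pd_coord]; simp
  simp [this]; ring

/-- Second order necessary condition. -/
lemma lap_nonpos_of_isLocalMax {u : Euc N → ℝ} (hu : ContDiff ℝ 2 u) {x : Euc N}
    (hx : IsLocalMax u x) : lap u x ≤ 0 := by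
  rw [lap_eq hu]
  refine Finset.sum_nonpos fun n _ => ?_
  set g : ℝ → ℝ := fun t => u (x + t • ee n) with hg
  have hline : ∀ t : ℝ, HasDerivAt (fun t : ℝ => x + t • (ee n : Euc N)) (ee n) t := fun t => by
    simpa using ((hasDerivAt_id t).smul_const (ee n : Euc N)).const_add x
  have hd : ∀ v : Euc N → ℝ, Differentiable ℝ v → ∀ t,
      HasDerivAt (fun t : ℝ => v (x + t • ee n)) (pd n v (x + t • ee n)) t := fun v hv t =>
    (hv (x + t • ee n)).hasFDerivAt.comp_hasDerivAt t (hline t)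
  have hg1 : deriv g = fun t => pd n u (x + t • ee n) := funext fun t => (hd u (dif2 hu) t).deriv
  have hg2 : deriv (deriv g) 0 = pd n (pd n u) x := by
    rw [hg1, (hd _ (difpd hu n) 0).deriv]; simp
  have hcont : ContinuousAt (fun t : ℝ => x + t • (ee n : Euc N)) 0 := (hline 0).continuousAt
  have hmax : IsLocalMax g 0 := by
    have : Tendsto (fun t : ℝ => x + t • (ee n : Euc N)) (nhds 0) (nhds x) := by
      simpa [ContinuousAt] using hcont
    have h2 := this.eventually hx
    filter_upwards [h2] with t ht
    simpa [hg] using ht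
  rw [← hg2]
  by_contra! hpos
  have hmin := isLocalMin_of_deriv_deriv_pos hpos hmax.deriv_eq_zero (hd u (dif2 hu) 0).continuousAt
  have hconst : g =ᶠ[nhds 0] fun _ => g 0 := by
    filter_upwards [hmax, hmin] with t h1 h2 using le_antisymm h1 h2
  have h3 : deriv g =ᶠ[nhds 0] deriv (fun _ => g 0) := hconst.deriv
  have h4 := h3.deriv_eq
  simp at h4
  linarith

end LS

namespace LS

variable {N : ℕ}

/-- Maximum principle on the whole space. -/
lemma mp {u : Euc N → ℝ} (hu : ContDiff ℝ 2 u) {B : ℝ} (hB : ∀ x, u x ≤ B) {c m : ℝ} (hc : 0 < c)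
    (h : ∀ x, m < u x → c * (u x - m) ≤ lap u x) (x : Euc N) : u x ≤ m := by
  by_contra! hx
  set a := u x - m with ha
  have ha0 : 0 < a := by linarith
  set δ := min (a / (2 * (‖x‖ ^ 2 + 1))) (c * a / (8 * (N + 1))) with hδ
  have hδ0 : 0 < δ := by positivity
  have h1 : δ * ‖x‖ ^ 2 ≤ a / 2 := by
    have : δ ≤ a / (2 * (‖x‖ ^ 2 + 1)) := min_le_left _ _
    rw [le_div_iff₀ (by positivity)] at this
    nlinarith
  have h2 : δ * (2 * N) < c * (a / 2) := by
    have : δ ≤ c * a / (8 * (N + 1)) := min_le_right _ _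
    rw [le_div_iff₀ (by positivity)] at this
    have : 0 < c * a := by positivity
    nlinarith
  set v : Euc N → ℝ := fun y => u y - δ * ‖y‖ ^ 2 with hv
  have hvc : ContDiff ℝ 2 v := hu.sub (contDiff_const.mul contDiff_normsq)
  have hlim : Tendsto v (cocompact (Euc N)) atBot := by
    have h3 : Tendsto (fun y : Euc N => B - δ * ‖y‖ ^ 2) (cocompact (Euc N)) atBot := by
      have h4 : Tendsto (fun y : Euc N => δ * ‖y‖ ^ 2) (cocompact (Euc N)) atTop :=
        ((tendsto_pow_atTop (by norm_num : (2:ℕ) ≠ 0)).comp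
          (tendsto_norm_cocompact_atTop (E := Euc N))).const_mul_atTop hδ0
      simpa [sub_eq_add_neg] using tendsto_atBot_add_const_left _ B (tendsto_neg_atTop_atBot.comp h4)
    exact tendsto_atBot_mono (fun y => by simp only [hv]; linarith [hB y]) h3
  obtain ⟨z, hz⟩ := hvc.continuous.exists_forall_ge hlim
  have hzx := hz x
  have hl : lap v z ≤ 0 := lap_nonpos_of_isLocalMax hvc (Filter.Eventually.of_forall hz)
  rw [hv, lap_sub hu (contDiff_const.mul contDiff_normsq), lap_cmul contDiff_normsq, lap_normsq] at hl
  simp only [hv] at hzx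
  have hδz : 0 ≤ δ * ‖z‖ ^ 2 := by positivity
  have huz : a / 2 ≤ u z - m := by linarith
  have := h z (by linarith)
  nlinarith

/-- reflection in the coordinate `n` -/
noncomputable def rf (n : Fin N) : Euc N →L[ℝ] Euc N :=
  ContinuousLinearMap.id ℝ (Euc N) -
    (2:ℝ) • ((EuclideanSpace.proj n : Euc N →L[ℝ] ℝ).smulRight (ee n : Euc N))

lemma rf_apply (n : Fin N) (x : Euc N) (m : Fin N) : rf n x m = if m = n then - x m else x m := by
  have : rf n x = x - (2:ℝ) • (x n • (ee n : Euc N)) := rfl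
  rw [this]
  simp only [PiLp.sub_apply, PiLp.smul_apply, ee_apply, smul_eq_mul]
  split_ifs with h
  · subst h; ring
  · ring

lemma rf_ee (n m : Fin N) : rf n (ee m : Euc N) = (if m = n then (-1:ℝ) else 1) • (ee m : Euc N) := by
  ext k
  rw [rf_apply]
  simp only [ee_apply, PiLp.smul_apply, smul_eq_mul]
  split_ifs <;> simp_all

lemma norm_rf (n : Fin N) (x : Euc N) : ‖rf n x‖ = ‖x‖ := by
  rw [EuclideanSpace.norm_eq, EuclideanSpace.norm_eq]
  congr 1
  refine Finset.sum_congr rfl fun m _ => ?_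
  rw [rf_apply]; split_ifs <;> simp

lemma pd_rf {u : Euc N → ℝ} (hu : Differentiable ℝ u) (n m : Fin N) :
    pd m (fun x => u (rf n x)) = fun x => (if m = n then (-1:ℝ) else 1) * pd m u (rf n x) := by
  funext x; unfold pd
  have := (hu (rf n x)).hasFDerivAt.comp x (rf n : Euc N →L[ℝ] Euc N).hasFDerivAt
  rw [show (fun x => u (rf n x)) = u ∘ rf n from rfl, this.fderiv]
  simp only [ContinuousLinearMap.comp_apply, rf_ee, map_smul, smul_eq_mul]

lemma contDiff_rf {k : WithTop ℕ∞} {u : Euc N → ℝ} (hu : ContDiff ℝ k u) (n : Fin N) :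
    ContDiff ℝ k (fun x => u (rf n x)) := hu.comp (rf n : Euc N →L[ℝ] Euc N).contDiff

lemma lap_rf {u : Euc N → ℝ} (hu : ContDiff ℝ 2 u) (n : Fin N) (x : Euc N) :
    lap (fun x => u (rf n x)) x = lap u (rf n x) := by
  rw [lap_eq (contDiff_rf hu n), lap_eq hu]
  refine Finset.sum_congr rfl fun m _ => ?_
  rw [pd_rf (dif2 hu), pd_cmul (u := fun x => pd m u (rf n x))
    (dif1 (contDiff_rf (c1_pd hu m) n)), pd_rf (difpd hu m)]
  split_ifs <;> simp

/-- pd as a one-sided derivative bound -/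
lemma pd_le_of_right {v : Euc N → ℝ} (hv : Differentiable ℝ v) (n : Fin N) {d e : ℝ}
    (h0 : v 0 = 0) (h : ∀ t ∈ Ioo (0:ℝ) 1, v (t • ee n) ≤ d * t + e * t ^ 2) : pd n v 0 ≤ d := by
  have hd : HasDerivAt (fun t : ℝ => v (t • ee n)) (pd n v 0) 0 := by
    have hl : HasDerivAt (fun t : ℝ => t • (ee n : Euc N)) (ee n) 0 := by
      simpa using (hasDerivAt_id (0:ℝ)).smul_const (ee n : Euc N)
    have := (hv ((0:ℝ) • ee n)).hasFDerivAt.comp_hasDerivAt 0 hl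
    simp only [zero_smul] at this
    exact this
  have hs := (hasDerivAt_iff_tendsto_slope.1 hd).mono_left
    (nhdsWithin_mono 0 (fun t (ht : t ∈ Ioi (0:ℝ)) => ne_of_gt ht))
  have hr : Tendsto (fun t : ℝ => d + e * t) (nhdsWithin 0 (Ioi 0)) (nhds d) := by
    have : Tendsto (fun t : ℝ => d + e * t) (nhds 0) (nhds (d + e * 0)) := by
      apply Continuous.tendsto; fun_prop
    simpa using this.mono_left nhdsWithin_le_nhds
  refine le_of_tendsto_of_tendsto hs hr ?_
  have : Ioo (0:ℝ) 1 ∈ nhdsWithin (0:ℝ) (Ioi 0) := Ioo_mem_nhdsGT one_pos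
  filter_upwards [this] with t ht
  rw [slope_def_field]
  simp only [zero_smul, h0, sub_zero]
  rw [div_le_iff₀ ht.1]
  have := h t ht
  nlinarith

lemma grad0 {u : Euc N → ℝ} (hu : ContDiff ℝ 2 u) {M F : ℝ}
    (hM : ∀ x, ‖x‖ ≤ 1 → |u x| ≤ M) (hF : ∀ x, ‖x‖ ≤ 1 → |lap u x| ≤ F) (n : Fin N) :
    pd n u 0 ≤ N * M + F / 2 := by
  have hM0 : 0 ≤ M := (abs_nonneg _).trans (hM 0 (by simp))
  have hF0 : 0 ≤ F := (abs_nonneg _).trans (hF 0 (by simp))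
  refine le_of_forall_gt_imp_ge_of_dense fun d hd => ?_
  have hd0 : 0 < d := lt_of_le_of_lt (by positivity) hd
  set φ : Euc N → ℝ := fun x => (1/2) * (u x - u (rf n x)) with hφ
  set ψ : Euc N → ℝ := fun x => M * ‖x‖ ^ 2 + (d * x n - d * x n ^ 2) with hψ
  have hur := contDiff_rf hu n
  have hφc : ContDiff ℝ 2 φ := contDiff_const.mul (hu.sub hur)
  have hc1 : ContDiff ℝ 2 (fun x : Euc N => d * x n) := contDiff_const.mul (contDiff_coord n)
  have hc2 : ContDiff ℝ 2 (fun x : Euc N => x n ^ 2) := (contDiff_coord n).pow 2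
  have hc2' : ContDiff ℝ 2 (fun x : Euc N => d * x n ^ 2) := contDiff_const.mul hc2
  have hc3 : ContDiff ℝ 2 (fun x : Euc N => M * ‖x‖ ^ 2) := contDiff_const.mul contDiff_normsq
  have hψc : ContDiff ℝ 2 ψ := hc3.add (hc1.sub hc2')
  have hlφ : ∀ x, lap φ x = (1/2) * (lap u x - lap u (rf n x)) := fun x => by
    rw [hφ, lap_cmul (hu.sub hur), lap_sub hu hur, lap_rf hu]
  have hlψ : ∀ x, lap ψ x = 2 * N * M - 2 * d := fun x => by
    rw [hψ, lap_add hc3 (hc1.sub hc2'), lap_sub hc1 hc2', lap_cmul contDiff_normsq, lap_normsq,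
      lap_cmul (contDiff_coord n), lap_coord, lap_cmul hc2, lap_coordsq]; ring
  set D : Set (Euc N) := Metric.closedBall 0 1 ∩ {x | 0 ≤ x n} with hD
  have hcoord : Continuous (fun x : Euc N => x n) := (contDiff_coord (k := 0) n).continuous
  have hDc : IsCompact D := (isCompact_closedBall 0 1).inter_right (isClosed_le continuous_const hcoord)
  have key : ∀ x ∈ D, φ x ≤ ψ x := by
    obtain ⟨z, hz, hmax⟩ := hDc.exists_isMaxOn ⟨0, by simp [hD]⟩
      (hφc.sub hψc).continuous.continuousOn
    have hz1 : ‖z‖ ≤ 1 := by simpa using hz.1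
    have hz2 : 0 ≤ z n := hz.2
    have hzn : z n ≤ 1 := (le_abs_self _).trans ((PiLp.norm_apply_le z n).trans hz1)
    have hzval : φ z ≤ ψ z := by
      rcases hz2.eq_or_lt with h0 | hpos
      · have : rf n z = z := by
          ext m; rw [rf_apply]; split_ifs with hm
          · subst hm; rw [← h0]; simp
          · rfl
        simp only [hφ, hψ, this, ← h0]
        simp; positivity
      rcases hz1.eq_or_lt with h1 | hlt
      · have a1 := (abs_le.1 (hM z hz1)).2
        have a2 := (abs_le.1 (hM (rf n z) (by rw [norm_rf]; exact hz1))).1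
        simp only [hφ, hψ, h1]
        nlinarith [mul_nonneg (mul_nonneg hd0.le hz2) (sub_nonneg.2 hzn)]
      · exfalso
        have hnh : D ∈ nhds z := by
          refine inter_mem (Metric.closedBall_mem_nhds_of_mem (by simpa using hlt)) ?_
          exact mem_of_superset ((isOpen_lt continuous_const hcoord).mem_nhds hpos)
            (fun y (hy : 0 < y n) => hy.le)
        have := lap_nonpos_of_isLocalMax (hφc.sub hψc) (hmax.isLocalMax hnh)
        have e : lap (φ - ψ) z = lap φ z - lap ψ z := lap_sub hφc hψc z
        have e' : lap (fun x => φ x - ψ x) z = lap φ z - lap ψ z := lap_sub hφc hψc z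
        rw [e', hlφ, hlψ] at this
        have a1 := (abs_le.1 (hF z hz1)).1
        have a2 := (abs_le.1 (hF (rf n z) (by rw [norm_rf]; exact hz1))).2
        linarith
    intro x hx
    have h3 : φ x - ψ x ≤ φ z - ψ z := hmax hx
    linarith
  have hpd : pd n φ 0 = pd n u 0 := by
    rw [hφ, pd_cmul (dif2 (hu.sub hur)), pd_sub (dif2 hu) (dif2 hur), pd_rf (dif2 hu)]
    simp; ring
  rw [← hpd]
  refine pd_le_of_right (e := M - d) (dif2 hφc) n (by simp [hφ]) fun t ht => ?_
  have hmem : t • (ee n : Euc N) ∈ D := by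
    refine ⟨?_, ?_⟩
    · simp [norm_smul, abs_of_pos ht.1, ht.2.le]
    · simp [ee_apply, ht.1.le]
  refine (key _ hmem).trans (le_of_eq ?_)
  simp [hψ, norm_smul, ee_apply]; ring

/-- Gradient estimate. -/
lemma grad_est {u : Euc N → ℝ} (hu : ContDiff ℝ 2 u) {M F r : ℝ} (hr : 0 < r) (x₀ : Euc N)
    (hM : ∀ x, ‖x - x₀‖ ≤ r → |u x| ≤ M) (hF : ∀ x, ‖x - x₀‖ ≤ r → |lap u x| ≤ F) (n : Fin N) :
    |pd n u x₀| ≤ N * M / r + r * F / 2 := by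
  have hb : ∀ x : Euc N, ‖x‖ ≤ 1 → ‖(r • x + x₀) - x₀‖ ≤ r := fun x hx => by
    simp only [add_sub_cancel_right, norm_smul, Real.norm_eq_abs, abs_of_pos hr]
    nlinarith
  have main : ∀ v : Euc N → ℝ, ContDiff ℝ 2 v → (∀ x, ‖x - x₀‖ ≤ r → |v x| ≤ M) →
      (∀ x, ‖x - x₀‖ ≤ r → |lap v x| ≤ F) → pd n v x₀ ≤ N * M / r + r * F / 2 := by
    intro v hv h1 h2
    have := grad0 (contDiff_aff hv r x₀) (M := M) (F := r ^ 2 * F) (fun x hx => h1 _ (hb x hx))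
      (fun x hx => by
        rw [lap_aff hv, abs_mul, abs_of_pos (by positivity : 0 < r ^ 2)]
        exact mul_le_mul_of_nonneg_left (h2 _ (hb x hx)) (by positivity)) n
    rw [pd_comp_aff (dif2 hv)] at this
    simp only [smul_zero, zero_add] at this
    have e : N * M / r + r * F / 2 = (N * M + r ^ 2 * F / 2) / r := by field_simp
    rw [e, le_div_iff₀ hr]; linarith
  rw [abs_le]
  constructor
  · have := main (fun x => - u x) hu.neg (fun x hx => by simpa using hM x hx)
      (fun x hx => by rw [lap_neg hu]; simpa using hF x hx)
    have e : pd n (fun x => - u x) x₀ = - pd n u x₀ := by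
      have := congrFun (pd_cmul (dif2 hu) (-1) n) x₀
      simpa using this
    rw [e] at this; linarith
  · exact main u hu hM hF

/-- mean value bound in a coordinate direction -/
lemma diff_le {g : Euc N → ℝ} (hg : Differentiable ℝ g) (n : Fin N) (x : Euc N) {h G : ℝ}
    (hG : ∀ t : ℝ, |t| ≤ |h| → |pd n g (x + t • ee n)| ≤ G) :
    |g (x + h • ee n) - g x| ≤ G * |h| := by
  have hl : ∀ t : ℝ, HasDerivAt (fun t : ℝ => g (x + t • (ee n : Euc N))) (pd n g (x + t • ee n)) t := by
    intro t
    have : HasDerivAt (fun t : ℝ => x + t • (ee n : Euc N)) (ee n) t := by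
      simpa using ((hasDerivAt_id t).smul_const (ee n : Euc N)).const_add x
    exact (hg (x + t • ee n)).hasFDerivAt.comp_hasDerivAt t this
  have := (convex_Icc (-|h|) |h|).norm_image_sub_le_of_norm_hasDerivWithin_le (C := G)
    (fun t _ => (hl t).hasDerivWithinAt) (fun t ht => hG t (abs_le.2 ht))
    (x := 0) (y := h) ⟨by simp, by simp⟩ ⟨neg_abs_le h, le_abs_self h⟩
  simpa using this

lemma hasDerivAt_line {g : Euc N → ℝ} (hg : Differentiable ℝ g) (n : Fin N) (x : Euc N) (t : ℝ) :
    HasDerivAt (fun t : ℝ => g (x + t • (ee n : Euc N))) (pd n g (x + t • ee n)) t := by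
  have : HasDerivAt (fun t : ℝ => x + t • (ee n : Euc N)) (ee n) t := by
    simpa using ((hasDerivAt_id t).smul_const (ee n : Euc N)).const_add x
  exact (hg (x + t • ee n)).hasFDerivAt.comp_hasDerivAt t this

/-- Hessian estimate. -/
lemma hess_est {u : Euc N → ℝ} (hu : ContDiff ℝ 2 u) (hl : ContDiff ℝ 1 (lap u)) {M F r : ℝ}
    (hr : 0 < r) (x₀ : Euc N) (n m : Fin N)
    (hM : ∀ x, ‖x - x₀‖ ≤ 2 * r → |pd n u x| ≤ M)
    (hF : ∀ x, ‖x - x₀‖ ≤ 2 * r → |pd n (lap u) x| ≤ F) :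
    |pd n (pd m u) x₀| ≤ N * M / r + r * F / 2 := by
  have hd := hasDerivAt_line (difpd hu m) n x₀ 0
  simp only [zero_smul, add_zero] at hd
  have hs := (hasDerivAt_iff_tendsto_slope.1 hd).abs
  refine le_of_tendsto hs ?_
  have hmem : Ioo (-r) r \ {0} ∈ nhdsWithin (0:ℝ) {0}ᶜ :=
    inter_mem (mem_nhdsWithin_of_mem_nhds (Ioo_mem_nhds (by linarith) hr)) self_mem_nhdsWithin
  filter_upwards [hmem] with h hh
  have hh0 : h ≠ 0 := hh.2
  have hhr : |h| ≤ r := abs_le.2 ⟨hh.1.1.le, hh.1.2.le⟩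
  have hhp : 0 < |h| := abs_pos.2 hh0
  set q : Euc N → ℝ := fun x => h⁻¹ * (u ((1:ℝ) • x + h • ee n) - u x) with hq
  have hus := contDiff_aff hu 1 (h • (ee n : Euc N))
  have hqc : ContDiff ℝ 2 q := contDiff_const.mul (hus.sub hu)
  have hball : ∀ x : Euc N, ‖x - x₀‖ ≤ r → ∀ t : ℝ, |t| ≤ |h| → ‖(x + t • ee n) - x₀‖ ≤ 2 * r := by
    intro x hx t ht
    have : (x + t • ee n) - x₀ = (x - x₀) + t • ee n := by abel
    rw [this]
    refine (norm_add_le _ _).trans ?_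
    rw [norm_smul, norm_ee, mul_one, Real.norm_eq_abs]; linarith
  have gq := grad_est hqc hr x₀ (M := M) (F := F) (fun x hx => by
      have := diff_le (dif2 hu) n x (h := h) (fun t ht => hM _ (hball x hx t ht))
      simp only [hq, one_smul, abs_mul, abs_inv]
      rw [inv_mul_le_iff₀ hhp]; linarith) (fun x hx => by
      have := diff_le (dif1 hl) n x (h := h) (fun t ht => hF _ (hball x hx t ht))
      rw [hq, lap_cmul (hus.sub hu), lap_sub hus hu, lap_aff hu]
      simp only [one_smul, abs_mul, abs_inv, one_pow, one_mul]
      rw [inv_mul_le_iff₀ hhp]; linarith) m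
  have e : pd m q x₀ = slope (fun t : ℝ => pd m u (x₀ + t • ee n)) 0 h := by
    rw [hq, pd_cmul (dif2 (hus.sub hu)), pd_sub (dif2 hus) (dif2 hu), pd_comp_aff (dif2 hu),
      slope_def_field]
    simp; field_simp
  rw [← e]; exact gq

end LS

namespace LS

variable {N : ℕ}

/-- locally uniformly Cauchy -/
def LUC (F : ℕ → Euc N → ℝ) : Prop :=
  ∀ R δ : ℝ, 0 < δ → ∃ K, ∀ k ≥ K, ∀ l ≥ K, ∀ x, ‖x‖ ≤ R → |F k x - F l x| ≤ δ

/-- locally uniform convergence -/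
def LUT (F : ℕ → Euc N → ℝ) (G : Euc N → ℝ) : Prop :=
  ∀ R δ : ℝ, 0 < δ → ∃ K, ∀ k ≥ K, ∀ x, ‖x‖ ≤ R → |F k x - G x| ≤ δ

lemma LUT.luc {F : ℕ → Euc N → ℝ} {G : Euc N → ℝ} (h : LUT F G) : LUC F := by
  intro R δ hδ
  obtain ⟨K, hK⟩ := h R (δ / 2) (by positivity)
  refine ⟨K, fun k hk l hl x hx => ?_⟩
  have h1 := abs_le.1 (hK k hk x hx)
  have h2 := abs_le.1 (hK l hl x hx)
  rw [abs_le]; constructor <;> linarith [h1.1, h1.2, h2.1, h2.2]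

lemma LUT.tendsto {F : ℕ → Euc N → ℝ} {G : Euc N → ℝ} (h : LUT F G) (x : Euc N) :
    Tendsto (fun k => F k x) atTop (nhds (G x)) := by
  rw [Metric.tendsto_atTop]
  intro δ hδ
  obtain ⟨K, hK⟩ := h ‖x‖ (δ / 2) (by positivity)
  exact ⟨K, fun k hk => by rw [Real.dist_eq]; linarith [hK k hk x le_rfl]⟩

lemma LUC.exists_lim {F : ℕ → Euc N → ℝ} (h : LUC F) : ∃ G, LUT F G := by
  have hc : ∀ x, ∃ g, Tendsto (fun k => F k x) atTop (nhds g) := fun x => by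
    refine cauchySeq_tendsto_of_complete (Metric.cauchySeq_iff.2 fun δ hδ => ?_)
    obtain ⟨K, hK⟩ := h ‖x‖ (δ / 2) (by positivity)
    exact ⟨K, fun k hk l hl => by rw [Real.dist_eq]; linarith [hK k hk l hl x le_rfl]⟩
  choose G hG using hc
  refine ⟨G, fun R δ hδ => ?_⟩
  obtain ⟨K, hK⟩ := h R δ hδ
  refine ⟨K, fun k hk x hx => ?_⟩
  refine le_of_tendsto ((tendsto_const_nhds.sub (hG x)).abs) ?_
  filter_upwards [eventually_ge_atTop K] with l hl using hK k hk l hl x hx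

lemma LUC.lut {F : ℕ → Euc N → ℝ} (h : LUC F) {G : Euc N → ℝ}
    (hG : ∀ x, Tendsto (fun k => F k x) atTop (nhds (G x))) : LUT F G := by
  obtain ⟨G', hG'⟩ := h.exists_lim
  have : G = G' := funext fun x => tendsto_nhds_unique (hG x) (hG'.tendsto x)
  rw [this]; exact hG'

lemma LUT.continuous {F : ℕ → Euc N → ℝ} {G : Euc N → ℝ} (h : LUT F G)
    (hF : ∀ k, Continuous (F k)) : Continuous G := by
  have : TendstoLocallyUniformly F G atTop := by
    rw [Metric.tendstoLocallyUniformly_iff]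
    intro δ hδ x
    obtain ⟨K, hK⟩ := h (‖x‖ + 1) (δ / 2) (by positivity)
    refine ⟨Metric.ball x 1, Metric.ball_mem_nhds x one_pos, ?_⟩
    filter_upwards [eventually_ge_atTop K] with k hk y hy
    have : ‖y‖ ≤ ‖x‖ + 1 := by
      have h1 : ‖y - x‖ < 1 := by simpa [dist_eq_norm] using hy
      have := norm_le_norm_add_norm_sub' y x
      linarith
    rw [dist_comm, Real.dist_eq]; linarith [hK k hk y this]
  exact this.continuous (Frequently.of_forall hF)

lemma LUC.const (g : Euc N → ℝ) : LUC (fun _ => g) := fun R δ hδ => ⟨0, by simp [hδ.le]⟩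

lemma LUC.add {F G : ℕ → Euc N → ℝ} (hF : LUC F) (hG : LUC G) : LUC (fun k x => F k x + G k x) := by
  intro R δ hδ
  obtain ⟨K, hK⟩ := hF R (δ / 2) (by positivity)
  obtain ⟨L, hL⟩ := hG R (δ / 2) (by positivity)
  refine ⟨max K L, fun k hk l hl x hx => ?_⟩
  have h1 := abs_le.1 (hK k (le_of_max_le_left hk) l (le_of_max_le_left hl) x hx)
  have h2 := abs_le.1 (hL k (le_of_max_le_right hk) l (le_of_max_le_right hl) x hx)
  rw [abs_le]; constructor <;> linarith [h1.1, h1.2, h2.1, h2.2]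

lemma LUC.neg {F : ℕ → Euc N → ℝ} (hF : LUC F) : LUC (fun k x => - F k x) := by
  intro R δ hδ
  obtain ⟨K, hK⟩ := hF R δ hδ
  refine ⟨K, fun k hk l hl x hx => ?_⟩
  have := hK l hl k hk x hx
  rwa [show - F k x - - F l x = F l x - F k x by ring]

lemma LUC.sub {F G : ℕ → Euc N → ℝ} (hF : LUC F) (hG : LUC G) : LUC (fun k x => F k x - G k x) := by
  simpa [sub_eq_add_neg] using hF.add hG.neg

lemma LUC.bdd {F : ℕ → Euc N → ℝ} (hF : LUC F) (hc : ∀ k, Continuous (F k)) (R : ℝ) :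
    ∃ B, 0 ≤ B ∧ ∃ K, ∀ k ≥ K, ∀ x, ‖x‖ ≤ R → |F k x| ≤ B := by
  obtain ⟨K, hK⟩ := hF R 1 one_pos
  obtain ⟨B, hB⟩ := (isCompact_closedBall (0 : Euc N) R).exists_bound_of_continuousOn
    (hc K).continuousOn
  refine ⟨max B 0 + 1, by positivity, K, fun k hk x hx => ?_⟩
  have h1 := hB x (by simpa using hx)
  have h2 := hK k hk K le_rfl x hx
  rw [Real.norm_eq_abs] at h1
  have := abs_sub_abs_le_abs_sub (F k x) (F K x)
  linarith [le_max_left B 0]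

lemma LUC.mul {F G : ℕ → Euc N → ℝ} (hF : LUC F) (hG : LUC G) (hFc : ∀ k, Continuous (F k))
    (hGc : ∀ k, Continuous (G k)) : LUC (fun k x => F k x * G k x) := by
  intro R δ hδ
  obtain ⟨A, hA, K1, hK1⟩ := hF.bdd hFc R
  obtain ⟨B, hB, K2, hK2⟩ := hG.bdd hGc R
  obtain ⟨K, hK⟩ := hF R (δ / (2 * (B + 1))) (by positivity)
  obtain ⟨L, hL⟩ := hG R (δ / (2 * (A + 1))) (by positivity)
  refine ⟨max (max K1 K2) (max K L), fun k hk l hl x hx => ?_⟩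
  simp only [ge_iff_le, max_le_iff] at hk hl
  have a := hK k hk.2.1 l hl.2.1 x hx
  have b := hL k hk.2.2 l hl.2.2 x hx
  have c := hK1 k hk.1.1 x hx
  have d := hK2 l hl.1.2 x hx
  have e : F k x * G k x - F l x * G l x = F k x * (G k x - G l x) + (F k x - F l x) * G l x := by
    ring
  rw [e]
  refine (abs_add_le _ _).trans ?_
  rw [abs_mul, abs_mul]
  have h1 : |F k x| * |G k x - G l x| ≤ A * (δ / (2 * (A + 1))) :=
    mul_le_mul c b (abs_nonneg _) hA
  have h2 : |F k x - F l x| * |G l x| ≤ (δ / (2 * (B + 1))) * B :=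
    mul_le_mul a d (abs_nonneg _) (by positivity)
  have h3 : A * (δ / (2 * (A + 1))) ≤ δ / 2 := by
    rw [mul_div_assoc', div_le_div_iff₀ (by positivity) (by positivity)]; nlinarith
  have h4 : (δ / (2 * (B + 1))) * B ≤ δ / 2 := by
    rw [div_mul_eq_mul_div, div_le_div_iff₀ (by positivity) (by positivity)]; nlinarith
  linarith

lemma fderiv_eq_sum (u : Euc N → ℝ) (x : Euc N) :
    fderiv ℝ u x = ∑ n, pd n u x • (EuclideanSpace.proj n : Euc N →L[ℝ] ℝ) := by
  ext v
  rw [fderiv_apply_eq]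
  simp only [_root_.sum_apply]
  refine Finset.sum_congr rfl fun n _ => ?_
  exact mul_comm _ _

lemma norm_sum_proj_le (a : Fin N → ℝ) :
    ‖∑ n, a n • (EuclideanSpace.proj n : Euc N →L[ℝ] ℝ)‖ ≤ ∑ n, |a n| := by
  refine ContinuousLinearMap.opNorm_le_bound _ (by positivity) fun v => ?_
  have : (∑ n, a n • (EuclideanSpace.proj n : Euc N →L[ℝ] ℝ)) v = ∑ n, a n * v n := by
    simp only [_root_.sum_apply]; rfl
  rw [this, Finset.sum_mul]
  refine (Finset.abs_sum_le_sum_abs _ _).trans (Finset.sum_le_sum fun n _ => ?_)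
  rw [abs_mul]
  gcongr
  exact PiLp.norm_apply_le v n

/-- C¹ limits -/
lemma c1_limit {u : ℕ → Euc N → ℝ} {v : Euc N → ℝ} {G : Fin N → Euc N → ℝ}
    (hu : ∀ k, ContDiff ℝ 1 (u k)) (hv : ∀ x, Tendsto (fun k => u k x) atTop (nhds (v x)))
    (hG : ∀ n, LUT (fun k => pd n (u k)) (G n)) :
    ContDiff ℝ 1 v ∧ ∀ n, pd n v = G n := by
  set G' : Euc N → (Euc N →L[ℝ] ℝ) := fun x =>
    ∑ n, G n x • (EuclideanSpace.proj n : Euc N →L[ℝ] ℝ) with hG'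
  have hloc : TendstoLocallyUniformlyOn (fun k x => fderiv ℝ (u k) x) G' atTop univ := by
    rw [tendstoLocallyUniformlyOn_univ, Metric.tendstoLocallyUniformly_iff]
    intro δ hδ x
    have : ∀ n, ∃ K, ∀ k ≥ K, ∀ y : Euc N, ‖y‖ ≤ ‖x‖ + 1 →
      |pd n (u k) y - G n y| ≤ δ / (2 * (N + 1)) := fun n => hG n (‖x‖ + 1) _ (by positivity)
    choose K hK using this
    refine ⟨Metric.ball x 1, Metric.ball_mem_nhds x one_pos, ?_⟩
    filter_upwards [eventually_ge_atTop (Finset.univ.sup K)] with k hk y hy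
    have hy' : ‖y‖ ≤ ‖x‖ + 1 := by
      have h1 : ‖y - x‖ < 1 := by simpa [dist_eq_norm] using hy
      have := norm_le_norm_add_norm_sub' y x
      linarith
    rw [dist_comm, dist_eq_norm, hG', fderiv_eq_sum, ← Finset.sum_sub_distrib]
    simp_rw [← sub_smul]
    refine (norm_sum_proj_le _).trans_lt ?_
    have : ∑ n, |pd n (u k) y - G n y| ≤ ∑ _n : Fin N, δ / (2 * (N + 1)) :=
      Finset.sum_le_sum fun n _ => hK n k ((Finset.le_sup (Finset.mem_univ n)).trans hk) y hy'
    refine this.trans_lt ?_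
    simp only [Finset.sum_const, Finset.card_univ, Fintype.card_fin, nsmul_eq_mul]
    rw [mul_div_assoc', div_lt_iff₀ (by positivity)]
    nlinarith
  have hder : ∀ x, HasFDerivAt v (G' x) x := fun x =>
    hasFDerivAt_of_tendstoLocallyUniformlyOn isOpen_univ hloc
      (fun k y _ => (dif1 (hu k) y).hasFDerivAt) (fun y _ => hv y) (mem_univ x)
  have hGc : ∀ n, Continuous (G n) := fun n => (hG n).continuous fun k => c0_pd (hu k) n
  refine ⟨contDiff_one_iff_fderiv.2 ⟨fun x => (hder x).differentiableAt, ?_⟩, fun n => ?_⟩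
  · rw [show fderiv ℝ v = G' from funext fun x => (hder x).fderiv]
    exact continuous_finsetSum _ fun n _ => (hGc n).smul continuous_const
  · funext x
    unfold pd
    rw [(hder x).fderiv, hG']
    simp only [_root_.sum_apply]
    have : ∀ m : Fin N, (G m x • (EuclideanSpace.proj m : Euc N →L[ℝ] ℝ)) (ee n)
        = G m x * (ee n : Euc N) m := fun m => rfl
    simp [this, ee_apply]

lemma luc_grad {u : ℕ → Euc N → ℝ} (hu : ∀ k, ContDiff ℝ 2 (u k)) (h0 : LUC u)
    (hl : LUC (fun k => lap (u k))) (n : Fin N) : LUC (fun k => pd n (u k)) := by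
  intro R δ hδ
  obtain ⟨K, hK⟩ := h0 (R + 1) (δ / (N + 1)) (by positivity)
  obtain ⟨L, hL⟩ := hl (R + 1) (δ / (N + 1)) (by positivity)
  refine ⟨max K L, fun k hk l hl x hx => ?_⟩
  simp only [ge_iff_le, max_le_iff] at hk hl
  have hb : ∀ y : Euc N, ‖y - x‖ ≤ 1 → ‖y‖ ≤ R + 1 := fun y hy => by
    have := norm_le_norm_add_norm_sub' y x
    linarith
  have := grad_est ((hu k).sub (hu l)) one_pos x
    (fun y hy => hK k hk.1 l hl.1 y (hb y hy)) (fun y hy => by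
      have e : lap (fun x => u k x - u l x) y = _ := lap_sub (hu k) (hu l) y
      change |lap (fun x => u k x - u l x) y| ≤ _
      rw [e]; exact hL k hk.2 l hl.2 y (hb y hy)) n
  have e : pd n (fun x => u k x - u l x) = _ := pd_sub (dif2 (hu k)) (dif2 (hu l)) n
  change |pd n (fun x => u k x - u l x) x| ≤ _ at this
  rw [e] at this
  refine this.trans ?_
  have h3 : (δ / (N + 1) : ℝ) * (N + 1) = δ := by field_simp
  have h4 : (0:ℝ) < δ / (N + 1) := by positivity
  nlinarith

lemma luc_hess {u : ℕ → Euc N → ℝ} (hu : ∀ k, ContDiff ℝ 2 (u k))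
    (hlc : ∀ k, ContDiff ℝ 1 (lap (u k))) (n m : Fin N) (h0 : LUC (fun k => pd n (u k)))
    (hl : LUC (fun k => pd n (lap (u k)))) : LUC (fun k => pd n (pd m (u k))) := by
  intro R δ hδ
  obtain ⟨K, hK⟩ := h0 (R + 2) (δ / (N + 1)) (by positivity)
  obtain ⟨L, hL⟩ := hl (R + 2) (δ / (N + 1)) (by positivity)
  refine ⟨max K L, fun k hk l hl x hx => ?_⟩
  simp only [ge_iff_le, max_le_iff] at hk hl
  have hb : ∀ y : Euc N, ‖y - x‖ ≤ 2 * 1 → ‖y‖ ≤ R + 2 := fun y hy => by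
    have := norm_le_norm_add_norm_sub' y x
    linarith
  have hd : ContDiff ℝ 2 (fun x => u k x - u l x) := (hu k).sub (hu l)
  have e1 : lap (fun x => u k x - u l x) = fun x => lap (u k) x - lap (u l) x :=
    funext fun y => lap_sub (hu k) (hu l) y
  have := hess_est hd (by rw [e1]; exact (hlc k).sub (hlc l)) one_pos x n m
    (M := δ / (N + 1)) (F := δ / (N + 1))
    (fun y hy => by rw [pd_sub (dif2 (hu k)) (dif2 (hu l)) n]; exact hK k hk.1 l hl.1 y (hb y hy))
    (fun y hy => by
      rw [e1, pd_sub (dif1 (hlc k)) (dif1 (hlc l)) n]; exact hL k hk.2 l hl.2 y (hb y hy))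
  rw [pd_sub (dif2 (hu k)) (dif2 (hu l)) m, pd_sub (difpd (hu k) m) (difpd (hu l) m)] at this
  refine this.trans ?_
  have h3 : (δ / (N + 1) : ℝ) * (N + 1) = δ := by field_simp
  have h4 : (0:ℝ) < δ / (N + 1) := by positivity
  nlinarith

lemma contDiff_two_of_pd {v : Euc N → ℝ} (hv : ContDiff ℝ 1 v) (h : ∀ n, ContDiff ℝ 1 (pd n v)) :
    ContDiff ℝ 2 v := by
  have : ContDiff ℝ (1 + 1) v := by
    rw [contDiff_succ_iff_fderiv]
    refine ⟨dif1 hv, by simp, ?_⟩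
    rw [funext (fderiv_eq_sum v)]
    exact ContDiff.sum fun n _ => (h n).smul contDiff_const
  simpa [one_add_one_eq_two] using this

/-- C² limits -/
lemma c2_limit {u : ℕ → Euc N → ℝ} (hu : ∀ k, ContDiff ℝ 2 (u k))
    (hlc : ∀ k, ContDiff ℝ 1 (lap (u k))) (h0 : LUC u) (hl : LUC (fun k => lap (u k)))
    (hl1 : ∀ n, LUC (fun k => pd n (lap (u k)))) {v : Euc N → ℝ}
    (hv : ∀ x, Tendsto (fun k => u k x) atTop (nhds (v x))) :
    ContDiff ℝ 2 v ∧ (∀ n, LUT (fun k => pd n (u k)) (pd n v)) ∧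
      ∀ x, Tendsto (fun k => lap (u k) x) atTop (nhds (lap v x)) := by
  have hg := luc_grad hu h0 hl
  have hh := fun n m => luc_hess hu hlc n m (hg n) (hl1 n)
  choose G hG using fun n => (hg n).exists_lim
  choose H hH using fun n m => (hh n m).exists_lim
  obtain ⟨hv1, hvG⟩ := c1_limit (fun k => c21 (hu k)) hv hG
  have h2 : ∀ m, ContDiff ℝ 1 (G m) ∧ ∀ n, pd n (G m) = H n m := fun m =>
    c1_limit (fun k => c1_pd (hu k) m) (fun x => (hG m).tendsto x) (fun n => hH n m)
  have hv2 : ContDiff ℝ 2 v := contDiff_two_of_pd hv1 fun n => by rw [hvG n]; exact (h2 n).1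
  refine ⟨hv2, fun n => by rw [hvG n]; exact hG n, fun x => ?_⟩
  simp_rw [fun k => lap_eq (hu k) x]
  rw [lap_eq hv2]
  refine tendsto_finsetSum _ fun n _ => ?_
  rw [hvG n, (h2 n).2 n]
  exact (hH n n).tendsto x

/-! ### the smooth radius -/
noncomputable def sr (x : Euc N) : ℝ := Real.sqrt (1 + ‖x‖ ^ 2)

lemma sr_sq (x : Euc N) : sr x * sr x = 1 + ‖x‖ ^ 2 := Real.mul_self_sqrt (by positivity)
lemma one_le_sr (x : Euc N) : 1 ≤ sr x := by
  unfold sr; rw [Real.one_le_sqrt]; nlinarith [sq_nonneg ‖x‖]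
lemma sr_pos (x : Euc N) : 0 < sr x := one_pos.trans_le (one_le_sr x)
lemma norm_le_sr (x : Euc N) : ‖x‖ ≤ sr x := Real.le_sqrt_of_sq_le (by linarith)
lemma sr_le (x : Euc N) : sr x ≤ 1 + ‖x‖ := by
  unfold sr; rw [Real.sqrt_le_left (by positivity)]; nlinarith [norm_nonneg x]

lemma contDiff_sr {k : WithTop ℕ∞} : ContDiff ℝ k (sr : Euc N → ℝ) :=
  (contDiff_const.add contDiff_normsq).sqrt fun x => by positivity

lemma pd_sr (n : Fin N) (x : Euc N) : pd n sr x = x n / sr x := by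
  have h1 := congrFun (pd_mul (dif1 (N := N) contDiff_sr) (dif1 contDiff_sr) n) x
  rw [funext (sr_sq (N := N)), pd_add (by fun_prop) (dif1 contDiff_normsq), pd_const, pd_normsq] at h1
  rw [eq_div_iff (sr_pos x).ne']
  simp only at h1
  linarith

lemma sum_pd_sr (x : Euc N) : ∑ n, pd n sr x ^ 2 = ‖x‖ ^ 2 / sr x ^ 2 := by
  simp_rw [pd_sr, div_pow]
  rw [← Finset.sum_div, EuclideanSpace.norm_sq_eq]
  simp

lemma lap_sr (x : Euc N) : lap sr x = (N - ‖x‖ ^ 2 / sr x ^ 2) / sr x := by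
  have h1 := lap_mul (N := N) contDiff_sr contDiff_sr x
  rw [funext (sr_sq (N := N)), lap_add contDiff_const contDiff_normsq, lap_const, lap_normsq] at h1
  have h2 := sum_pd_sr x
  simp_rw [← pow_two] at h1
  rw [h2] at h1
  rw [eq_div_iff (sr_pos x).ne']
  linarith

lemma sr_facts (hN : 1 ≤ N) (x : Euc N) :
    (0 ≤ ∑ n, pd n sr x ^ 2 ∧ ∑ n, pd n sr x ^ 2 ≤ 1) ∧ (0 ≤ lap sr x ∧ lap sr x ≤ N) := by
  have h0 := sr_pos x
  have h1 : ‖x‖ ^ 2 / sr x ^ 2 ≤ 1 := by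
    rw [div_le_one (by positivity)]; nlinarith [sr_sq x]
  have h2 : 0 ≤ ‖x‖ ^ 2 / sr x ^ 2 := by positivity
  have hN' : (1:ℝ) ≤ N := by exact_mod_cast hN
  rw [sum_pd_sr, lap_sr]
  refine ⟨⟨h2, h1⟩, div_nonneg (by linarith) h0.le, ?_⟩
  rw [div_le_iff₀ h0]
  nlinarith [one_le_sr x]

lemma lap_exp_sr (μ : ℝ) (x : Euc N) : lap (fun x => exp (μ * sr x)) x
    = (μ ^ 2 * ∑ n, pd n sr x ^ 2) * exp (μ * sr x) + μ * lap sr x * exp (μ * sr x) := by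
  have hF : ContDiff ℝ 2 (fun t : ℝ => exp (μ * t)) := by fun_prop
  have hd : deriv (fun t : ℝ => exp (μ * t)) = fun t => μ * exp (μ * t) := by
    funext t
    have : HasDerivAt (fun t : ℝ => exp (μ * t)) (exp (μ * t) * (μ * 1)) t :=
      ((hasDerivAt_id t).const_mul μ).exp
    rw [this.deriv]; ring
  have hdd : deriv (deriv (fun t : ℝ => exp (μ * t))) = fun t => μ ^ 2 * exp (μ * t) := by
    rw [hd]; funext t
    rw [deriv_const_mul _ (by fun_prop), hd]; ring
  have := lap_comp hF (contDiff_sr (N := N)) x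
  rw [this, hdd, hd]; ring

lemma contDiff_exp_sr {k : WithTop ℕ∞} (μ : ℝ) : ContDiff ℝ k (fun x : Euc N => exp (μ * sr x)) :=
  (contDiff_const.mul contDiff_sr).exp

/-- growing barrier -/
lemma lap_exp_le (hN : 1 ≤ N) {μ : ℝ} (hμ : 0 ≤ μ) (x : Euc N) :
    lap (fun x => exp (μ * sr x)) x ≤ (μ ^ 2 + μ * N) * exp (μ * sr x) := by
  obtain ⟨⟨a, b⟩, c, d⟩ := sr_facts hN x
  rw [lap_exp_sr, add_mul]
  gcongr
  nlinarith [sq_nonneg μ]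

/-- exponential weight centred at `Q` -/
noncomputable def rho (μ : ℝ) (Q x : Euc N) : ℝ := exp (-μ * sr (x - Q))

lemma rho_pos (μ : ℝ) (Q x : Euc N) : 0 < rho μ Q x := exp_pos _
lemma rho_le_one {μ : ℝ} (hμ : 0 ≤ μ) (Q x : Euc N) : rho μ Q x ≤ 1 := by
  unfold rho; rw [exp_le_one_iff]; nlinarith [sr_pos (x - Q)]

lemma contDiff_rho {k : WithTop ℕ∞} (μ : ℝ) (Q : Euc N) : ContDiff ℝ k (rho μ Q) := by
  have := contDiff_aff (contDiff_exp_sr (k := k) (N := N) (-μ)) 1 (-Q)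
  simp only [one_smul, ← sub_eq_add_neg] at this
  exact this

lemma lap_rho_le (hN : 1 ≤ N) {μ : ℝ} (hμ : 0 ≤ μ) (Q x : Euc N) :
    lap (rho μ Q) x ≤ μ ^ 2 * rho μ Q x := by
  have := lap_aff (contDiff_exp_sr (N := N) (-μ)) 1 (-Q) x
  simp only [one_smul, ← sub_eq_add_neg, one_pow, one_mul] at this
  have e : rho μ Q = fun x => exp (-μ * sr (x - Q)) := rfl
  rw [e, this, lap_exp_sr]
  obtain ⟨⟨a, b⟩, c, d⟩ := sr_facts hN (x - Q)
  have h1 : 0 < exp (-μ * sr (x - Q)) := exp_pos _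
  simp only
  have h2 : 0 ≤ μ * lap sr (x - Q) * exp (-μ * sr (x - Q)) := by positivity
  have h3 : μ ^ 2 * (∑ n, pd n sr (x - Q) ^ 2) * exp (-μ * sr (x - Q)) ≤
      μ ^ 2 * 1 * exp (-μ * sr (x - Q)) := by gcongr
  nlinarith

end LS

namespace LS
open scoped ContDiff SchwartzMap Laplacian
variable {N : ℕ}

lemma lap_eq_laplacian {u : Euc N → ℝ} (hu : ContDiff ℝ 2 u) (x : Euc N) :
    lap u x = Laplacian.laplacian u x := by
  rw [InnerProductSpace.laplacian_eq_iteratedFDeriv_orthonormalBasis u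
    (EuclideanSpace.basisFun (Fin N) ℝ), lap_eq hu]
  refine Finset.sum_congr rfl fun n _ => ?_
  rw [iteratedFDeriv_two_apply]
  have hd : DifferentiableAt ℝ (fderiv ℝ u) x :=
    (hu.fderiv_right (m := 1) (by norm_num)).differentiable (by norm_num) x
  have : pd n (pd n u) x = (fderiv ℝ (fderiv ℝ u) x (ee n)) (ee n) := by
    unfold pd
    rw [fderiv_clm_apply hd (by fun_prop)]
    simp
  rw [this]
  simp [ee]

lemma tg_mult (lam : ℝ) (hl : 0 < lam) :
    (fun ξ : Euc N => (lam + (2 * π) ^ 2 * ‖ξ‖ ^ 2)⁻¹).HasTemperateGrowth := by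
  have h1 := Function.hasTemperateGrowth_one_add_norm_sq_rpow (Euc N) (-1)
  have h2 : (fun ξ : Euc N => (2 * π / sqrt lam) • ξ).HasTemperateGrowth := by fun_prop
  have h3 := h1.comp h2
  have h4 : (fun ξ : Euc N => (lam + (2 * π) ^ 2 * ‖ξ‖ ^ 2)⁻¹) =
      fun ξ : Euc N => lam⁻¹ * ((fun x : Euc N => (1 + ‖x‖ ^ 2) ^ (-1:ℝ)) ∘
        (fun ξ : Euc N => (2 * π / sqrt lam) • ξ)) ξ := by
    funext ξ
    simp only [Function.comp, norm_smul, Real.norm_eq_abs]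
    rw [Real.rpow_neg_one, ← mul_inv, mul_pow (|_|), sq_abs, div_pow, Real.sq_sqrt hl.le]
    congr 1
    field_simp
  rw [h4]
  exact (Function.HasTemperateGrowth.const _).mul h3

lemma schwartz_solve (lam : ℝ) (hl : 0 < lam) (G : 𝓢(Euc N, ℂ)) :
    ∃ U : 𝓢(Euc N, ℂ), ∀ x, -(Laplacian.laplacian (U : Euc N → ℂ) x) + (lam : ℂ) * U x = G x := by
  set m : Euc N → ℝ := fun ξ => (lam + (2 * π) ^ 2 * ‖ξ‖ ^ 2)⁻¹ with hm
  have hmt := tg_mult (N := N) lam hl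
  have hn : (fun ξ : Euc N => ‖ξ‖ ^ 2).HasTemperateGrowth := by fun_prop
  set U := SchwartzMap.fourierMultiplierCLM ℂ m G with hU
  refine ⟨U, fun x => ?_⟩
  have h1 : G = (lam : ℝ) • U + ((2 * π) ^ 2 : ℝ) • SchwartzMap.fourierMultiplierCLM ℂ
      (fun ξ : Euc N => ‖ξ‖ ^ 2) U := by
    rw [hU, SchwartzMap.fourierMultiplierCLM_fourierMultiplierCLM_apply hn hmt]
    have hp : ((fun ξ : Euc N => ‖ξ‖ ^ 2) * m).HasTemperateGrowth := hn.mul hmt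
    have e1 := SchwartzMap.fourierMultiplierCLM_smul (F := ℂ) hmt lam
    have e2 := SchwartzMap.fourierMultiplierCLM_smul (F := ℂ) hp ((2 * π) ^ 2)
    have e1' := congrArg (fun T => T G) e1
    have e2' := congrArg (fun T => T G) e2
    simp only [_root_.smul_apply] at e1' e2'
    rw [← e1', ← e2']
    simp only [SchwartzMap.fourierMultiplierCLM_apply]
    rw [← FourierTransform.fourierInv_add, ← _root_.add_apply, ← SchwartzMap.smulLeftCLM_add]
    · have : (lam • m + ((2 * π) ^ 2) • ((fun ξ : Euc N => ‖ξ‖ ^ 2) * m)) = fun _ => (1:ℝ) := by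
        funext ξ
        simp only [hm, Pi.add_apply, Pi.smul_apply, Pi.mul_apply, smul_eq_mul]
        have : lam + (2 * π) ^ 2 * ‖ξ‖ ^ 2 ≠ 0 := by positivity
        field_simp
      rw [this]
      simp
    · exact (Function.HasTemperateGrowth.const lam).smul hmt
    · exact (Function.HasTemperateGrowth.const ((2 * π) ^ 2)).smul hp
  have h2 := SchwartzMap.laplacian_eq_fourierMultiplierCLM U
  have h3 := congrArg (fun T : 𝓢(Euc N, ℂ) => T x) h2
  simp only at h3
  rw [SchwartzMap.laplacian_apply] at h3
  have h4 := congrArg (fun T : 𝓢(Euc N, ℂ) => T x) h1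
  simp only at h4
  rw [h3, h4]
  simp
  ring

/-- `u` is a bounded classical solution of `-Δu + V u = g`. -/
def Sol (V g u : Euc N → ℝ) : Prop :=
  ContDiff ℝ 2 u ∧ (∃ B, ∀ x, |u x| ≤ B) ∧ ∀ x, -lap u x + V x * u x = g x

lemma solve_cs (lam : ℝ) (hl : 0 < lam) {g : Euc N → ℝ} (hg : ContDiff ℝ ∞ g)
    (hs : HasCompactSupport g) : ∃ u, Sol (fun _ => lam) g u := by
  have hg' : ContDiff ℝ ∞ (fun x => (g x : ℂ)) := Complex.ofRealCLM.contDiff.comp hg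
  have hs' : HasCompactSupport (fun x => (g x : ℂ)) := hs.comp_left (g := fun t : ℝ => (t : ℂ)) (by simp)
  obtain ⟨U, hU⟩ := schwartz_solve lam hl (hs'.toSchwartzMap hg')
  have hUc : ContDiff ℝ 2 (U : Euc N → ℂ) := U.smooth 2
  have huc : ContDiff ℝ 2 (Complex.reCLM ∘ U) := Complex.reCLM.contDiff.comp hUc
  refine ⟨Complex.reCLM ∘ U, huc, ?_, fun x => ?_⟩
  · obtain ⟨B, -, hB⟩ := U.decay 0 0
    refine ⟨B, fun x => ?_⟩
    have := hB x
    simp at this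
    exact (Complex.abs_re_le_norm _).trans this
  · rw [lap_eq_laplacian huc, hUc.contDiffAt.laplacian_CLM_comp_left]
    have := congrArg Complex.re (hU x)
    simpa using this

end LS

namespace LS
open scoped ContDiff Convolution
variable {N : ℕ}

lemma mollify {h : Euc N → ℝ} (hh : ContDiff ℝ 1 h) (hs : HasCompactSupport h) {δ : ℝ} (hδ : 0 < δ) :
    ∃ g : Euc N → ℝ, ContDiff ℝ ∞ g ∧ HasCompactSupport g ∧ (∀ x, |g x - h x| ≤ δ) ∧
      ∀ n x, |pd n g x - pd n h x| ≤ δ := by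
  have huc : UniformContinuous h := hs.uniformContinuous_of_continuous hh.continuous
  have hs1 : HasCompactSupport (fderiv ℝ h) := hs.fderiv ℝ
  have huc1 : UniformContinuous (fderiv ℝ h) :=
    hs1.uniformContinuous_of_continuous (hh.continuous_fderiv (by norm_num))
  obtain ⟨r1, hr1, h1⟩ := Metric.uniformContinuous_iff.1 huc δ hδ
  obtain ⟨r2, hr2, h2⟩ := Metric.uniformContinuous_iff.1 huc1 δ hδ
  set r := min r1 r2 with hr
  have hr0 : 0 < r := lt_min hr1 hr2
  let φ : ContDiffBump (0 : Euc N) := ⟨r / 2, r, by positivity, by linarith⟩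
  have hφr : φ.rOut = r := rfl
  set g : Euc N → ℝ := (φ.normed volume ⋆[ContinuousLinearMap.lsmul ℝ ℝ, volume] h) with hg
  have hli : LocallyIntegrable (φ.normed volume) (volume : Measure (Euc N)) :=
    (φ.contDiff_normed (n := 1)).continuous.locallyIntegrable
  have hpd : ∀ n x, pd n g x = (φ.normed volume ⋆[ContinuousLinearMap.lsmul ℝ ℝ, volume] pd n h) x := by
    intro n x
    have h3 := hs.hasFDerivAt_convolution_right (ContinuousLinearMap.lsmul ℝ ℝ) hli hh x
    unfold pd
    rw [hg, h3.fderiv, convolution_precompR_apply _ hli hs1 (hh.continuous_fderiv (by norm_num))]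
  refine ⟨g, ?_, ?_, fun x => ?_, fun n x => ?_⟩
  · exact φ.hasCompactSupport_normed.contDiff_convolution_left _ φ.contDiff_normed
      hh.continuous.locallyIntegrable
  · exact φ.hasCompactSupport_normed.convolution _ hs
  · rw [← Real.dist_eq]
    refine φ.dist_normed_convolution_le hh.continuous.aestronglyMeasurable fun y hy => ?_
    exact (h1 (lt_of_lt_of_le (show dist y x < r from hy) (min_le_left _ _))).le
  · rw [← Real.dist_eq, hpd]
    refine φ.dist_normed_convolution_le (c0_pd hh n).aestronglyMeasurable fun y hy => ?_
    have h4 := (h2 (lt_of_lt_of_le (show dist y x < r from hy) (min_le_right _ _))).le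
    rw [Real.dist_eq]
    have h5 := ((fderiv ℝ h y) - (fderiv ℝ h x)).le_opNorm (ee n)
    rw [norm_ee, mul_one, ← dist_eq_norm] at h5
    exact h5.trans h4

/-- cutoff functions -/
lemma exists_cutoff (R : ℝ) (hR : 0 < R) : ∃ ζ : Euc N → ℝ, ContDiff ℝ ∞ ζ ∧ HasCompactSupport ζ ∧
    (∀ x, 0 ≤ ζ x ∧ ζ x ≤ 1) ∧ ∀ x, ‖x‖ ≤ R → ζ x = 1 := by
  let φ : ContDiffBump (0 : Euc N) := ⟨R, R + 1, hR, by linarith⟩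
  exact ⟨φ, φ.contDiff, φ.hasCompactSupport, fun x => ⟨φ.nonneg, φ.le_one⟩,
    fun x hx => φ.one_of_mem_closedBall (by simpa using hx)⟩

lemma pd_congr_ball {g h : Euc N → ℝ} {R : ℝ} (H : ∀ x, ‖x‖ < R → g x = h x) (n : Fin N) (x : Euc N)
    (hx : ‖x‖ < R) : pd n g x = pd n h x := by
  unfold pd
  have : g =ᶠ[nhds x] h := by
    filter_upwards [(isOpen_lt continuous_norm continuous_const).mem_nhds hx] with y hy using H y hy
  rw [this.fderiv_eq]

/-- C¹ bounded functions are local C¹ limits of test functions -/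
lemma approx_cs {g : Euc N → ℝ} (hg : ContDiff ℝ 1 g) {M : ℝ} (hM : ∀ x, |g x| ≤ M) :
    ∃ G : ℕ → Euc N → ℝ, (∀ k, ContDiff ℝ ∞ (G k)) ∧ (∀ k, HasCompactSupport (G k)) ∧
      (∀ k x, |G k x| ≤ M + 1) ∧ LUT G g ∧ ∀ n, LUT (fun k => pd n (G k)) (pd n g) := by
  choose ζ hζ1 hζ2 hζ3 hζ4 using fun k : ℕ => exists_cutoff (N := N) ((k:ℝ) + 1) (by positivity)
  have hh : ∀ k, ContDiff ℝ 1 (fun x => ζ k x * g x) := fun k =>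
    ((hζ1 k).of_le (by exact_mod_cast le_top)).mul hg
  choose G hG1 hG2 hG3 hG4 using fun k : ℕ => mollify (hh k) ((hζ2 k).mul_right (f' := g))
    (δ := 1 / ((k:ℝ) + 1)) (by positivity)
  have hsmall : ∀ k : ℕ, 1 / ((k:ℝ) + 1) ≤ 1 := fun k => by
    rw [div_le_one (by positivity)]; linarith [(Nat.cast_nonneg k : (0:ℝ) ≤ k)]
  have hK : ∀ R δ : ℝ, 0 < δ → ∃ K : ℕ, ∀ k ≥ K, R < (k:ℝ) + 1 ∧ 1 / ((k:ℝ) + 1) ≤ δ := by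
    intro R δ hδ
    obtain ⟨K, hK⟩ := exists_nat_gt (max R (1 / δ))
    refine ⟨K, fun k hk => ?_⟩
    have h1 : (K:ℝ) ≤ k := by exact_mod_cast hk
    have h2 := (le_max_left _ _).trans_lt hK
    have h3 := (le_max_right _ _).trans_lt hK
    refine ⟨by linarith, ?_⟩
    rw [div_le_iff₀ (by positivity)]
    rw [div_lt_iff₀ hδ] at h3
    nlinarith
  refine ⟨G, hG1, hG2, fun k x => ?_, fun R δ hδ => ?_, fun n R δ hδ => ?_⟩
  · have h1 := hG3 k x
    have h2 : |ζ k x * g x| ≤ M := by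
      rw [abs_mul, abs_of_nonneg (hζ3 k x).1]
      calc ζ k x * |g x| ≤ 1 * |g x| := by gcongr; exact (hζ3 k x).2
        _ ≤ M := by linarith [hM x]
    have := abs_sub_abs_le_abs_sub (G k x) (ζ k x * g x)
    linarith [hsmall k]
  · obtain ⟨K, hK⟩ := hK R δ hδ
    refine ⟨K, fun k hk x hx => ?_⟩
    have h1 := hG3 k x
    rw [hζ4 k x (by linarith [(hK k hk).1]), one_mul] at h1
    exact h1.trans (hK k hk).2
  · obtain ⟨K, hK⟩ := hK R δ hδ
    refine ⟨K, fun k hk x hx => ?_⟩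
    have h1 := hG4 k n x
    rw [pd_congr_ball (g := fun x => ζ k x * g x) (h := g) (R := k + 1) (fun y hy => by rw [hζ4 k y hy.le, one_mul]) n x
      (by linarith [(hK k hk).1])] at h1
    exact h1.trans (hK k hk).2

lemma mp_le {u V : Euc N → ℝ} (hu : ContDiff ℝ 2 u) {B : ℝ} (hB : ∀ x, u x ≤ B) {c m : ℝ} (hc : 0 < c)
    (hV : ∀ x, c ≤ V x) (hm : 0 ≤ m)
    (h : ∀ x, m < u x → -lap u x + V x * u x ≤ c * m) (x : Euc N) : u x ≤ m := by
  refine mp hu hB hc (fun x hx => ?_) x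
  have h1 := h x hx
  have h2 : c * u x ≤ V x * u x := mul_le_mul_of_nonneg_right (hV x) (by linarith)
  linarith

lemma mp_abs {u V : Euc N → ℝ} (hu : ContDiff ℝ 2 u) {B : ℝ} (hB : ∀ x, |u x| ≤ B) {c m : ℝ}
    (hc : 0 < c) (hV : ∀ x, c ≤ V x) (hm : 0 ≤ m)
    (h : ∀ x, m < |u x| → |-lap u x + V x * u x| ≤ c * m) (x : Euc N) : |u x| ≤ m := by
  rw [abs_le]
  constructor
  · have := mp_le (u := fun x => - u x) hu.neg (fun x => (neg_le_abs _).trans (hB x)) hc hV hm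
      (fun x hx => by
        rw [lap_neg hu]
        have := h x (hx.trans_le (neg_le_abs _))
        have := (abs_le.1 this).1
        linarith) x
    linarith
  · exact mp_le hu (fun x => (le_abs_self _).trans (hB x)) hc hV hm
      (fun x hx => (le_abs_self _).trans (h x (hx.trans_le (le_abs_self _)))) x

/-- interior comparison: equation with small right side only on a large ball -/
lemma mp_ball (hN : 1 ≤ N) {u V : Euc N → ℝ} (hu : ContDiff ℝ 2 u) {B : ℝ} (hB : ∀ x, |u x| ≤ B)
    {c μ δ R : ℝ} (hc : 0 < c) (hμ : 0 ≤ μ) (hμc : μ ^ 2 + μ * N ≤ c) (hV : ∀ x, c ≤ V x) (hδ : 0 ≤ δ)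
    (h : ∀ x, ‖x‖ ≤ R → |-lap u x + V x * u x| ≤ c * δ) (x : Euc N) :
    |u x| ≤ δ + B * exp (μ * (sr x - R)) := by
  have hB0 : 0 ≤ B := (abs_nonneg _).trans (hB 0)
  have main : ∀ v : Euc N → ℝ, ContDiff ℝ 2 v → (∀ x, v x ≤ B) →
      (∀ x, ‖x‖ ≤ R → -lap v x + V x * v x ≤ c * δ) → v x ≤ δ + B * exp (μ * (sr x - R)) := by
    intro v hv hvB hvl
    set K := B * exp (-(μ * R)) with hK
    have hK0 : 0 ≤ K := by positivity
    have hcd : ContDiff ℝ 2 (fun x : Euc N => K * exp (μ * sr x)) :=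
      contDiff_const.mul (contDiff_exp_sr μ)
    have e : ∀ x : Euc N, K * exp (μ * sr x) = B * exp (μ * (sr x - R)) := fun x => by
      rw [hK, mul_assoc, ← exp_add]; congr 2; ring
    have := mp_le (u := fun x => v x - K * exp (μ * sr x)) (V := V) (hv.sub hcd) (B := B)
      (fun x => by have : 0 ≤ K * exp (μ * sr x) := by positivity
                   linarith [hvB x]) hc hV hδ (fun x hx => by
        rw [lap_sub hv hcd, lap_cmul (contDiff_exp_sr μ)]
        have hxR : ‖x‖ ≤ R := by
          by_contra! hxR
          have h1 : B ≤ K * exp (μ * sr x) := by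
            rw [e]
            refine le_mul_of_one_le_right hB0 (one_le_exp ?_)
            have := norm_le_sr x
            exact mul_nonneg hμ (by linarith)
          linarith [hvB x]
        have h1 := lap_exp_le hN hμ x
        have h2 := hvl x hxR
        have h3 : (μ ^ 2 + μ * N) * exp (μ * sr x) ≤ V x * exp (μ * sr x) := by
          gcongr; exact hμc.trans (hV x)
        have h4 : K * lap (fun x => exp (μ * sr x)) x ≤ K * (V x * exp (μ * sr x)) := by
          gcongr; linarith
        nlinarith) x
    rw [← e]; linarith
  rw [abs_le]
  constructor
  · have := main (fun x => - u x) hu.neg (fun x => (neg_le_abs _).trans (hB x)) (fun x hx => by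
      rw [lap_neg hu]
      have := (abs_le.1 (h x hx)).1
      linarith)
    linarith
  · exact main u hu (fun x => (le_abs_self _).trans (hB x))
      (fun x hx => (le_abs_self _).trans (h x hx))

lemma exists_rate (N : ℕ) {c : ℝ} (hc : 0 < c) : ∃ μ : ℝ, 0 < μ ∧ μ ^ 2 + μ * N ≤ c := by
  refine ⟨min 1 (c / (N + 1)), by positivity, ?_⟩
  have h1 : min 1 (c / (N + 1)) ≤ 1 := min_le_left _ _
  have h2 : min 1 (c / (N + 1)) ≤ c / (N + 1) := min_le_right _ _
  have h3 : 0 < min 1 (c / ((N:ℝ) + 1)) := by positivity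
  rw [le_div_iff₀ (by positivity)] at h2
  nlinarith

/-- stability of solvability under local limits -/
lemma sol_limit (hN : 1 ≤ N) {V g u : ℕ → Euc N → ℝ} {V' g' : Euc N → ℝ} {c M : ℝ} (hc : 0 < c)
    (hM : 0 ≤ M)
    (hVc : ∀ k x, c ≤ V k x) (hgM : ∀ k x, |g k x| ≤ M) (hV1 : ∀ k, ContDiff ℝ 1 (V k))
    (hg1 : ∀ k, ContDiff ℝ 1 (g k)) (hVl : LUT V V') (hgl : LUT g g')
    (hVl1 : ∀ n, LUC (fun k => pd n (V k))) (hgl1 : ∀ n, LUC (fun k => pd n (g k)))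
    (hu : ∀ k, Sol (V k) (g k) (u k)) :
    ∃ v, Sol V' g' v := by
  have hub : ∀ k x, |u k x| ≤ M / c := fun k x => by
    obtain ⟨h1, ⟨B, hB⟩, h2⟩ := hu k
    refine mp_abs h1 hB hc (hVc k) (by positivity) (fun x _ => ?_) x
    rw [h2, mul_div_cancel₀ _ hc.ne']; exact hgM k x
  have hu2 : ∀ k, ContDiff ℝ 2 (u k) := fun k => (hu k).1
  have hleq : ∀ k, lap (u k) = fun x => V k x * u k x - g k x := fun k => funext fun x => by
    linarith [(hu k).2.2 x]
  obtain ⟨μ, hμ0, hμ⟩ := exists_rate N hc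
  have hM0 : 0 ≤ M / c := by positivity
  have h0 : LUC u := by
    intro R δ hδ
    -- choose the large radius
    obtain ⟨S, hS⟩ : ∃ S : ℝ, (2 * (M / c)) * exp (μ * (1 + R - S)) ≤ δ / 2 := by
      have : Tendsto (fun S : ℝ => (2 * (M / c)) * exp (μ * (1 + R - S))) atTop (nhds (2 * (M / c) * 0)) := by
        refine Tendsto.const_mul _ (tendsto_exp_atBot.comp ?_)
        refine Tendsto.const_mul_atBot hμ0 ?_
        exact (tendsto_atBot_add_const_left _ (1 + R) tendsto_neg_atTop_atBot).congr fun S => (sub_eq_add_neg _ _).symm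
      rw [mul_zero] at this
      exact (this.eventually (ge_mem_nhds (by positivity : (0:ℝ) < δ / 2))).exists
    obtain ⟨K, hK⟩ := hVl.luc S (c * (δ / 2) / (2 * (M / c + 1))) (by positivity)
    obtain ⟨L, hL⟩ := hgl.luc S (c * (δ / 2) / 2) (by positivity)
    refine ⟨max K L, fun k hk l hl x hx => ?_⟩
    simp only [ge_iff_le, max_le_iff] at hk hl
    have := mp_ball hN ((hu2 k).sub (hu2 l)) (V := V k) (B := 2 * (M / c)) (fun x => by
        have := abs_sub (u k x) (u l x)
        linarith [hub k x, hub l x]) hc hμ0.le hμ (hVc k) (δ := δ / 2) (R := S) (by positivity)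
      (fun y hy => by
        have e : lap (fun x => u k x - u l x) y = _ := lap_sub (hu2 k) (hu2 l) y
        change |-lap (fun x => u k x - u l x) y + V k y * (u k y - u l y)| ≤ _
        rw [e, hleq, hleq]
        have a := hK k hk.1 l hl.1 y hy
        have b := hL k hk.2 l hl.2 y hy
        have e2 : -(V k y * u k y - g k y - (V l y * u l y - g l y)) + V k y * (u k y - u l y)
          = (g k y - g l y) - (V k y - V l y) * u l y := by ring
        rw [e2]
        refine (abs_sub _ _).trans ?_
        rw [abs_mul]
        have h3 : |V k y - V l y| * |u l y| ≤ c * (δ / 2) / (2 * (M / c + 1)) * (M / c) :=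
          mul_le_mul a (hub l y) (abs_nonneg _) (by positivity)
        have h4 : c * (δ / 2) / (2 * (M / c + 1)) * (M / c) ≤ c * (δ / 2) / 2 := by
          rw [div_mul_eq_mul_div, div_le_div_iff₀ (by positivity) (by positivity)]
          have : 0 < c * (δ / 2) := by positivity
          nlinarith
        linarith) x
    refine this.trans ?_
    have h5 : exp (μ * (sr x - S)) ≤ exp (μ * (1 + R - S)) := by
      gcongr; linarith [sr_le x]
    nlinarith
  have hVcont : ∀ k, Continuous (V k) := fun k => (hV1 k).continuous
  have hl : LUC (fun k => lap (u k)) := by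
    simp_rw [hleq]
    exact (hVl.luc.mul h0 hVcont fun k => (hu2 k).continuous).sub hgl.luc
  have hg := luc_grad hu2 h0 hl
  have hl1 : ∀ n, LUC (fun k => pd n (lap (u k))) := fun n => by
    have e : (fun k => pd n (lap (u k))) = fun k x => (V k x * pd n (u k) x + pd n (V k) x * u k x)
        - pd n (g k) x := by
      funext k
      rw [hleq, pd_sub (u := fun x => V k x * u k x) ((dif1 (hV1 k)).mul (dif2 (hu2 k)))
        (dif1 (hg1 k)), pd_mul (dif1 (hV1 k)) (dif2 (hu2 k))]
    rw [e]
    exact ((hVl.luc.mul (hg n) hVcont fun k => c0_pd (c21 (hu2 k)) n).add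
      ((hVl1 n).mul h0 (fun k => c0_pd (hV1 k) n) fun k => (hu2 k).continuous)).sub (hgl1 n)
  obtain ⟨v, hv⟩ := h0.exists_lim
  obtain ⟨hv2, -, hvl⟩ := c2_limit hu2 (fun k => by
    rw [hleq]; exact ((hV1 k).mul (c21 (hu2 k))).sub (hg1 k)) h0 hl hl1 hv.tendsto
  refine ⟨v, hv2, ⟨M / c, fun x => ?_⟩, fun x => ?_⟩
  · exact le_of_tendsto (hv.tendsto x).abs (Eventually.of_forall fun k => hub k x)
  · have h1 := (hvl x).neg.add ((hVl.tendsto x).mul (hv.tendsto x))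
    simp_rw [(hu _).2.2 x] at h1
    exact tendsto_nhds_unique h1 (hgl.tendsto x)

lemma solve_const (hN : 1 ≤ N) (lam : ℝ) (hl : 0 < lam) {g : Euc N → ℝ} (hg : ContDiff ℝ 1 g) {M : ℝ}
    (hM : ∀ x, |g x| ≤ M) : ∃ u, Sol (fun _ => lam) g u := by
  have hM0 : 0 ≤ M := (abs_nonneg _).trans (hM 0)
  obtain ⟨G, hG1, hG2, hG3, hG4, hG5⟩ := approx_cs hg hM
  choose u hu using fun k => solve_cs lam hl (hG1 k) (hG2 k)
  exact sol_limit hN (V := fun _ _ => lam) (V' := fun _ => lam) hl (by linarith : 0 ≤ M + 1)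
    (fun _ _ => le_rfl) hG3 (fun _ => contDiff_const)
    (fun k => (hG1 k).of_le (by exact_mod_cast le_top)) (fun R δ hδ => ⟨0, by simp [hδ.le]⟩) hG4
    (fun n => LUC.const _) (fun n => (hG5 n).luc) hu

end LS

namespace LS
open scoped ContDiff BoundedContinuousFunction
variable {N : ℕ}

/-- bounded continuous functions -/
abbrev XX (N : ℕ) := Euc N →ᵇ ℝ

lemma xabs (g : XX N) (x : Euc N) : |g x| ≤ ‖g‖ := g.norm_coe_le_norm x

lemma xabs_sub (g h : XX N) (x : Euc N) : |g x - h x| ≤ ‖g - h‖ := (g - h).norm_coe_le_norm x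

lemma xle {g : XX N} {M : ℝ} (hM : 0 ≤ M) (h : ∀ x, |g x| ≤ M) : ‖g‖ ≤ M :=
  (BoundedContinuousFunction.norm_le hM).2 h

noncomputable def mkX (g : Euc N → ℝ) (hg : Continuous g) (M : ℝ) (h : ∀ x, |g x| ≤ M) : XX N :=
  BoundedContinuousFunction.ofNormedAddCommGroup g hg M h

lemma mkX_apply (g : Euc N → ℝ) (hg : Continuous g) (M : ℝ) (h : ∀ x, |g x| ≤ M) (x : Euc N) :
    mkX g hg M h x = g x := rfl

lemma dense_c1 (g : XX N) {δ : ℝ} (hδ : 0 < δ) : ∃ g' : XX N, ContDiff ℝ 1 g' ∧ ‖g' - g‖ ≤ δ := by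
  obtain ⟨G, hG⟩ := exists_contMDiffMap_forall_mem_convex_of_local_const (n := ⊤) (modelWithCornersSelf ℝ (Euc N))
    (t := fun x => Metric.closedBall (g x) δ) (fun x => convex_closedBall _ _) (fun x => by
      refine ⟨g x, ?_⟩
      have := Metric.continuousAt_iff'.1 (g.continuous.continuousAt (x := x)) δ hδ
      filter_upwards [this] with y hy
      rw [Metric.mem_closedBall, dist_comm]; exact hy.le)
  have h1 : ∀ x, |G x - g x| ≤ δ := fun x => by
    have := hG x
    rwa [Metric.mem_closedBall, Real.dist_eq] at this
  have hs : ContDiff ℝ 1 (G : Euc N → ℝ) := G.contMDiff.contDiff.of_le (by exact_mod_cast le_top)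
  refine ⟨mkX G hs.continuous (δ + ‖g‖) fun x => ?_, hs, xle hδ.le h1⟩
  have := abs_sub_abs_le_abs_sub (G x) (g x)
  linarith [h1 x, xabs g x]

lemma seq_c1 (g : XX N) : ∃ G : ℕ → XX N, (∀ k, ContDiff ℝ 1 (G k)) ∧ Tendsto G atTop (nhds g) := by
  choose G h1 h2 using fun k : ℕ => dense_c1 g (δ := 1 / ((k:ℝ) + 1)) (by positivity)
  refine ⟨G, h1, ?_⟩
  rw [tendsto_iff_norm_sub_tendsto_zero]
  exact squeeze_zero (fun _ => norm_nonneg _) h2 tendsto_one_div_add_atTop_nhds_zero_nat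

lemma Sol.bound {V g u : Euc N → ℝ} (h : Sol V g u) {c M : ℝ} (hc : 0 < c) (hV : ∀ x, c ≤ V x)
    (hg : ∀ x, |g x| ≤ M) (x : Euc N) : |u x| ≤ M / c := by
  obtain ⟨h1, ⟨B, hB⟩, h2⟩ := h
  have hM : 0 ≤ M := (abs_nonneg _).trans (hg 0)
  refine mp_abs h1 hB hc hV (by positivity) (fun x _ => ?_) x
  rw [h2, mul_div_cancel₀ _ hc.ne']; exact hg x

lemma Sol.add {V g u g' u' : Euc N → ℝ} (h : Sol V g u) (h' : Sol V g' u') :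
    Sol V (fun x => g x + g' x) (fun x => u x + u' x) := by
  obtain ⟨h1, ⟨B, hB⟩, h2⟩ := h
  obtain ⟨h1', ⟨B', hB'⟩, h2'⟩ := h'
  refine ⟨h1.add h1', ⟨B + B', fun x => (abs_add_le _ _).trans (add_le_add (hB x) (hB' x))⟩, fun x => ?_⟩
  rw [lap_add h1 h1']; simp only [← h2, ← h2']; ring

lemma Sol.cmul {V g u : Euc N → ℝ} (h : Sol V g u) (a : ℝ) :
    Sol V (fun x => a * g x) (fun x => a * u x) := by
  obtain ⟨h1, ⟨B, hB⟩, h2⟩ := h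
  refine ⟨contDiff_const.mul h1, ⟨|a| * B, fun x => ?_⟩, fun x => ?_⟩
  · rw [abs_mul]; exact mul_le_mul_of_nonneg_left (hB x) (abs_nonneg _)
  rw [lap_cmul h1]; simp only [← h2]; ring

lemma Sol.sub {V g u g' u' : Euc N → ℝ} (h : Sol V g u) (h' : Sol V g' u') :
    Sol V (fun x => g x - g' x) (fun x => u x - u' x) := by
  have := h.add (h'.cmul (-1))
  simpa [sub_eq_add_neg] using this

lemma Sol.unique {V g u u' : Euc N → ℝ} (h : Sol V g u) (h' : Sol V g u') {c : ℝ} (hc : 0 < c)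
    (hV : ∀ x, c ≤ V x) : u = u' := by
  funext x
  have := (h.sub h').bound hc hV (M := 0) (by simp) x
  rw [zero_div] at this
  exact sub_eq_zero.1 (abs_nonpos_iff.1 this)

/-- `T` is the solution operator of `-Δ + V`. -/
def IsOp (V : Euc N → ℝ) (c : ℝ) (T : XX N →L[ℝ] XX N) : Prop :=
  0 < c ∧ (∀ x, c ≤ V x) ∧ ContDiff ℝ 1 V ∧ ∀ g : XX N, ContDiff ℝ 1 g → Sol V g (T g)

lemma exists_op {V : Euc N → ℝ} {c : ℝ} (hc : 0 < c) (hV : ∀ x, c ≤ V x) (hV1 : ContDiff ℝ 1 V)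
    (hs : ∀ (g : Euc N → ℝ) (M : ℝ), ContDiff ℝ 1 g → (∀ x, |g x| ≤ M) → ∃ u, Sol V g u) :
    ∃ T, IsOp V c T := by
  let Rel : XX N → XX N → Prop := fun g u => ∃ G U : ℕ → XX N, (∀ k, ContDiff ℝ 1 (G k)) ∧
    (∀ k, Sol V (G k) (U k)) ∧ Tendsto G atTop (nhds g) ∧ Tendsto U atTop (nhds u)
  have hbd : ∀ {g g' u u' : XX N}, Sol V g u → Sol V g' u' → ‖u - u'‖ ≤ ‖g - g'‖ / c :=
    fun {g g' u u'} h h' => xle (by positivity) fun x =>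
      (h.sub h').bound hc hV (fun x => xabs_sub g g' x) x
  have hex : ∀ g, ∃ u, Rel g u := fun g => by
    obtain ⟨G, hG1, hG2⟩ := seq_c1 g
    have hU : ∀ k, ∃ U : XX N, Sol V (G k) U := fun k => by
      obtain ⟨u, hu⟩ := hs _ ‖G k‖ (hG1 k) (xabs _)
      exact ⟨mkX u hu.1.continuous _ hu.2.1.choose_spec, hu⟩
    choose U hU using hU
    have hcs : CauchySeq U := by
      rw [Metric.cauchySeq_iff]
      intro δ hδ
      obtain ⟨K, hK⟩ := Metric.cauchySeq_iff.1 hG2.cauchySeq (δ * c) (by positivity)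
      refine ⟨K, fun k hk l hl => ?_⟩
      have := hK k hk l hl
      rw [dist_eq_norm] at this ⊢
      refine (hbd (hU k) (hU l)).trans_lt ?_
      rwa [div_lt_iff₀ hc]
    obtain ⟨u, hu⟩ := cauchySeq_tendsto_of_complete hcs
    exact ⟨u, G, U, hG1, hU, hG2, hu⟩
  have hbnd : ∀ {g g' u u' : XX N}, Rel g u → Rel g' u' → ‖u - u'‖ ≤ ‖g - g'‖ / c := by
    rintro g g' u u' ⟨G, U, -, h1, h2, h3⟩ ⟨G', U', -, h1', h2', h3'⟩
    exact le_of_tendsto_of_tendsto' (h3.sub h3').norm ((h2.sub h2').norm.div_const c)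
      fun k => hbd (h1 k) (h1' k)
  have huq : ∀ {g u u' : XX N}, Rel g u → Rel g u' → u = u' := fun {g u u'} h h' => by
    have := hbnd h h'
    rw [sub_self, norm_zero, zero_div] at this
    exact sub_eq_zero.1 (norm_le_zero_iff.1 this)
  have hadd : ∀ {g g' u u' : XX N}, Rel g u → Rel g' u' → Rel (g + g') (u + u') := by
    rintro g g' u u' ⟨G, U, h0, h1, h2, h3⟩ ⟨G', U', h0', h1', h2', h3'⟩
    exact ⟨fun k => G k + G' k, fun k => U k + U' k, fun k => (h0 k).add (h0' k),
      fun k => (h1 k).add (h1' k), h2.add h2', h3.add h3'⟩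
  have hsm : ∀ (a : ℝ) {g u : XX N}, Rel g u → Rel (a • g) (a • u) := by
    rintro a g u ⟨G, U, h0, h1, h2, h3⟩
    exact ⟨fun k => a • G k, fun k => a • U k, fun k => contDiff_const.mul (h0 k),
      fun k => (h1 k).cmul a, h2.const_smul a, h3.const_smul a⟩
  choose t ht using hex
  let L : XX N →ₗ[ℝ] XX N :=
    { toFun := t
      map_add' := fun a b => huq (ht (a + b)) (hadd (ht a) (ht b))
      map_smul' := fun a b => huq (ht (a • b)) (hsm a (ht b)) }
  have h0 : Rel 0 0 := ⟨fun _ => 0, fun _ => 0, fun _ => contDiff_const,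
    fun _ => ⟨contDiff_const, ⟨0, fun x => by simp⟩, fun x => by
      change -lap (fun _ => 0) x + V x * 0 = 0
      rw [lap_const]; ring⟩, tendsto_const_nhds, tendsto_const_nhds⟩
  have hb : ∀ g : XX N, ‖L g‖ ≤ 1 / c * ‖g‖ := fun g => by
    have := hbnd (ht g) h0
    rw [sub_zero, sub_zero] at this
    rw [one_div_mul_eq_div]; exact this
  refine ⟨⟨L, AddMonoidHomClass.continuous_of_bound L (1 / c) hb⟩, hc, hV, hV1, fun g hg => ?_⟩
  obtain ⟨u, hu⟩ := hs _ ‖g‖ hg (xabs _)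
  let u' : XX N := mkX u hu.1.continuous _ hu.2.1.choose_spec
  have : t g = u' := huq (ht g) ⟨fun _ => g, fun _ => u', fun _ => hg, fun _ => hu,
    tendsto_const_nhds, tendsto_const_nhds⟩
  change Sol V g (t g)
  rw [this]; exact hu

section op
variable {V : Euc N → ℝ} {c : ℝ} {T : XX N →L[ℝ] XX N}

/-- comparison principle -/
lemma IsOp.le (hT : IsOp V c T) {g : XX N} {b : Euc N → ℝ} (hb : ContDiff ℝ 2 b) {B : ℝ}
    (hB : ∀ x, -B ≤ b x) (h : ∀ x, g x ≤ -lap b x + V x * b x) (x : Euc N) : T g x ≤ b x := by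
  obtain ⟨hc, hV, -, hT⟩ := hT
  obtain ⟨G, hG1, hG2⟩ := seq_c1 g
  have h1 : ∀ k, T (G k) x ≤ b x + ‖G k - g‖ / c := fun k => by
    obtain ⟨a1, ⟨B', hB'⟩, a2⟩ := hT (G k) (hG1 k)
    have := mp_le (u := fun x => T (G k) x - b x) (V := V) (a1.sub hb) (B := B' + B) (fun x => by
      linarith [hB x, (abs_le.1 (hB' x)).2]) hc hV (m := ‖G k - g‖ / c) (by positivity) (fun x _ => by
        rw [lap_sub a1 hb, mul_div_cancel₀ _ hc.ne']
        have := (abs_le.1 (xabs_sub (G k) g x)).2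
        have := a2 x
        have := h x
        linarith) x
    linarith
  have h2 : Tendsto (fun k => T (G k) x) atTop (nhds (T g x)) := by
    have : Continuous (fun g => T g x) := by fun_prop
    exact (this.tendsto g).comp hG2
  have h3 : Tendsto (fun k => b x + ‖G k - g‖ / c) atTop (nhds (b x + 0 / c)) :=
    ((tendsto_iff_norm_sub_tendsto_zero.1 hG2).div_const c).const_add _
  rw [zero_div, add_zero] at h3
  exact le_of_tendsto_of_tendsto' h2 h3 h1

lemma IsOp.abs_le (hT : IsOp V c T) {g : XX N} {b : Euc N → ℝ} (hb : ContDiff ℝ 2 b) {B : ℝ}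
    (hB : ∀ x, -B ≤ b x) (h : ∀ x, |g x| ≤ -lap b x + V x * b x) (x : Euc N) : |T g x| ≤ b x := by
  rw [_root_.abs_le]
  constructor
  · have := hT.le (g := -g) hb hB (fun x => (neg_le_abs _).trans (h x)) x
    rw [map_neg] at this
    have e : (-(T g)) x = - T g x := rfl
    linarith
  · exact hT.le hb hB (fun x => (le_abs_self _).trans (h x)) x

lemma IsOp.bound (hT : IsOp V c T) {g : XX N} {M : ℝ} (h : ∀ x, |g x| ≤ M) (x : Euc N) :
    |T g x| ≤ M / c := by
  have hM : 0 ≤ M := (abs_nonneg _).trans (h 0)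
  have hc := hT.1
  refine hT.abs_le (b := fun _ => M / c) contDiff_const (B := 0) (fun x => ?_) (fun x => ?_) x
  · rw [neg_zero]; positivity
  · rw [lap_const]
    have : c * (M / c) ≤ V x * (M / c) := by gcongr; exact hT.2.1 x
    rw [mul_div_cancel₀ _ hc.ne'] at this
    linarith [h x]

lemma IsOp.norm_le (hT : IsOp V c T) (g : XX N) : ‖T g‖ ≤ ‖g‖ / c :=
  xle (div_nonneg (norm_nonneg _) hT.1.le) (hT.bound (xabs g))

lemma IsOp.opNorm (hT : IsOp V c T) : ‖T‖ ≤ 1 / c :=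
  T.opNorm_le_bound (by have := hT.1; positivity) fun g => by
    rw [one_div_mul_eq_div]; exact hT.norm_le g

/-- uniqueness -/
lemma IsOp.eq_of_sol (hT : IsOp V c T) {g u : XX N} (h : Sol V g u) : T g = u := by
  obtain ⟨u2, -, ue⟩ := h
  ext x
  apply le_antisymm
  · exact hT.le u2 (B := ‖u‖) (fun x => (_root_.abs_le.1 (xabs u x)).1) (fun x => (ue x).ge) x
  · have := hT.le (g := -g) (b := fun x => - u x) u2.neg (B := ‖u‖) (fun x => by
      linarith [(_root_.abs_le.1 (xabs u x)).2]) (fun x => by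
        rw [lap_neg u2]
        have := ue x
        have e : (-g) x = - g x := rfl
        linarith) x
    rw [map_neg] at this
    have e : (-(T g)) x = - T g x := rfl
    linarith

lemma xlut {G : ℕ → XX N} {g : XX N} (h : Tendsto G atTop (nhds g)) : LUT (fun k => (G k : Euc N → ℝ)) g := by
  intro R δ hδ
  have := (tendsto_iff_norm_sub_tendsto_zero.1 h).eventually (ge_mem_nhds hδ)
  obtain ⟨K, hK⟩ := eventually_atTop.1 this
  exact ⟨K, fun k hk x _ => (xabs_sub _ _ x).trans (hK k hk)⟩

/-- first-order regularity -/
lemma IsOp.c1_aux (hT : IsOp V c T) {g : XX N} {G : ℕ → XX N} (hG1 : ∀ k, ContDiff ℝ 1 (G k))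
    (hG2 : Tendsto G atTop (nhds g)) : ContDiff ℝ 1 (T g) ∧
      ∀ n, LUT (fun k => pd n (T (G k))) (pd n (T g)) := by
  obtain ⟨hc, hV, hV1, hT⟩ := hT
  have h0 : LUT (fun k => (T (G k) : Euc N → ℝ)) (T g) := xlut ((T.continuous.tendsto g).comp hG2)
  have hS := fun k => hT (G k) (hG1 k)
  have e : ∀ k, lap (T (G k)) = fun x => V x * T (G k) x - G k x := fun k => funext fun x => by
    linarith [(hS k).2.2 x]
  have hl : LUC (fun k => lap (T (G k))) := by
    simp_rw [e]
    exact ((LUC.const V).mul h0.luc (fun _ => hV1.continuous) fun k => (T (G k)).continuous).sub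
      (xlut hG2).luc
  have hg := fun n => luc_grad (fun k => (hS k).1) h0.luc hl n
  choose D hD using fun n => (hg n).exists_lim
  obtain ⟨h1, h2⟩ := c1_limit (fun k => c21 (hS k).1) h0.tendsto hD
  exact ⟨h1, fun n => by rw [h2]; exact hD n⟩

lemma IsOp.c1 (hT : IsOp V c T) (g : XX N) : ContDiff ℝ 1 (T g) := by
  obtain ⟨G, hG1, hG2⟩ := seq_c1 g
  exact (hT.c1_aux hG1 hG2).1

lemma IsOp.grad (hT : IsOp V c T) {g : XX N} {M F L r : ℝ} (hr : 0 < r) (x₀ : Euc N)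
    (hM : ∀ x, ‖x - x₀‖ ≤ r → |T g x| ≤ M) (hF : ∀ x, ‖x - x₀‖ ≤ r → |g x| ≤ F)
    (hL : ∀ x, ‖x - x₀‖ ≤ r → |V x| ≤ L) (n : Fin N) :
    |pd n (T g) x₀| ≤ N * M / r + r * (L * M + F) / 2 := by
  obtain ⟨G, hG1, hG2⟩ := seq_c1 g
  have hd := ((hT.c1_aux hG1 hG2).2 n).tendsto x₀
  have hL0 : 0 ≤ L := (abs_nonneg _).trans (hL x₀ (by simp [hr.le]))
  have a1 : Tendsto (fun k => ‖G k - g‖) atTop (nhds 0) := tendsto_iff_norm_sub_tendsto_zero.1 hG2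
  have a2 : Tendsto (fun k => ‖T (G k) - T g‖) atTop (nhds 0) :=
    tendsto_iff_norm_sub_tendsto_zero.1 ((T.continuous.tendsto g).comp hG2)
  have h1 : ∀ k, |pd n (T (G k)) x₀| ≤ N * (M + ‖T (G k) - T g‖) / r
      + r * (L * (M + ‖T (G k) - T g‖) + (F + ‖G k - g‖)) / 2 := fun k => by
    have hS := hT.2.2.2 (G k) (hG1 k)
    have b1 : ∀ x, ‖x - x₀‖ ≤ r → |T (G k) x| ≤ M + ‖T (G k) - T g‖ := fun x hx => by
      have := abs_sub_abs_le_abs_sub (T (G k) x) (T g x)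
      linarith [xabs_sub (T (G k)) (T g) x, hM x hx]
    refine grad_est hS.1 hr x₀ b1 (fun x hx => ?_) n
    have e : lap (T (G k)) x = V x * T (G k) x - G k x := by linarith [hS.2.2 x]
    rw [e]
    refine (abs_sub _ _).trans (add_le_add ?_ ?_)
    · rw [abs_mul]; exact mul_le_mul (hL x hx) (b1 x hx) (abs_nonneg _) hL0
    · have := abs_sub_abs_le_abs_sub (G k x) (g x)
      linarith [xabs_sub (G k) g x, hF x hx]
  have h2 : Tendsto (fun k => N * (M + ‖T (G k) - T g‖) / r
      + r * (L * (M + ‖T (G k) - T g‖) + (F + ‖G k - g‖)) / 2) atTop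
      (nhds (N * (M + 0) / r + r * (L * (M + 0) + (F + 0)) / 2)) :=
    (((a2.const_add M).const_mul (N:ℝ)).div_const r).add
      (((((a2.const_add M).const_mul L).add (a1.const_add F)).const_mul r).div_const 2)
  simp only [add_zero] at h2
  exact le_of_tendsto_of_tendsto' hd.abs h2 h1

end op

/-- solvability for bounded potentials -/
lemma solve_bdd (hN : 1 ≤ N) {V : Euc N → ℝ} {c lam : ℝ} (hc : 0 < c) (hV1 : ContDiff ℝ 1 V)
    (hV : ∀ x, c ≤ V x) (hVl : ∀ x, V x ≤ lam) {g : Euc N → ℝ} (hg : ContDiff ℝ 1 g) {M : ℝ}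
    (hM : ∀ x, |g x| ≤ M) : ∃ u, Sol V g u := by
  have hcl : c ≤ lam := (hV 0).trans (hVl 0)
  have hl : 0 < lam := by linarith
  obtain ⟨R, hR⟩ := exists_op (V := fun _ : Euc N => lam) (c := lam) hl (fun _ => le_rfl) contDiff_const
    (fun g M hg hM => solve_const hN lam hl hg hM)
  set m : XX N := mkX (fun x => lam - V x) (continuous_const.sub hV1.continuous) (lam - c) (fun x => by
    rw [abs_le]; constructor <;> linarith [hV x, hVl x]) with hm
  have hmn : ‖m‖ ≤ lam - c := xle (by linarith) fun x => by
    rw [hm, mkX_apply, abs_le]; constructor <;> linarith [hV x, hVl x]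
  set A : XX N →L[ℝ] XX N := R.comp (ContinuousLinearMap.mul ℝ (XX N) m) with hA
  have hA1 : ‖A‖ < 1 := by
    refine (ContinuousLinearMap.opNorm_le_bound _ (M := (lam - c) / lam)
      (div_nonneg (by linarith) hl.le) (fun v => ?_)).trans_lt ((div_lt_one hl).2 (by linarith))
    refine (hR.norm_le _).trans ?_
    rw [div_mul_eq_mul_div]
    gcongr
    exact (norm_mul_le _ _).trans (by gcongr)
  set G : XX N := mkX g hg.continuous M hM with hG
  set u : XX N := (↑(Units.oneSub A hA1)⁻¹ : XX N →L[ℝ] XX N) (R G) with hu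
  have hu1 : u - A u = R G := by
    have := (Units.oneSub A hA1).mul_inv
    have h2 := congrArg (fun B : XX N →L[ℝ] XX N => B (R G)) this
    exact h2
  have hu2 : u = R (m * u + G) := by
    rw [map_add, ← hu1]
    change u = A u + (u - A u)
    abel
  have hu3 : ContDiff ℝ 1 u := by rw [hu2]; exact hR.c1 _
  have hu4 : ContDiff ℝ 1 (m * u + G : XX N) := by
    have : ContDiff ℝ 1 (fun x => (lam - V x) * u x + g x) :=
      ((contDiff_const.sub hV1).mul hu3).add hg
    exact this
  have hS := hR.2.2.2 _ hu4
  rw [← hu2] at hS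
  refine ⟨u, hS.1, hS.2.1, fun x => ?_⟩
  have := hS.2.2 x
  have e : (m * u + G : XX N) x = (lam - V x) * u x + g x := rfl
  rw [e] at this
  linarith

lemma solve_gen (hN : 1 ≤ N) {V : Euc N → ℝ} {c : ℝ} (hc : 0 < c) (hV1 : ContDiff ℝ 1 V)
    (hV : ∀ x, c ≤ V x) {g : Euc N → ℝ} (hg : ContDiff ℝ 1 g) {M : ℝ}
    (hM : ∀ x, |g x| ≤ M) : ∃ u, Sol V g u := by
  have hM0 : 0 ≤ M := (abs_nonneg _).trans (hM 0)
  choose ζ hζ1 hζ2 hζ3 hζ4 using fun k : ℕ => exists_cutoff (N := N) ((k:ℝ) + 1) (by positivity)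
  have hlam : ∀ k, ∃ lam : ℝ, c ≤ lam ∧ ∀ x, ζ k x ≠ 0 → V x ≤ lam := fun k => by
    obtain ⟨L, hL⟩ := (hζ2 k).isCompact.exists_bound_of_continuousOn (f := V) hV1.continuous.continuousOn
    refine ⟨max c L, le_max_left _ _, fun x hx => ?_⟩
    exact (le_abs_self _).trans ((hL x (subset_tsupport _ hx)).trans (le_max_right _ _))
  choose lam hlc hlV using hlam
  set W : ℕ → Euc N → ℝ := fun k x => lam k + (V x - lam k) * ζ k x with hW
  have hWV : ∀ (k : ℕ) x, ‖x‖ ≤ (k:ℝ) + 1 → W k x = V x := fun k x hx => by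
    simp only [hW]; rw [hζ4 k x hx]; ring
  have hW1 : ∀ k, ContDiff ℝ 1 (W k) := fun k =>
    contDiff_const.add ((hV1.sub contDiff_const).mul ((hζ1 k).of_le (by exact_mod_cast le_top)))
  have hWc : ∀ k x, c ≤ W k x := fun k x => by
    have e : W k x = lam k * (1 - ζ k x) + V x * ζ k x := by simp only [hW]; ring
    rw [e]
    have := hζ3 k x
    nlinarith [hV x, hlc k]
  have hWl : ∀ k x, W k x ≤ lam k := fun k x => by
    simp only [hW]
    by_cases h : ζ k x = 0
    · simp [h]
    · have := hlV k x h
      have := hζ3 k x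
      nlinarith
  choose u hu using fun k => solve_bdd hN hc (hW1 k) (hWc k) (hWl k) hg hM
  have hev : ∀ R : ℝ, ∃ K : ℕ, ∀ k ≥ K, R < (k:ℝ) + 1 := fun R => by
    obtain ⟨K, hK⟩ := exists_nat_gt R
    refine ⟨K, fun k hk => ?_⟩
    have : (K:ℝ) ≤ k := by exact_mod_cast hk
    linarith
  refine sol_limit hN (V := W) (g := fun _ => g) hc hM0 hWc (fun _ => hM) hW1 (fun _ => hg) ?_
    (fun R δ hδ => ⟨0, by simp [hδ.le]⟩) (fun n => ?_) (fun n => LUC.const _) hu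
  · intro R δ hδ
    obtain ⟨K, hK⟩ := hev R
    refine ⟨K, fun k hk x hx => ?_⟩
    rw [hWV k x (by linarith [hK k hk]), sub_self, abs_zero]; exact hδ.le
  · have : LUT (fun k => pd n (W k)) (pd n V) := by
      intro R δ hδ
      obtain ⟨K, hK⟩ := hev R
      refine ⟨K, fun k hk x hx => ?_⟩
      beta_reduce
      rw [pd_congr_ball (g := W k) (h := V) (R := k + 1) (fun y hy => hWV k y hy.le) n x
        (by linarith [hK k hk]), sub_self, abs_zero]; exact hδ.le
    exact this.luc

lemma op_exists (hN : 1 ≤ N) {V : Euc N → ℝ} {c : ℝ} (hc : 0 < c) (hV1 : ContDiff ℝ 1 V)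
    (hV : ∀ x, c ≤ V x) : ∃ T, IsOp V c T :=
  exists_op hc hV hV1 fun _ _ hg hM => solve_gen hN hc hV1 hV hg hM

end LS

namespace LS
open scoped ContDiff BoundedContinuousFunction
variable {N : ℕ}

lemma contDiff_dsq {k : WithTop ℕ∞} (x₀ : Euc N) : ContDiff ℝ k (fun x : Euc N => ‖x - x₀‖ ^ 2) :=
  (contDiff_normsq (N := N)).comp (contDiff_id.sub contDiff_const)

lemma lap_dsq (x₀ x : Euc N) : lap (fun x : Euc N => ‖x - x₀‖ ^ 2) x = 2 * N := by
  have e : (fun x : Euc N => ‖x - x₀‖ ^ 2) = fun x => (fun y : Euc N => ‖y‖ ^ 2) ((1:ℝ) • x + (-x₀)) := by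
    funext x; simp [sub_eq_add_neg]
  rw [e, lap_aff contDiff_normsq, lap_normsq]; ring

lemma rpow_le_one_add_sq {t σ : ℝ} (ht : 0 ≤ t) (h0 : 0 ≤ σ) (h1 : σ ≤ 1) : t ^ σ ≤ 1 + t ^ 2 := by
  rcases le_total t 1 with h | h
  · have := Real.rpow_le_one ht h h0
    nlinarith [sq_nonneg t]
  · have : t ^ σ ≤ t ^ (1:ℝ) := Real.rpow_le_rpow_of_exponent_le h h1
    rw [Real.rpow_one] at this
    nlinarith

/-- Hölder functions -/
def Hol (σ H : ℝ) (h : Euc N → ℝ) : Prop := 0 ≤ H ∧ ∀ x y, |h x - h y| ≤ H * ‖x - y‖ ^ σ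

/-- resolvent at scale `r` -/
def IsRes (r : ℝ) (R : XX N →L[ℝ] XX N) : Prop := 0 < r ∧ IsOp (fun _ => (r ^ 2)⁻¹) (r ^ 2)⁻¹ R

lemma res_exists (hN : 1 ≤ N) {r : ℝ} (hr : 0 < r) : ∃ R : XX N →L[ℝ] XX N, IsRes r R := by
  obtain ⟨R, hR⟩ := op_exists hN (c := (r ^ 2)⁻¹) (by positivity) (V := fun _ : Euc N => (r ^ 2)⁻¹)
    contDiff_const (fun _ => le_rfl)
  exact ⟨R, hr, hR⟩

section
variable {r : ℝ} {R : XX N →L[ℝ] XX N}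

lemma IsRes.const (hR : IsRes r R) (a : ℝ) :
    R (BoundedContinuousFunction.const _ a) = BoundedContinuousFunction.const _ (r ^ 2 * a) := by
  have := hR.1
  refine hR.2.eq_of_sol ⟨contDiff_const, ⟨|r ^ 2 * a|, fun x => le_rfl⟩, fun x => ?_⟩
  change -lap (fun _ => r ^ 2 * a) x + (r ^ 2)⁻¹ * (r ^ 2 * a) = a
  rw [lap_const]; field_simp; ring

lemma IsRes.norm_le (hR : IsRes r R) (g : XX N) : ‖R g‖ ≤ ‖g‖ * r ^ 2 := by
  have := hR.2.norm_le g
  rwa [div_inv_eq_mul] at this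

lemma IsRes.hol (hR : IsRes r R) {σ H : ℝ} (hσ0 : 0 ≤ σ) (hσ1 : σ ≤ 1) {h : XX N} (hh : Hol σ H h)
    (x₀ : Euc N) :
    |(r ^ 2)⁻¹ * R h x₀ - h x₀| ≤ (2 * N + 1) * (H * r ^ σ) ∧
    ∀ n, |pd n (R h) x₀| ≤ (N * (2 * N + 2) + N + 2) * (H * r ^ σ * r) := by
  obtain ⟨hr, hO⟩ := id hR
  obtain ⟨hH, hh⟩ := hh
  set s := H * r ^ σ with hs
  have hs0 : 0 ≤ s := by positivity
  set h' : XX N := h - BoundedContinuousFunction.const _ (h x₀) with hh'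
  have e1 : ∀ x, h' x = h x - h x₀ := fun x => rfl
  have hb : ∀ x, |h' x| ≤ s * (1 + (r ^ 2)⁻¹ * ‖x - x₀‖ ^ 2) := fun x => by
    rw [e1]
    refine (hh x x₀).trans ?_
    have h1 := rpow_le_one_add_sq (t := ‖x - x₀‖ / r) (by positivity) hσ0 hσ1
    rw [Real.div_rpow (norm_nonneg _) hr.le, div_le_iff₀ (by positivity)] at h1
    calc H * ‖x - x₀‖ ^ σ ≤ H * ((1 + (‖x - x₀‖ / r) ^ 2) * r ^ σ) := by gcongr
      _ = _ := by rw [hs, div_pow]; field_simp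
  have hc2 : ContDiff ℝ 2 (fun x : Euc N => r ^ 2 * (2 * N + 1) + ‖x - x₀‖ ^ 2) :=
    contDiff_const.add (contDiff_dsq x₀)
  have hRb : ∀ x, |R h' x| ≤ s * (r ^ 2 * (2 * N + 1) + ‖x - x₀‖ ^ 2) := by
    refine hO.abs_le (contDiff_const.mul hc2) (B := 0) (fun x => ?_) fun x => ?_
    · rw [neg_zero]; positivity
    · rw [lap_cmul hc2, lap_add contDiff_const (contDiff_dsq x₀), lap_const, lap_dsq]
      refine (hb x).trans (le_of_eq ?_)
      field_simp; ring
  have e2 : R h = R h' + BoundedContinuousFunction.const _ (r ^ 2 * h x₀) := by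
    rw [hh', map_sub, hR.const]; abel
  refine ⟨?_, fun n => ?_⟩
  · have h1 := hRb x₀
    rw [sub_self, norm_zero] at h1
    have e3 : (r ^ 2)⁻¹ * R h x₀ - h x₀ = (r ^ 2)⁻¹ * R h' x₀ := by
      rw [e2]
      change (r ^ 2)⁻¹ * (R h' x₀ + r ^ 2 * h x₀) - h x₀ = _
      field_simp; ring
    rw [e3, abs_mul, abs_of_pos (by positivity : 0 < (r ^ 2)⁻¹)]
    calc (r ^ 2)⁻¹ * |R h' x₀| ≤ (r ^ 2)⁻¹ * (s * (r ^ 2 * (2 * N + 1) + 0 ^ 2)) := by gcongr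
      _ = _ := by field_simp; ring
  · have e4 : pd n (R h) = pd n (R h') := by
      rw [e2]
      change pd n (fun x => R h' x + r ^ 2 * h x₀) = _
      rw [pd_add (dif1 (hO.c1 h')) (differentiable_const _), pd_const]
      simp
    rw [e4]
    have := hO.grad (g := h') (M := s * (r ^ 2 * (2 * N + 2))) (F := s * 2) (L := (r ^ 2)⁻¹) hr x₀
      (fun x hx => (hRb x).trans (by
        have : ‖x - x₀‖ ^ 2 ≤ r ^ 2 := by gcongr
        gcongr; linarith))
      (fun x hx => (hb x).trans (by
        have h1 : ‖x - x₀‖ ^ 2 ≤ r ^ 2 := by gcongr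
        have h2 : (r ^ 2)⁻¹ * ‖x - x₀‖ ^ 2 ≤ 1 := by
          rw [inv_mul_le_iff₀ (by positivity), mul_one]; exact h1
        gcongr; linarith))
      (fun x _ => (abs_of_pos (by positivity : 0 < (r ^ 2)⁻¹)).le) n
    refine this.trans (le_of_eq ?_)
    field_simp; ring

lemma hol_of_pd {g : Euc N → ℝ} (hg : ContDiff ℝ 1 g) {G : ℝ} (hG : ∀ n x, |pd n g x| ≤ G) (hG0 : 0 ≤ G) :
    Hol 1 (N * G) g := by
  refine ⟨by positivity, fun x y => ?_⟩
  rw [Real.rpow_one]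
  have := Convex.norm_image_sub_le_of_norm_fderiv_le (f := g) (s := univ) (C := N * G) (x := y) (y := x) (𝕜 := ℝ)
    (fun x _ => (dif1 hg) x) (fun x _ => by
      refine (norm_fderiv_le g x).trans ?_
      calc ∑ n, |pd n g x| ≤ ∑ _n : Fin N, G := Finset.sum_le_sum fun n _ => hG n x
        _ = N * G := by simp) convex_univ (mem_univ _) (mem_univ _)
  exact this

lemma IsRes.hess (hR : IsRes r R) {g : XX N} (hg : ContDiff ℝ 1 g) {G : ℝ} (hG : ∀ n x, |pd n g x| ≤ G)
    (n m : Fin N) (x : Euc N) :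
    |pd n (pd m (R g)) x| ≤ ((N + 1) * ((N * (2 * N + 2) + N + 2) * N) + 1) * (G * r) := by
  have hG0 : 0 ≤ G := (abs_nonneg _).trans (hG n x)
  have hr := hR.1
  have hS := hR.2.2.2.2 g hg
  set Cn : ℝ := (N * (2 * N + 2) + N + 2) * N with hCn
  have hCn0 : 0 ≤ Cn := by positivity
  have h1 : ∀ k y, |pd k (R g) y| ≤ Cn * (G * r ^ 2) := fun k y => by
    have := (hR.hol zero_le_one le_rfl (hol_of_pd hg hG hG0) y).2 k
    rw [Real.rpow_one] at this
    refine this.trans (le_of_eq ?_); rw [hCn]; ring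
  have hl : lap (R g) = fun x => (r ^ 2)⁻¹ * R g x - g x := funext fun x => by
    linarith [hS.2.2 x]
  have hl1 : ContDiff ℝ 1 (lap (R g)) := by
    rw [hl]; exact (contDiff_const.mul (c21 hS.1)).sub hg
  have h2 := hess_est hS.1 hl1 (M := Cn * (G * r ^ 2)) (F := (Cn + 1) * G) hr x n m
    (fun y _ => h1 n y) (fun y _ => by
      rw [hl, pd_sub (u := fun x => (r ^ 2)⁻¹ * R g x) ((dif2 hS.1).const_mul _) (dif1 hg),
        pd_cmul (dif2 hS.1)]
      refine (abs_sub _ _).trans ?_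
      rw [abs_mul, abs_of_pos (by positivity : 0 < (r ^ 2)⁻¹)]
      calc (r ^ 2)⁻¹ * |pd n (R g) y| + |pd n g y| ≤ (r ^ 2)⁻¹ * (Cn * (G * r ^ 2)) + G := by
            gcongr
            · exact h1 n y
            · exact hG n y
        _ = (Cn + 1) * G := by field_simp)
  refine h2.trans ?_
  have e : N * (Cn * (G * r ^ 2)) / r + r * ((Cn + 1) * G) / 2 = (N * Cn + (Cn + 1) / 2) * (G * r) := by
    field_simp
  rw [e]
  exact mul_le_mul_of_nonneg_right (by linarith) (by positivity)

/-- resolvent identity -/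
lemma res_identity {V V' : Euc N → ℝ} {c c' : ℝ} {A B : XX N →L[ℝ] XX N} (hA : IsOp V c A)
    (hB : IsOp V' c' B) {a b : ℝ} (ha : ∀ x, V x = a) (hb : ∀ x, V' x = b) (g : XX N) :
    A g - B g = A ((b - a) • B g) := by
  have h1 : ∀ g : XX N, ContDiff ℝ 1 g → A g - B g = A ((b - a) • B g) := fun g hg => by
    have s1 := hA.2.2.2 g hg
    have s2 := hB.2.2.2 g hg
    symm
    refine hA.eq_of_sol ⟨s1.1.sub s2.1, ⟨_, xabs (A g - B g)⟩, fun x => ?_⟩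
    have e : lap (A g - B g : XX N) x = lap (A g) x - lap (B g) x := lap_sub s1.1 s2.1 x
    have e2 : (A g - B g : XX N) x = A g x - B g x := rfl
    have e3 : ((b - a) • B g : XX N) x = (b - a) * B g x := rfl
    rw [e, e2, e3]
    have t1 := s1.2.2 x
    have t2 := s2.2.2 x
    rw [ha] at t1 ⊢
    rw [hb] at t2
    linarith
  obtain ⟨G, hG1, hG2⟩ := seq_c1 g
  have c1 : Continuous fun g : XX N => A g - B g := by fun_prop
  have c2 : Continuous fun g : XX N => A ((b - a) • B g) := by fun_prop
  refine tendsto_nhds_unique ((c1.tendsto g).comp hG2) ?_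
  refine ((c2.tendsto g).comp hG2).congr fun k => ?_
  exact (h1 _ (hG1 k)).symm

lemma lut_geom {F : ℕ → Euc N → ℝ} {C q : ℝ} (hq0 : 0 ≤ q) (hq : q < 1)
    (h : ∀ k x, |F (k + 1) x - F k x| ≤ C * q ^ k) : LUC F := by
  have hd : ∀ x k, dist (F k x) (F (k + 1) x) ≤ C * q ^ k := fun x k => by
    rw [dist_comm, Real.dist_eq]; exact h k x
  have hl : ∀ x, ∃ a, Tendsto (fun k => F k x) atTop (nhds a) := fun x =>
    cauchySeq_tendsto_of_complete (cauchySeq_of_le_geometric q C hq (hd x))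
  choose g hg using hl
  have : LUT F g := by
    intro R δ hδ
    have ht : Tendsto (fun k => C * q ^ k / (1 - q)) atTop (nhds (C * 0 / (1 - q))) :=
      ((tendsto_pow_atTop_nhds_zero_of_lt_one hq0 hq).const_mul C).div_const _
    rw [mul_zero, zero_div] at ht
    obtain ⟨K, hK⟩ := eventually_atTop.1 (ht.eventually (ge_mem_nhds hδ))
    refine ⟨K, fun k hk x _ => ?_⟩
    have := dist_le_of_le_geometric_of_tendsto q C hq (hd x) (hg x) k
    rw [Real.dist_eq] at this
    exact this.trans (hK k hk)
  exact this.luc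

/-- Schauder-type regularity -/
lemma schauder (hN : 1 ≤ N) {c : ℝ} (hR : IsOp (fun _ => 1) c R) {σ H : ℝ} (hσ0 : 0 < σ)
    (hσ1 : σ ≤ 1) {h : XX N} (hh : Hol σ H h) : Sol (fun _ => 1) h (R h) := by
  set r : ℕ → ℝ := fun k => (1 / 2 : ℝ) ^ k with hr
  have hr0 : ∀ k, 0 < r k := fun k => by positivity
  have hrs : ∀ k, r (k + 1) = r k / 2 := fun k => by simp only [hr]; rw [pow_succ]; ring
  choose Q hQ using fun k => res_exists hN (hr0 k)
  set C1 : ℝ := N * (2 * N + 2) + N + 2 with hC1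
  have hC10 : 0 ≤ C1 := by positivity
  have hH := hh.1
  -- approximations
  set U : ℕ → XX N := fun k => R h - Q k h with hU
  have hU1 : ∀ k, U k = R (((r k ^ 2)⁻¹ - 1) • Q k h) := fun k =>
    res_identity hR (hQ k).2 (fun _ => rfl) (fun _ => rfl) h
  have hqc : ∀ k, ContDiff ℝ 1 (Q k h) := fun k => (hQ k).2.c1 h
  have hUS : ∀ k, Sol (fun _ => 1) (((r k ^ 2)⁻¹ - 1) • Q k h : XX N) (U k) := fun k => by
    rw [hU1]
    exact hR.2.2.2 _ (contDiff_const.mul (hqc k))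
  have hU2 : ∀ k, ContDiff ℝ 2 (U k) := fun k => (hUS k).1
  set q : ℝ := (1 / 2 : ℝ) ^ σ with hq
  have hq0 : 0 ≤ q := by positivity
  have hq1 : q < 1 := Real.rpow_lt_one (by norm_num) (by norm_num) hσ0
  have hrq : ∀ k, (r k) ^ σ = q ^ k := fun k => by
    simp only [hr, hq]
    rw [← Real.rpow_natCast, ← Real.rpow_natCast, ← Real.rpow_mul (by norm_num),
      ← Real.rpow_mul (by norm_num), mul_comm]
  have hrto : Tendsto r atTop (nhds 0) :=
    tendsto_pow_atTop_nhds_zero_of_lt_one (by norm_num) (by norm_num)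
  have hqto : Tendsto (fun k => q ^ k) atTop (nhds 0) :=
    tendsto_pow_atTop_nhds_zero_of_lt_one hq0 hq1
  have hgr : ∀ k n x, |pd n (Q k h) x| ≤ C1 * (H * q ^ k * r k) := fun k n x => by
    have := ((hQ k).hol hσ0.le hσ1 hh x).2 n
    rwa [hrq] at this
  -- consecutive differences
  have hD : ∀ k, U (k + 1) - U k = Q k (((r (k + 1) ^ 2)⁻¹ - (r k ^ 2)⁻¹) • Q (k + 1) h) := fun k => by
    rw [← res_identity (hQ k).2 (hQ (k + 1)).2 (fun _ => rfl) (fun _ => rfl) h]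
    simp only [hU]; abel
  obtain ⟨C2, hC2⟩ : ∃ C2 : ℝ, ∀ k n m x, |pd n (pd m (U (k + 1) - U k : XX N)) x| ≤ C2 * q ^ k := by
    refine ⟨((N + 1) * ((N * (2 * N + 2) + N + 2) * N) + 1) * (3 / 2 * C1 * H), fun k n m x => ?_⟩
    rw [hD]
    have hg1 : ContDiff ℝ 1 (((r (k + 1) ^ 2)⁻¹ - (r k ^ 2)⁻¹) • Q (k + 1) h : XX N) :=
      contDiff_const.mul (hqc (k + 1))
    have hrk := hr0 k
    have := (hQ k).hess hg1 (G := 3 / 2 * C1 * H * q ^ k * (r k)⁻¹) (fun n x => by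
      change |pd n (fun x => ((r (k + 1) ^ 2)⁻¹ - (r k ^ 2)⁻¹) * Q (k + 1) h x) x| ≤ _
      rw [pd_cmul (dif1 (hqc (k + 1)))]
      have e : (r (k + 1) ^ 2)⁻¹ - (r k ^ 2)⁻¹ = 3 * (r k ^ 2)⁻¹ := by
        rw [hrs]; field_simp; ring
      rw [e, abs_mul, abs_of_pos (by positivity)]
      calc 3 * (r k ^ 2)⁻¹ * |pd n (Q (k + 1) h) x|
          ≤ 3 * (r k ^ 2)⁻¹ * (C1 * (H * q ^ (k + 1) * r (k + 1))) := by gcongr; exact hgr _ _ _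
        _ = 3 / 2 * C1 * H * (q ^ k * q) * (r k)⁻¹ := by
            rw [hrs, pow_succ]; field_simp; ring
        _ ≤ 3 / 2 * C1 * H * (q ^ k * 1) * (r k)⁻¹ := by gcongr
        _ = _ := by ring) n m x
    refine this.trans (le_of_eq ?_)
    field_simp
  -- limits
  have hpt : ∀ x, Tendsto (fun k => U k x) atTop (nhds (R h x)) := fun x => by
    have h1 : Tendsto (fun k => Q k h x) atTop (nhds 0) := by
      refine squeeze_zero_norm (a := fun k => ‖h‖ * r k ^ 2) (fun k => ?_) ?_
      · exact (xabs _ x).trans ((hQ k).norm_le h)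
      · simpa using (hrto.pow 2).const_mul ‖h‖
    have h2 := h1.const_sub (R h x)
    rw [sub_zero] at h2
    exact h2
  have hpd : ∀ n, LUT (fun k => pd n (U k)) (pd n (R h)) := fun n => by
    intro S δ hδ
    have ht : Tendsto (fun k => C1 * (H * q ^ k * r k)) atTop (nhds (C1 * (H * 0 * 0))) :=
      ((hqto.const_mul H).mul hrto).const_mul C1
    rw [mul_zero, mul_zero] at ht
    obtain ⟨K, hK⟩ := eventually_atTop.1 (ht.eventually (ge_mem_nhds hδ))
    refine ⟨K, fun k hk x _ => ?_⟩
    change |pd n (fun x => R h x - Q k h x) x - pd n (R h) x| ≤ δ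
    rw [pd_sub (dif1 (hR.c1 h)) (dif1 (hqc k))]
    rw [sub_sub_cancel_left, abs_neg]
    exact (hgr k n x).trans (hK k hk)
  have hhs : ∀ n m, LUC (fun k => pd n (pd m (U k))) := fun n m => by
    refine lut_geom hq0 hq1 (C := C2) fun k x => ?_
    have e : pd n (pd m (U (k + 1) - U k : XX N)) x = pd n (pd m (U (k + 1))) x - pd n (pd m (U k)) x := by
      change pd n (pd m (fun x => U (k + 1) x - U k x)) x = _
      rw [pd_sub (dif2 (hU2 _)) (dif2 (hU2 _)), pd_sub (difpd (hU2 _) m) (difpd (hU2 _) m)]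
    rw [← e]; exact hC2 k n m x
  have hlim : ∀ m, ContDiff ℝ 1 (pd m (R h)) ∧
      ∀ n x, Tendsto (fun k => pd n (pd m (U k)) x) atTop (nhds (pd n (pd m (R h)) x)) := fun m => by
    choose E hE using fun n => (hhs n m).exists_lim
    obtain ⟨a, b⟩ := c1_limit (fun k => c1_pd (hU2 k) m) (hpd m).tendsto hE
    exact ⟨a, fun n x => by rw [b]; exact (hE n).tendsto x⟩
  have h2 : ContDiff ℝ 2 (R h) := contDiff_two_of_pd (hR.c1 h) fun n => (hlim n).1
  refine ⟨h2, ⟨_, xabs (R h)⟩, fun x => ?_⟩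
  have hlap : Tendsto (fun k => lap (U k) x) atTop (nhds (lap (R h) x)) := by
    rw [lap_eq h2]
    simp_rw [fun k => lap_eq (hU2 k) x]
    exact tendsto_finsetSum _ fun n _ => (hlim n).2 n x
  have h3 : Tendsto (fun k => -lap (U k) x + 1 * U k x) atTop (nhds (-lap (R h) x + 1 * R h x)) :=
    hlap.neg.add ((hpt x).const_mul 1)
  have h4 : Tendsto (fun k => -lap (U k) x + 1 * U k x) atTop (nhds (h x)) := by
    have e : ∀ k, -lap (U k) x + 1 * U k x = ((r k ^ 2)⁻¹ * Q k h x - h x) - Q k h x + h x := fun k => by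
      rw [(hUS k).2.2 x]
      change ((r k ^ 2)⁻¹ - 1) * Q k h x = _
      ring
    simp_rw [e]
    have t1 : Tendsto (fun k => (r k ^ 2)⁻¹ * Q k h x - h x) atTop (nhds 0) := by
      refine squeeze_zero_norm (a := fun k => (2 * N + 1) * (H * q ^ k)) (fun k => ?_) ?_
      · have := ((hQ k).hol hσ0.le hσ1 hh x).1
        rwa [hrq] at this
      · simpa using (hqto.const_mul H).const_mul (2 * (N:ℝ) + 1)
    have t2 : Tendsto (fun k => Q k h x) atTop (nhds 0) := by
      refine squeeze_zero_norm (a := fun k => ‖h‖ * r k ^ 2) (fun k => ?_) ?_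
      · exact (xabs _ x).trans ((hQ k).norm_le h)
      · simpa using (hrto.pow 2).const_mul ‖h‖
    simpa using (t1.sub t2).add_const (h x)
  exact tendsto_nhds_unique h3 h4

end

end LS

namespace LS
open scoped ContDiff BoundedContinuousFunction
variable {N : ℕ}

/-- standing assumptions on the nonlinearity and the ground state -/
structure GS (N : ℕ) (f : ℝ → ℝ) (σ A : ℝ) (w : Euc N → ℝ) : Prop where
  hN : 1 ≤ N
  σ0 : 0 < σ
  σ1 : σ < 1
  odd : ∀ t, f (-t) = - f t
  f0 : f 0 = 0
  f'0 : deriv f 0 = 0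
  C1 : ContDiff ℝ 1 f
  holder : ∀ R > 0, ∃ C > 0, ∀ s t : ℝ, |s| ≤ R → |t| ≤ R →
      |deriv f s - deriv f t| ≤ C * |s - t| ^ σ
  pos : ∀ x, 0 < w x
  C2 : ContDiff ℝ 2 w
  eq : ∀ x, lap w x - w x + f (w x) = 0
  A0 : 0 < A
  asym : Tendsto (fun x : Euc N =>
        w x * ‖x‖ ^ (((N : ℝ) - 1) / 2) * Real.exp ‖x‖) (Filter.comap norm atTop) (nhds A)
  nondeg : ∀ u : Euc N → ℝ, ContDiff ℝ 2 u →
      (∃ C, ∀ x, |u x| ≤ C) → Tendsto u (Filter.comap norm atTop) (nhds 0) →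
      (∀ x, lap u x - u x + deriv f (w x) * u x = 0) →
      ∃ c : Fin N → ℝ, ∀ x, u x = ∑ n, c n * lineDeriv ℝ w x (EuclideanSpace.single n 1)

/-- mean value estimate -/
lemma mv {f : ℝ → ℝ} (hf : Differentiable ℝ f) {a b m K : ℝ}
    (h : ∀ x ∈ uIcc a b, |deriv f x - m| ≤ K) : |f b - f a - m * (b - a)| ≤ K * |b - a| := by
  have hd : ∀ x, HasDerivAt (fun x => f x - m * x) (deriv f x - m) x := fun x => by
    have h1 := (hf x).hasDerivAt.sub ((hasDerivAt_id' x).const_mul m)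
    rw [mul_one] at h1; exact h1
  have := Convex.norm_image_sub_le_of_norm_hasDerivWithin_le (f := fun x => f x - m * x) (C := K)
    (s := uIcc a b) (fun x _ => (hd x).hasDerivWithinAt) h
    (convex_uIcc a b) left_mem_uIcc right_mem_uIcc
  rw [Real.norm_eq_abs, Real.norm_eq_abs] at this
  convert this using 2; ring

lemma abs_le_of_mem_uIcc {a b x R : ℝ} (ha : |a| ≤ R) (hb : |b| ≤ R) (hx : x ∈ uIcc a b) : |x| ≤ R := by
  rw [abs_le] at *
  rcases mem_uIcc.1 hx with h | h <;> constructor <;> linarith [ha.1, ha.2, hb.1, hb.2, h.1, h.2]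

lemma abs_sub_le_of_mem_uIcc {a b x : ℝ} (hx : x ∈ uIcc a b) : |x - a| ≤ |b - a| := by
  rcases mem_uIcc.1 hx with h | h
  · rw [abs_of_nonneg (by linarith [h.1]), abs_of_nonneg (by linarith [h.1, h.2])]; linarith [h.2]
  · rw [abs_of_nonpos (by linarith [h.2]), abs_of_nonpos (by linarith [h.1, h.2])]; linarith [h.1]

section gs
variable {f : ℝ → ℝ} {σ A : ℝ} {w : Euc N → ℝ}

lemma GS.fd (g : GS N f σ A w) : Differentiable ℝ f := g.C1.differentiable (by norm_num)

lemma GS.f'c (g : GS N f σ A w) : Continuous (deriv f) := g.C1.continuous_deriv (by norm_num)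

lemma GS.even (g : GS N f σ A w) (t : ℝ) : deriv f (-t) = deriv f t := by
  have h1 : HasDerivAt (fun t => f (-t)) (deriv f (-t) * (-1)) t :=
    (g.fd (-t)).hasDerivAt.comp t (hasDerivAt_neg t)
  have h2 : HasDerivAt (fun t => f (-t)) (-(deriv f t)) t := by
    have : (fun t => f (-t)) = fun t => - f t := funext g.odd
    rw [this]; exact (g.fd t).hasDerivAt.neg
  linarith [h1.unique h2]

lemma GS.fb (g : GS N f σ A w) (R : ℝ) (hR : 0 < R) : ∃ C > 0,
    (∀ s t, |s| ≤ R → |t| ≤ R → |deriv f s - deriv f t| ≤ C * |s - t| ^ σ) ∧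
    (∀ s, |s| ≤ R → |deriv f s| ≤ C * |s| ^ σ) ∧
    (∀ s, |s| ≤ R → |f s| ≤ C * |s| ^ (1 + σ)) ∧
    (∀ s t, |s| ≤ R → |t| ≤ R → |f s - f t| ≤ C * |s - t|) := by
  obtain ⟨C, hC, h⟩ := g.holder R hR
  have h' : ∀ s, |s| ≤ R → |deriv f s| ≤ C * |s| ^ σ := fun s hs => by
    simpa [g.f'0] using h s 0 hs (by simp [hR.le])
  have hσ := g.σ0
  refine ⟨C * (1 + R ^ σ), by positivity, fun s t hs ht => ?_, fun s hs => ?_, fun s hs => ?_,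
    fun s t hs ht => ?_⟩
  · refine (h s t hs ht).trans ?_
    gcongr
    exact le_mul_of_one_le_right hC.le (by linarith [Real.rpow_nonneg hR.le σ])
  · refine (h' s hs).trans ?_
    gcongr
    exact le_mul_of_one_le_right hC.le (by linarith [Real.rpow_nonneg hR.le σ])
  · have := mv g.fd (a := 0) (b := s) (m := 0) (K := C * |s| ^ σ) (fun x hx => by
      rw [sub_zero]
      have h1 := abs_sub_le_of_mem_uIcc hx
      rw [sub_zero, sub_zero] at h1
      refine (h' x (h1.trans hs)).trans ?_
      gcongr)
    rw [g.f0, sub_zero, sub_zero, zero_mul, sub_zero] at this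
    refine this.trans ?_
    rw [Real.rpow_add_of_nonneg (abs_nonneg s) zero_le_one hσ.le, Real.rpow_one]
    have e : C * |s| ^ σ * |s| = C * (|s| * |s| ^ σ) := by ring
    rw [e]
    gcongr
    exact le_mul_of_one_le_right hC.le (by linarith [Real.rpow_nonneg hR.le σ])
  · have := mv g.fd (a := t) (b := s) (m := 0) (K := C * R ^ σ) (fun x hx => by
      rw [sub_zero]
      have h1 := abs_le_of_mem_uIcc ht hs hx
      refine (h' x h1).trans ?_
      gcongr)
    rw [zero_mul, sub_zero] at this
    refine this.trans ?_
    gcongr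
    linarith

lemma mem_comap_norm {p : Euc N → Prop} (h : ∀ᶠ x in Filter.comap norm atTop, p x) :
    ∃ S : ℝ, ∀ x, S ≤ ‖x‖ → p x := by
  rw [eventually_comap] at h
  obtain ⟨S, hS⟩ := eventually_atTop.1 h
  exact ⟨S, fun x hx => hS _ hx x rfl⟩

/-- exponential upper bound -/
lemma GS.upper (g : GS N f σ A w) : ∃ C > 0, ∀ x, w x ≤ C * exp (-‖x‖) := by
  have h1 := g.asym.eventually (Iio_mem_nhds (lt_add_one A))
  obtain ⟨S, hS⟩ := mem_comap_norm h1
  obtain ⟨B, hB⟩ := (isCompact_closedBall (0 : Euc N) (max S 1)).exists_bound_of_continuousOn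
    (f := w) g.C2.continuous.continuousOn
  have hA := g.A0
  refine ⟨max (A + 1) (B * exp (max S 1)), by positivity, fun x => ?_⟩
  by_cases hx : ‖x‖ ≤ max S 1
  · have h2 := hB x (by simpa using hx)
    rw [Real.norm_eq_abs] at h2
    have hB0 : 0 ≤ B := (abs_nonneg _).trans h2
    calc w x ≤ B := (le_abs_self _).trans h2
      _ = B * exp (max S 1) * exp (-(max S 1)) := by rw [mul_assoc, ← exp_add]; simp
      _ ≤ max (A + 1) (B * exp (max S 1)) * exp (-‖x‖) := by gcongr; exact le_max_right _ _
  · push Not at hx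
    have h2 : S ≤ ‖x‖ := (le_max_left _ _).trans hx.le
    have h3 : 1 ≤ ‖x‖ := (le_max_right _ _).trans hx.le
    have h4 := hS x h2
    have hNr : (1:ℝ) ≤ N := by exact_mod_cast g.hN
    have h5 : 1 ≤ ‖x‖ ^ (((N : ℝ) - 1) / 2) := Real.one_le_rpow h3 (by linarith)
    have h6 : w x * exp ‖x‖ ≤ A + 1 := by
      have : w x * exp ‖x‖ ≤ w x * ‖x‖ ^ (((N : ℝ) - 1) / 2) * exp ‖x‖ := by
        have := g.pos x
        gcongr
        exact le_mul_of_one_le_right this.le h5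
      exact this.trans (le_of_lt h4)
    calc w x = w x * exp ‖x‖ * exp (-‖x‖) := by rw [mul_assoc, ← exp_add]; simp
      _ ≤ max (A + 1) (B * exp (max S 1)) * exp (-‖x‖) := by
        gcongr; exact h6.trans (le_max_left _ _)

/-- exponential lower bound -/
lemma GS.lower (g : GS N f σ A w) {κ : ℝ} (hκ : 1 < κ) : ∃ c > 0, ∀ x, c * exp (-(κ * ‖x‖)) ≤ w x := by
  have hA := g.A0
  have ht : Tendsto (fun x : Euc N => (w x * ‖x‖ ^ (((N : ℝ) - 1) / 2) * exp ‖x‖) *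
      (exp ((κ - 1) * ‖x‖) / ‖x‖ ^ (((N : ℝ) - 1) / 2))) (Filter.comap norm atTop) atTop :=
    g.asym.pos_mul_atTop hA ((tendsto_exp_mul_div_rpow_atTop _ _ (by linarith)).comp tendsto_comap)
  obtain ⟨S, hS⟩ := mem_comap_norm (ht.eventually_ge_atTop 1)
  have hcont : Continuous fun x : Euc N => w x * exp (κ * ‖x‖) :=
    g.C2.continuous.mul (by fun_prop)
  obtain ⟨y, -, hy⟩ := (isCompact_closedBall (0 : Euc N) (max S 1)).exists_isMinOn
    ⟨0, by simp⟩ hcont.continuousOn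
  have hy0 : 0 < w y * exp (κ * ‖y‖) := mul_pos (g.pos y) (exp_pos _)
  refine ⟨min 1 (w y * exp (κ * ‖y‖)), by positivity, fun x => ?_⟩
  have key : min 1 (w y * exp (κ * ‖y‖)) ≤ w x * exp (κ * ‖x‖) := by
    by_cases hx : ‖x‖ ≤ max S 1
    · exact (min_le_right _ _).trans (hy (by simpa using hx))
    · push Not at hx
      have h2 : S ≤ ‖x‖ := (le_max_left _ _).trans hx.le
      have h3 : 1 ≤ ‖x‖ := (le_max_right _ _).trans hx.le
      refine (min_le_left _ _).trans ((hS x h2).trans (le_of_eq ?_))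
      have h5 : 0 < ‖x‖ ^ (((N : ℝ) - 1) / 2) := Real.rpow_pos_of_pos (by linarith) _
      have e : exp (κ * ‖x‖) = exp ‖x‖ * exp ((κ - 1) * ‖x‖) := by rw [← exp_add]; congr 1; ring
      rw [e]; field_simp
  calc _ ≤ w x * exp (κ * ‖x‖) * exp (-(κ * ‖x‖)) := by gcongr
    _ = w x := by rw [mul_assoc, ← exp_add]; simp

lemma GS.lapw (g : GS N f σ A w) : lap w = fun x => w x - f (w x) :=
  funext fun x => by linarith [g.eq x]

lemma exp_shift {x y : Euc N} {r : ℝ} (h : ‖x - y‖ ≤ r) : exp (-‖x‖) ≤ exp r * exp (-‖y‖) := by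
  rw [← exp_add]
  have := norm_sub_norm_le y x
  rw [norm_sub_rev] at this
  exact exp_le_exp.2 (by linarith)

lemma exp_neg_norm_le_one (x : Euc N) : exp (-‖x‖) ≤ 1 := exp_le_one_iff.2 (by simp)

lemma GS.fw1 (g : GS N f σ A w) : ContDiff ℝ 1 (fun x => f (w x)) := g.C1.comp (c21 g.C2)

lemma GS.pdfw (g : GS N f σ A w) (n : Fin N) : pd n (fun x => f (w x)) = fun x => deriv f (w x) * pd n w x :=
  pd_comp g.fd (dif2 g.C2) n

/-- decay of `w` and its first two derivatives -/
lemma GS.decay (g : GS N f σ A w) : ∃ C > 0, (∀ x, w x ≤ C * exp (-‖x‖)) ∧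
    (∀ n x, |pd n w x| ≤ C * exp (-‖x‖)) ∧ (∀ n m x, |pd n (pd m w) x| ≤ C * exp (-‖x‖)) ∧
    (∀ x, |deriv f (w x)| ≤ C) := by
  obtain ⟨C0, hC0, h0⟩ := g.upper
  have hwC : ∀ x, |w x| ≤ C0 := fun x => by
    rw [abs_of_pos (g.pos x)]
    exact (h0 x).trans (by nlinarith [exp_neg_norm_le_one x])
  obtain ⟨Cf, hCf, -, hf1, -, hf2⟩ := g.fb C0 hC0
  have hσ := g.σ0
  have hf' : ∀ x, |deriv f (w x)| ≤ Cf * C0 ^ σ := fun x => by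
    refine (hf1 _ (hwC x)).trans ?_
    have := hwC x
    gcongr
  have hfw : ∀ x, |f (w x)| ≤ Cf * w x := fun x => by
    have := hf2 (w x) 0 (hwC x) (by simp [hC0.le])
    rwa [g.f0, sub_zero, sub_zero, abs_of_pos (g.pos x)] at this
  have hl : ∀ x, |lap w x| ≤ (1 + Cf) * (C0 * exp (-‖x‖)) := fun x => by
    rw [g.lapw]
    refine (abs_sub _ _).trans ?_
    have := hfw x
    have := h0 x
    rw [abs_of_pos (g.pos x)]
    nlinarith
  obtain ⟨C1, hC1, h1⟩ : ∃ C > 0, ∀ n x, |pd n w x| ≤ C * exp (-‖x‖) := by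
    refine ⟨N * (C0 * exp 1) + (1 + Cf) * C0 * exp 1 / 2, by positivity, fun n x => ?_⟩
    have := grad_est g.C2 (M := C0 * (exp 1 * exp (-‖x‖))) (F := (1 + Cf) * (C0 * (exp 1 * exp (-‖x‖))))
      one_pos x (fun y hy => by
        rw [abs_of_pos (g.pos y)]
        refine (h0 y).trans ?_
        gcongr; exact exp_shift hy) (fun y hy => by
        refine (hl y).trans ?_
        gcongr; exact exp_shift hy) n
    refine this.trans (le_of_eq ?_); ring
  have hl1 : ContDiff ℝ 1 (lap w) := by rw [g.lapw]; exact (c21 g.C2).sub g.fw1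
  have hpl : ∀ n x, |pd n (lap w) x| ≤ (1 + Cf * C0 ^ σ) * (C1 * exp (-‖x‖)) := fun n x => by
    rw [g.lapw, pd_sub (dif2 g.C2) (dif1 g.fw1), g.pdfw]
    refine (abs_sub _ _).trans ?_
    rw [abs_mul, add_mul, one_mul]
    refine add_le_add (h1 n x) (mul_le_mul (hf' x) (h1 n x) (abs_nonneg _) (by positivity))
  obtain ⟨C2, hC2, h2⟩ : ∃ C > 0, ∀ n m x, |pd n (pd m w) x| ≤ C * exp (-‖x‖) := by
    refine ⟨N * (C1 * exp 1) * 2 + (1 + Cf * C0 ^ σ) * C1 * exp 1 / 4, by positivity, fun n m x => ?_⟩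
    have := hess_est g.C2 hl1 (M := C1 * (exp 1 * exp (-‖x‖)))
      (F := (1 + Cf * C0 ^ σ) * (C1 * (exp 1 * exp (-‖x‖)))) (by norm_num : (0:ℝ) < 1 / 2) x n m
      (fun y hy => by
        refine (h1 n y).trans ?_
        gcongr; exact exp_shift (by linarith)) (fun y hy => by
        refine (hpl n y).trans ?_
        gcongr; exact exp_shift (by linarith))
    refine this.trans (le_of_eq ?_); ring
  have hp : 0 < Cf * C0 ^ σ := by positivity
  refine ⟨C0 + C1 + C2 + Cf * C0 ^ σ, by positivity, fun x => (h0 x).trans ?_, fun n x => (h1 n x).trans ?_,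
    fun n m x => (h2 n m x).trans ?_, fun x => (hf' x).trans ?_⟩
  · gcongr; linarith
  · gcongr; linarith
  · gcongr; linarith
  · linarith

lemma hol_of_lip {u : Euc N → ℝ} {M L σ : ℝ} (hM : ∀ x, |u x| ≤ M) (hL : Hol 1 L u) (hσ0 : 0 < σ)
    (hσ1 : σ ≤ 1) : Hol σ (2 * M + L) u := by
  have hM0 : 0 ≤ M := (abs_nonneg _).trans (hM 0)
  obtain ⟨hL0, hL⟩ := hL
  refine ⟨by positivity, fun x y => ?_⟩
  rcases le_total ‖x - y‖ 1 with h | h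
  · refine (hL x y).trans ?_
    have : ‖x - y‖ ^ (1:ℝ) ≤ ‖x - y‖ ^ σ := by
      rcases eq_or_lt_of_le (norm_nonneg (x - y)) with h0 | h0
      · rw [← h0, Real.zero_rpow one_ne_zero, Real.zero_rpow hσ0.ne']
      · exact Real.rpow_le_rpow_of_exponent_ge h0 h hσ1
    gcongr; linarith
  · have h1 : 1 ≤ ‖x - y‖ ^ σ := Real.one_le_rpow h hσ0.le
    have := abs_sub (u x) (u y)
    have := hM x
    have := hM y
    nlinarith

lemma hol_mul {u v : Euc N → ℝ} {M M' H H' σ : ℝ} (hM : ∀ x, |u x| ≤ M) (hM' : ∀ x, |v x| ≤ M')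
    (hu : Hol σ H u) (hv : Hol σ H' v) : Hol σ (M * H' + H * M') (fun x => u x * v x) := by
  have hM0 : 0 ≤ M := (abs_nonneg _).trans (hM 0)
  have hM0' : 0 ≤ M' := (abs_nonneg _).trans (hM' 0)
  refine ⟨add_nonneg (mul_nonneg hM0 hv.1) (mul_nonneg hu.1 hM0'), fun x y => ?_⟩
  have e : u x * v x - u y * v y = u x * (v x - v y) + (u x - u y) * v y := by ring
  rw [e]
  refine (abs_add_le _ _).trans ?_
  rw [abs_mul, abs_mul, add_mul]
  have h1 : |u x| * |v x - v y| ≤ M * (H' * ‖x - y‖ ^ σ) :=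
    mul_le_mul (hM x) (hv.2 x y) (abs_nonneg _) hM0
  have h2 : |u x - u y| * |v y| ≤ H * ‖x - y‖ ^ σ * M' :=
    mul_le_mul (hu.2 x y) (hM' y) (abs_nonneg _) ((abs_nonneg _).trans (hu.2 x y))
  linarith

/-- Hölder continuity of `f'(u)` for Lipschitz bounded `u` -/
lemma GS.hol_f' (g : GS N f σ A w) {u : Euc N → ℝ} {M L : ℝ} (hM0 : 0 < M) (hM : ∀ x, |u x| ≤ M)
    (hL : Hol 1 L u) : ∃ H, Hol σ H (fun x => deriv f (u x)) := by
  obtain ⟨C, hC, h⟩ := g.holder M hM0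
  have hL0 := hL.1
  have hσ := g.σ0
  refine ⟨C * L ^ σ, by positivity, fun x y => (h _ _ (hM x) (hM y)).trans ?_⟩
  have h1 := hL.2 x y
  rw [Real.rpow_one] at h1
  rw [mul_assoc, ← Real.mul_rpow hL0 (norm_nonneg _)]
  gcongr

/-- regularity of the derivatives of `w` -/
lemma GS.dw (g : GS N f σ A w) (n : Fin N) : ContDiff ℝ 2 (pd n w) ∧
    (∀ x, lap (pd n w) x = pd n w x - deriv f (w x) * pd n w x) ∧
    ∃ H, Hol σ H (fun x => deriv f (w x) * pd n w x) := by
  obtain ⟨C, hC, d0, d1, d2, d3⟩ := g.decay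
  have b0 : ∀ x, |w x| ≤ C := fun x => by
    rw [abs_of_pos (g.pos x)]; exact (d0 x).trans (by nlinarith [exp_neg_norm_le_one x])
  have b1 : ∀ n x, |pd n w x| ≤ C := fun n x => (d1 n x).trans (by nlinarith [exp_neg_norm_le_one x])
  have b2 : ∀ n m x, |pd n (pd m w) x| ≤ C := fun n m x =>
    (d2 n m x).trans (by nlinarith [exp_neg_norm_le_one x])
  have l0 : Hol 1 (N * C) w := hol_of_pd (c21 g.C2) b1 hC.le
  have l1 : Hol 1 (N * C) (pd n w) := hol_of_pd (c1_pd g.C2 n) (fun m => b2 m n) hC.le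
  obtain ⟨H1, hH1⟩ := g.hol_f' hC b0 l0
  have hH := hol_mul d3 (b1 n) hH1 (hol_of_lip (b1 n) l1 g.σ0 g.σ1.le)
  set H := C * (2 * C + N * C) + H1 * C with hHdef
  have hcont : Continuous (fun x => deriv f (w x) * pd n w x) :=
    (g.f'c.comp g.C2.continuous).mul (c0_pd (c21 g.C2) n)
  set h : XX N := mkX _ hcont (C * C) (fun x => by
    rw [abs_mul]; exact mul_le_mul (d3 x) (b1 n x) (abs_nonneg _) hC.le) with hh
  obtain ⟨R, hR⟩ := op_exists g.hN one_pos (V := fun _ : Euc N => (1:ℝ)) contDiff_const (fun _ => le_rfl)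
  have hS := schauder g.hN hR g.σ0 g.σ1.le (h := h) hH
  obtain ⟨v2, -, ve⟩ := hS
  have hσ := g.σ0
  -- identification through difference quotients
  have key : ∀ x, pd n w x = R h x := by
    have hdq : ∀ t : ℝ, 0 < t → ∀ x, |(t⁻¹ * w ((1:ℝ) • x + t • ee n) - t⁻¹ * w x) - R h x| ≤ H * t ^ σ := by
      intro t ht
      have c1 : ContDiff ℝ 2 (fun x => w ((1:ℝ) • x + t • (ee n : Euc N))) := contDiff_aff g.C2 1 _
      have c2 : ContDiff ℝ 2 (fun x => t⁻¹ * w ((1:ℝ) • x + t • (ee n : Euc N))) := contDiff_const.mul c1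
      have c3 : ContDiff ℝ 2 (fun x => t⁻¹ * w x) := contDiff_const.mul g.C2
      have c4 : ContDiff ℝ 2 (fun x => t⁻¹ * w ((1:ℝ) • x + t • (ee n : Euc N)) - t⁻¹ * w x) := c2.sub c3
      have hH0 : 0 ≤ H := hH.1
      refine mp_abs (V := fun _ => 1) (c4.sub v2) (B := t⁻¹ * C + t⁻¹ * C + ‖R h‖) (fun x => ?_) one_pos
        (fun _ => le_rfl) (by positivity) (fun x _ => ?_)
      · refine (abs_sub _ _).trans (add_le_add ((abs_sub _ _).trans ?_) (xabs _ x))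
        rw [abs_mul, abs_mul, abs_of_pos (inv_pos.2 ht)]
        gcongr <;> exact b0 _
      · rw [lap_sub c4 v2, lap_sub c2 c3, lap_cmul c1, lap_cmul g.C2, lap_aff g.C2, g.lapw]
        have v := ve x
        have e : h x = deriv f (w x) * pd n w x := rfl
        rw [e] at v
        have hG : Differentiable ℝ (fun y : Euc N => f (w y) - (deriv f (w x) * pd n w x) * y n) :=
          (dif1 g.fw1).sub ((contDiff_coord (k := 1) n).differentiable (by norm_num) |>.const_mul _)
        have := diff_le hG n x (h := t) (G := H * t ^ σ) (fun s hs => by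
          rw [pd_sub (u := fun y => f (w y)) (dif1 g.fw1)
            ((contDiff_coord (k := 1) n).differentiable (by norm_num) |>.const_mul _),
            pd_cmul ((contDiff_coord (k := 1) n).differentiable (by norm_num)), pd_coord, g.pdfw]
          simp only [if_true, mul_one]
          refine (hH.2 _ _).trans ?_
          have : ‖x + s • (ee n : Euc N) - x‖ ≤ t := by
            rw [add_sub_cancel_left, norm_smul, norm_ee, mul_one, Real.norm_eq_abs]
            rwa [abs_of_pos ht] at hs
          gcongr)
        rw [abs_of_pos ht] at this
        have e2 : (x + t • (ee n : Euc N)) n = x n + t := by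
          rw [PiLp.add_apply, PiLp.smul_apply, ee_apply]; simp
        rw [e2] at this
        rw [one_smul]
        have e3 : -(t⁻¹ * (1 ^ 2 * (w (x + t • ee n) - f (w (x + t • ee n)))) - t⁻¹ * (w x - f (w x)) - lap (R h) x)
            + 1 * (t⁻¹ * w (x + t • ee n) - t⁻¹ * w x - R h x)
            = t⁻¹ * (f (w (x + t • ee n)) - deriv f (w x) * pd n w x * (x n + t)
              - (f (w x) - deriv f (w x) * pd n w x * x n)) := by
          have : lap (R h) x = R h x - deriv f (w x) * pd n w x := by linarith
          rw [this]; field_simp; ring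
        rw [e3, abs_mul, abs_of_pos (inv_pos.2 ht), inv_mul_le_iff₀ ht]
        linarith
    intro x
    have h1 := (hasDerivAt_line (dif2 g.C2) n x 0)
    rw [zero_smul, add_zero] at h1
    have h2 := h1.tendsto_slope_zero_right
    have h3 : Tendsto (fun t : ℝ => H * t ^ σ) (nhdsWithin 0 (Ioi 0)) (nhds (H * 0 ^ σ)) :=
      ((Real.continuousAt_rpow_const 0 σ (Or.inr hσ.le)).tendsto.mono_left nhdsWithin_le_nhds).const_mul H
    rw [Real.zero_rpow hσ.ne', mul_zero] at h3
    have h4 : |pd n w x - R h x| ≤ 0 := by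
      refine le_of_tendsto_of_tendsto ((h2.sub_const (R h x)).abs) h3 ?_
      filter_upwards [self_mem_nhdsWithin] with t ht
      have := hdq t ht x
      simpa [smul_eq_mul, mul_sub] using this
    exact sub_eq_zero.1 (abs_nonpos_iff.1 h4)
  have ke : pd n w = R h := funext key
  refine ⟨ke ▸ v2, fun x => ?_, H, hH⟩
  have v := ve x
  have e : h x = deriv f (w x) * pd n w x := rfl
  rw [e] at v
  have e4 : lap (pd n w) x = lap (R h) x := by rw [ke]
  rw [e4]
  linarith [key x]

end gs
end LS

namespace LS
open scoped ContDiff BoundedContinuousFunction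
variable {N : ℕ}

lemma two_le_inf : (2 : WithTop ℕ∞) ≤ ∞ := by
  rw [show (2 : WithTop ℕ∞) = ((2 : ℕ∞) : WithTop ℕ∞) from rfl]
  exact WithTop.coe_le_coe.2 le_top

lemma int_exp {μ : ℝ} (hμ : 0 < μ) (Q : Euc N) : Integrable (fun x : Euc N => exp (-(μ * ‖x - Q‖))) := by
  have h0 : Integrable (fun x : Euc N => exp (-(μ * ‖x‖))) := by
    have hi := integrable_one_add_norm (E := Euc N) (μ := volume) (r := (N : ℝ) + 1) (by simp)
    set k : ℝ := max 1 (((N : ℝ) + 1) / μ) with hk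
    have hk1 : 1 ≤ k := le_max_left _ _
    have hk2 : ((N : ℝ) + 1) / μ ≤ k := le_max_right _ _
    have hN : (0 : ℝ) < (N : ℝ) + 1 := by positivity
    refine (hi.const_mul (k ^ ((N : ℝ) + 1))).mono' (by fun_prop) (Eventually.of_forall fun x => ?_)
    rw [Real.norm_eq_abs, abs_of_pos (exp_pos _)]
    have ht : 0 ≤ ‖x‖ := norm_nonneg x
    have h1 : 1 + ‖x‖ ≤ k * exp (μ * ‖x‖ / ((N : ℝ) + 1)) := by
      have := add_one_le_exp (μ * ‖x‖ / ((N : ℝ) + 1))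
      have h2 : ‖x‖ ≤ k * (μ * ‖x‖ / ((N : ℝ) + 1)) := by
        calc ‖x‖ = ((N : ℝ) + 1) / μ * (μ * ‖x‖ / ((N : ℝ) + 1)) := by field_simp
          _ ≤ _ := by gcongr
      nlinarith
    have h3 : (1 + ‖x‖) ^ ((N : ℝ) + 1) ≤ k ^ ((N : ℝ) + 1) * exp (μ * ‖x‖) := by
      calc (1 + ‖x‖) ^ ((N : ℝ) + 1) ≤ (k * exp (μ * ‖x‖ / ((N : ℝ) + 1))) ^ ((N : ℝ) + 1) := by
            gcongr
        _ = _ := by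
            rw [mul_rpow (by linarith) (exp_pos _).le, ← Real.exp_mul]
            congr 2; field_simp
    rw [exp_neg, rpow_neg (by linarith), ← div_eq_mul_inv, inv_eq_one_div, div_le_div_iff₀ (exp_pos _) (by positivity)]
    linarith
  have := h0.comp_sub_right Q
  simpa using this

lemma integrable_of_exp {μ C : ℝ} (hμ : 0 < μ) {Q : Euc N} {u : Euc N → ℝ} (hu : Continuous u)
    (h : ∀ x, |u x| ≤ C * exp (-(μ * ‖x - Q‖))) : Integrable u :=
  ((int_exp hμ Q).const_mul C).mono' hu.aestronglyMeasurable (Eventually.of_forall h)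

lemma pd_compact {u : Euc N → ℝ} (hs : HasCompactSupport u) (n : Fin N) : HasCompactSupport (pd n u) :=
  hs.fderiv_apply ℝ (ee n)

/-- Green's identity against a compactly supported function. -/
lemma green_cs {u φ : Euc N → ℝ} (hu : ContDiff ℝ 2 u) (hφ : ContDiff ℝ 2 φ) (hs : HasCompactSupport φ) :
    ∫ x, u x * lap φ x = ∫ x, φ x * lap u x := by
  have key : ∀ n, Integrable (fun x => u x * pd n (pd n φ) x) ∧ Integrable (fun x => φ x * pd n (pd n u) x) ∧
      ∫ x, u x * pd n (pd n φ) x = ∫ x, φ x * pd n (pd n u) x := by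
    intro n
    have cu := hu.continuous
    have cu1 := c0_pd (c21 hu) n
    have cu2 := c0_pd (c1_pd hu n) n
    have cp := hφ.continuous
    have cp1 := c0_pd (c21 hφ) n
    have cp2 := c0_pd (c1_pd hφ n) n
    have s1 := pd_compact hs n
    have s2 := pd_compact s1 n
    have i1 : Integrable (fun x => u x * pd n (pd n φ) x) := (cu.mul cp2).integrable_of_hasCompactSupport s2.mul_left
    have i2 : Integrable (fun x => φ x * pd n (pd n u) x) := (cp.mul cu2).integrable_of_hasCompactSupport hs.mul_right
    have i3 : Integrable (fun x => pd n u x * pd n φ x) := (cu1.mul cp1).integrable_of_hasCompactSupport s1.mul_left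
    have i4 : Integrable (fun x => u x * pd n φ x) := (cu.mul cp1).integrable_of_hasCompactSupport s1.mul_left
    have i5 : Integrable (fun x => pd n u x * φ x) := (cu1.mul cp).integrable_of_hasCompactSupport hs.mul_left
    refine ⟨i1, i2, ?_⟩
    have e1 : ∫ x, u x * pd n (pd n φ) x = - ∫ x, pd n u x * pd n φ x :=
      integral_mul_fderiv_eq_neg_fderiv_mul_of_integrable (v := ee n) i3 i1 i4
        (fun x _ => dif2 hu x) (fun x _ => difpd hφ n x)
    have e2 : ∫ x, pd n u x * pd n φ x = - ∫ x, pd n (pd n u) x * φ x :=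
      integral_mul_fderiv_eq_neg_fderiv_mul_of_integrable (v := ee n)
        (i2.congr (Eventually.of_forall fun x => mul_comm _ _)) i3 i5
        (fun x _ => difpd hu n x) (fun x _ => dif2 hφ x)
    rw [e1, e2, neg_neg]
    exact integral_congr_ae (Eventually.of_forall fun x => mul_comm _ _)
  simp_rw [lap_eq hu, lap_eq hφ, Finset.mul_sum]
  rw [integral_finsetSum _ (fun n _ => (key n).1), integral_finsetSum _ (fun n _ => (key n).2.1)]
  exact Finset.sum_congr rfl fun n _ => (key n).2.2

/-- a sequence of cut-offs -/
lemma cut_seq (N : ℕ) : ∃ (θ : ℕ → Euc N → ℝ) (B : ℝ), 0 ≤ B ∧ (∀ k, ContDiff ℝ ∞ (θ k)) ∧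
    (∀ k, HasCompactSupport (θ k)) ∧ (∀ k x, 0 ≤ θ k x ∧ θ k x ≤ 1) ∧
    (∀ k n x, |pd n (θ k) x| ≤ B / ((k : ℝ) + 1)) ∧ (∀ k x, |lap (θ k) x| ≤ B / ((k : ℝ) + 1)) ∧
    ∀ x, ∀ᶠ k in atTop, θ k x = 1 := by
  obtain ⟨ζ, hζ, hs, h01, h1⟩ := exists_cutoff (N := N) 1 one_pos
  have h2 : ContDiff ℝ 2 ζ := hζ.of_le two_le_inf
  have b1 : ∀ n, ∃ B, ∀ x, ‖pd n ζ x‖ ≤ B := fun n =>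
    (c0_pd (c21 h2) n).bounded_above_of_compact_support (pd_compact hs n)
  choose B1 hB1 using b1
  have b2 : ∃ B, ∀ x, ‖lap ζ x‖ ≤ B := by
    refine (continuous_lap h2).bounded_above_of_compact_support ?_
    have : lap ζ = ∑ n, pd n (pd n ζ) := by
      funext x; rw [lap_eq h2, Finset.sum_apply]
    rw [this]
    refine Finset.sum_induction _ HasCompactSupport (fun a b ha hb => ha.add hb) HasCompactSupport.zero ?_
    exact fun n _ => pd_compact (pd_compact hs n) n
  obtain ⟨B2, hB2⟩ := b2
  have hB1' : ∀ n, 0 ≤ B1 n := fun n => (norm_nonneg _).trans (hB1 n 0)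
  have hB2' : 0 ≤ B2 := (norm_nonneg _).trans (hB2 0)
  have hS : 0 ≤ ∑ n, B1 n := Finset.sum_nonneg fun n _ => hB1' n
  refine ⟨fun k x => ζ (((k : ℝ) + 1)⁻¹ • x + 0), (∑ n, B1 n) + B2, by positivity, fun k => contDiff_aff hζ _ _,
    fun k => ?_, fun k x => h01 _, fun k n x => ?_, fun k x => ?_, fun x => ?_⟩
  · have hk : (((k : ℝ) + 1)⁻¹) ≠ 0 := by positivity
    simp only [add_zero]
    exact hs.comp_homeomorph (Homeomorph.smulOfNeZero _ hk)
  · rw [pd_comp_aff (dif2 h2)]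
    simp only
    rw [abs_mul, abs_of_pos (by positivity), div_eq_mul_inv, mul_comm]
    gcongr
    refine (hB1 n _).trans ?_
    have := Finset.single_le_sum (f := B1) (fun n _ => hB1' n) (Finset.mem_univ n)
    linarith
  · rw [lap_aff h2, abs_mul, abs_of_pos (by positivity), div_eq_mul_inv, mul_comm]
    have hk1 : ((k : ℝ) + 1)⁻¹ ≤ 1 := inv_le_one_of_one_le₀ (by linarith [(Nat.cast_nonneg k : (0 : ℝ) ≤ k)])
    have hk0 : 0 < ((k : ℝ) + 1)⁻¹ := by positivity
    have : (((k : ℝ) + 1)⁻¹) ^ 2 ≤ ((k : ℝ) + 1)⁻¹ := by nlinarith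
    gcongr
    refine (hB2 _).trans ?_
    linarith
  · obtain ⟨K, hK⟩ := exists_nat_ge ‖x‖
    filter_upwards [eventually_ge_atTop K] with k hk
    refine h1 _ ?_
    rw [add_zero, norm_smul, Real.norm_eq_abs, abs_of_pos (by positivity), inv_mul_le_iff₀ (by positivity)]
    have : (K : ℝ) ≤ k := by exact_mod_cast hk
    linarith

lemma tendsto_div_succ (B : ℝ) : Tendsto (fun k : ℕ => B / ((k : ℝ) + 1)) atTop (nhds 0) := by
  have := (tendsto_one_div_add_atTop_nhds_zero_nat (𝕜 := ℝ)).const_mul B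
  simpa [div_eq_mul_inv] using this

lemma green {u v : Euc N → ℝ} (hu : ContDiff ℝ 2 u) (hv : ContDiff ℝ 2 v) {B C μ : ℝ} (hμ : 0 < μ)
    (hB : ∀ x, |u x| ≤ B) (hB2 : ∀ x, |lap u x| ≤ B) (h0 : ∀ x, |v x| ≤ C * exp (-(μ * ‖x‖)))
    (h1 : ∀ n x, |pd n v x| ≤ C * exp (-(μ * ‖x‖))) (h2 : ∀ x, |lap v x| ≤ C * exp (-(μ * ‖x‖))) :
    ∫ x, u x * lap v x = ∫ x, v x * lap u x := by
  obtain ⟨θ, D, hD, t1, t2, t3, t4, t5, t6⟩ := cut_seq N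
  have t1' : ∀ k, ContDiff ℝ 2 (θ k) := fun k => (t1 k).of_le two_le_inf
  have hB0 : 0 ≤ B := (abs_nonneg _).trans (hB 0)
  have hC0 : 0 ≤ C := nonneg_of_mul_nonneg_left ((abs_nonneg _).trans (h0 0)) (exp_pos _)
  have hk1 : ∀ k : ℕ, D / ((k : ℝ) + 1) ≤ D := fun k => div_le_self hD (by linarith [(Nat.cast_nonneg k : (0 : ℝ) ≤ k)])
  have hi : Integrable (fun x : Euc N => exp (-(μ * ‖x‖))) := by simpa using int_exp hμ (0 : Euc N)
  have key : ∀ k, ∫ x, u x * (θ k x * lap v x + 2 * (∑ n, pd n (θ k) x * pd n v x) + lap (θ k) x * v x)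
      = ∫ x, θ k x * v x * lap u x := by
    intro k
    rw [← green_cs (φ := fun x => θ k x * v x) hu ((t1' k).mul hv) (t2 k).mul_right]
    simp_rw [lap_mul (t1' k) hv]
  have cl := continuous_lap hv
  have clu := continuous_lap hu
  have T1 : Tendsto (fun k => ∫ x, u x * (θ k x * lap v x + 2 * (∑ n, pd n (θ k) x * pd n v x) + lap (θ k) x * v x))
      atTop (nhds (∫ x, u x * lap v x)) := by
    refine tendsto_integral_of_dominated_convergence (fun x => B * ((1 + 2 * (N * D) + D) * C) * exp (-(μ * ‖x‖))) (fun k => ?_)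
      (hi.const_mul _) (fun k => Eventually.of_forall fun x => ?_) (Eventually.of_forall fun x => ?_)
    · have c1 := hu.continuous; have c2 := (t1' k).continuous; have c3 := hv.continuous
      have c4 := continuous_lap (t1' k)
      have c5 : ∀ n, Continuous (pd n (θ k)) := c0_pd (c21 (t1' k))
      have c6 : ∀ n, Continuous (pd n v) := c0_pd (c21 hv)
      exact (by fun_prop : Continuous _).aestronglyMeasurable
    · rw [Real.norm_eq_abs, abs_mul]
      have e := exp_pos (-(μ * ‖x‖))
      have a1 : |θ k x * lap v x| ≤ 1 * (C * exp (-(μ * ‖x‖))) := by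
        rw [abs_mul]; gcongr; exacts [by rw [abs_of_nonneg (t3 k x).1]; exact (t3 k x).2, h2 x]
      have a2 : |∑ n, pd n (θ k) x * pd n v x| ≤ N * (D * (C * exp (-(μ * ‖x‖)))) := by
        refine (Finset.abs_sum_le_sum_abs _ _).trans ?_
        refine (Finset.sum_le_card_nsmul _ _ (D * (C * exp (-(μ * ‖x‖)))) fun n _ => ?_).trans_eq (by simp)
        rw [abs_mul]; gcongr; exacts [(t4 k n x).trans (hk1 k), h1 n x]
      have a3 : |lap (θ k) x * v x| ≤ D * (C * exp (-(μ * ‖x‖))) := by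
        rw [abs_mul]; gcongr; exacts [(t5 k x).trans (hk1 k), h0 x]
      have : |θ k x * lap v x + 2 * (∑ n, pd n (θ k) x * pd n v x) + lap (θ k) x * v x|
          ≤ (1 + 2 * (N * D) + D) * C * exp (-(μ * ‖x‖)) := by
        refine (abs_add_three _ _ _).trans ?_
        rw [abs_mul 2, abs_two]
        linarith
      rw [mul_assoc]
      gcongr
      exact hB x
    · refine Tendsto.const_mul _ ?_
      have l1 : Tendsto (fun k => θ k x * lap v x) atTop (nhds (lap v x)) :=
        tendsto_const_nhds.congr' ((t6 x).mono fun k hk => by simp only [hk, one_mul])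
      have l2 : Tendsto (fun k => ∑ n, pd n (θ k) x * pd n v x) atTop (nhds (∑ n : Fin N, 0 * pd n v x)) := by
        refine tendsto_finsetSum _ fun n _ => Tendsto.mul_const _ ?_
        exact squeeze_zero_norm (fun k => t4 k n x) (tendsto_div_succ D)
      have l3 : Tendsto (fun k => lap (θ k) x * v x) atTop (nhds (0 * v x)) :=
        Tendsto.mul_const _ (squeeze_zero_norm (fun k => t5 k x) (tendsto_div_succ D))
      have := (l1.add (l2.const_mul 2)).add l3
      simpa using this
  have T2 : Tendsto (fun k => ∫ x, θ k x * v x * lap u x) atTop (nhds (∫ x, v x * lap u x)) := by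
    refine tendsto_integral_of_dominated_convergence (fun x => (C * B) * exp (-(μ * ‖x‖))) (fun k => ?_)
      (hi.const_mul _) (fun k => Eventually.of_forall fun x => ?_) (Eventually.of_forall fun x => ?_)
    · have c2 := (t1' k).continuous; have c3 := hv.continuous
      exact (by fun_prop : Continuous _).aestronglyMeasurable
    · rw [Real.norm_eq_abs, abs_mul, abs_mul]
      calc |θ k x| * |v x| * |lap u x| ≤ 1 * (C * exp (-(μ * ‖x‖))) * B := by
            gcongr; exacts [by rw [abs_of_nonneg (t3 k x).1]; exact (t3 k x).2, h0 x, hB2 x]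
        _ = _ := by ring
    · exact tendsto_const_nhds.congr' ((t6 x).mono fun k hk => by simp only [hk, one_mul])
  simp_rw [key] at T1
  exact tendsto_nhds_unique T1 T2

/-- discretisation criterion for compactness -/
lemma compact_of {E : Type*} [NormedAddCommGroup E] [NormedSpace ℝ E] (L : E →L[ℝ] XX N) {H M : ℝ} (hM : 0 < M) {μ : ℝ} (hμ : 0 < μ)
    (hL : ∀ ψ, ‖ψ‖ ≤ 1 → Hol 1 H (L ψ)) (hd : ∀ ψ, ‖ψ‖ ≤ 1 → ∀ x, |L ψ x| ≤ M * exp (-(μ * ‖x‖))) :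
    IsCompactOperator L := by
  rw [show (L : E → XX N) = (L : E →ₗ[ℝ] XX N) from rfl,
    isCompactOperator_iff_isCompact_closure_image_closedBall _ one_pos]
  refine TotallyBounded.isCompact_of_isClosed ?_ isClosed_closure
  refine TotallyBounded.closure ?_
  have hH : 0 ≤ H := (hL 0 (by simp)).1
  refine Metric.totallyBounded_of_finite_discretization fun ε hε => ?_
  -- radius
  obtain ⟨r, hr⟩ : ∃ r : ℝ, M * exp (-(μ * r)) < ε / 4 := by
    have : Tendsto (fun r : ℝ => M * exp (-(μ * r))) atTop (nhds (M * 0)) :=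
      (tendsto_exp_neg_atTop_nhds_zero.comp (tendsto_id.const_mul_atTop hμ)).const_mul M
    rw [mul_zero] at this
    exact (this.eventually (gt_mem_nhds (by positivity))).exists
  set δ : ℝ := ε / (8 * (H + 1)) with hδ
  have hδ0 : 0 < δ := by positivity
  have hδH : H * δ ≤ ε / 8 := by
    rw [hδ]; rw [mul_div_assoc', div_le_div_iff₀ (by positivity) (by positivity)]; nlinarith
  obtain ⟨t, -, ht, hcov⟩ := (isCompact_closedBall (0 : Euc N) r).finite_cover_balls hδ0
  set e8 := ε / 8 with he8
  have he80 : 0 < e8 := by positivity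
  obtain ⟨k, hk⟩ := exists_nat_ge (M / e8 + 1)
  have : Fintype t := ht.fintype
  have fl : ∀ (u : (L : E →ₗ[ℝ] XX N) '' Metric.closedBall 0 1) (p : t), ⌊u.1 p.1 / e8⌋ ∈ Finset.Icc (-(k : ℤ)) k := by
    rintro ⟨_, ψ, hψ, rfl⟩ p
    have hψ' : ‖ψ‖ ≤ 1 := by simpa using hψ
    have h1 : |L ψ p.1| ≤ M := (hd ψ hψ' p.1).trans (by
      have : exp (-(μ * ‖p.1‖)) ≤ 1 := exp_le_one_iff.2 (by have := norm_nonneg p.1; nlinarith)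
      nlinarith)
    have h2 : |L ψ p.1 / e8| ≤ M / e8 := by
      rw [abs_div, abs_of_pos he80]; gcongr
    rw [abs_le] at h2
    rw [Finset.mem_Icc]
    refine ⟨Int.le_floor.2 (by push_cast; show -(k:ℝ) ≤ L ψ p.1 / e8; linarith), ?_⟩
    have : ((⌊L ψ p.1 / e8⌋ : ℤ) : ℝ) ≤ k := (Int.floor_le _).trans (by linarith)
    exact_mod_cast this
  refine ⟨t → Finset.Icc (-(k : ℤ)) k, inferInstance, fun u p => ⟨_, fl u p⟩, ?_⟩
  rintro ⟨_, ψ, hψ, rfl⟩ ⟨_, ψ', hψ', rfl⟩ heq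
  have hψ1 : ‖ψ‖ ≤ 1 := by simpa using hψ
  have hψ2 : ‖ψ'‖ ≤ 1 := by simpa using hψ'
  have hpt : ∀ p ∈ t, |L ψ p - L ψ' p| ≤ e8 := by
    intro p hp
    have h := congrArg Subtype.val (congrFun heq ⟨p, hp⟩)
    have := Int.abs_sub_lt_one_of_floor_eq_floor h
    change |L ψ p / e8 - L ψ' p / e8| < 1 at this
    rw [← sub_div, abs_div, abs_of_pos he80, div_lt_one he80] at this
    exact this.le
  rw [dist_eq_norm]
  refine lt_of_le_of_lt (xle (M := ε / 2) (by positivity) fun x => ?_) (by linarith)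
  change |L ψ x - L ψ' x| ≤ ε / 2
  by_cases hx : ‖x‖ ≤ r
  · have := hcov (show x ∈ Metric.closedBall (0 : Euc N) r by simpa using hx)
    obtain ⟨p, hp, hxp⟩ := mem_iUnion₂.1 this
    rw [Metric.mem_ball, dist_eq_norm] at hxp
    have a1 := (hL ψ hψ1).2 x p
    have a2 := (hL ψ' hψ2).2 x p
    rw [rpow_one] at a1 a2
    have a3 : H * ‖x - p‖ ≤ ε / 8 := (mul_le_mul_of_nonneg_left hxp.le hH).trans hδH
    have a4 := hpt p hp
    rw [abs_le] at *
    constructor <;> linarith [a1.1, a1.2, a2.1, a2.2, a4.1, a4.2]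
  · push Not at hx
    have e1 : M * exp (-(μ * ‖x‖)) ≤ ε / 4 := by
      refine le_trans ?_ hr.le
      gcongr
    have a1 := (hd ψ hψ1 x).trans e1
    have a2 := (hd ψ' hψ2 x).trans e1
    rw [abs_le] at *
    constructor <;> linarith [a1.1, a1.2, a2.1, a2.2]

end LS

namespace LS
open scoped ContDiff BoundedContinuousFunction
variable {N : ℕ}

lemma rho_le_exp {μ : ℝ} (hμ : 0 ≤ μ) (Q x : Euc N) : rho μ Q x ≤ exp (-(μ * ‖x - Q‖)) := by
  rw [rho, neg_mul]
  gcongr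
  exact norm_le_sr _

lemma exp_le_rho {μ : ℝ} (hμ : 0 ≤ μ) (Q x : Euc N) : exp (-(μ * ‖x - Q‖)) ≤ exp μ * rho μ Q x := by
  rw [rho, ← exp_add]
  gcongr
  have := sr_le (x - Q)
  nlinarith

lemma IsOp.decay {V : Euc N → ℝ} {c : ℝ} {T : XX N →L[ℝ] XX N} (hN : 1 ≤ N) (hT : IsOp V c T) {μ M m : ℝ}
    (hμ : 0 ≤ μ) (hμc : μ ^ 2 ≤ c / 2) (hM : 0 ≤ M) (hm : 0 ≤ m) {Q : Euc N} {g : XX N}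
    (hg : ∀ x, |g x| ≤ M * exp (-(μ * ‖x - Q‖)) + m) (x : Euc N) :
    |T g x| ≤ 2 / c * exp μ * M * exp (-(μ * ‖x - Q‖)) + m / c := by
  have hc := hT.1
  have hb : ContDiff ℝ 2 (fun x => (2 / c * exp μ * M) * rho μ Q x + m / c) :=
    ((contDiff_rho μ Q).const_smul (2 / c * exp μ * M)).add contDiff_const
  have h := hT.abs_le (g := g) hb (B := 0) (fun x => by
    have := rho_pos μ Q x
    rw [neg_zero]; positivity) (fun x => ?_) x
  · refine h.trans ?_
    have := rho_le_exp hμ Q x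
    gcongr
  · have e1 : lap (fun x => (2 / c * exp μ * M) * rho μ Q x + m / c) x = (2 / c * exp μ * M) * lap (rho μ Q) x := by
      rw [lap_add (u := fun x => (2 / c * exp μ * M) * rho μ Q x) (v := fun _ => m / c)
        (contDiff_const.mul (contDiff_rho μ Q)) contDiff_const, lap_const, lap_cmul (contDiff_rho μ Q), add_zero]
    rw [e1]
    have h1 := lap_rho_le hN hμ Q x
    have h2 := hg x
    have h3 := exp_le_rho hμ Q x
    have h4 := hT.2.1 x
    have h5 := rho_pos μ Q x
    have k0 : 0 ≤ 2 / c * exp μ * M := by positivity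
    have k1 : (2 / c * exp μ * M) * lap (rho μ Q) x ≤ (2 / c * exp μ * M) * (c / 2 * rho μ Q x) := by
      gcongr
      exact h1.trans (by gcongr)
    have k2 : c * ((2 / c * exp μ * M) * rho μ Q x + m / c) ≤ V x * ((2 / c * exp μ * M) * rho μ Q x + m / c) := by
      gcongr
    have k3 : c * ((2 / c * exp μ * M) * rho μ Q x + m / c) = 2 * (exp μ * M * rho μ Q x) + m := by field_simp
    have k4 : (2 / c * exp μ * M) * (c / 2 * rho μ Q x) = exp μ * M * rho μ Q x := by field_simp
    have k5 : M * exp (-(μ * ‖x - Q‖)) ≤ exp μ * M * rho μ Q x := by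
      calc _ ≤ M * (exp μ * rho μ Q x) := by gcongr
        _ = _ := by ring
    linarith

lemma integrable_mulX {h : Euc N → ℝ} (hi : Integrable h) (ψ : XX N) : Integrable (fun x => ψ x * h x) :=
  hi.bdd_mul (c := ‖ψ‖) ψ.continuous.aestronglyMeasurable (Eventually.of_forall ψ.norm_coe_le_norm)

noncomputable def pairL (h : Euc N → ℝ) (hi : Integrable h) : XX N →ₗ[ℝ] ℝ where
  toFun := fun ψ => ∫ x, ψ x * h x
  map_add' := fun ψ φ => by
    rw [← integral_add (integrable_mulX hi ψ) (integrable_mulX hi φ)]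
    exact integral_congr_ae (Eventually.of_forall fun x => by simp [add_mul])
  map_smul' := fun a ψ => by
    rw [RingHom.id_apply, smul_eq_mul, ← integral_const_mul]
    exact integral_congr_ae (Eventually.of_forall fun x => by simp [mul_assoc])

lemma pairL_bound (h : Euc N → ℝ) (hi : Integrable h) (ψ : XX N) : ‖pairL h hi ψ‖ ≤ (∫ x, |h x|) * ‖ψ‖ := by
  change ‖∫ x, ψ x * h x‖ ≤ _
  refine (norm_integral_le_of_norm_le (hi.abs.mul_const ‖ψ‖) (Eventually.of_forall fun x => ?_)).trans_eq ?_
  · rw [norm_mul, mul_comm]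
    exact mul_le_mul_of_nonneg_left (ψ.norm_coe_le_norm x) (norm_nonneg _)
  · rw [integral_mul_const]

open Classical in
/-- integration against `h` as a functional on bounded continuous functions -/
noncomputable def pairX (h : Euc N → ℝ) : XX N →L[ℝ] ℝ :=
  if hi : Integrable h then
    ⟨pairL h hi, AddMonoidHomClass.continuous_of_bound (pairL h hi) (∫ x, |h x|) (pairL_bound h hi)⟩
  else 0

lemma pairX_apply {h : Euc N → ℝ} (hi : Integrable h) (ψ : XX N) : pairX h ψ = ∫ x, ψ x * h x := by
  rw [pairX, dif_pos hi]; rfl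

lemma abs_int_le {h ψ B : Euc N → ℝ} (hB : Integrable B) {M : ℝ} (hψ : ∀ x, |ψ x * h x| ≤ M * B x) :
    |∫ x, ψ x * h x| ≤ M * ∫ x, B x := by
  refine (norm_integral_le_of_norm_le (hB.const_mul M) (Eventually.of_forall fun x => (Real.norm_eq_abs _).trans_le (hψ x))).trans_eq ?_
  rw [integral_const_mul]

abbrev E1 (N : ℕ) := XX N × (Fin N → ℝ)

/-- the model compact operator -/
noncomputable def CC (R : XX N →L[ℝ] XX N) (m : XX N) (d h : Fin N → XX N) : E1 N →L[ℝ] E1 N :=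
  (ContinuousLinearMap.inl ℝ (XX N) (Fin N → ℝ)) ∘L (R ∘L ContinuousLinearMap.mul ℝ (XX N) m) ∘L
      (ContinuousLinearMap.fst ℝ (XX N) (Fin N → ℝ)) +
    ((- ∑ n, ((ContinuousLinearMap.proj n : (Fin N → ℝ) →L[ℝ] ℝ) ∘L
        ContinuousLinearMap.fst ℝ (Fin N → ℝ) (Fin N → ℝ)).smulRight (d n)).prod
      (ContinuousLinearMap.snd ℝ (Fin N → ℝ) (Fin N → ℝ))) ∘L
    ((ContinuousLinearMap.snd ℝ (XX N) (Fin N → ℝ)).prod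
      (ContinuousLinearMap.snd ℝ (XX N) (Fin N → ℝ) -
        (ContinuousLinearMap.pi fun n => pairX (h n)) ∘L ContinuousLinearMap.fst ℝ (XX N) (Fin N → ℝ)))

lemma CC_fst (R : XX N →L[ℝ] XX N) (m : XX N) (d h : Fin N → XX N) (z : E1 N) :
    (CC R m d h z).1 = R (m * z.1) - ∑ n, z.2 n • d n := by
  simp [CC, sub_eq_add_neg]

lemma CC_snd (R : XX N →L[ℝ] XX N) (m : XX N) (d h : Fin N → XX N) (z : E1 N) (n : Fin N) :
    (CC R m d h z).2 n = z.2 n - pairX (h n) z.1 := by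
  simp [CC]

structure Mod (f : ℝ → ℝ) (w : Euc N → ℝ) (R : XX N →L[ℝ] XX N) (m : XX N) (d h : Fin N → XX N) : Prop where
  op : IsOp (fun _ => 1) 1 R
  m_eq : ∀ x, m x = deriv f (w x)
  d_eq : ∀ n x, d n x = pd n w x
  h_eq : ∀ n x, h n x = deriv f (w x) * pd n w x

section gs
variable {f : ℝ → ℝ} {σ A : ℝ} {w : Euc N → ℝ}

lemma GS.fw_decay (g : GS N f σ A w) : ∃ C > 0, ∀ x, |deriv f (w x)| ≤ C * exp (-(σ * ‖x‖)) := by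
  obtain ⟨C0, hC0, h0, -⟩ := g.decay
  obtain ⟨Cf, hCf, -, hf1, -⟩ := g.fb C0 hC0
  refine ⟨Cf * C0 ^ σ, by positivity, fun x => ?_⟩
  have hw := g.pos x
  have hwC : |w x| ≤ C0 := by
    rw [abs_of_pos hw]
    exact (h0 x).trans (by nlinarith [exp_neg_norm_le_one x])
  refine (hf1 _ hwC).trans ?_
  rw [abs_of_pos hw, mul_assoc]
  gcongr
  calc w x ^ σ ≤ (C0 * exp (-‖x‖)) ^ σ := rpow_le_rpow hw.le (h0 x) g.σ0.le
    _ = _ := by rw [mul_rpow hC0.le (exp_pos _).le, ← Real.exp_mul]; congr 2; ring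

lemma GS.mod_exists (g : GS N f σ A w) : ∃ R m d h, Mod f w R m d h := by
  obtain ⟨C, hC, h0, h1, -, h3⟩ := g.decay
  obtain ⟨R, hR⟩ := op_exists (N := N) g.hN (V := fun _ => 1) one_pos contDiff_const (fun _ => le_rfl)
  have cm : Continuous (fun x => deriv f (w x)) := g.f'c.comp g.C2.continuous
  have cd : ∀ n, Continuous (pd n w) := c0_pd (c21 g.C2)
  have hd : ∀ n x, |pd n w x| ≤ C := fun n x => (h1 n x).trans (by nlinarith [exp_neg_norm_le_one x])
  exact ⟨R, mkX _ cm C h3, fun n => mkX _ (cd n) C (hd n),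
    fun n => mkX (fun x => deriv f (w x) * pd n w x) (cm.mul (cd n)) (C * C) (fun x => by
      rw [abs_mul]
      exact mul_le_mul (h3 x) (hd n x) (abs_nonneg _) hC.le),
    hR, fun _ => rfl, fun _ _ => rfl, fun _ _ => rfl⟩

variable {R : XX N →L[ℝ] XX N} {m : XX N} {d h : Fin N → XX N}

lemma exp_mono_rate {a b : ℝ} (h : a ≤ b) (x : Euc N) : exp (-(b * ‖x‖)) ≤ exp (-(a * ‖x‖)) := by
  gcongr

lemma Mod.h_decay (g : GS N f σ A w) (M : Mod f w R m d h) : ∃ C > 0, ∀ n x, |h n x| ≤ C * exp (-(1 * ‖x‖)) := by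
  obtain ⟨C, hC, h0, h1, -, h3⟩ := g.decay
  refine ⟨C * C, by positivity, fun n x => ?_⟩
  rw [M.h_eq, abs_mul, mul_assoc, one_mul]
  exact mul_le_mul (h3 x) (h1 n x) (abs_nonneg _) hC.le

lemma Mod.h_int (g : GS N f σ A w) (M : Mod f w R m d h) (n : Fin N) : Integrable (h n) := by
  obtain ⟨C, hC, hh⟩ := M.h_decay g
  exact integrable_of_exp (Q := 0) one_pos (h n).continuous (fun x => by simpa using hh n x)

/-- decay and Lipschitz bound of the operator `R (m ψ)` -/
lemma Mod.K_bound (g : GS N f σ A w) (M : Mod f w R m d h) {μ : ℝ} (hμ : 0 ≤ μ) (hμσ : μ ≤ σ)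
    (hμ2 : μ ^ 2 ≤ 1 / 2) : ∃ C > 0, ∀ ψ : XX N,
      (∀ x, |R (m * ψ) x| ≤ C * ‖ψ‖ * exp (-(μ * ‖x‖))) ∧ Hol 1 (C * ‖ψ‖) (R (m * ψ)) := by
  obtain ⟨C, hC, hm⟩ := g.fw_decay
  set D := 2 * exp μ * C with hD
  have hD0 : 0 < D := by positivity
  have hmψ : ∀ ψ : XX N, ∀ x, |(m * ψ) x| ≤ C * ‖ψ‖ * exp (-(μ * ‖x - 0‖)) + 0 := fun ψ x => by
    rw [sub_zero, add_zero, BoundedContinuousFunction.mul_apply, abs_mul, M.m_eq]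
    calc _ ≤ (C * exp (-(μ * ‖x‖))) * ‖ψ‖ := by
          gcongr
          · exact (hm x).trans (by gcongr)
          · exact xabs ψ x
      _ = _ := by ring
  have key : ∀ ψ : XX N, ∀ x, |R (m * ψ) x| ≤ D * ‖ψ‖ * exp (-(μ * ‖x‖)) := fun ψ x => by
    have := M.op.decay g.hN hμ hμ2 (by positivity) le_rfl (hmψ ψ) x
    rw [sub_zero] at this
    refine this.trans_eq ?_
    rw [hD]; ring
  have e1 : ∀ x : Euc N, exp (-(μ * ‖x‖)) ≤ 1 := fun x => exp_le_one_iff.2 (by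
    have := norm_nonneg x; nlinarith)
  refine ⟨D + N * (N * D + (D + C) / 2), by positivity, fun ψ => ⟨fun x => (key ψ x).trans ?_, ?_⟩⟩
  · gcongr
    have : (0:ℝ) ≤ N * (N * D + (D + C) / 2) := by positivity
    linarith
  · have hp : ∀ n x, |pd n (R (m * ψ)) x| ≤ (N * D + (D + C) / 2) * ‖ψ‖ := fun n x => by
      have := M.op.grad (g := m * ψ) (M := D * ‖ψ‖) (F := C * ‖ψ‖) (L := 1) one_pos x
        (fun y _ => (key ψ y).trans (mul_le_of_le_one_right (by positivity) (e1 y)))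
        (fun y _ => (hmψ ψ y).trans (by
          rw [add_zero, sub_zero]; exact mul_le_of_le_one_right (by positivity) (e1 y)))
        (fun y _ => by simp) n
      refine this.trans_eq ?_
      ring
    have := hol_of_pd (M.op.c1 (m * ψ)) hp (by positivity)
    refine ⟨by positivity, fun x y => (this.2 x y).trans ?_⟩
    have : 0 ≤ ‖x - y‖ ^ (1:ℝ) := by positivity
    gcongr ?_ * _
    have : 0 ≤ D * ‖ψ‖ := by positivity
    nlinarith

lemma GS.comb_c2 (g : GS N f σ A w) (c : Fin N → ℝ) : ContDiff ℝ 2 (fun x => ∑ n, c n * pd n w x) :=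
  ContDiff.sum fun n _ => contDiff_const.mul (g.dw n).1

lemma GS.comb_lap (g : GS N f σ A w) (c : Fin N → ℝ) (x : Euc N) :
    lap (fun x => ∑ n, c n * pd n w x) x = (∑ n, c n * pd n w x) - deriv f (w x) * ∑ n, c n * pd n w x := by
  rw [lap_sum Finset.univ (u := fun n x => c n * pd n w x) (fun n => contDiff_const.mul (g.dw n).1)]
  rw [Finset.mul_sum, ← Finset.sum_sub_distrib]
  refine Finset.sum_congr rfl fun n _ => ?_
  rw [lap_cmul (g.dw n).1, (g.dw n).2.1]
  ring

lemma GS.comb_decay (g : GS N f σ A w) (c : Fin N → ℝ) : ∃ C, 0 < C ∧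
    (∀ x, |∑ n, c n * pd n w x| ≤ C * exp (-(1 * ‖x‖))) ∧
    (∀ k x, |pd k (fun x => ∑ n, c n * pd n w x) x| ≤ C * exp (-(1 * ‖x‖))) ∧
    (∀ x, |lap (fun x => ∑ n, c n * pd n w x) x| ≤ C * exp (-(1 * ‖x‖))) := by
  obtain ⟨C, hC, h0, h1, h2, h3⟩ := g.decay
  have hS : 0 ≤ ∑ n, |c n| := Finset.sum_nonneg fun n _ => abs_nonneg _
  have a0 : ∀ x, |∑ n, c n * pd n w x| ≤ (∑ n, |c n|) * C * exp (-(1 * ‖x‖)) := fun x => by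
    refine (Finset.abs_sum_le_sum_abs _ _).trans ?_
    rw [Finset.sum_mul, Finset.sum_mul, one_mul]
    refine Finset.sum_le_sum fun n _ => ?_
    rw [abs_mul, mul_assoc]
    exact mul_le_mul_of_nonneg_left (h1 n x) (abs_nonneg _)
  refine ⟨(∑ n, |c n|) * C * (1 + C) + 1, by positivity, fun x => (a0 x).trans ?_, fun k x => ?_, fun x => ?_⟩
  · gcongr
    nlinarith [mul_nonneg hS hC.le]
  · rw [pd_sum Finset.univ (u := fun n x => c n * pd n w x) (fun n => (contDiff_const.mul (g.dw n).1).differentiable (by norm_num))]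
    have : |∑ n, pd k (fun x => c n * pd n w x) x| ≤ (∑ n, |c n|) * C * exp (-(1 * ‖x‖)) := by
      refine (Finset.abs_sum_le_sum_abs _ _).trans ?_
      rw [Finset.sum_mul, Finset.sum_mul, one_mul]
      refine Finset.sum_le_sum fun n _ => ?_
      rw [pd_cmul (difpd g.C2 n), abs_mul, mul_assoc]
      exact mul_le_mul_of_nonneg_left (h2 k n x) (abs_nonneg _)
    refine this.trans ?_
    gcongr
    nlinarith [mul_nonneg hS hC.le]
  · rw [g.comb_lap]
    set v := ∑ n, c n * pd n w x with hv
    have : |v - deriv f (w x) * v| ≤ (1 + C) * |v| := by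
      refine (abs_sub _ _).trans ?_
      rw [abs_mul]
      have := h3 x
      nlinarith [abs_nonneg v]
    refine this.trans ?_
    calc (1 + C) * |v| ≤ (1 + C) * ((∑ n, |c n|) * C * exp (-(1 * ‖x‖))) := by gcongr; exact a0 x
      _ ≤ _ := by
        have := exp_pos (-(1 * ‖x‖))
        nlinarith

/-- coercivity on combinations of derivatives -/
lemma GS.comb_zero (g : GS N f σ A w) (c : Fin N → ℝ)
    (h : ∫ x, deriv f (w x) * (∑ n, c n * pd n w x) * (∑ n, c n * pd n w x) = 0) :
    (∀ x, ∑ n, c n * pd n w x = 0) ∧ c = 0 := by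
  obtain ⟨C, hC, d0, d1, d2⟩ := g.comb_decay c
  have hv := g.comb_c2 c
  have hl := g.comb_lap c
  set v := fun x => ∑ n, c n * pd n w x with hvdef
  have e1 : ∀ x : Euc N, exp (-(1 * ‖x‖)) ≤ 1 := fun x => by simp
  have e0 : ∀ x : Euc N, 0 < exp (-(1 * ‖x‖)) := fun x => exp_pos _
  have p1 : ∀ n x, pd n (fun x => v x * v x) x = 2 * (v x * pd n v x) := fun n x => by
    rw [pd_mul (dif2 hv) (dif2 hv)]; ring
  have p2 : ∀ x, lap (fun x => v x * v x) x = 2 * (v x * lap v x) + 2 * ∑ n, pd n v x * pd n v x := fun x => by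
    rw [lap_mul hv hv]; ring
  have prod : ∀ {a b x}, |a| ≤ C * exp (-(1 * ‖x‖)) → |b| ≤ C * exp (-(1 * ‖(x : Euc N)‖)) →
      |a * b| ≤ C * C * exp (-(1 * ‖x‖)) := fun {a b x} ha hb => by
    rw [abs_mul]
    calc |a| * |b| ≤ (C * exp (-(1 * ‖x‖))) * (C * 1) := by
          gcongr
          exact hb.trans (by gcongr; exact e1 x)
      _ = _ := by ring
  have D0 : ∀ x, |v x * v x| ≤ C * C * exp (-(1 * ‖x‖)) := fun x => prod (d0 x) (d0 x)
  have D2 : ∀ x, |v x * lap v x| ≤ C * C * exp (-(1 * ‖x‖)) := fun x => prod (d0 x) (d2 x)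
  have D1 : ∀ x, |∑ n, pd n v x * pd n v x| ≤ N * (C * C * exp (-(1 * ‖x‖))) := fun x => by
    refine (Finset.abs_sum_le_sum_abs _ _).trans ?_
    exact (Finset.sum_le_card_nsmul _ _ _ fun n _ => prod (d1 n x) (d1 n x)).trans_eq (by simp)
  have G := green (u := fun _ : Euc N => (1 : ℝ)) (v := fun x => v x * v x) contDiff_const (hv.mul hv) (B := 1)
    (C := 2 * (C * C) + 2 * (N * (C * C))) one_pos (by simp) (fun x => by rw [lap_const]; simp)
    (fun x => (D0 x).trans (by gcongr; nlinarith [mul_nonneg (Nat.cast_nonneg N : (0:ℝ) ≤ N) (mul_pos hC hC).le]))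
    (fun n x => by
      rw [p1, abs_mul, abs_two]
      have := prod (d0 x) (d1 n x)
      have k : 0 ≤ 2 * ((N:ℝ) * (C * C)) * exp (-(1 * ‖x‖)) := by positivity
      nlinarith)
    (fun x => by
      rw [p2]
      refine (abs_add_le _ _).trans ?_
      rw [abs_mul 2, abs_mul 2, abs_two]
      nlinarith [D2 x, D1 x])
  simp_rw [p2, lap_const] at G
  simp only [one_mul, mul_zero, integral_zero] at G
  have cl : Continuous (lap v) := continuous_lap hv
  have cp : ∀ n, Continuous (pd n v) := c0_pd (c21 hv)
  have cv := hv.continuous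
  have i1 : Integrable (fun x => v x * lap v x) := integrable_of_exp (Q := 0) one_pos (cv.mul cl) (fun x => by rw [sub_zero]; exact D2 x)
  have i2 : Integrable (fun x => ∑ n, pd n v x * pd n v x) :=
    integrable_of_exp (Q := 0) (C := N * (C * C)) one_pos (by fun_prop) (fun x => by rw [sub_zero, mul_assoc]; exact D1 x)
  have i3 : Integrable (fun x => v x * v x) := integrable_of_exp (Q := 0) one_pos (cv.mul cv) (fun x => by rw [sub_zero]; exact D0 x)
  rw [integral_add (i1.const_mul 2) (i2.const_mul 2), integral_const_mul, integral_const_mul] at G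
  have hE : ∫ x, v x * lap v x = ∫ x, v x * v x := by
    have : ∀ x, v x * lap v x = v x * v x - deriv f (w x) * v x * v x := fun x => by rw [hl]; ring
    have i4 : Integrable (fun x => deriv f (w x) * v x * v x) := by
      refine (i3.sub i1).congr (Eventually.of_forall fun x => ?_)
      simp only [Pi.sub_apply]
      rw [this]; ring
    simp_rw [this]
    rw [integral_sub i3 i4, h, sub_zero]
  have h5 : 0 ≤ ∫ x, ∑ n, pd n v x * pd n v x :=
    integral_nonneg fun x => Finset.sum_nonneg fun n _ => mul_self_nonneg _
  have h6 : ∫ x, v x * v x = 0 := by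
    have : 0 ≤ ∫ x, v x * v x := integral_nonneg fun x => mul_self_nonneg _
    linarith
  have h7 : ∀ x, v x = 0 := by
    have h8 := (integral_eq_zero_iff_of_nonneg (fun x => mul_self_nonneg (v x)) i3).1 h6
    have h9 := (cv.mul cv).ae_eq_iff_eq (μ := volume) continuous_zero |>.1 h8
    exact fun x => mul_self_eq_zero.1 (congrFun h9 x)
  refine ⟨h7, ?_⟩
  -- `w` is constant in direction `c`
  by_contra hc
  set e : Euc N := WithLp.toLp 2 c with he
  have hec : ∀ n, e n = c n := fun n => rfl
  have he0 : e ≠ 0 := fun h0 => hc (by funext n; rw [← hec n, h0]; rfl)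
  have hder : ∀ t : ℝ, HasDerivAt (fun t : ℝ => w (t • e)) 0 t := fun t => by
    have h10 : HasDerivAt (fun t : ℝ => t • e) e t := by simpa using (hasDerivAt_id t).smul_const e
    have h11 := ((dif2 g.C2) (t • e)).hasFDerivAt.comp_hasDerivAt t h10
    rw [fderiv_apply_eq] at h11
    have : ∑ n, e n * pd n w (t • e) = 0 := h7 (t • e)
    rw [this] at h11
    exact h11
  have hconst : ∀ t : ℝ, w (t • e) = w 0 := fun t => by
    have := is_const_of_deriv_eq_zero (fun t => (hder t).differentiableAt) (fun t => (hder t).deriv) t 0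
    simpa using this
  obtain ⟨C0, hC0, hup⟩ := g.upper
  have htend : Tendsto (fun t : ℝ => C0 * exp (-(t * ‖e‖))) atTop (nhds (C0 * 0)) :=
    (tendsto_exp_neg_atTop_nhds_zero.comp (tendsto_id.atTop_mul_const (norm_pos_iff.2 he0))).const_mul C0
  rw [mul_zero] at htend
  obtain ⟨t, ht1, ht2⟩ := ((htend.eventually (gt_mem_nhds (g.pos 0))).and (eventually_ge_atTop 0)).exists
  have := hup (t • e)
  rw [hconst, norm_smul, Real.norm_eq_abs, abs_of_nonneg ht2] at this
  linarith

end gs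
end LS

namespace LS
open scoped ContDiff BoundedContinuousFunction
variable {N : ℕ}

section gs
variable {f : ℝ → ℝ} {σ A : ℝ} {w : Euc N → ℝ}
variable {R : XX N →L[ℝ] XX N} {m : XX N} {d h : Fin N → XX N}

lemma Mod.compact (g : GS N f σ A w) (M : Mod f w R m d h) : IsCompactOperator (CC R m d h) := by
  have hσ0 := g.σ0
  have hσ1 := g.σ1
  obtain ⟨C, hC, hK⟩ := M.K_bound g (μ := σ / 2) (by linarith) (by linarith) (by nlinarith)
  have k1 : IsCompactOperator (R ∘L ContinuousLinearMap.mul ℝ (XX N) m) := by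
    refine compact_of (H := C) (M := C) _ hC (μ := σ / 2) (by linarith) (fun ψ hψ => ?_) (fun ψ hψ x => ?_)
    · refine ⟨hC.le, fun x y => ((hK ψ).2.2 x y).trans ?_⟩
      gcongr
      exact mul_le_of_le_one_right hC.le hψ
    · refine ((hK ψ).1 x).trans ?_
      gcongr
      exact mul_le_of_le_one_right hC.le hψ
  have k2 := (k1.comp_clm (ContinuousLinearMap.fst ℝ (XX N) (Fin N → ℝ))).clm_comp
    (ContinuousLinearMap.inl ℝ (XX N) (Fin N → ℝ))
  have k3 := (isCompactOperator_of_locallyCompactSpace_dom (((ContinuousLinearMap.snd ℝ (XX N) (Fin N → ℝ)).prod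
      (ContinuousLinearMap.snd ℝ (XX N) (Fin N → ℝ) -
        (ContinuousLinearMap.pi fun n => pairX (h n)) ∘L ContinuousLinearMap.fst ℝ (XX N) (Fin N → ℝ))))).clm_comp
      ((- ∑ n, ((ContinuousLinearMap.proj n : (Fin N → ℝ) →L[ℝ] ℝ) ∘L
        ContinuousLinearMap.fst ℝ (Fin N → ℝ) (Fin N → ℝ)).smulRight (d n)).prod
      (ContinuousLinearMap.snd ℝ (Fin N → ℝ) (Fin N → ℝ)))
  exact k2.add k3

lemma Mod.inj (g : GS N f σ A w) (M : Mod f w R m d h) (z : E1 N) (hz : CC R m d h z = z) : z = 0 := by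
  have hσ0 := g.σ0
  have hσ1 := g.σ1
  obtain ⟨C, hC, hK⟩ := M.K_bound g (μ := σ / 2) (by linarith) (by linarith) (by nlinarith)
  obtain ⟨ψ, a⟩ := z
  have e1 : R (m * ψ) - ∑ n, a n • d n = ψ := by
    have := congrArg Prod.fst hz
    rwa [CC_fst] at this
  have e2 : ∀ n, ∫ x, ψ x * h n x = 0 := fun n => by
    have h1 : (CC R m d h (ψ, a)).2 n = a n := by rw [hz]
    rw [CC_snd, pairX_apply (M.h_int g n)] at h1
    simpa using h1
  set v := fun x => ∑ n, a n * pd n w x with hvd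
  have hv2 : ContDiff ℝ 2 v := g.comb_c2 a
  obtain ⟨Cv, hCv, d0, d1, d2⟩ := g.comb_decay a
  have hev : ∀ x, ψ x = R (m * ψ) x - v x := fun x => by
    conv_lhs => rw [← e1]
    simp [hvd, M.d_eq]
  have hexp1 : ∀ x : Euc N, exp (-(1 * ‖x‖)) ≤ 1 := fun x => by simp
  -- Hölder regularity of `m ψ`
  have hvl : Hol 1 (N * Cv) v := hol_of_pd (c21 hv2) (fun n x => (d1 n x).trans
    (mul_le_of_le_one_right hCv.le (hexp1 x))) hCv.le
  have hψl : Hol 1 (C * ‖ψ‖ + N * Cv) ψ := by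
    refine ⟨by positivity, fun x y => ?_⟩
    have h1 := (hK ψ).2.2 x y
    have h2 := hvl.2 x y
    rw [hev, hev, add_mul]
    have : R (m * ψ) x - v x - (R (m * ψ) y - v y) = (R (m * ψ) x - R (m * ψ) y) - (v x - v y) := by ring
    rw [this]
    exact (abs_sub _ _).trans (by linarith)
  have hwl : ∃ L, Hol 1 L w := by
    obtain ⟨C1, hC1, -, h1, -⟩ := g.decay
    exact ⟨_, hol_of_pd (c21 g.C2) (fun n x => (h1 n x).trans
      (mul_le_of_le_one_right hC1.le (exp_neg_norm_le_one x))) hC1.le⟩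
  obtain ⟨Lw, hLw⟩ := hwl
  obtain ⟨C1, hC1, hw1, -, -, hf'⟩ := g.decay
  obtain ⟨H1, hH1⟩ := g.hol_f' hC1 (fun x => by
    rw [abs_of_pos (g.pos x)]
    exact (hw1 x).trans (mul_le_of_le_one_right hC1.le (exp_neg_norm_le_one x))) hLw
  have hmψ := hol_mul hf' (xabs ψ) hH1 (hol_of_lip (xabs ψ) hψl hσ0 hσ1.le)
  have hmψ' : Hol σ _ (m * ψ : XX N) := ⟨hmψ.1, fun x y => by
    have := hmψ.2 x y
    simpa [M.m_eq] using this⟩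
  have hS := schauder g.hN M.op hσ0 hσ1.le hmψ'
  have hψ2 : ContDiff ℝ 2 ψ := by
    have : (ψ : Euc N → ℝ) = fun x => R (m * ψ) x - v x := funext hev
    rw [this]; exact hS.1.sub hv2
  have hlapψ : ∀ x, lap ψ x = ψ x - deriv f (w x) * ψ x + deriv f (w x) * v x := fun x => by
    have h1 := hS.2.2 x
    have h2 : lap ψ x = lap (R (m * ψ)) x - lap v x := by
      conv_lhs => rw [show (ψ : Euc N → ℝ) = fun x => R (m * ψ) x - v x from funext hev]
      exact lap_sub hS.1 hv2 x
    have h3 : lap v x = v x - deriv f (w x) * v x := g.comb_lap a x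
    rw [h2, h3]
    rw [BoundedContinuousFunction.mul_apply, M.m_eq] at h1
    have h4 := hev x
    linarith
  -- Green
  have hvb : ∀ x, |v x| ≤ Cv := fun x => (d0 x).trans (mul_le_of_le_one_right hCv.le (hexp1 x))
  have G := green (B := ‖ψ‖ + C1 * ‖ψ‖ + C1 * Cv) hψ2 hv2 one_pos (fun x => (xabs ψ x).trans (by
      have : 0 ≤ C1 * ‖ψ‖ + C1 * Cv := by positivity
      linarith)) (fun x => by
      rw [hlapψ]
      have a1 := xabs ψ x
      have a2 : |deriv f (w x) * ψ x| ≤ C1 * ‖ψ‖ := by rw [abs_mul]; gcongr; exact hf' x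
      have a3 : |deriv f (w x) * v x| ≤ C1 * Cv := by rw [abs_mul]; gcongr; exacts [hf' x, hvb x]
      refine (abs_add_le _ _).trans (add_le_add ((abs_sub _ _).trans (add_le_add a1 a2)) a3)) d0 d1 d2
  have hIntg : ∀ q : Euc N → ℝ, Continuous q → (∃ B, ∀ x, |q x| ≤ B) → Integrable (fun x => q x * v x) := by
    rintro q hq ⟨B, hB⟩
    have hB0 : 0 ≤ B := (abs_nonneg _).trans (hB 0)
    refine integrable_of_exp (Q := 0) (C := B * Cv) one_pos (hq.mul hv2.continuous) (fun x => ?_)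
    rw [abs_mul, sub_zero, mul_assoc]
    gcongr
    exacts [hB x, d0 x]
  have cf : Continuous (fun x => deriv f (w x)) := g.f'c.comp g.C2.continuous
  have i1 : Integrable (fun x => ψ x * v x) := hIntg _ ψ.continuous ⟨_, xabs ψ⟩
  have i2 : Integrable (fun x => deriv f (w x) * ψ x * v x) := hIntg _ (cf.mul ψ.continuous)
    ⟨C1 * ‖ψ‖, fun x => by rw [abs_mul]; gcongr; exacts [hf' x, xabs ψ x]⟩
  have i3 : Integrable (fun x => deriv f (w x) * v x * v x) := hIntg _ (cf.mul hv2.continuous)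
    ⟨C1 * Cv, fun x => by rw [abs_mul]; gcongr; exacts [hf' x, hvb x]⟩
  have q1 : ∀ x, ψ x * lap v x = ψ x * v x - deriv f (w x) * ψ x * v x := fun x => by
    have h3 : lap v x = v x - deriv f (w x) * v x := g.comb_lap a x
    rw [h3]; ring
  have q2 : ∀ x, v x * lap ψ x = ψ x * v x - deriv f (w x) * ψ x * v x + deriv f (w x) * v x * v x := fun x => by
    rw [hlapψ]; ring
  simp_rw [q1, q2] at G
  have i12 : Integrable (fun x => ψ x * v x - deriv f (w x) * ψ x * v x) := i1.sub i2
  rw [integral_add i12 i3] at G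
  have hz1 : ∫ x, deriv f (w x) * v x * v x = 0 := by linarith
  obtain ⟨hv0, ha0⟩ := g.comb_zero a hz1
  -- now `a = 0`
  have hlapψ' : ∀ x, lap ψ x - ψ x + deriv f (w x) * ψ x = 0 := fun x => by
    have h1 := hlapψ x
    have h2 : v x = 0 := hv0 x
    rw [h2] at h1
    linarith
  have htend : Tendsto ψ (Filter.comap norm atTop) (nhds 0) := by
    have h1 : ∀ x, ‖ψ x‖ ≤ C * ‖ψ‖ * exp (-(σ / 2 * ‖x‖)) := fun x => by
      have h2 : v x = 0 := hv0 x
      rw [hev, h2, sub_zero]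
      exact (hK ψ).1 x
    refine squeeze_zero_norm h1 ?_
    have h3 : Tendsto (fun r : ℝ => C * ‖ψ‖ * exp (-(σ / 2 * r))) atTop (nhds (C * ‖ψ‖ * 0)) :=
      (tendsto_exp_neg_atTop_nhds_zero.comp (tendsto_id.const_mul_atTop (by linarith))).const_mul _
    rw [mul_zero] at h3
    exact h3.comp tendsto_comap
  obtain ⟨c, hc⟩ := g.nondeg ψ hψ2 ⟨_, xabs ψ⟩ htend hlapψ'
  have hc' : ∀ x, ψ x = ∑ n, c n * pd n w x := fun x => by
    rw [hc]
    exact Finset.sum_congr rfl fun n _ => by rw [lineDeriv_eq_pd (dif2 g.C2 x)]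
  have hz2 : ∫ x, deriv f (w x) * (∑ n, c n * pd n w x) * (∑ n, c n * pd n w x) = 0 := by
    have : ∀ x, deriv f (w x) * (∑ n, c n * pd n w x) * (∑ n, c n * pd n w x) = ∑ n, c n * (ψ x * h n x) := fun x => by
      rw [mul_right_comm, mul_comm, Finset.sum_mul]
      refine Finset.sum_congr rfl fun n _ => ?_
      rw [M.h_eq, hc']; ring
    simp_rw [this]
    rw [integral_finsetSum _ fun n _ => (integrable_mulX (M.h_int g n) ψ).const_mul _]
    simp_rw [integral_const_mul, e2]
    simp
  have := (g.comb_zero c hz2).1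
  refine Prod.ext ?_ ha0
  ext x
  change ψ x = 0
  rw [hc', this]

lemma Mod.exists_S (g : GS N f σ A w) (M : Mod f w R m d h) : ∃ S : E1 N →L[ℝ] E1 N,
    S = CC R m d h + CC R m d h * S := by
  rcases (M.compact g).hasEigenvalue_or_mem_resolventSet (one_ne_zero (α := ℝ)) with h1 | h1
  · exfalso
    obtain ⟨z, hz⟩ := h1.exists_hasEigenvector
    refine hz.2 (M.inj g z ?_)
    have := hz.apply_eq_smul
    rw [one_smul] at this
    exact this
  · obtain ⟨B, hB⟩ := (show IsUnit _ from h1)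
    rw [map_one] at hB
    have h2 : (1 - CC R m d h) * (B⁻¹ : (E1 N →L[ℝ] E1 N)ˣ) = 1 := by rw [← hB]; exact B.mul_inv
    refine ⟨(B⁻¹ : (E1 N →L[ℝ] E1 N)ˣ) - 1, ?_⟩
    refine ContinuousLinearMap.ext fun z => ?_
    have h3 : (B⁻¹ : (E1 N →L[ℝ] E1 N)ˣ).1 z - CC R m d h ((B⁻¹ : (E1 N →L[ℝ] E1 N)ˣ).1 z) = z := congrArg (fun T => T z) h2
    have h4 : CC R m d h ((B⁻¹ : (E1 N →L[ℝ] E1 N)ˣ).1 z - z) =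
      CC R m d h ((B⁻¹ : (E1 N →L[ℝ] E1 N)ˣ).1 z) - CC R m d h z := map_sub _ _ _
    change (B⁻¹ : (E1 N →L[ℝ] E1 N)ˣ).1 z - z = CC R m d h z + CC R m d h ((B⁻¹ : (E1 N →L[ℝ] E1 N)ˣ).1 z - z)
    rw [h4, add_sub_cancel, sub_eq_iff_eq_add, ← sub_eq_iff_eq_add']
    exact h3
end gs
end LS

namespace LS
open scoped ContDiff BoundedContinuousFunction
variable {N ℓ : ℕ}

/-- translation operator on bounded continuous functions -/
noncomputable def trL (Q : Euc N) : XX N →ₗ[ℝ] XX N where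
  toFun ψ := ψ.compContinuous ⟨fun x => x - Q, by fun_prop⟩
  map_add' _ _ := rfl
  map_smul' _ _ := rfl

lemma trL_bound (Q : Euc N) (ψ : XX N) : ‖trL Q ψ‖ ≤ 1 * ‖ψ‖ := by
  rw [one_mul]
  exact xle (norm_nonneg _) fun x => xabs ψ (x - Q)

noncomputable def tr (Q : Euc N) : XX N →L[ℝ] XX N :=
  ⟨trL Q, AddMonoidHomClass.continuous_of_bound (trL Q) 1 (trL_bound Q)⟩

lemma tr_apply (Q : Euc N) (ψ : XX N) (x : Euc N) : tr Q ψ x = ψ (x - Q) := rfl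

lemma tr_norm (Q : Euc N) (ψ : XX N) : ‖tr Q ψ‖ ≤ ‖ψ‖ := xle (norm_nonneg _) fun x => xabs ψ (x - Q)

abbrev Zs (N ℓ : ℕ) := XX N × (Fin ℓ → Fin N → ℝ)

noncomputable def Jm (Q : Euc N) (j : Fin ℓ) : E1 N →L[ℝ] Zs N ℓ :=
  (tr Q ∘L ContinuousLinearMap.fst ℝ (XX N) (Fin N → ℝ)).prod
    (ContinuousLinearMap.single ℝ (fun _ : Fin ℓ => Fin N → ℝ) j ∘L ContinuousLinearMap.snd ℝ (XX N) (Fin N → ℝ))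

noncomputable def Js (Q : Euc N) (j : Fin ℓ) : Zs N ℓ →L[ℝ] E1 N :=
  (tr (-Q) ∘L ContinuousLinearMap.fst ℝ (XX N) (Fin ℓ → Fin N → ℝ)).prod
    (ContinuousLinearMap.proj j ∘L ContinuousLinearMap.snd ℝ (XX N) (Fin ℓ → Fin N → ℝ))

lemma Jm_fst (Q : Euc N) (j : Fin ℓ) (z : E1 N) : (Jm Q j z).1 = tr Q z.1 := rfl
lemma Jm_snd (Q : Euc N) (j : Fin ℓ) (z : E1 N) : (Jm Q j z).2 = Pi.single j z.2 := rfl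
lemma Js_fst (Q : Euc N) (j : Fin ℓ) (z : Zs N ℓ) : (Js Q j z).1 = tr (-Q) z.1 := rfl
lemma Js_snd (Q : Euc N) (j : Fin ℓ) (z : Zs N ℓ) : (Js Q j z).2 = z.2 j := rfl

lemma Jm_norm (Q : Euc N) (j : Fin ℓ) (z : E1 N) : ‖Jm Q j z‖ ≤ ‖z‖ := by
  refine max_le ((tr_norm _ _).trans (norm_fst_le z)) ?_
  rw [Jm_snd, Pi.norm_single]
  exact norm_snd_le z

lemma Js_norm (Q : Euc N) (j : Fin ℓ) (z : Zs N ℓ) : ‖Js Q j z‖ ≤ ‖z‖ := by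
  refine max_le ((tr_norm _ _).trans (norm_fst_le z)) ?_
  exact (norm_le_pi_norm z.2 j).trans (norm_snd_le z)

lemma Js_Jm (Q : Euc N) (j : Fin ℓ) (z : E1 N) : Js Q j (Jm Q j z) = z := by
  refine Prod.ext ?_ ?_
  · ext x
    simp [Js_fst, Jm_fst, tr_apply]
  · simp [Js_snd, Jm_snd]

lemma Js_Jm_ne (Q Q' : Euc N) {i j : Fin ℓ} (h : i ≠ j) (z : E1 N) :
    Js Q i (Jm Q' j z) = (tr (Q' - Q) z.1, 0) := by
  refine Prod.ext ?_ ?_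
  · ext x
    simp only [Js_fst, Jm_fst, tr_apply]
    congr 1; abel
  · simp [Js_snd, Jm_snd, h]

section gs
variable {f : ℝ → ℝ} {σ A : ℝ} {w : Euc N → ℝ}
variable {R : XX N →L[ℝ] XX N} {m : XX N} {d h : Fin N → XX N}

lemma exp_cross {μ ν : ℝ} (hμ : 0 ≤ μ) (x D : Euc N) :
    exp (-(ν * ‖x‖)) * exp (-(μ * ‖x - D‖)) ≤ exp (-(μ * ‖D‖)) * exp (-((ν - μ) * ‖x‖)) := by
  rw [← exp_add, ← exp_add]
  apply exp_le_exp.2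
  have := norm_sub_norm_le D x
  rw [norm_sub_rev] at this
  nlinarith

/-- interaction of two distant bumps -/
lemma Mod.cross (g : GS N f σ A w) (M : Mod f w R m d h) : ∃ C > 0, ∀ (ψ : XX N) (B : ℝ) (D : Euc N), 0 ≤ B →
    (∀ x, |ψ x| ≤ B * exp (-(σ / 2 * ‖x‖))) →
    ‖CC R m d h (tr D ψ, 0)‖ ≤ C * B * exp (-(σ / 2 * ‖D‖)) := by
  have hσ0 := g.σ0
  have hσ1 := g.σ1
  obtain ⟨C1, hC1, h1⟩ := g.fw_decay
  obtain ⟨C2, hC2, h2⟩ := M.h_decay g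
  set I := ∫ x : Euc N, exp (-((1 - σ / 2) * ‖x - 0‖)) with hI
  have hI0 : 0 ≤ I := integral_nonneg fun x => (exp_pos _).le
  have hIi : Integrable fun x : Euc N => exp (-((1 - σ / 2) * ‖x - 0‖)) := int_exp (by linarith) 0
  refine ⟨C1 + C2 * I, by positivity, fun ψ B D hB hψ => ?_⟩
  refine max_le ?_ ?_
  · rw [CC_fst]
    simp only [Pi.zero_apply, zero_smul, Finset.sum_const_zero, sub_zero]
    refine (M.op.norm_le _).trans ?_
    rw [div_one]
    refine xle (by positivity) fun x => ?_
    rw [BoundedContinuousFunction.mul_apply, tr_apply, M.m_eq, abs_mul]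
    have h3 : |deriv f (w x)| * |ψ (x - D)| ≤ (C1 * exp (-(σ * ‖x‖))) * (B * exp (-(σ / 2 * ‖x - D‖))) := by
      gcongr
      exacts [h1 x, hψ _]
    refine h3.trans ?_
    have h4 := exp_cross (ν := σ) (μ := σ / 2) (by linarith) x D
    have h5 : exp (-((σ - σ / 2) * ‖x‖)) ≤ 1 := exp_le_one_iff.2 (by
      have := norm_nonneg x
      nlinarith)
    have h6 : exp (-(σ / 2 * ‖D‖)) * exp (-((σ - σ / 2) * ‖x‖)) ≤ exp (-(σ / 2 * ‖D‖)) :=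
      mul_le_of_le_one_right (exp_pos _).le h5
    calc _ = C1 * B * (exp (-(σ * ‖x‖)) * exp (-(σ / 2 * ‖x - D‖))) := by ring
      _ ≤ C1 * B * exp (-(σ / 2 * ‖D‖)) := by gcongr; exact h4.trans h6
      _ ≤ _ := by
        have : 0 ≤ C2 * I * B * exp (-(σ / 2 * ‖D‖)) := by positivity
        nlinarith
  · refine (pi_norm_le_iff_of_nonneg (by positivity)).2 fun n => ?_
    rw [CC_snd, pairX_apply (M.h_int g n)]
    simp only [Pi.zero_apply, zero_sub, norm_neg, Real.norm_eq_abs]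
    refine (abs_int_le (M := C2 * B * exp (-(σ / 2 * ‖D‖))) hIi fun x => ?_).trans ?_
    · rw [abs_mul, tr_apply]
      have h3 : |ψ (x - D)| * |h n x| ≤ (B * exp (-(σ / 2 * ‖x - D‖))) * (C2 * exp (-(1 * ‖x‖))) := by
        gcongr
        exacts [hψ _, h2 n x]
      refine h3.trans ?_
      have h4 := exp_cross (ν := 1) (μ := σ / 2) (by linarith) x D
      rw [sub_zero]
      calc _ = C2 * B * (exp (-(1 * ‖x‖)) * exp (-(σ / 2 * ‖x - D‖))) := by ring
        _ ≤ C2 * B * (exp (-(σ / 2 * ‖D‖)) * exp (-((1 - σ / 2) * ‖x‖))) := by gcongr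
        _ = _ := by ring
    · have : 0 ≤ C1 * B * exp (-(σ / 2 * ‖D‖)) := by positivity
      rw [← hI]
      nlinarith

lemma Mod.S_decay (g : GS N f σ A w) (M : Mod f w R m d h) {S : E1 N →L[ℝ] E1 N}
    (hS : S = CC R m d h + CC R m d h * S) : ∃ C > 0, ∀ z x, |(S z).1 x| ≤ C * ‖z‖ * exp (-(σ / 2 * ‖x‖)) := by
  have hσ0 := g.σ0
  have hσ1 := g.σ1
  obtain ⟨C, hC, hK⟩ := M.K_bound g (μ := σ / 2) (by linarith) (by linarith) (by nlinarith)
  obtain ⟨C1, hC1, -, h1, -⟩ := g.decay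
  refine ⟨(C + N * C1) * (1 + ‖S‖), by positivity, fun z x => ?_⟩
  have e1 : S z = CC R m d h (z + S z) := by
    rw [map_add]
    exact congrArg (fun T => T z) hS
  have hn : ‖z + S z‖ ≤ (1 + ‖S‖) * ‖z‖ := by
    have := S.le_opNorm z
    have := norm_add_le z (S z)
    linarith
  set y := z + S z
  rw [e1, CC_fst]
  have h2 := (hK y.1).1 x
  have h3 : |(∑ n, y.2 n • d n) x| ≤ N * (‖y‖ * (C1 * exp (-‖x‖))) := by
    simp only [BoundedContinuousFunction.coe_sum, Finset.sum_apply, BoundedContinuousFunction.coe_smul, smul_eq_mul]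
    refine (Finset.abs_sum_le_sum_abs _ _).trans ?_
    refine (Finset.sum_le_card_nsmul _ _ (‖y‖ * (C1 * exp (-‖x‖))) fun n _ => ?_).trans ?_
    · rw [abs_mul, M.d_eq]
      gcongr
      · exact (norm_le_pi_norm y.2 n).trans (norm_snd_le y)
      · exact h1 n x
    · simp
  have h4 : exp (-‖x‖) ≤ exp (-(σ / 2 * ‖x‖)) := by
    have := exp_mono_rate (a := σ / 2) (b := 1) (by linarith) x
    simpa using this
  rw [BoundedContinuousFunction.sub_apply]
  refine (abs_sub _ _).trans ((add_le_add h2 h3).trans ?_)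
  calc _ ≤ C * ‖y‖ * exp (-(σ / 2 * ‖x‖)) + N * (‖y‖ * (C1 * exp (-(σ / 2 * ‖x‖)))) := by
        gcongr
        exact norm_fst_le y
    _ = (C + N * C1) * ‖y‖ * exp (-(σ / 2 * ‖x‖)) := by ring
    _ ≤ (C + N * C1) * ((1 + ‖S‖) * ‖z‖) * exp (-(σ / 2 * ‖x‖)) := by gcongr
    _ = _ := by ring

/-- The inverse of a small perturbation of the multi-bump model operator. -/
lemma Mod.assemble (g : GS N f σ A w) (M : Mod f w R m d h) (ℓ : ℕ) : ∃ δ₀ > 0, ∃ D₀ : ℝ, ∃ K > 0,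
    ∀ Q : Fin ℓ → Euc N, (∀ i j, i ≠ j → D₀ ≤ ‖Q i - Q j‖) → ∀ 𝓛 : Zs N ℓ →L[ℝ] Zs N ℓ,
    (∀ z, ‖𝓛 z - (z - ∑ i, Jm (Q i) i (CC R m d h (Js (Q i) i z)))‖ ≤ δ₀ * ‖z‖) →
    ∃ G : Zs N ℓ →L[ℝ] Zs N ℓ, ∀ z, 𝓛 (G z) = z ∧ ‖G z‖ ≤ K * ‖z‖ := by
  have hσ0 := g.σ0
  obtain ⟨S, hS⟩ := M.exists_S g
  obtain ⟨C1, hC1, h1⟩ := M.S_decay g hS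
  obtain ⟨C2, hC2, h2⟩ := M.cross g
  set K0 := 1 + ℓ * ‖S‖ with hK0
  have hK0p : 0 < K0 := by positivity
  -- choose the distance
  have htend : Tendsto (fun D : ℝ => (ℓ * (ℓ * (C2 * C1))) * exp (-(σ / 2 * D))) atTop (nhds ((ℓ * (ℓ * (C2 * C1))) * 0)) :=
    (tendsto_exp_neg_atTop_nhds_zero.comp (tendsto_id.const_mul_atTop (by linarith))).const_mul _
  rw [mul_zero] at htend
  obtain ⟨D₀, hD⟩ := (htend.eventually_le_const (show (0:ℝ) < 1 / 4 by norm_num)).exists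
  refine ⟨1 / (4 * K0), by positivity, D₀, 2 * K0, by positivity, fun Q hQ 𝓛 h𝓛 => ?_⟩
  set G₀ : Zs N ℓ →L[ℝ] Zs N ℓ := ContinuousLinearMap.id ℝ _ + ∑ j, (Jm (Q j) j) ∘L (S ∘L Js (Q j) j) with hG₀
  have hG₀a : ∀ z, G₀ z = z + ∑ j, Jm (Q j) j (S (Js (Q j) j z)) := fun z => by
    simp [hG₀, sum_apply]
  have hG₀n : ∀ z, ‖G₀ z‖ ≤ K0 * ‖z‖ := fun z => by
    rw [hG₀a]
    refine (norm_add_le _ _).trans ?_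
    have : ‖∑ j, Jm (Q j) j (S (Js (Q j) j z))‖ ≤ ∑ j : Fin ℓ, ‖S‖ * ‖z‖ :=
      norm_sum_le_of_le _ fun j _ => (Jm_norm _ _ _).trans ((S.le_opNorm _).trans (by
        gcongr
        exact Js_norm _ _ _))
    simp only [Finset.sum_const, Finset.card_univ, Fintype.card_fin, nsmul_eq_mul] at this
    rw [hK0]; linarith
  -- the remainder
  have hrem : ∀ z, G₀ z - ∑ i, Jm (Q i) i (CC R m d h (Js (Q i) i (G₀ z))) =
      z - ∑ i, ∑ j ∈ Finset.univ.erase i, Jm (Q i) i (CC R m d h (Js (Q i) i (Jm (Q j) j (S (Js (Q j) j z))))) := fun z => by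
    have key : ∀ i, Jm (Q i) i (CC R m d h (Js (Q i) i (G₀ z))) = Jm (Q i) i (S (Js (Q i) i z)) +
        ∑ j ∈ Finset.univ.erase i, Jm (Q i) i (CC R m d h (Js (Q i) i (Jm (Q j) j (S (Js (Q j) j z))))) := fun i => by
      have e1 : S (Js (Q i) i z) = CC R m d h (Js (Q i) i z) + CC R m d h (S (Js (Q i) i z)) :=
        congrArg (fun T => T (Js (Q i) i z)) hS
      rw [hG₀a]
      simp only [map_add, map_sum]
      rw [← Finset.add_sum_erase _ _ (Finset.mem_univ i), Js_Jm]
      conv_rhs => rw [e1, map_add]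
      rw [add_assoc]
    simp_rw [key, Finset.sum_add_distrib]
    rw [hG₀a]
    abel
  have hremn : ∀ z, ‖∑ i, ∑ j ∈ Finset.univ.erase i,
      Jm (Q i) i (CC R m d h (Js (Q i) i (Jm (Q j) j (S (Js (Q j) j z)))))‖ ≤ 1 / 4 * ‖z‖ := fun z => by
    have hb : ∀ i, ∀ j ∈ Finset.univ.erase i,
        ‖Jm (Q i) i (CC R m d h (Js (Q i) i (Jm (Q j) j (S (Js (Q j) j z)))))‖ ≤ C2 * (C1 * ‖z‖) * exp (-(σ / 2 * D₀)) := by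
      intro i j hj
      have hne : i ≠ j := (Finset.ne_of_mem_erase hj).symm
      refine (Jm_norm _ _ _).trans ?_
      rw [Js_Jm_ne _ _ hne]
      refine (h2 _ (C1 * ‖z‖) _ (by positivity) fun x => (h1 _ x).trans ?_).trans ?_
      · gcongr
        exact Js_norm _ _ _
      · gcongr
        exact hQ j i hne.symm
    have hc0 : 0 ≤ C2 * (C1 * ‖z‖) * exp (-(σ / 2 * D₀)) := by positivity
    refine (norm_sum_le_of_le _ (f := fun i => _) (n := fun _ => ℓ * (C2 * (C1 * ‖z‖) * exp (-(σ / 2 * D₀)))) fun i _ => ?_).trans ?_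
    · refine (norm_sum_le_of_le _ (hb i)).trans ?_
      rw [Finset.sum_const, nsmul_eq_mul]
      gcongr
      have := Finset.card_erase_le (s := (Finset.univ : Finset (Fin ℓ))) (a := i)
      simp
    · simp only [Finset.sum_const, Finset.card_univ, Fintype.card_fin, nsmul_eq_mul]
      have h0 := norm_nonneg z
      calc _ = (ℓ * (ℓ * (C2 * C1))) * exp (-(σ / 2 * D₀)) * ‖z‖ := by ring
        _ ≤ _ := by gcongr
  set T1 : Zs N ℓ →L[ℝ] Zs N ℓ := ContinuousLinearMap.id ℝ _ - 𝓛 ∘L G₀ with hT1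
  have hT1a : ∀ z, T1 z = z - 𝓛 (G₀ z) := fun z => rfl
  have hT1n : ∀ z, ‖T1 z‖ ≤ 1 / 2 * ‖z‖ := fun z => by
    have a1 := h𝓛 (G₀ z)
    rw [hrem] at a1
    have a2 := hremn z
    have a3 : 1 / (4 * K0) * ‖G₀ z‖ ≤ 1 / 4 * ‖z‖ := by
      rw [show 1 / 4 * ‖z‖ = 1 / (4 * K0) * (K0 * ‖z‖) by field_simp]
      gcongr
      exact hG₀n z
    set Sg := ∑ i, ∑ j ∈ Finset.univ.erase i,
      Jm (Q i) i (CC R m d h (Js (Q i) i (Jm (Q j) j (S (Js (Q j) j z)))))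
    rw [hT1a]
    have : z - 𝓛 (G₀ z) = Sg - (𝓛 (G₀ z) - (z - Sg)) := by abel
    rw [this]
    refine (norm_sub_le _ _).trans ?_
    linarith
  have hT1op : ‖T1‖ < 1 := lt_of_le_of_lt (T1.opNorm_le_bound (by norm_num) hT1n) (by norm_num)
  let B := Units.oneSub T1 hT1op
  have hB : ∀ z, (B⁻¹).1 z - T1 ((B⁻¹).1 z) = z := fun z => congrArg (fun T => T z) B.mul_inv
  refine ⟨G₀ ∘L (B⁻¹).1, fun z => ?_⟩
  have hz := hB z
  set y := (B⁻¹).1 z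
  change 𝓛 (G₀ y) = z ∧ ‖G₀ y‖ ≤ _
  refine ⟨by rw [hT1a, sub_sub_cancel] at hz; exact hz, ?_⟩
  have h5 : ‖y‖ ≤ 2 * ‖z‖ := by
    have h6 := norm_sub_norm_le y (T1 y)
    rw [hz] at h6
    have := hT1n y
    linarith
  calc _ ≤ K0 * ‖y‖ := hG₀n y
    _ ≤ K0 * (2 * ‖z‖) := by gcongr
    _ = _ := by ring
end gs
end LS

namespace LS
open scoped ContDiff BoundedContinuousFunction
variable {N ℓ : ℕ}

lemma isOp_translate {R : XX N →L[ℝ] XX N} (hR : IsOp (fun _ => 1) 1 R) (Q : Euc N) :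
    IsOp (fun _ => 1) 1 (tr Q ∘L (R ∘L tr (-Q))) := by
  refine ⟨one_pos, fun _ => le_rfl, contDiff_const, fun g hg => ?_⟩
  have hg' : ContDiff ℝ 1 (tr (-Q) g) := by
    have := contDiff_aff hg 1 Q
    convert this using 2 with x
    simp [tr_apply]
  obtain ⟨h1, ⟨B, h2⟩, h3⟩ := hR.2.2.2 _ hg'
  have e : ((tr Q ∘L (R ∘L tr (-Q))) g : Euc N → ℝ) = fun x => R (tr (-Q) g) ((1:ℝ) • x + -Q) := by
    funext x
    change R (tr (-Q) g) (x - Q) = _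
    rw [one_smul, sub_eq_add_neg]
  rw [e]
  refine ⟨contDiff_aff h1 1 (-Q), ⟨B, fun x => h2 _⟩, fun x => ?_⟩
  rw [lap_aff h1]
  have := h3 ((1:ℝ) • x + -Q)
  rw [tr_apply] at this
  simp only [one_pow, one_mul, one_smul] at this ⊢
  rw [this]
  congr 1
  abel

/-- Comparison of the resolvents of `-Δ+V` and `-Δ+1` on localised data. -/
lemma TR (hN : 1 ≤ N) {c μ : ℝ} (hc : 0 < c) (hμ : 0 ≤ μ) (hμc : μ ^ 2 ≤ c / 2) (hμ1 : μ ^ 2 ≤ 1 / 2) :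
    ∃ C > 0, ∀ (V : Euc N → ℝ) (T R : XX N →L[ℝ] XX N), IsOp V c T → IsOp (fun _ => 1) 1 R →
    ∀ (Q : Euc N) (δ r B : ℝ), 0 < δ → δ ≤ 1 → 0 ≤ B → exp (-(μ * r)) ≤ δ →
    (∀ y, ‖y - Q‖ ≤ r → |V y - 1| ≤ δ) → ∀ g : XX N, (∀ x, |g x| ≤ B * exp (-(μ * ‖x - Q‖))) →
    ‖T g - R g‖ ≤ C * δ * B := by
  set K := 2 / c * exp μ + 1 / c + (2 / 1 * exp μ + 1 / 1) with hK
  have hKp : 0 < K := by positivity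
  refine ⟨K + K / c + (1 / c + 1), by positivity, fun V T R hT hR Q δ r B hδ hδ1 hB hr hV g hg => ?_⟩
  rcases hB.eq_or_lt with rfl | hB
  · have : g = 0 := by
      ext x
      have := hg x
      rw [zero_mul] at this
      simpa using this
    simp [this]
  obtain ⟨g', hg'1, hg'2⟩ := dense_c1 g (mul_pos hδ hB)
  have hg'3 : ∀ x, |g' x| ≤ B * exp (-(μ * ‖x - Q‖)) + δ * B := fun x => by
    have h1 := (xabs_sub g' g x).trans hg'2
    have h2 := abs_sub_abs_le_abs_sub (g' x) (g x)
    linarith [hg x]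
  have hu := hT.decay hN hμ hμc hB.le (by positivity) hg'3
  have hv := hR.decay hN hμ hμ1 hB.le (by positivity) hg'3
  obtain ⟨su, -, eu⟩ := hT.2.2.2 g' hg'1
  obtain ⟨sv, -, ev⟩ := hR.2.2.2 g' hg'1
  have hexp1 : ∀ x, exp (-(μ * ‖x - Q‖)) ≤ 1 := fun x => exp_le_one_iff.2 (by
    have := norm_nonneg (x - Q)
    nlinarith)
  have hd : ∀ x, |T g' x - R g' x| ≤ (K + K / c) * δ * B := by
    refine mp_abs (V := V) (su.sub sv) (B := ‖T g' - R g'‖) (fun x => xabs_sub _ _ x) hc hT.2.1 (by positivity) fun x hx => ?_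
    rw [lap_sub su sv]
    have e1 : -(lap (T g') x - lap (R g') x) + V x * (T g' x - R g' x) = -((V x - 1) * R g' x) := by
      have := eu x
      have := ev x
      linarith
    rw [e1, abs_neg, abs_mul]
    by_cases hxr : ‖x - Q‖ ≤ r
    · have h1 : |R g' x| ≤ K * B := by
        refine (hv x).trans ?_
        calc _ ≤ 2 / 1 * exp μ * B * 1 + 1 * B / 1 := by
              gcongr
              exact hexp1 x
          _ = (2 / 1 * exp μ + 1 / 1) * B := by ring
          _ ≤ _ := by
            gcongr
            rw [hK]
            have : 0 ≤ 2 / c * exp μ + 1 / c := by positivity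
            linarith
      calc _ ≤ δ * (K * B) := by gcongr; exact hV x hxr
        _ = c * ((K / c) * δ * B) := by field_simp
        _ ≤ _ := by
          gcongr
          linarith
    · exfalso
      push Not at hxr
      have h2 : exp (-(μ * ‖x - Q‖)) ≤ δ := by
        refine (exp_le_exp.2 ?_).trans hr
        nlinarith
      have h3 : |T g' x - R g' x| ≤ K * δ * B := by
        refine (abs_sub _ _).trans ((add_le_add (hu x) (hv x)).trans ?_)
        calc _ ≤ (2 / c * exp μ * B * δ + δ * B / c) + (2 / 1 * exp μ * B * δ + δ * B / 1) := by gcongr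
          _ = K * δ * B := by rw [hK]; ring
      have h4 : 0 ≤ K / c * δ * B := by positivity
      nlinarith
  have h5 : ‖T g' - R g'‖ ≤ (K + K / c) * δ * B := xle (by positivity) hd
  have h6 : ‖T (g - g')‖ ≤ 1 / c * (δ * B) := by
    refine (hT.norm_le _).trans ?_
    rw [norm_sub_rev, div_mul_eq_mul_div, one_mul]
    gcongr
  have h7 : ‖R (g - g')‖ ≤ 1 * (δ * B) := by
    refine (hR.norm_le _).trans ?_
    rw [norm_sub_rev, div_one, one_mul]
    exact hg'2
  have e : T g - R g = (T g' - R g') + (T (g - g') - R (g - g')) := by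
    rw [map_sub, map_sub]; abel
  rw [e]
  refine (norm_add_le _ _).trans ((add_le_add h5 (norm_sub_le _ _)).trans ?_)
  linarith

/-- Approximate solution data in the rescaled variables. -/
structure Apx (f : ℝ → ℝ) (w : Euc N → ℝ) (c CU δ r : ℝ) (V : Euc N → ℝ) (T : XX N →L[ℝ] XX N)
    (Q : Fin ℓ → Euc N) (U : Euc N → ℝ) (Y Yt : Fin ℓ → Fin N → Euc N → ℝ) : Prop where
  op : IsOp V c T
  U2 : ContDiff ℝ 2 U
  Ub : ∀ y, |U y| ≤ CU
  Y2 : ∀ i n, ContDiff ℝ 2 (Y i n)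
  Yt_eq : ∀ i n y, Yt i n y = V y * Y i n y - lap (Y i n) y
  hY : ∀ i n y, |Y i n y - pd n w (y - Q i)| ≤ δ
  hYt : ∀ i n y, |Yt i n y - deriv f (w (y - Q i)) * pd n w (y - Q i)| ≤ δ * exp (-(1 / 2 * ‖y - Q i‖))
  hf : ∀ y, |deriv f (U y) - ∑ i, deriv f (w (y - Q i))| ≤ δ
  hV : ∀ i y, ‖y - Q i‖ ≤ r → |V y - 1| ≤ δ

section gs
variable {f : ℝ → ℝ} {σ A : ℝ} {w : Euc N → ℝ}
variable {R : XX N →L[ℝ] XX N} {m : XX N} {d h : Fin N → XX N}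
variable {c CU δ r : ℝ} {V : Euc N → ℝ} {T : XX N →L[ℝ] XX N}
variable {Q : Fin ℓ → Euc N} {U : Euc N → ℝ} {Y Yt : Fin ℓ → Fin N → Euc N → ℝ}

lemma Apx.Yt_cont (D : Apx f w c CU δ r V T Q U Y Yt) (i : Fin ℓ) (n : Fin N) : Continuous (Yt i n) := by
  have : Yt i n = fun y => V y * Y i n y - lap (Y i n) y := funext (D.Yt_eq i n)
  rw [this]
  exact (D.op.2.2.1.continuous.mul (D.Y2 i n).continuous).sub (continuous_lap (D.Y2 i n))

lemma Apx.Yt_bound (g : GS N f σ A w) : ∃ C > 0, ∀ {ℓ : ℕ} {c CU δ r : ℝ} {V : Euc N → ℝ} {T : XX N →L[ℝ] XX N}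
    {Q : Fin ℓ → Euc N} {U : Euc N → ℝ} {Y Yt : Fin ℓ → Fin N → Euc N → ℝ}, δ ≤ 1 → 
    Apx f w c CU δ r V T Q U Y Yt → (∀ i n y, |Yt i n y| ≤ C * exp (-(1 / 2 * ‖y - Q i‖))) ∧
      ∀ i n y, |Y i n y| ≤ C := by
  obtain ⟨C, hC, hw, h1, h2, h3⟩ := g.decay
  refine ⟨1 + C * C + C, by positivity, fun {ℓ c CU δ r V T Q U Y Yt} hδ D => ⟨fun i n y => ?_, fun i n y => ?_⟩⟩
  · have a1 := D.hYt i n y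
    have a2 : |deriv f (w (y - Q i)) * pd n w (y - Q i)| ≤ C * (C * exp (-‖y - Q i‖)) := by
      rw [abs_mul]; gcongr
      exacts [h3 _, h1 _ _]
    have a3 : exp (-‖y - Q i‖) ≤ exp (-(1 / 2 * ‖y - Q i‖)) := by
      have := exp_mono_rate (a := 1 / 2) (b := 1) (by norm_num) (y - Q i)
      simpa using this
    have a4 := abs_sub_abs_le_abs_sub (Yt i n y) (deriv f (w (y - Q i)) * pd n w (y - Q i))
    have a5 : C * (C * exp (-‖y - Q i‖)) ≤ C * (C * exp (-(1 / 2 * ‖y - Q i‖))) := by gcongr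
    have a6 := exp_pos (-(1 / 2 * ‖y - Q i‖))
    nlinarith
  · have a1 := D.hY i n y
    have a2 : |pd n w (y - Q i)| ≤ C := (h1 n _).trans (mul_le_of_le_one_right hC.le (exp_neg_norm_le_one _))
    have a4 := abs_sub_abs_le_abs_sub (Y i n y) (pd n w (y - Q i))
    nlinarith

lemma Apx.Yt_int (g : GS N f σ A w) (hδ : δ ≤ 1) (D : Apx f w c CU δ r V T Q U Y Yt) (i : Fin ℓ) (n : Fin N) :
    Integrable (Yt i n) := by
  obtain ⟨C, hC, h⟩ := Apx.Yt_bound g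
  exact integrable_of_exp (by norm_num) (D.Yt_cont i n) ((h hδ D).1 i n)

/-- the linearised operator -/
noncomputable def LL (T : XX N →L[ℝ] XX N) (mU : XX N) (YX : Fin ℓ → Fin N → XX N) (Yt : Fin ℓ → Fin N → Euc N → ℝ) :
    Zs N ℓ →L[ℝ] Zs N ℓ :=
  ((ContinuousLinearMap.fst ℝ (XX N) (Fin ℓ → Fin N → ℝ)
    - (T ∘L ContinuousLinearMap.mul ℝ (XX N) mU) ∘L ContinuousLinearMap.fst ℝ (XX N) (Fin ℓ → Fin N → ℝ))
    + ∑ i, ∑ n, ((ContinuousLinearMap.proj n : (Fin N → ℝ) →L[ℝ] ℝ) ∘L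
      (ContinuousLinearMap.proj i : (Fin ℓ → Fin N → ℝ) →L[ℝ] (Fin N → ℝ)) ∘L
        ContinuousLinearMap.snd ℝ (XX N) (Fin ℓ → Fin N → ℝ)).smulRight (YX i n)).prod
  (ContinuousLinearMap.pi fun i => ContinuousLinearMap.pi fun n =>
    (pairX (Yt i n)) ∘L ContinuousLinearMap.fst ℝ (XX N) (Fin ℓ → Fin N → ℝ))

lemma LL_fst (T : XX N →L[ℝ] XX N) (mU : XX N) (YX : Fin ℓ → Fin N → XX N) (Yt : Fin ℓ → Fin N → Euc N → ℝ) (z : Zs N ℓ) :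
    (LL T mU YX Yt z).1 = z.1 - T (mU * z.1) + ∑ i, ∑ n, z.2 i n • YX i n := by
  simp [LL, sum_apply]

lemma LL_snd (T : XX N →L[ℝ] XX N) (mU : XX N) (YX : Fin ℓ → Fin N → XX N) (Yt : Fin ℓ → Fin N → Euc N → ℝ) (z : Zs N ℓ)
    (i : Fin ℓ) (n : Fin N) :
    (LL T mU YX Yt z).2 i n = pairX (Yt i n) z.1 := by
  simp [LL]

end gs
end LS

namespace LS
open scoped ContDiff BoundedContinuousFunction
variable {N ℓ : ℕ}

lemma rate_exists {σ c : ℝ} (hσ : 0 < σ) (hc : 0 < c) : ∃ μ : ℝ, 0 < μ ∧ μ ≤ σ ∧ μ ≤ 1 / 2 ∧ μ ^ 2 ≤ c / 4 ∧ μ ^ 2 ≤ 1 / 4 := by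
  refine ⟨min σ (min (c / 2) (1 / 2)), by positivity, min_le_left _ _, (min_le_right _ _).trans (min_le_right _ _), ?_, ?_⟩
  all_goals
    set μ := min σ (min (c / 2) (1 / 2)) with hμ
    have h0 : 0 < μ := by positivity
    have h1 : μ ≤ c / 2 := (min_le_right _ _).trans (min_le_left _ _)
    have h2 : μ ≤ 1 / 2 := (min_le_right _ _).trans (min_le_right _ _)
    nlinarith

lemma exp_small {μ : ℝ} (hμ : 0 < μ) {δ : ℝ} (hδ : 0 < δ) : ∃ r : ℝ, 0 < r ∧ exp (-(μ * r)) ≤ δ := by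
  have htend : Tendsto (fun D : ℝ => exp (-(μ * D))) atTop (nhds 0) :=
    tendsto_exp_neg_atTop_nhds_zero.comp (tendsto_id.const_mul_atTop hμ)
  obtain ⟨r, hr1, hr2⟩ := ((htend.eventually_le_const hδ).and (eventually_gt_atTop 0)).exists
  exact ⟨r, hr2, hr1⟩

section gs
variable {f : ℝ → ℝ} {σ A : ℝ} {w : Euc N → ℝ}
variable {R : XX N →L[ℝ] XX N} {m : XX N} {d h : Fin N → XX N}

lemma Mod.linear (g : GS N f σ A w) (M : Mod f w R m d h) (ℓ : ℕ) {c : ℝ} (hc : 0 < c) :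
    ∃ δ₁ > 0, δ₁ ≤ 1 ∧ ∃ r₁ > 0, ∃ D₁ : ℝ, ∃ K > 0, ∀ (CU : ℝ) (V : Euc N → ℝ) (T : XX N →L[ℝ] XX N)
      (Q : Fin ℓ → Euc N) (U : Euc N → ℝ) (Y Yt : Fin ℓ → Fin N → Euc N → ℝ) (mU : XX N) (YX : Fin ℓ → Fin N → XX N),
      Apx f w c CU δ₁ r₁ V T Q U Y Yt → (∀ i j, i ≠ j → D₁ ≤ ‖Q i - Q j‖) → (∀ y, mU y = deriv f (U y)) →
      (∀ i n y, YX i n y = Y i n y) →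
      ∃ G : Zs N ℓ →L[ℝ] Zs N ℓ, ∀ z, LL T mU YX Yt (G z) = z ∧ ‖G z‖ ≤ K * ‖z‖ := by
  obtain ⟨δ₀, hδ₀, D₀, K, hK, hG⟩ := M.assemble g ℓ
  obtain ⟨μ, hμ, hμσ, hμh, hμc, hμ1⟩ := rate_exists g.σ0 hc
  obtain ⟨C1, hC1, hTR⟩ := TR g.hN hc hμ.le (by linarith) (by linarith)
  obtain ⟨C2, hC2, hfw⟩ := g.fw_decay
  set I := ∫ x : Euc N, exp (-(1 / 2 * ‖x - 0‖)) with hI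
  have hI0 : 0 ≤ I := integral_nonneg fun x => (exp_pos _).le
  set L := 1 / c + ℓ * (C1 * C2) + ℓ * N + I + 1 with hL
  have hLp : 0 < L := by positivity
  set δ₁ := min 1 (δ₀ / L) with hδ₁
  have hδp : 0 < δ₁ := by positivity
  have hδ1 : δ₁ ≤ 1 := min_le_left _ _
  have hδL : L * δ₁ ≤ δ₀ := by
    have : δ₁ ≤ δ₀ / L := min_le_right _ _
    rw [le_div_iff₀ hLp] at this
    linarith
  obtain ⟨r₁, hr₁, hr₁'⟩ := exp_small hμ hδp
  refine ⟨δ₁, hδp, hδ1, r₁, hr₁, D₀, K, hK, fun CU V T Q U Y Yt mU YX D hQ hmU hYX => hG Q hQ _ fun z => ?_⟩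
  obtain ⟨ψ, a⟩ := z
  set z : Zs N ℓ := (ψ, a)
  have hψz : ‖ψ‖ ≤ ‖z‖ := norm_fst_le z
  have haz : ∀ i n, |a i n| ≤ ‖z‖ := fun i n =>
    ((norm_le_pi_norm (a i) n).trans (norm_le_pi_norm a i)).trans (norm_snd_le z)
  have hz0 := norm_nonneg z
  refine max_le ?_ ?_
  · -- first component
    set mi : Fin ℓ → XX N := fun i => tr (Q i) m with hmi
    set Ri : Fin ℓ → (XX N →L[ℝ] XX N) := fun i => tr (Q i) ∘L (R ∘L tr (-(Q i))) with hRi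
    have e1 : (LL T mU YX Yt z - (z - ∑ i, Jm (Q i) i (CC R m d h (Js (Q i) i z)))).1
        = -(T ((mU - ∑ i, mi i) * ψ)) - ∑ i, (T (mi i * ψ) - Ri i (mi i * ψ))
          + ∑ i, ∑ n, a i n • (YX i n - tr (Q i) (d n)) := by
      have e2 : ∀ i, (Jm (Q i) i (CC R m d h (Js (Q i) i z))).1 = Ri i (mi i * ψ) - ∑ n, a i n • tr (Q i) (d n) := fun i => by
        rw [Jm_fst, CC_fst, map_sub, map_sum]
        congr 1
        · change tr (Q i) (R (m * tr (-(Q i)) ψ)) = tr (Q i) (R (tr (-(Q i)) (mi i * ψ)))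
          congr 2
          ext x
          simp [hmi, tr_apply]
      rw [Prod.fst_sub, LL_fst, Prod.fst_sub, Prod.fst_sum]
      simp_rw [e2, smul_sub, Finset.sum_sub_distrib]
      have e3 : T ((mU - ∑ i, mi i) * ψ) = T (mU * ψ) - ∑ i, T (mi i * ψ) := by
        rw [sub_mul, map_sub, Finset.sum_mul, map_sum]
      rw [e3]
      change ψ - T (mU * ψ) + _ - _ = _
      simp only [z]
      abel
    rw [e1]
    have b1 : ‖T ((mU - ∑ i, mi i) * ψ)‖ ≤ 1 / c * (δ₁ * ‖z‖) := by
      refine (D.op.norm_le _).trans ?_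
      rw [div_mul_eq_mul_div, one_mul]
      gcongr
      refine (norm_mul_le _ _).trans ?_
      gcongr
      refine xle hδp.le fun y => ?_
      have := D.hf y
      simpa [hmU, hmi, tr_apply, M.m_eq] using this
    have b2 : ∀ i, ‖T (mi i * ψ) - Ri i (mi i * ψ)‖ ≤ C1 * δ₁ * (C2 * ‖z‖) := fun i => by
      refine hTR V T (Ri i) D.op (isOp_translate M.op _) (Q i) δ₁ r₁ (C2 * ‖z‖) hδp hδ1 (by positivity) hr₁' (D.hV i) _ fun x => ?_
      rw [BoundedContinuousFunction.mul_apply, abs_mul]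
      have : |mi i x| ≤ C2 * exp (-(μ * ‖x - Q i‖)) := by
        simp only [hmi, tr_apply, M.m_eq]
        refine (hfw _).trans ?_
        gcongr
      calc _ ≤ (C2 * exp (-(μ * ‖x - Q i‖))) * ‖z‖ := by
            gcongr
            exact (xabs ψ x).trans hψz
        _ = _ := by ring
    have b3 : ∀ i n, ‖a i n • (YX i n - tr (Q i) (d n))‖ ≤ ‖z‖ * δ₁ := fun i n => by
      rw [norm_smul]
      gcongr
      · exact haz i n
      · refine xle hδp.le fun y => ?_
        have := D.hY i n y
        simpa [hYX, tr_apply, M.d_eq] using this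
    have b4 : ‖∑ i, (T (mi i * ψ) - Ri i (mi i * ψ))‖ ≤ ℓ * (C1 * δ₁ * (C2 * ‖z‖)) := by
      refine (norm_sum_le_of_le _ fun i _ => b2 i).trans ?_
      simp
    have b5 : ‖∑ i, ∑ n, a i n • (YX i n - tr (Q i) (d n))‖ ≤ ℓ * (N * (‖z‖ * δ₁)) := by
      refine (norm_sum_le_of_le _ (n := fun _ => N * (‖z‖ * δ₁)) fun i _ => (norm_sum_le_of_le _ fun n _ => b3 i n).trans ?_).trans ?_
      · simp
      · simp
    refine (norm_add_le _ _).trans ?_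
    have b6 := norm_sub_le (-(T ((mU - ∑ i, mi i) * ψ))) (∑ i, (T (mi i * ψ) - Ri i (mi i * ψ)))
    rw [norm_neg] at b6
    calc _ ≤ 1 / c * (δ₁ * ‖z‖) + ℓ * (C1 * δ₁ * (C2 * ‖z‖)) + ℓ * (N * (‖z‖ * δ₁)) := by linarith
      _ = (1 / c + ℓ * (C1 * C2) + ℓ * N) * δ₁ * ‖z‖ := by ring
      _ ≤ L * δ₁ * ‖z‖ := by gcongr; rw [hL]; linarith
      _ ≤ _ := by gcongr
  · -- second component
    refine (pi_norm_le_iff_of_nonneg (by positivity)).2 fun i => (pi_norm_le_iff_of_nonneg (by positivity)).2 fun n => ?_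
    have e1 : (LL T mU YX Yt z - (z - ∑ i, Jm (Q i) i (CC R m d h (Js (Q i) i z)))).2 i n
        = ∫ y, ψ y * (Yt i n y - h n (y - Q i)) := by
      have hYi := D.Yt_int g hδ1 i n
      have hhi : Integrable (fun y => h n (y - Q i)) := (M.h_int g n).comp_sub_right (Q i)
      have e2 : (∑ j, Jm (Q j) j (CC R m d h (Js (Q j) j z))).2 i n = a i n - pairX (h n) (tr (-(Q i)) ψ) := by
        rw [Prod.snd_sum, Finset.sum_apply, Finset.sum_apply]
        rw [Finset.sum_eq_single i]
        · rw [Jm_snd, Pi.single_eq_same, CC_snd]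
          rfl
        · intro j _ hj
          rw [Jm_snd, Pi.single_eq_of_ne hj.symm]
          rfl
        · simp
      have e3 : (LL T mU YX Yt z - (z - ∑ i, Jm (Q i) i (CC R m d h (Js (Q i) i z)))).2 i n
        = (LL T mU YX Yt z).2 i n - (a i n - (∑ j, Jm (Q j) j (CC R m d h (Js (Q j) j z))).2 i n) := rfl
      rw [e3, e2, sub_sub_cancel, LL_snd, pairX_apply hYi, pairX_apply (M.h_int g n)]
      have e4 : ∫ x, tr (-(Q i)) ψ x * h n x = ∫ y, ψ y * h n (y - Q i) := by
        rw [← integral_sub_right_eq_self _ (Q i)]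
        congr 1
        funext y
        simp [tr_apply]
      rw [e4, ← integral_sub (integrable_mulX hYi ψ) (integrable_mulX hhi ψ)]
      congr 1
      funext y
      ring
    rw [e1, Real.norm_eq_abs]
    refine (abs_int_le (M := ‖z‖ * δ₁) (B := fun y => exp (-(1 / 2 * ‖y - Q i‖))) (int_exp (by norm_num) _) fun y => ?_).trans ?_
    · rw [abs_mul, mul_assoc]
      gcongr
      · exact (xabs ψ y).trans hψz
      · rw [M.h_eq]
        exact D.hYt i n y
    · have e5 : ∫ y, exp (-(1 / 2 * ‖y - Q i‖)) = I := by
        rw [hI]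
        simp_rw [sub_zero]
        exact integral_sub_right_eq_self (fun y : Euc N => exp (-(1 / 2 * ‖y‖))) (Q i)
      rw [e5]
      calc _ = I * δ₁ * ‖z‖ := by ring
        _ ≤ L * δ₁ * ‖z‖ := by
          gcongr
          have : 0 ≤ 1 / c + ℓ * (C1 * C2) + ℓ * N := by positivity
          rw [hL]; linarith
        _ ≤ _ := by gcongr
end gs
end LS

namespace LS
open scoped ContDiff BoundedContinuousFunction
variable {N ℓ : ℕ}

lemma exists_fX {f : ℝ → ℝ} (hf : Continuous f) (v : XX N) : ∃ F : XX N, ∀ y, F y = f (v y) := by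
  obtain ⟨B, hB⟩ := (isCompact_Icc (a := -‖v‖) (b := ‖v‖)).exists_bound_of_continuousOn hf.continuousOn
  exact ⟨mkX (fun y => f (v y)) (hf.comp v.continuous) B fun y => hB _ (abs_le.1 (xabs v y)), fun y => rfl⟩

/-- a fixed point in a ball -/
lemma fixed_ball {E : Type*} [NormedAddCommGroup E] [CompleteSpace E] (Φ : E → E) {ρ : ℝ} (hρ : 0 ≤ ρ)
    (h1 : ∀ z, ‖z‖ ≤ ρ → ‖Φ z‖ ≤ ρ)
    (h2 : ∀ z z', ‖z‖ ≤ ρ → ‖z'‖ ≤ ρ → ‖Φ z - Φ z'‖ ≤ 1 / 2 * ‖z - z'‖) : ∃ z, ‖z‖ ≤ ρ ∧ Φ z = z := by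
  have hm : MapsTo Φ (Metric.closedBall 0 ρ) (Metric.closedBall 0 ρ) := fun z hz => by
    rw [mem_closedBall_zero_iff] at hz ⊢
    exact h1 z hz
  have hcn : ContractingWith (1 / 2) (hm.restrict Φ _ _) := by
    refine ⟨by rw [← NNReal.coe_lt_coe]; norm_num, LipschitzWith.of_dist_le_mul fun z z' => ?_⟩
    have := h2 z z' (mem_closedBall_zero_iff.1 z.2) (mem_closedBall_zero_iff.1 z'.2)
    rw [Subtype.dist_eq, Subtype.dist_eq, dist_eq_norm, dist_eq_norm]
    simpa using this
  obtain ⟨y, hy, hf, -⟩ := hcn.exists_fixedPoint' (Metric.isClosed_closedBall.isComplete) hm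
    (Metric.mem_closedBall_self hρ) (edist_ne_top _ _)
  exact ⟨y, mem_closedBall_zero_iff.1 hy, hf⟩

section gs
variable {f : ℝ → ℝ} {σ A : ℝ} {w : Euc N → ℝ}
variable {R : XX N →L[ℝ] XX N} {m : XX N} {d h : Fin N → XX N}

lemma Mod.core (g : GS N f σ A w) (M : Mod f w R m d h) (ℓ : ℕ) {c CU : ℝ} (hc : 0 < c) (hCU : 0 < CU) :
    ∃ δ₁ > 0, δ₁ ≤ 1 ∧ ∃ r₁ > 0, ∃ D₁ : ℝ, ∃ K > 0, ∃ κ₁ > 0, ∀ (V : Euc N → ℝ) (T : XX N →L[ℝ] XX N)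
      (Q : Fin ℓ → Euc N) (U : Euc N → ℝ) (Y Yt : Fin ℓ → Fin N → Euc N → ℝ) (κ : ℝ),
      Apx f w c CU δ₁ r₁ V T Q U Y Yt → (∀ i j, i ≠ j → D₁ ≤ ‖Q i - Q j‖) → κ ≤ κ₁ →
      (∀ y, |lap U y - V y * U y + f (U y)| ≤ κ) →
      ∃ (ψ : XX N) (a : Fin ℓ → Fin N → ℝ), ContDiff ℝ 2 ψ ∧ ‖ψ‖ ≤ 1 ∧ ‖ψ‖ ≤ K * κ ∧ (∀ i n, |a i n| ≤ K * κ) ∧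
        (∀ i n, ∫ y, ψ y * Yt i n y = 0) ∧
        ∀ y, lap (fun y => U y + ψ y) y - V y * (U y + ψ y) + f (U y + ψ y) = ∑ i, ∑ n, a i n * Yt i n y := by
  have hσ0 := g.σ0
  obtain ⟨δ₁, hδ₁, hδ1, r₁, hr₁, D₁, K, hK, hlin⟩ := M.linear g ℓ hc
  obtain ⟨C, hC, hfh, -, -, -⟩ := g.fb (CU + 1) (by positivity)
  obtain ⟨CY, hCY, hYb⟩ := Apx.Yt_bound g
  set ρ₁ := min 1 ((c / (2 * K * C)) ^ (1 / σ)) with hρ₁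
  have hρ₁p : 0 < ρ₁ := by positivity
  have hρ₁1 : ρ₁ ≤ 1 := min_le_left _ _
  have hρ₁σ : K * (C * ρ₁ ^ σ / c) ≤ 1 / 2 := by
    have h1 : ρ₁ ^ σ ≤ ((c / (2 * K * C)) ^ (1 / σ)) ^ σ := by
      gcongr
      exact min_le_right _ _
    rw [← rpow_mul (by positivity), one_div_mul_cancel hσ0.ne', rpow_one] at h1
    calc _ ≤ K * (C * (c / (2 * K * C)) / c) := by gcongr
      _ = 1 / 2 := by field_simp
  refine ⟨δ₁, hδ₁, hδ1, r₁, hr₁, D₁, 2 * K / c, by positivity, ρ₁ * c / (2 * K), by positivity,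
    fun V T Q U Y Yt κ D hQ hκ hE => ?_⟩
  have hκ0 : 0 ≤ κ := (abs_nonneg _).trans (hE 0)
  set ρ := 2 * K / c * κ with hρ
  have hρ0 : 0 ≤ ρ := by positivity
  have hρle : ρ ≤ ρ₁ := by
    calc _ ≤ 2 * K / c * (ρ₁ * c / (2 * K)) := by rw [hρ]; gcongr
      _ = ρ₁ := by field_simp
  have hρ1 : ρ ≤ 1 := hρle.trans hρ₁1
  have hfc : Continuous f := g.C1.continuous
  have hU0 : Continuous U := D.U2.continuous
  set UX : XX N := mkX U hU0 CU D.Ub with hUX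
  have hUXa : ∀ y, UX y = U y := fun y => rfl
  obtain ⟨mU, hmU⟩ := exists_fX g.f'c UX
  set YX : Fin ℓ → Fin N → XX N := fun i n => mkX (Y i n) (D.Y2 i n).continuous CY ((hYb hδ1 D).2 i n) with hYX
  choose fX hfX using fun v : XX N => exists_fX hfc v
  set EX : XX N := mkX (fun y => lap U y - V y * U y + f (U y))
    (((continuous_lap D.U2).sub (D.op.2.2.1.continuous.mul hU0)).add (hfc.comp hU0)) κ hE with hEX
  have hEXa : ∀ y, EX y = lap U y - V y * U y + f (U y) := fun y => rfl
  have hEXn : ‖EX‖ ≤ κ := xle hκ0 hE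
  obtain ⟨G, hG⟩ := hlin CU V T Q U Y Yt mU YX D hQ hmU (fun i n y => rfl)
  set NN : XX N → XX N := fun ψ => fX (UX + ψ) - fX UX - mU * ψ with hNN
  have hNNa : ∀ ψ y, NN ψ y = f (U y + ψ y) - f (U y) - deriv f (U y) * ψ y := fun ψ y => by
    have := hmU y
    simp only [hNN, BoundedContinuousFunction.sub_apply, BoundedContinuousFunction.mul_apply, hfX, hmU,
      BoundedContinuousFunction.add_apply, hUXa]
  have hNL : ∀ ψ ψ' : XX N, ‖ψ‖ ≤ ρ → ‖ψ'‖ ≤ ρ → ‖NN ψ - NN ψ'‖ ≤ C * ρ₁ ^ σ * ‖ψ - ψ'‖ := fun ψ ψ' h1 h2 => by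
    refine xle (by positivity) fun y => ?_
    rw [BoundedContinuousFunction.sub_apply, hNNa, hNNa]
    have b1 := abs_le.1 ((xabs ψ y).trans h1)
    have b2 := abs_le.1 ((xabs ψ' y).trans h2)
    have b3 := abs_le.1 (D.Ub y)
    have hm := mv (f := f) g.fd (a := U y + ψ' y) (b := U y + ψ y) (m := deriv f (U y)) (K := C * ρ₁ ^ σ) (by
      intro x hx
      have hx1 : |x - U y| ≤ ρ := by
        rcases mem_uIcc.1 hx with hx | hx <;> exact abs_le.2 ⟨by linarith [hx.1, hx.2], by linarith [hx.1, hx.2]⟩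
      have hx2 := abs_le.1 hx1
      refine (hfh x (U y) (abs_le.2 ⟨by linarith, by linarith⟩) (abs_le.2 ⟨by linarith, by linarith⟩)).trans ?_
      gcongr
      exact hx1.trans hρle)
    have e1 : U y + ψ y - (U y + ψ' y) = ψ y - ψ' y := by ring
    rw [e1] at hm
    have e2 : f (U y + ψ y) - f (U y) - deriv f (U y) * ψ y - (f (U y + ψ' y) - f (U y) - deriv f (U y) * ψ' y)
      = f (U y + ψ y) - f (U y + ψ' y) - deriv f (U y) * (ψ y - ψ' y) := by ring
    rw [e2]
    refine hm.trans ?_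
    gcongr
    exact xabs_sub ψ ψ' y
  have hN0 : NN 0 = 0 := by
    ext y
    rw [hNNa]
    simp
  set Φ : Zs N ℓ → Zs N ℓ := fun z => G (T (EX + NN z.1), 0) with hΦ
  have hpair : ∀ u : XX N, ‖G (T u, 0)‖ ≤ K * (‖u‖ / c) := fun u => by
    refine (hG _).2.trans ?_
    gcongr
    refine max_le (D.op.norm_le u) ?_
    simp only [norm_zero]
    positivity
  obtain ⟨z, hz, hzf⟩ := fixed_ball Φ hρ0 (fun z hz => by
      have hz1 : ‖z.1‖ ≤ ρ := (norm_fst_le z).trans hz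
      have h1 := hNL z.1 0 hz1 (by rw [norm_zero]; exact hρ0)
      rw [hN0, sub_zero, sub_zero] at h1
      have h2 : ‖EX + NN z.1‖ ≤ κ + C * ρ₁ ^ σ * ρ := (norm_add_le _ _).trans
        (add_le_add hEXn (h1.trans (by gcongr)))
      calc _ ≤ K * ((κ + C * ρ₁ ^ σ * ρ) / c) := (hpair _).trans (by gcongr)
        _ = K * κ / c + (K * (C * ρ₁ ^ σ / c)) * ρ := by ring
        _ ≤ K * κ / c + 1 / 2 * ρ := by gcongr
        _ = ρ := by rw [hρ]; ring)
    (fun z z' hz hz' => by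
      have hz1 : ‖z.1‖ ≤ ρ := (norm_fst_le z).trans hz
      have hz1' : ‖z'.1‖ ≤ ρ := (norm_fst_le z').trans hz'
      have h1 := hNL z.1 z'.1 hz1 hz1'
      have e : Φ z - Φ z' = G (T (NN z.1 - NN z'.1), 0) := by
        simp only [hΦ]
        rw [← map_sub]
        congr 1
        refine Prod.ext ?_ ?_
        · simp only [Prod.fst_sub, map_add, map_sub]; abel
        · simp
      rw [e]
      calc _ ≤ K * ((C * ρ₁ ^ σ * ‖z - z'‖) / c) := (hpair _).trans (by
            gcongr
            refine h1.trans ?_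
            gcongr
            exact norm_fst_le (z - z'))
        _ = (K * (C * ρ₁ ^ σ / c)) * ‖z - z'‖ := by ring
        _ ≤ _ := by gcongr)
  have hLz : LL T mU YX Yt z = (T (EX + NN z.1), 0) := by
    conv_lhs => rw [← hzf]
    exact (hG _).1
  obtain ⟨ψ, a⟩ := z
  have hLz1 : ψ - T (mU * ψ) + ∑ i, ∑ n, a i n • YX i n = T (EX + NN ψ) := by
    have := congrArg Prod.fst hLz
    rwa [LL_fst] at this
  have hLz2 : ∀ i n, ∫ y, ψ y * Yt i n y = 0 := fun i n => by
    have : (LL T mU YX Yt (ψ, a)).2 i n = 0 := by rw [hLz]; rfl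
    rwa [LL_snd, pairX_apply (D.Yt_int g hδ1 i n)] at this
  have hUT : T (fX UX - EX) = UX := by
    refine D.op.eq_of_sol ⟨D.U2, ⟨CU, D.Ub⟩, fun x => ?_⟩
    rw [BoundedContinuousFunction.sub_apply, hfX, hEXa]
    change -lap U x + V x * U x = f (U x) - _
    ring
  set v := UX + ψ with hv
  have hvT : v + ∑ i, ∑ n, a i n • YX i n = T (fX v) := by
    have e : fX v = (fX UX - EX) + mU * ψ + (EX + NN ψ) := by
      simp only [hNN, hv]; abel
    rw [e, map_add, map_add, hUT, ← hLz1]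
    simp only [hv]; abel
  set S : Euc N → ℝ := fun y => ∑ i, ∑ n, a i n * Y i n y with hS
  have hSin : ∀ i, ContDiff ℝ 2 (fun y => ∑ n, a i n * Y i n y) := fun i =>
    ContDiff.sum fun n _ => contDiff_const.mul (D.Y2 i n)
  have hS2 : ContDiff ℝ 2 S := ContDiff.sum fun i _ => hSin i
  have hva : ∀ y, v y = T (fX v) y - S y := fun y => by
    have h0 : T (fX v) y = v y + (∑ i, ∑ n, a i n • YX i n) y := by
      rw [← hvT]; rfl
    have : (∑ i, ∑ n, a i n • YX i n) y = S y := by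
      simp [hS, hYX, mkX_apply]
    rw [h0, this]; ring
  have hv1 : ContDiff ℝ 1 v := by
    rw [show (v : Euc N → ℝ) = fun y => T (fX v) y - S y from funext hva]
    exact (D.op.c1 _).sub (c21 hS2)
  have hfv1 : ContDiff ℝ 1 (fX v) := by
    rw [show (fX v : Euc N → ℝ) = fun y => f (v y) from funext (hfX v)]
    exact g.C1.comp hv1
  obtain ⟨s2, -, se⟩ := D.op.2.2.2 _ hfv1
  have hv2 : ContDiff ℝ 2 v := by
    rw [show (v : Euc N → ℝ) = fun y => T (fX v) y - S y from funext hva]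
    exact s2.sub hS2
  have hψ2 : ContDiff ℝ 2 ψ := by
    have : (ψ : Euc N → ℝ) = fun y => v y - U y := by
      funext y
      change ψ y = U y + ψ y - U y
      ring
    rw [this]; exact hv2.sub D.U2
  refine ⟨ψ, a, hψ2, ((norm_fst_le _).trans hz).trans hρ1, (norm_fst_le _).trans hz, fun i n => ?_, hLz2, fun y => ?_⟩
  · exact (((norm_le_pi_norm (a i) n).trans (norm_le_pi_norm a i)).trans (norm_snd_le (ψ, a))).trans hz
  · change lap (v : Euc N → ℝ) y - V y * v y + f (v y) = _
    have e1 : lap (v : Euc N → ℝ) y = lap (T (fX v)) y - lap S y := by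
      conv_lhs => rw [show (v : Euc N → ℝ) = fun y => T (fX v) y - S y from funext hva]
      exact lap_sub s2 hS2 y
    have e2 : lap S y = ∑ i, ∑ n, a i n * lap (Y i n) y := by
      rw [hS, lap_sum Finset.univ (u := fun i y => ∑ n, a i n * Y i n y) (fun i => hSin i)]
      refine Finset.sum_congr rfl fun i _ => ?_
      rw [lap_sum Finset.univ (u := fun n y => a i n * Y i n y) (fun n => contDiff_const.mul (D.Y2 i n))]
      exact Finset.sum_congr rfl fun n _ => lap_cmul (D.Y2 i n) _ y
    have e3 : ∑ i, ∑ n, a i n * Yt i n y = V y * S y - lap S y := by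
      rw [e2, hS, Finset.mul_sum, ← Finset.sum_sub_distrib]
      refine Finset.sum_congr rfl fun i _ => ?_
      rw [Finset.mul_sum, ← Finset.sum_sub_distrib]
      refine Finset.sum_congr rfl fun n _ => ?_
      rw [D.Yt_eq]; ring
    have e4 := se y
    rw [hfX] at e4
    rw [e3, e1]
    have e5 := hva y
    have e6 : V y * v y = V y * T (fX v) y - V y * S y := by rw [e5]; ring
    rw [e6]
    linarith
end gs
end LS

namespace LS
open scoped ContDiff BoundedContinuousFunction
variable {N ℓ : ℕ}

lemma V_taylor {V : Euc N → ℝ} (hV : ContDiff ℝ 2 V) (hV0 : V 0 = 1) (hV1 : fderiv ℝ V 0 = 0) :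
    ∃ C > 0, ∀ x, ‖x‖ ≤ 1 → |V x - 1| ≤ C * ‖x‖ ^ 2 := by
  have key1 : ∀ n : Fin N, ∃ C, 0 ≤ C ∧ ∀ x, ‖x‖ ≤ 1 → |pd n V x| ≤ C * ‖x‖ := fun n => by
    have h1 := c1_pd hV n
    have hc : Continuous fun x => ∑ m, |pd m (pd n V) x| :=
      continuous_finsetSum _ fun m _ => (c0_pd h1 m).abs
    obtain ⟨C, hC⟩ := (isCompact_closedBall (0 : Euc N) 1).exists_bound_of_continuousOn hc.continuousOn
    refine ⟨C, (norm_nonneg _).trans (hC 0 (Metric.mem_closedBall_self zero_le_one)), fun x hx => ?_⟩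
    have := (convex_closedBall (0 : Euc N) 1).norm_image_sub_le_of_norm_fderiv_le (𝕜 := ℝ) (f := pd n V) (C := C)
      (fun y _ => dif1 h1 y) (fun y hy => (norm_fderiv_le _ _).trans ((le_abs_self _).trans (hC y hy)))
      (Metric.mem_closedBall_self zero_le_one) (mem_closedBall_zero_iff.2 hx)
    have h0 : pd n V 0 = 0 := by unfold pd; rw [hV1]; rfl
    rwa [h0, sub_zero, sub_zero] at this
  choose CC hCC0 hCC using key1
  set C := ∑ n, CC n with hCdef
  have hC0 : 0 ≤ C := Finset.sum_nonneg fun n _ => hCC0 n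
  have key : ∀ x, ‖x‖ ≤ 1 → ‖fderiv ℝ V x‖ ≤ C * ‖x‖ := fun x hx => by
    refine (norm_fderiv_le _ _).trans ?_
    rw [hCdef, Finset.sum_mul]
    exact Finset.sum_le_sum fun n _ => hCC n x hx
  refine ⟨|C| + 1, by positivity, fun x hx => ?_⟩
  have hd := dif2 hV
  have := (convex_closedBall (0 : Euc N) ‖x‖).norm_image_sub_le_of_norm_fderiv_le (f := V) (C := C * ‖x‖)
      (fun y _ => hd y) (fun y hy => by
        rw [mem_closedBall_zero_iff] at hy
        exact (key y (hy.trans hx)).trans (by gcongr))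
      (Metric.mem_closedBall_self (norm_nonneg x)) (mem_closedBall_zero_iff.2 le_rfl)
  rw [hV0, sub_zero, Real.norm_eq_abs] at this
  refine this.trans ?_
  rw [mul_assoc, ← sq]
  gcongr
  linarith [le_abs_self C]

lemma P_small {lam : Fin N → ℝ} (hlam : ∀ n, lam n ≠ 0) :
    ∃ C > 0, ∀ (ε β : ℝ) (P : Euc N), 0 < ε → ∑ n, |lam n| * (P n) ^ 2 < ε ^ (2 * β) → ‖P‖ ≤ C * ε ^ β := by
  refine ⟨1 + ∑ n, 1 / |lam n|, by positivity, fun ε β P hε h => ?_⟩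
  have h1 : ‖P‖ ^ 2 ≤ (∑ n, 1 / |lam n|) * ε ^ (2 * β) := by
    rw [EuclideanSpace.norm_sq_eq, Finset.sum_mul]
    refine Finset.sum_le_sum fun n _ => ?_
    have h2 : |lam n| * (P n) ^ 2 ≤ ∑ n, |lam n| * (P n) ^ 2 :=
      Finset.single_le_sum (f := fun n => |lam n| * (P n) ^ 2) (fun i _ => by positivity) (Finset.mem_univ n)
    have h3 := abs_pos.2 (hlam n)
    rw [Real.norm_eq_abs, sq_abs, one_div, ← div_eq_inv_mul, le_div_iff₀ h3]
    linarith
  have h2 : ε ^ (2 * β) = (ε ^ β) ^ 2 := by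
    rw [mul_comm, rpow_mul hε.le]; norm_num
  rw [h2] at h1
  have hS : 0 ≤ ∑ n, 1 / |lam n| := by positivity
  refine abs_le_of_sq_le_sq' (a := ‖P‖) (b := _) ?_ (by positivity) |>.2
  rw [mul_pow]
  refine h1.trans ?_
  gcongr
  nlinarith

lemma exp_half_sq {s : ℝ} (hs : 0 ≤ s) : s ^ 2 * exp (-(1 / 2 * s)) ≤ 8 := by
  have := quadratic_le_exp_of_nonneg (x := 1 / 2 * s) (by positivity)
  rw [exp_neg, ← div_eq_mul_inv, div_le_iff₀ (exp_pos _)]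
  nlinarith

/-- rewriting `exp (-s)` as a square -/
lemma exp_split (s : ℝ) : exp (-s) = exp (-(1 / 2 * s)) * exp (-(1 / 2 * s)) := by
  rw [← exp_add]; congr 1; ring

lemma eps_le {ε β : ℝ} (h0 : 0 < ε) (h1 : ε ≤ 1) (hβ : β ≤ 1) : ε ≤ ε ^ β := by
  conv_lhs => rw [← rpow_one ε]
  exact rpow_le_rpow_of_exponent_ge h0 h1 hβ

lemma eps_sq {ε β : ℝ} (h0 : 0 < ε) : ε ^ (2 * β) = (ε ^ β) ^ 2 := by
  rw [mul_comm, rpow_mul h0.le]; norm_num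

lemma near_est {V : Euc N → ℝ} {C₁ CP : ℝ} (hC₁ : 0 < C₁) (hCP : 0 < CP)
    (hV : ∀ x, ‖x‖ ≤ 1 → |V x - 1| ≤ C₁ * ‖x‖ ^ 2) {ε β : ℝ} (h0 : 0 < ε) (h1 : ε ≤ 1) (hβ : β ≤ 1)
    {Q y : Euc N} (hQ : ‖ε • Q‖ ≤ CP * ε ^ β) (hy : ‖ε • y‖ < 1) :
    |V (ε • y) - 1| * exp (-‖y - Q‖) ≤ C₁ * (16 + 2 * CP ^ 2) * ε ^ (2 * β) * exp (-(1 / 2 * ‖y - Q‖)) := by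
  set s := ‖y - Q‖ with hs
  have hs0 : 0 ≤ s := norm_nonneg _
  have e1 : ‖ε • y‖ ≤ ε ^ β * (s + CP) := by
    have : ε • y = ε • (y - Q) + ε • Q := by rw [← smul_add, sub_add_cancel]
    rw [this]
    refine (norm_add_le _ _).trans ?_
    rw [norm_smul, Real.norm_eq_abs, abs_of_pos h0, mul_add]
    have := eps_le h0 h1 hβ
    gcongr
    linarith
  have e2 : |V (ε • y) - 1| ≤ C₁ * (ε ^ (2 * β) * (s + CP) ^ 2) := by
    refine (hV _ hy.le).trans ?_
    rw [eps_sq h0, ← mul_pow]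
    gcongr
  have e3 : (s + CP) ^ 2 * exp (-(1 / 2 * s)) ≤ 16 + 2 * CP ^ 2 := by
    have := exp_half_sq hs0
    have h5 : exp (-(1 / 2 * s)) ≤ 1 := exp_le_one_iff.2 (by linarith)
    have h6 := exp_pos (-(1 / 2 * s))
    have h7 : (s + CP) ^ 2 ≤ 2 * s ^ 2 + 2 * CP ^ 2 := by nlinarith [sq_nonneg (s - CP)]
    calc _ ≤ (2 * s ^ 2 + 2 * CP ^ 2) * exp (-(1 / 2 * s)) := by gcongr
      _ = 2 * (s ^ 2 * exp (-(1 / 2 * s))) + 2 * CP ^ 2 * exp (-(1 / 2 * s)) := by ring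
      _ ≤ 2 * 8 + 2 * CP ^ 2 * 1 := by gcongr
      _ = _ := by ring
  rw [exp_split]
  calc _ ≤ C₁ * (ε ^ (2 * β) * (s + CP) ^ 2) * (exp (-(1 / 2 * s)) * exp (-(1 / 2 * s))) := by gcongr
    _ = C₁ * ((s + CP) ^ 2 * exp (-(1 / 2 * s))) * ε ^ (2 * β) * exp (-(1 / 2 * s)) := by ring
    _ ≤ _ := by gcongr

lemma far_est {CP : ℝ} {ε β : ℝ} (h0 : 0 < ε) (h1 : ε ≤ 1) (hβ : β ≤ 1)
    {Q y : Euc N} (hQ : ‖ε • Q‖ ≤ CP * ε ^ β) (hCP : CP * ε ^ β ≤ 1 / 2) (hy : 1 ≤ ‖ε • y‖) :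
    exp (-‖y - Q‖) ≤ 32 * ε ^ (2 * β) * exp (-(1 / 2 * ‖y - Q‖)) := by
  set s := ‖y - Q‖ with hs
  have e1 : 1 / 2 ≤ ε * s := by
    have : ε • y = ε • (y - Q) + ε • Q := by rw [← smul_add, sub_add_cancel]
    rw [this] at hy
    have := hy.trans (norm_add_le _ _)
    rw [norm_smul, Real.norm_eq_abs, abs_of_pos h0] at this
    linarith
  have hs0 : 0 ≤ s := norm_nonneg _
  have e2 := exp_half_sq hs0
  have e3 : exp (-(1 / 2 * s)) ≤ 32 * ε ^ 2 := by
    have h6 := exp_pos (-(1 / 2 * s))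
    have h8 : 1 / 4 ≤ (ε * s) ^ 2 := by nlinarith
    calc exp (-(1 / 2 * s)) ≤ 4 * (ε * s) ^ 2 * exp (-(1 / 2 * s)) := by nlinarith
      _ = 4 * ε ^ 2 * (s ^ 2 * exp (-(1 / 2 * s))) := by ring
      _ ≤ 4 * ε ^ 2 * 8 := by gcongr
      _ = _ := by ring
  have e4 : ε ^ 2 ≤ ε ^ (2 * β) := by
    rw [eps_sq h0]; gcongr; exact eps_le h0 h1 hβ
  rw [exp_split]
  gcongr
  linarith

lemma aff_sub (Q : Euc N) {u : Euc N → ℝ} : (fun y => u (y - Q)) = fun y => u ((1 : ℝ) • y + -Q) := by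
  simp [sub_eq_add_neg]

lemma aff_smul (ε : ℝ) {u : Euc N → ℝ} : (fun y => u (ε • y)) = fun y => u (ε • y + 0) := by simp

lemma c_shift {k : WithTop ℕ∞} {u : Euc N → ℝ} (hu : ContDiff ℝ k u) (Q : Euc N) :
    ContDiff ℝ k (fun y => u (y - Q)) := by
  rw [aff_sub]; exact contDiff_aff hu _ _
lemma c_smul {k : WithTop ℕ∞} {u : Euc N → ℝ} (hu : ContDiff ℝ k u) (ε : ℝ) :
    ContDiff ℝ k (fun y => u (ε • y)) := by
  rw [aff_smul]; exact contDiff_aff hu _ _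
lemma pd_shift {u : Euc N → ℝ} (hu : Differentiable ℝ u) (Q : Euc N) (n : Fin N) :
    pd n (fun y => u (y - Q)) = fun y => pd n u (y - Q) := by
  rw [aff_sub, pd_comp_aff hu]; simp [sub_eq_add_neg]
lemma pd_smul {u : Euc N → ℝ} (hu : Differentiable ℝ u) (ε : ℝ) (n : Fin N) :
    pd n (fun y => u (ε • y)) = fun y => ε * pd n u (ε • y) := by
  rw [aff_smul, pd_comp_aff hu]; simp
lemma lap_shift {u : Euc N → ℝ} (hu : ContDiff ℝ 2 u) (Q y : Euc N) :
    lap (fun y => u (y - Q)) y = lap u (y - Q) := by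
  rw [aff_sub, lap_aff hu]; simp [sub_eq_add_neg]
lemma lap_smul {u : Euc N → ℝ} (hu : ContDiff ℝ 2 u) (ε : ℝ) (y : Euc N) :
    lap (fun y => u (ε • y)) y = ε ^ 2 * lap u (ε • y) := by
  rw [aff_smul, lap_aff hu]; simp

lemma pd_evEq {u v : Euc N → ℝ} {x : Euc N} (h : u =ᶠ[nhds x] v) (n : Fin N) : pd n u =ᶠ[nhds x] pd n v := by
  filter_upwards [h.fderiv (𝕜 := ℝ)] with y hy
  simp only [pd, hy]

lemma lap_evEq {u v : Euc N → ℝ} (hu : ContDiff ℝ 2 u) (hv : ContDiff ℝ 2 v) {x : Euc N}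
    (h : u =ᶠ[nhds x] v) : lap u x = lap v x := by
  rw [lap_eq hu, lap_eq hv]
  exact Finset.sum_congr rfl fun n _ => (pd_evEq (pd_evEq h n) n).eq_of_nhds

lemma bdd_of_compact {u : Euc N → ℝ} (hu : Continuous u) (hs : HasCompactSupport u) : ∃ C > 0, ∀ x, |u x| ≤ C := by
  obtain ⟨C, hC⟩ := hs.exists_bound_of_continuous hu
  exact ⟨|C| + 1, by positivity, fun x => ((hC x).trans (le_abs_self C)).trans (by linarith)⟩

/-- crude bounds for a cut-off times a decaying function -/
lemma prod_bound {V a v : Euc N → ℝ} (hVc : Continuous V) (ha : ContDiff ℝ 2 a) (hs : HasCompactSupport a)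
    (hv : ContDiff ℝ 2 v) {Cv : ℝ} (hCv : 0 < Cv) (v0 : ∀ x, |v x| ≤ Cv * exp (-‖x‖))
    (v1 : ∀ n x, |pd n v x| ≤ Cv * exp (-‖x‖)) (v2 : ∀ x, |lap v x| ≤ Cv * exp (-‖x‖)) :
    ∃ C > 0, ∀ (ε : ℝ) (Q y : Euc N), 0 < ε → ε ≤ 1 →
      |a (ε • y) * v (y - Q)| ≤ C * exp (-‖y - Q‖) ∧
      |V (ε • y) * (a (ε • y) * v (y - Q))| ≤ C * exp (-‖y - Q‖) ∧
      |lap (fun y => a (ε • y) * v (y - Q)) y| ≤ C * exp (-‖y - Q‖) := by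
  obtain ⟨A0, hA0, h0⟩ := bdd_of_compact ha.continuous hs
  obtain ⟨A1, hA1, h1⟩ := bdd_of_compact (hVc.mul ha.continuous) (hs.mul_left (f := V))
  have hlc : HasCompactSupport (lap a) := by
    rw [show lap a = fun x => ∑ n, pd n (pd n a) x from funext fun x => lap_eq ha x]
    refine HasCompactSupport.of_support_subset_isCompact hs.isCompact ?_
    intro x hx
    obtain ⟨n, -, hn⟩ := Finset.exists_ne_zero_of_sum_ne_zero hx
    by_contra hx'
    apply hn
    have e : a =ᶠ[nhds x] fun _ => 0 := notMem_tsupport_iff_eventuallyEq.1 hx'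
    have := (pd_evEq (pd_evEq e n) n).eq_of_nhds
    rw [this, pd_const, pd_const]
  obtain ⟨A2, hA2, h2⟩ := bdd_of_compact (continuous_lap ha) hlc
  choose A3 hA3 h3 using fun n => bdd_of_compact (c0_pd (c21 ha) n) (pd_compact hs n)
  refine ⟨A0 * Cv + A1 * Cv + (A0 * Cv + 2 * ∑ n, A3 n * Cv + A2 * Cv), ?_, fun ε Q y e0 e1 => ?_⟩
  · have : 0 ≤ ∑ n, A3 n * Cv := Finset.sum_nonneg fun n _ => (mul_pos (hA3 n) hCv).le
    positivity
  set E := exp (-‖y - Q‖) with hE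
  have hEp : 0 < E := exp_pos _
  have hS0 : 0 ≤ ∑ n, A3 n * Cv := Finset.sum_nonneg fun n _ => (mul_pos (hA3 n) hCv).le
  have b0 : |a (ε • y) * v (y - Q)| ≤ A0 * Cv * E := by
    rw [abs_mul, mul_assoc]; exact mul_le_mul (h0 _) (v0 _) (abs_nonneg _) hA0.le
  have b1 : |V (ε • y) * (a (ε • y) * v (y - Q))| ≤ A1 * Cv * E := by
    rw [← mul_assoc, abs_mul, mul_assoc]; exact mul_le_mul (h1 _) (v0 _) (abs_nonneg _) hA1.le
  have b2 : |lap (fun y => a (ε • y) * v (y - Q)) y| ≤ (A0 * Cv + 2 * ∑ n, A3 n * Cv + A2 * Cv) * E := by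
    rw [lap_mul (c_smul ha ε) (c_shift hv Q), lap_shift hv, lap_smul ha]
    simp only [pd_smul (dif2 ha), pd_shift (dif2 hv)]
    have t1 : |a (ε • y) * lap v (y - Q)| ≤ A0 * Cv * E := by
      rw [abs_mul, mul_assoc]; exact mul_le_mul (h0 _) (v2 _) (abs_nonneg _) hA0.le
    have t3 : |ε ^ 2 * lap a (ε • y) * v (y - Q)| ≤ A2 * Cv * E := by
      rw [abs_mul, abs_mul, abs_of_nonneg (by positivity : 0 ≤ ε ^ 2), mul_assoc A2]
      refine mul_le_mul ?_ (v0 _) (abs_nonneg _) hA2.le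
      calc _ ≤ 1 * A2 := mul_le_mul (by nlinarith) (h2 _) (abs_nonneg _) (by norm_num)
        _ = A2 := one_mul _
    have t2 : |∑ n, ε * pd n a (ε • y) * pd n v (y - Q)| ≤ (∑ n, A3 n * Cv) * E := by
      rw [Finset.sum_mul]
      refine (Finset.abs_sum_le_sum_abs _ _).trans (Finset.sum_le_sum fun n _ => ?_)
      rw [abs_mul, abs_mul, abs_of_pos e0, mul_assoc (A3 n)]
      refine mul_le_mul ?_ (v1 _ _) (abs_nonneg _) (hA3 n).le
      calc _ ≤ 1 * A3 n := mul_le_mul e1 (h3 _ _) (abs_nonneg _) (by norm_num)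
        _ = A3 n := one_mul _
    have := abs_add_le (a (ε • y) * lap v (y - Q) + 2 * ∑ n, ε * pd n a (ε • y) * pd n v (y - Q)) (ε ^ 2 * lap a (ε • y) * v (y - Q))
    have h' := abs_add_le (a (ε • y) * lap v (y - Q)) (2 * ∑ n, ε * pd n a (ε • y) * pd n v (y - Q))
    rw [abs_mul 2, abs_two] at h'
    linarith
  have p1 : 0 ≤ A0 * Cv * E := by positivity
  have p2 : 0 ≤ A1 * Cv * E := by positivity
  have p3 : 0 ≤ (A0 * Cv + 2 * ∑ n, A3 n * Cv + A2 * Cv) * E := by positivity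
  refine ⟨?_, ?_, ?_⟩ <;> linarith

end LS

namespace LS
open scoped ContDiff BoundedContinuousFunction
variable {N ℓ : ℕ}

/-- a single (cut off) peak -/
noncomputable def Ff (χ w : Euc N → ℝ) (ε : ℝ) (Q : Euc N) (y : Euc N) : ℝ := χ (ε • y) * w (y - Q)
noncomputable def Yf (χ w : Euc N → ℝ) (ε : ℝ) (Q : Euc N) (n : Fin N) : Euc N → ℝ := pd n (Ff χ w ε Q)
noncomputable def Ytf (V χ w : Euc N → ℝ) (ε : ℝ) (Q : Euc N) (n : Fin N) (y : Euc N) : ℝ :=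
  V (ε • y) * Yf χ w ε Q n y - lap (Yf χ w ε Q n) y
noncomputable def Uf (χ w : Euc N → ℝ) (τ : Fin ℓ → ℝ) (ε : ℝ) (Q : Fin ℓ → Euc N) (y : Euc N) : ℝ :=
  ∑ i, τ i * Ff χ w ε (Q i) y

section gs
variable {f : ℝ → ℝ} {σ A : ℝ} {w : Euc N → ℝ} {χ V : Euc N → ℝ}

lemma Ff_c2 (g : GS N f σ A w) (hχ : ContDiff ℝ ∞ χ) (ε : ℝ) (Q : Euc N) : ContDiff ℝ 2 (Ff χ w ε Q) :=
  (c_smul (hχ.of_le two_le_inf) ε).mul (c_shift g.C2 Q)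

lemma Yf_eq (g : GS N f σ A w) (hχ : ContDiff ℝ ∞ χ) (ε : ℝ) (Q : Euc N) (n : Fin N) :
    Yf χ w ε Q n = fun y => χ (ε • y) * pd n w (y - Q) + ε * (pd n χ (ε • y) * w (y - Q)) := by
  have h2 : ContDiff ℝ 2 χ := hχ.of_le two_le_inf
  unfold Yf Ff
  rw [pd_mul (dif2 (c_smul h2 ε)) (dif2 (c_shift g.C2 Q)), pd_shift (dif2 g.C2), pd_smul (dif2 h2)]
  funext y; ring

lemma pdχ_c2 (hχ : ContDiff ℝ ∞ χ) (n : Fin N) : ContDiff ℝ 2 (pd n χ) :=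
  contDiff_pd hχ (by
    rw [show ((2 : WithTop ℕ∞) + 1) = ((3 : ℕ∞) : WithTop ℕ∞) by norm_num]
    exact WithTop.coe_le_coe.2 le_top) n

lemma Yf_c2 (g : GS N f σ A w) (hχ : ContDiff ℝ ∞ χ) (ε : ℝ) (Q : Euc N) (n : Fin N) :
    ContDiff ℝ 2 (Yf χ w ε Q n) := by
  rw [Yf_eq g hχ]
  exact ((c_smul (hχ.of_le two_le_inf) ε).mul (c_shift (g.dw n).1 Q)).add
    (contDiff_const.mul ((c_smul (pdχ_c2 hχ n) ε).mul (c_shift g.C2 Q)))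

lemma Ff_near (hχ1 : ∀ x : Euc N, ‖x‖ < 1 → χ x = 1) {ε : ℝ} (Q : Euc N) {y : Euc N} (hy : ‖ε • y‖ < 1) :
    Ff χ w ε Q =ᶠ[nhds y] fun y => w (y - Q) := by
  have : IsOpen {y : Euc N | ‖ε • y‖ < 1} := isOpen_lt (by fun_prop) continuous_const
  filter_upwards [this.mem_nhds hy] with z hz
  unfold Ff
  rw [hχ1 _ hz, one_mul]

/-- everything about one peak -/
lemma GS.single (g : GS N f σ A w) (hχ : ContDiff ℝ ∞ χ) (hs : HasCompactSupport χ)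
    (hχ1 : ∀ x : Euc N, ‖x‖ < 1 → χ x = 1) (hVc : Continuous V) {C₁ CP : ℝ} (hC₁ : 0 < C₁) (hCP : 0 < CP)
    (hV : ∀ x, ‖x‖ ≤ 1 → |V x - 1| ≤ C₁ * ‖x‖ ^ 2) :
    ∃ C > 0, ∀ (ε β : ℝ) (Q y : Euc N), 0 < ε → ε ≤ 1 → β ≤ 1 → ‖ε • Q‖ ≤ CP * ε ^ β → CP * ε ^ β ≤ 1 / 2 →
      (∀ n, |Yf χ w ε Q n y - pd n w (y - Q)| ≤ C * ε ^ (2 * β) * exp (-(1 / 2 * ‖y - Q‖))) ∧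
      (∀ n, |Ytf V χ w ε Q n y - deriv f (w (y - Q)) * pd n w (y - Q)|
        ≤ C * ε ^ (2 * β) * exp (-(1 / 2 * ‖y - Q‖))) ∧
      (‖ε • y‖ < 1 → |lap (Ff χ w ε Q) y - V (ε • y) * Ff χ w ε Q y + f (w (y - Q))|
        ≤ C * ε ^ (2 * β) * exp (-(1 / 2 * ‖y - Q‖))) ∧
      (1 ≤ ‖ε • y‖ → |lap (Ff χ w ε Q) y - V (ε • y) * Ff χ w ε Q y| + w (y - Q)
        ≤ C * ε ^ (2 * β) * exp (-(1 / 2 * ‖y - Q‖))) := by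
  obtain ⟨Cw, hCw, w0, w1, w2, w3⟩ := g.decay
  have w0' : ∀ x, |w x| ≤ Cw * exp (-‖x‖) := fun x => by rw [abs_of_pos (g.pos x)]; exact w0 x
  have hχ2 : ContDiff ℝ 2 χ := hχ.of_le two_le_inf
  have hNp : (0 : ℝ) ≤ N := Nat.cast_nonneg N
  set B := Cw + N * Cw + Cw * Cw with hB
  have hBp : 0 < B := by positivity
  have hB1 : Cw ≤ B := by nlinarith [mul_nonneg hNp hCw.le]
  have hup : ∀ x : Euc N, Cw * exp (-‖x‖) ≤ B * exp (-‖x‖) := fun x => by gcongr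
  have lw : ∀ x, |lap w x| ≤ B * exp (-‖x‖) := fun x => by
    rw [lap_eq g.C2]
    calc _ ≤ ∑ n, |pd n (pd n w) x| := Finset.abs_sum_le_sum_abs _ _
      _ ≤ ∑ _n : Fin N, Cw * exp (-‖x‖) := Finset.sum_le_sum fun n _ => w2 n n x
      _ = N * Cw * exp (-‖x‖) := by simp; ring
      _ ≤ _ := by gcongr; nlinarith
  have ldw : ∀ n x, |lap (pd n w) x| ≤ B * exp (-‖x‖) := fun n x => by
    rw [(g.dw n).2.1]
    calc _ ≤ |pd n w x| + |deriv f (w x) * pd n w x| := abs_sub _ _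
      _ ≤ Cw * exp (-‖x‖) + Cw * (Cw * exp (-‖x‖)) := by
        rw [abs_mul]
        exact add_le_add (w1 n x) (mul_le_mul (w3 x) (w1 n x) (abs_nonneg _) hCw.le)
      _ = (Cw + Cw * Cw) * exp (-‖x‖) := by ring
      _ ≤ _ := by gcongr; nlinarith [mul_nonneg hNp hCw.le]
  obtain ⟨K0, hK0, k0⟩ := prod_bound hVc hχ2 hs g.C2 hBp (fun x => (w0' x).trans (hup x))
    (fun n x => (w1 n x).trans (hup x)) lw
  choose K1 hK1 k1 using fun n => prod_bound hVc hχ2 hs (g.dw n).1 hBp (fun x => (w1 n x).trans (hup x))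
    (fun m x => (w2 m n x).trans (hup x)) (ldw n)
  choose K2 hK2 k2 using fun n => prod_bound hVc (pdχ_c2 hχ n) (pd_compact hs n) g.C2 hBp
    (fun x => (w0' x).trans (hup x)) (fun n x => (w1 n x).trans (hup x)) lw
  set K := K0 + ∑ n, (K1 n + K2 n) with hK
  have hK1K : ∀ n, K1 n + K2 n ≤ K := fun n => by
    have := Finset.single_le_sum (f := fun n => K1 n + K2 n) (fun i _ => (add_pos (hK1 i) (hK2 i)).le) (Finset.mem_univ n)
    linarith
  have hKp : 0 < K := by
    have : 0 ≤ ∑ n, (K1 n + K2 n) := Finset.sum_nonneg fun i _ => (add_pos (hK1 i) (hK2 i)).le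
    positivity
  have hK0K : K0 ≤ K := by
    have : 0 ≤ ∑ n, (K1 n + K2 n) := Finset.sum_nonneg fun i _ => (add_pos (hK1 i) (hK2 i)).le
    linarith
  set C := Cw * (C₁ * (16 + 2 * CP ^ 2)) + (2 * K + Cw + Cw * Cw) * 32 with hC
  have hCp : 0 < C := by positivity
  refine ⟨C, hCp, fun ε β Q y h0 h1 hβ hQ hCPε => ?_⟩
  set X := ε ^ (2 * β) * exp (-(1 / 2 * ‖y - Q‖)) with hX
  have hXp : 0 < X := by positivity
  rw [mul_assoc]
  have hCX : 0 ≤ C * X := by positivity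
  rcases lt_or_ge ‖ε • y‖ 1 with hy | hy
  · have ne := near_est hC₁ hCP hV h0 h1 hβ hQ hy
    rw [mul_assoc (C₁ * (16 + 2 * CP ^ 2)), ← hX] at ne
    have hnear := Ff_near (w := w) hχ1 Q hy
    have hYn : ∀ n, Yf χ w ε Q n =ᶠ[nhds y] fun y => pd n w (y - Q) := fun n => by
      have := pd_evEq hnear n
      rwa [pd_shift (dif2 g.C2)] at this
    have hlY : ∀ n, lap (Yf χ w ε Q n) y = pd n w (y - Q) - deriv f (w (y - Q)) * pd n w (y - Q) := fun n => by
      rw [lap_evEq (Yf_c2 g hχ ε Q n) (c_shift (g.dw n).1 Q) (hYn n), lap_shift (g.dw n).1, (g.dw n).2.1]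
    have hlF : lap (Ff χ w ε Q) y = w (y - Q) - f (w (y - Q)) := by
      rw [lap_evEq (Ff_c2 g hχ ε Q) (c_shift g.C2 Q) hnear, lap_shift g.C2, g.lapw]
    have fin : ∀ t, |t| ≤ Cw * exp (-‖y - Q‖) → |(V (ε • y) - 1) * t| ≤ C * X := fun t ht => by
      rw [abs_mul]
      calc _ ≤ |V (ε • y) - 1| * (Cw * exp (-‖y - Q‖)) := by gcongr
        _ = Cw * (|V (ε • y) - 1| * exp (-‖y - Q‖)) := by ring
        _ ≤ Cw * (C₁ * (16 + 2 * CP ^ 2) * X) := by gcongr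
        _ = Cw * (C₁ * (16 + 2 * CP ^ 2)) * X := by ring
        _ ≤ _ := by
          gcongr
          have : 0 ≤ (2 * K + Cw + Cw * Cw) * 32 := by positivity
          linarith
    refine ⟨fun n => ?_, fun n => ?_, fun _ => ?_, fun hy' => absurd hy' (not_le.2 hy)⟩
    · rw [(hYn n).eq_of_nhds, sub_self, abs_zero]; exact hCX
    · have := fin _ (w1 n (y - Q))
      unfold Ytf
      rw [hlY, (hYn n).eq_of_nhds]
      convert this using 2; ring
    · have := fin _ (w0' (y - Q))
      rw [hlF, hnear.eq_of_nhds, ← abs_neg]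
      convert this using 2; ring
  · have fe := far_est h0 h1 hβ hQ hCPε hy
    rw [mul_assoc 32, ← hX] at fe
    have fin : ∀ t, t ≤ (2 * K + Cw + Cw * Cw) * exp (-‖y - Q‖) → t ≤ C * X := fun t ht => by
      refine ht.trans ?_
      calc _ ≤ (2 * K + Cw + Cw * Cw) * (32 * X) := by gcongr
        _ = (2 * K + Cw + Cw * Cw) * 32 * X := by ring
        _ ≤ _ := by
          gcongr
          have : 0 ≤ Cw * (C₁ * (16 + 2 * CP ^ 2)) := by positivity
          linarith
    set E := exp (-‖y - Q‖) with hE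
    have hEp : 0 < E := exp_pos _
    have hY0 : ∀ n, |Yf χ w ε Q n y| ≤ K * E ∧ |V (ε • y) * Yf χ w ε Q n y| ≤ K * E ∧
        |lap (Yf χ w ε Q n) y| ≤ K * E := fun n => by
      obtain ⟨a1, a2, a3⟩ := k1 n ε Q y h0 h1
      obtain ⟨b1, b2, b3⟩ := k2 n ε Q y h0 h1
      have hKE : K1 n * E + K2 n * E ≤ K * E := by rw [← add_mul]; gcongr; exact hK1K n
      have red : ∀ s t, |s| ≤ K1 n * E → |t| ≤ K2 n * E → |s + ε * t| ≤ K * E := fun s t hs ht => by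
        have : |ε * t| ≤ K2 n * E := by
          rw [abs_mul, abs_of_pos h0]
          calc _ ≤ 1 * |t| := by gcongr
            _ ≤ _ := by linarith
        linarith [abs_add_le s (ε * t)]
      refine ⟨?_, ?_, ?_⟩
      · rw [Yf_eq g hχ]; exact red _ _ a1 b1
      · rw [Yf_eq g hχ]
        have := red _ _ a2 b2
        convert this using 2; ring
      · rw [Yf_eq g hχ, lap_add ((c_smul hχ2 ε).mul (c_shift (g.dw n).1 Q))
          (contDiff_const.mul ((c_smul (pdχ_c2 hχ n) ε).mul (c_shift g.C2 Q))),
          lap_cmul ((c_smul (pdχ_c2 hχ n) ε).mul (c_shift g.C2 Q))]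
        exact red _ _ a3 b3
    obtain ⟨c1, c2, c3⟩ := k0 ε Q y h0 h1
    have hK0E : K0 * E ≤ K * E := by gcongr
    have p1 : 0 ≤ K * E := by positivity
    have p2 : 0 ≤ Cw * E := by positivity
    have p3 : 0 ≤ Cw * Cw * E := by positivity
    refine ⟨fun n => ?_, fun n => ?_, fun hy' => absurd hy' (not_lt.2 hy), fun _ => ?_⟩
    · refine fin _ ((abs_sub _ _).trans ?_)
      linarith [(hY0 n).1, w1 n (y - Q)]
    · refine fin _ ?_
      unfold Ytf
      have t1 := abs_sub (V (ε • y) * Yf χ w ε Q n y) (lap (Yf χ w ε Q n) y)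
      have t2 := abs_sub (V (ε • y) * Yf χ w ε Q n y - lap (Yf χ w ε Q n) y) (deriv f (w (y - Q)) * pd n w (y - Q))
      have t3 : |deriv f (w (y - Q)) * pd n w (y - Q)| ≤ Cw * (Cw * E) := by
        rw [abs_mul]; exact mul_le_mul (w3 _) (w1 n _) (abs_nonneg _) hCw.le
      linarith [(hY0 n).2.1, (hY0 n).2.2]
    · refine fin _ ?_
      have t1 := abs_sub (lap (Ff χ w ε Q) y) (V (ε • y) * Ff χ w ε Q y)
      have c2' : |V (ε • y) * Ff χ w ε Q y| ≤ K0 * E := c2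
      have c3' : |lap (Ff χ w ε Q) y| ≤ K0 * E := c3
      linarith [w0 (y - Q)]

end gs
end LS

namespace LS
open scoped ContDiff BoundedContinuousFunction
variable {N ℓ : ℕ}

lemma small_rpow {K δ σ : ℝ} (hK : 0 < K) (hδ : 0 < δ) (hσ : 0 < σ) :
    ∃ t > 0, ∀ x, 0 ≤ x → x ≤ t → K * x ^ σ ≤ δ := by
  refine ⟨(δ / K) ^ (1 / σ), by positivity, fun x hx h => ?_⟩
  have h1 : x ^ σ ≤ ((δ / K) ^ (1 / σ)) ^ σ := by gcongr
  rw [← rpow_mul (by positivity), one_div_mul_cancel hσ.ne', rpow_one] at h1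
  rwa [mul_comm, ← le_div_iff₀ hK]

lemma eps_small {a K δ : ℝ} (ha : 0 < a) (hK : 0 < K) (hδ : 0 < δ) :
    ∀ᶠ ε : ℝ in nhdsWithin 0 (Ioi 0), K * ε ^ a ≤ δ := by
  obtain ⟨t, ht, h⟩ := small_rpow hK hδ ha
  have : ∀ᶠ ε : ℝ in nhdsWithin 0 (Ioi 0), ε ∈ Ioo 0 t := Ioo_mem_nhdsGT ht
  filter_upwards [this] with ε hε
  exact h ε hε.1.le hε.2.le

section gs
variable {f : ℝ → ℝ} {σ A : ℝ} {w : Euc N → ℝ} {χ V : Euc N → ℝ}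

lemma GS.f_sign (g : GS N f σ A w) {τ : ℝ} (hτ : τ = 1 ∨ τ = -1) (x : ℝ) : f (τ * x) = τ * f x := by
  rcases hτ with rfl | rfl
  · simp
  · rw [neg_one_mul, neg_one_mul, g.odd]
lemma GS.f'_sign (g : GS N f σ A w) {τ : ℝ} (hτ : τ = 1 ∨ τ = -1) (x : ℝ) : deriv f (τ * x) = deriv f x := by
  rcases hτ with rfl | rfl
  · simp
  · rw [neg_one_mul, g.even]
lemma abs_sign {τ : ℝ} (hτ : τ = 1 ∨ τ = -1) : |τ| = 1 := by
  rcases hτ with rfl | rfl <;> simp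

lemma GS.interact (g : GS N f σ A w) (ℓ : ℕ) {W : ℝ} (hW : 0 < W) :
    ∃ C > 0, ∀ (x τ : Fin ℓ → ℝ) (k : Fin ℓ), (∀ i, 0 < x i ∧ x i ≤ W) → (∀ i, τ i = 1 ∨ τ i = -1) →
      (∀ i, x i ≤ x k) →
      |f (∑ i, τ i * x i) - ∑ i, τ i * f (x i)|
        ≤ C * ∑ i ∈ Finset.univ.erase k, x i ^ ((1 + σ) / 2) * x k ^ ((1 + σ) / 2) ∧
      |deriv f (∑ i, τ i * x i) - ∑ i, deriv f (x i)| ≤ C * (∑ i ∈ Finset.univ.erase k, x i) ^ σ := by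
  have hσ0 := g.σ0
  have hσ1 := g.σ1
  set L : ℝ := ℓ + 1 with hL
  have hL1 : 1 ≤ L := by rw [hL]; linarith [Nat.cast_nonneg (α := ℝ) ℓ]
  have hLp : 0 < L := by linarith
  obtain ⟨C, hC, f1, f2, f3, -⟩ := g.fb (L * W) (by positivity)
  refine ⟨C * L + C, by positivity, fun x τ k hx hτ hk => ?_⟩
  set s := Finset.univ.erase k with hs
  have split : ∀ F : Fin ℓ → ℝ, ∑ i, F i = F k + ∑ i ∈ s, F i := fun F =>
    (Finset.add_sum_erase _ F (Finset.mem_univ k)).symm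
  have hxk := (hx k).1
  set S := ∑ i ∈ s, τ i * x i with hS
  set S' := ∑ i ∈ s, x i with hS'
  have hS'0 : 0 ≤ S' := Finset.sum_nonneg fun i _ => (hx i).1.le
  have hSS : |S| ≤ S' := (Finset.abs_sum_le_sum_abs _ _).trans (Finset.sum_le_sum fun i _ => by
    rw [abs_mul, abs_sign (hτ i), one_mul, abs_of_pos (hx i).1])
  have hcard : (s.card : ℝ) ≤ ℓ := by
    have : s.card ≤ (Finset.univ : Finset (Fin ℓ)).card := Finset.card_le_card (Finset.erase_subset _ _)
    rw [Finset.card_univ, Fintype.card_fin] at this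
    exact_mod_cast this
  have hS'k : S' ≤ ℓ * x k := by
    calc S' ≤ ∑ _i ∈ s, x k := Finset.sum_le_sum fun i _ => hk i
      _ = s.card * x k := by simp
      _ ≤ _ := by gcongr
  have hak : |τ k * x k| = x k := by rw [abs_mul, abs_sign (hτ k), one_mul, abs_of_pos hxk]
  have hb1 : |τ k * x k| ≤ L * x k := by rw [hak]; nlinarith
  have hb2 : |τ k * x k + S| ≤ L * x k := by
    refine (abs_add_le _ _).trans ?_
    rw [hak, hL]; linarith
  have hLW : L * x k ≤ L * W := by gcongr; exact (hx k).2
  rw [split fun i => τ i * x i, split fun i => τ i * f (x i), split fun i => deriv f (x i)]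
  constructor
  · have hm := mv (f := f) g.fd (a := τ k * x k) (b := τ k * x k + S) (m := 0) (K := C * (L * x k) ^ σ) (by
      intro z hz
      rw [sub_zero]
      have hzz := abs_le_of_mem_uIcc hb1 hb2 hz
      refine (f2 z (hzz.trans hLW)).trans ?_
      gcongr)
    rw [zero_mul, sub_zero, add_sub_cancel_left, g.f_sign (hτ k)] at hm
    have h1 : (L * x k) ^ σ ≤ L * x k ^ σ := by
      rw [mul_rpow hLp.le hxk.le]
      gcongr
      calc L ^ σ ≤ L ^ (1 : ℝ) := rpow_le_rpow_of_exponent_le hL1 hσ1.le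
        _ = L := rpow_one L
    have key : ∀ i ∈ s, x k ^ σ * x i ≤ x i ^ ((1 + σ) / 2) * x k ^ ((1 + σ) / 2) := fun i _ => by
      have hxi := (hx i).1
      have e1 : x i = x i ^ ((1 + σ) / 2) * x i ^ ((1 - σ) / 2) := by
        rw [← rpow_add hxi]; conv_lhs => rw [← rpow_one (x i)]
        congr 1; ring
      have e2 : x k ^ ((1 + σ) / 2) = x k ^ σ * x k ^ ((1 - σ) / 2) := by
        rw [← rpow_add hxk]; congr 1; ring
      have e3 : x i ^ ((1 - σ) / 2) ≤ x k ^ ((1 - σ) / 2) :=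
        rpow_le_rpow hxi.le (hk i) (by linarith)
      calc x k ^ σ * x i = x k ^ σ * (x i ^ ((1 + σ) / 2) * x i ^ ((1 - σ) / 2)) := by rw [← e1]
        _ ≤ x k ^ σ * (x i ^ ((1 + σ) / 2) * x k ^ ((1 - σ) / 2)) := by gcongr
        _ = _ := by rw [e2]; ring
    have t1 : |f (τ k * x k + S) - τ k * f (x k)| ≤ C * L * ∑ i ∈ s, x i ^ ((1 + σ) / 2) * x k ^ ((1 + σ) / 2) := by
      calc _ ≤ C * (L * x k) ^ σ * |S| := hm
        _ ≤ C * (L * x k ^ σ) * S' := by gcongr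
        _ = C * L * ∑ i ∈ s, x k ^ σ * x i := by rw [hS', ← Finset.mul_sum]; ring
        _ ≤ _ := by
          exact mul_le_mul_of_nonneg_left (Finset.sum_le_sum key) (by positivity)
    have t2 : |∑ i ∈ s, τ i * f (x i)| ≤ C * ∑ i ∈ s, x i ^ ((1 + σ) / 2) * x k ^ ((1 + σ) / 2) := by
      rw [Finset.mul_sum]
      refine (Finset.abs_sum_le_sum_abs _ _).trans (Finset.sum_le_sum fun i hi => ?_)
      have hxi := (hx i).1
      rw [abs_mul, abs_sign (hτ i), one_mul]
      have hxiL : |x i| ≤ L * W := by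
        rw [abs_of_pos hxi]; nlinarith [(hx i).2]
      refine (f3 _ hxiL).trans ?_
      gcongr
      refine le_trans ?_ (key i hi)
      rw [abs_of_pos hxi, add_comm, rpow_add hxi, rpow_one]
      gcongr
      exact hk i
    have e : f (τ k * x k + S) - (τ k * f (x k) + ∑ i ∈ s, τ i * f (x i))
      = (f (τ k * x k + S) - τ k * f (x k)) - ∑ i ∈ s, τ i * f (x i) := by ring
    rw [e]
    refine (abs_sub _ _).trans ?_
    rw [add_mul]
    exact add_le_add t1 t2
  · have t1 : |deriv f (τ k * x k + S) - deriv f (x k)| ≤ C * S' ^ σ := by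
      rw [← g.f'_sign (hτ k) (x k)]
      refine (f1 _ _ (hb2.trans hLW) (hb1.trans hLW)).trans ?_
      rw [add_sub_cancel_left]
      gcongr
    have t2 : |∑ i ∈ s, deriv f (x i)| ≤ C * ℓ * S' ^ σ := by
      calc _ ≤ ∑ i ∈ s, |deriv f (x i)| := Finset.abs_sum_le_sum_abs _ _
        _ ≤ ∑ _i ∈ s, C * S' ^ σ := Finset.sum_le_sum fun i hi => by
          have hxi := (hx i).1
          have hxiL : |x i| ≤ L * W := by
            rw [abs_of_pos hxi]; nlinarith [(hx i).2]
          refine (f2 _ hxiL).trans ?_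
          gcongr
          rw [abs_of_pos hxi]
          exact Finset.single_le_sum (f := x) (fun j _ => (hx j).1.le) hi
        _ = s.card * (C * S' ^ σ) := by simp
        _ ≤ ℓ * (C * S' ^ σ) := by gcongr
        _ = _ := by ring
    have e : deriv f (τ k * x k + S) - (deriv f (x k) + ∑ i ∈ s, deriv f (x i))
      = (deriv f (τ k * x k + S) - deriv f (x k)) - ∑ i ∈ s, deriv f (x i) := by ring
    rw [e]
    refine (abs_sub _ _).trans ?_
    have : (C * L + C) * S' ^ σ = C * S' ^ σ + C * ℓ * S' ^ σ + C * S' ^ σ := by rw [hL]; ring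
    have p : 0 ≤ C * S' ^ σ := by positivity
    linarith

lemma tri_Q (y Q Q' : Euc N) : ‖Q - Q'‖ ≤ ‖y - Q‖ + ‖y - Q'‖ := by
  have : Q - Q' = (y - Q') - (y - Q) := by abel
  rw [this]; linarith [norm_sub_le (y - Q') (y - Q)]

lemma GS.pair_est (g : GS N f σ A w) {β : ℝ} (hβ0 : 0 < β) (hβ1 : β < 1) :
    ∃ C > 0, ∃ μ > 0, μ ≤ 1 / 2 ∧ ∀ (ε : ℝ) (Q Q' y : Euc N), 0 < ε → w (Q - Q') < ε ^ (2 * β) →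
      w (y - Q) ^ ((1 + σ) / 2) * w (y - Q') ^ ((1 + σ) / 2)
        ≤ C * ε ^ (β ^ 2 * (1 + σ)) * exp (-(μ * ‖y - Q'‖)) := by
  have hσ0 := g.σ0
  have hσ1 := g.σ1
  obtain ⟨Cw, hCw, hw⟩ := g.upper
  set κ := (1 + 1 / β) / 2 with hκ
  have hκ1 : 1 < κ := by
    have : 1 < 1 / β := by rw [lt_div_iff₀ hβ0]; linarith
    rw [hκ]; linarith
  have hκβ : κ * β = (1 + β) / 2 := by rw [hκ]; field_simp; ring
  obtain ⟨c, hc, hl⟩ := g.lower hκ1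
  set q := (1 + σ) / 2 with hq
  have hqp : 0 < q := by rw [hq]; positivity
  have hq1 : q ≤ 1 := by rw [hq]; linarith
  set μ := q * ((1 - β) / 2) with hμ
  have hμp : 0 < μ := by
    have : 0 < (1 - β) / 2 := by linarith
    positivity
  refine ⟨Cw ^ q * Cw ^ q * (1 / c) ^ (q * β), by positivity, μ, hμp, ?_, fun ε Q Q' y hε h => ?_⟩
  · rw [hμ]; nlinarith
  have up : ∀ z, w z ^ q ≤ Cw ^ q * exp (-(q * ‖z‖)) := fun z => by
    calc _ ≤ (Cw * exp (-‖z‖)) ^ q := rpow_le_rpow (g.pos z).le (hw z) hqp.le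
      _ = _ := by rw [mul_rpow hCw.le (exp_pos _).le, ← exp_mul]; congr 2; ring
  have h1 : exp (-(κ * ‖Q - Q'‖)) ≤ 1 / c * ε ^ (2 * β) := by
    rw [one_div, ← div_eq_inv_mul, le_div_iff₀ hc]
    linarith [hl (Q - Q')]
  have h2 : exp (-(κ * β * q * ‖Q - Q'‖)) ≤ (1 / c) ^ (q * β) * ε ^ (β ^ 2 * (1 + σ)) := by
    calc _ = exp (-(κ * ‖Q - Q'‖)) ^ (q * β) := by rw [← exp_mul]; congr 1; ring
      _ ≤ (1 / c * ε ^ (2 * β)) ^ (q * β) := rpow_le_rpow (exp_pos _).le h1 (by positivity)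
      _ = _ := by
        rw [mul_rpow (by positivity) (by positivity), ← rpow_mul hε.le]
        congr 2; rw [hq]; ring
  have h3 : exp (-(q * ‖y - Q‖)) * exp (-(q * ‖y - Q'‖)) ≤ exp (-(κ * β * q * ‖Q - Q'‖)) * exp (-(μ * ‖y - Q'‖)) := by
    rw [← exp_add, ← exp_add, exp_le_exp, hκβ, hμ]
    have t := tri_Q y Q Q'
    have n1 := norm_nonneg (y - Q)
    have n2 := norm_nonneg (y - Q')
    have : (1 + β) / 2 * q * ‖Q - Q'‖ ≤ (1 + β) / 2 * q * (‖y - Q‖ + ‖y - Q'‖) := by gcongr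
    have e2 : 0 ≤ q * ((1 - β) / 2) * ‖y - Q‖ := by positivity
    nlinarith
  calc _ ≤ (Cw ^ q * exp (-(q * ‖y - Q‖))) * (Cw ^ q * exp (-(q * ‖y - Q'‖))) :=
        mul_le_mul (up _) (up _) (rpow_nonneg (g.pos _).le _) (by positivity)
    _ = Cw ^ q * Cw ^ q * (exp (-(q * ‖y - Q‖)) * exp (-(q * ‖y - Q'‖))) := by ring
    _ ≤ Cw ^ q * Cw ^ q * (((1 / c) ^ (q * β) * ε ^ (β ^ 2 * (1 + σ))) * exp (-(μ * ‖y - Q'‖))) := by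
        refine mul_le_mul_of_nonneg_left (h3.trans ?_) (by positivity)
        gcongr
    _ = _ := by ring

end gs
end LS

namespace LS
open scoped ContDiff BoundedContinuousFunction
variable {N ℓ : ℕ}

section gs
variable {f : ℝ → ℝ} {σ A : ℝ} {w : Euc N → ℝ} {χ V : Euc N → ℝ}

lemma Uf_c2 (g : GS N f σ A w) (hχ : ContDiff ℝ ∞ χ) (τ : Fin ℓ → ℝ) (ε : ℝ) (Q : Fin ℓ → Euc N) :
    ContDiff ℝ 2 (Uf χ w τ ε Q) :=
  ContDiff.sum fun i _ => contDiff_const.mul (Ff_c2 g hχ ε (Q i))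

lemma lap_Uf (g : GS N f σ A w) (hχ : ContDiff ℝ ∞ χ) (τ : Fin ℓ → ℝ) (ε : ℝ) (Q : Fin ℓ → Euc N) (y : Euc N) :
    lap (Uf χ w τ ε Q) y = ∑ i, τ i * lap (Ff χ w ε (Q i)) y := by
  unfold Uf
  rw [lap_sum Finset.univ (u := fun i y => τ i * Ff χ w ε (Q i) y) fun i => contDiff_const.mul (Ff_c2 g hχ ε (Q i))]
  exact Finset.sum_congr rfl fun i _ => lap_cmul (Ff_c2 g hχ ε (Q i)) _ y

lemma abs_Uf_le (g : GS N f σ A w) (hχr : ∀ x, χ x ∈ Icc (0 : ℝ) 1) {τ : Fin ℓ → ℝ} (hτ : ∀ i, τ i = 1 ∨ τ i = -1)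
    (ε : ℝ) (Q : Fin ℓ → Euc N) (y : Euc N) : |Uf χ w τ ε Q y| ≤ ∑ i, w (y - Q i) := by
  refine (Finset.abs_sum_le_sum_abs _ _).trans (Finset.sum_le_sum fun i _ => ?_)
  have hw := g.pos (y - Q i)
  have h := hχr (ε • y)
  rw [abs_mul, abs_sign (hτ i), one_mul, Ff, abs_mul, abs_of_pos hw, abs_of_nonneg h.1]
  nlinarith [h.2]

/-- The approximate solution: verification of the hypotheses of the reduction and the size of the error. -/
lemma GS.approx (g : GS N f σ A w) (hχ : ContDiff ℝ ∞ χ) (hs : HasCompactSupport χ)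
    (hχr : ∀ x, χ x ∈ Icc (0 : ℝ) 1)
    (hχ1 : ∀ x : Euc N, ‖x‖ < 1 → χ x = 1) (hVc : Continuous V) {C₁ CP : ℝ} (hC₁ : 0 < C₁) (hCP : 0 < CP)
    (hV : ∀ x, ‖x‖ ≤ 1 → |V x - 1| ≤ C₁ * ‖x‖ ^ 2) {β : ℝ} (hβ0 : 0 < β) (hβ1 : β < 1) (hℓ : 0 < ℓ)
    {τ : Fin ℓ → ℝ} (hτ : ∀ i, τ i = 1 ∨ τ i = -1) :
    ∃ CU > 0, ∃ CE > 0, ∃ μ₀ > 0, μ₀ ≤ 1 / 2 ∧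
      (∀ ε Q y, |Uf χ w τ ε Q y| ≤ CU) ∧
      (∀ ε Q y, |Uf χ w τ ε Q y| ≤ CU * ∑ i, exp (-‖y - Q i‖)) ∧
      ∀ (c δ r D : ℝ), 0 < δ → ∀ᶠ ε in nhdsWithin 0 (Ioi 0), ∀ Q : Fin ℓ → Euc N,
        (∀ i, ‖ε • Q i‖ ≤ CP * ε ^ β) → (∀ i j, i ≠ j → w (Q i - Q j) < ε ^ (2 * β)) →
        (∀ T, IsOp (fun y => V (ε • y)) c T → Apx f w c CU δ r (fun y => V (ε • y)) T Q (Uf χ w τ ε Q)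
          (fun i n => Yf χ w ε (Q i) n) (fun i n => Ytf V χ w ε (Q i) n)) ∧
        (∀ i j, i ≠ j → D ≤ ‖Q i - Q j‖) ∧
        ∀ y, |lap (Uf χ w τ ε Q) y - V (ε • y) * Uf χ w τ ε Q y + f (Uf χ w τ ε Q y)|
          ≤ CE * ε ^ (β ^ 2 * (1 + σ)) * ∑ i, exp (-(μ₀ * ‖y - Q i‖)) := by
  have hσ0 := g.σ0
  have hσ1 := g.σ1
  obtain ⟨Cw, hCw, hw⟩ := g.upper
  have hℓ0 : (0 : ℝ) < ℓ := Nat.cast_pos.2 hℓ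
  set CU := Cw * (ℓ + 1) with hCU
  have hCUp : 0 < CU := by positivity
  have hwC : ∀ z, w z ≤ Cw := fun z => (hw z).trans (by nlinarith [exp_neg_norm_le_one z])
  have hsumC : ∀ (Q : Fin ℓ → Euc N) y, ∑ i, w (y - Q i) ≤ CU := fun Q y => by
    calc _ ≤ ∑ _i : Fin ℓ, Cw := Finset.sum_le_sum fun i _ => hwC _
      _ = ℓ * Cw := by simp
      _ ≤ _ := by rw [hCU]; nlinarith
  obtain ⟨Cf, hCf, -, f2, -, f4⟩ := g.fb CU hCUp
  obtain ⟨CI, hCI, hI⟩ := g.interact ℓ hCw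
  obtain ⟨Cp, hCp, μ₀, hμ₀, hμ2, hpair⟩ := g.pair_est hβ0 hβ1
  obtain ⟨C, hC, hsin⟩ := g.single hχ hs hχ1 hVc hC₁ hCP hV
  obtain ⟨c₀, hc₀, hlow⟩ := g.lower (κ := 2) (by norm_num)
  have hU := abs_Uf_le (χ := χ) g hχr hτ
  refine ⟨CU, hCUp, C * (1 + Cf) + CI * Cp * ℓ, by positivity, μ₀, hμ₀, hμ2, fun ε Q y => (hU ε Q y).trans (hsumC Q y),
    fun ε Q y => (hU ε Q y).trans ?_, fun c δ r D hδ => ?_⟩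
  · calc _ ≤ ∑ i, Cw * exp (-‖y - Q i‖) := Finset.sum_le_sum fun i _ => hw _
      _ = Cw * ∑ i, exp (-‖y - Q i‖) := by rw [Finset.mul_sum]
      _ ≤ _ := by
        gcongr
        rw [hCU]; nlinarith
  obtain ⟨t, ht, hsm⟩ := small_rpow (K := Cf * (ℓ + 1) + CI) (δ := δ) (by positivity) hδ hσ0
  obtain ⟨D', hD', hDe⟩ := exp_small (μ := 1 / 2) (δ := t / (ℓ * Cw)) (by norm_num) (by positivity)
  filter_upwards [eps_small hβ0 hCP (by norm_num : (0 : ℝ) < 1 / 2),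
    eps_small (a := 2 * β) (by positivity) hC hδ,
    eps_small (a := 2 * β) (K := ℓ * C) (by positivity) (by positivity) ht,
    eps_small (a := β) (K := |r| + CP) (by positivity) (by positivity) (by norm_num : (0 : ℝ) < 1),
    eps_small (a := β) (K := C₁ * (|r| + CP)) (by positivity) (by positivity) hδ,
    eps_small (a := 2 * β) (K := 1) (δ := c₀ * exp (-(2 * max D D'))) (by positivity) (by norm_num) (by positivity),
    Ioo_mem_nhdsGT (zero_lt_one (α := ℝ))] with ε e1 e2 e3 e4 e5 e6 e7 Q hQ hwQ
  have h0 := e7.1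
  have h1 := e7.2.le
  have hsep : ∀ i j, i ≠ j → max D D' ≤ ‖Q i - Q j‖ := fun i j hij => by
    have := ((hlow (Q i - Q j)).trans_lt (hwQ i j hij)).trans_le ((one_mul _).symm.le.trans e6)
    have := exp_lt_exp.1 (lt_of_mul_lt_mul_left this hc₀.le)
    linarith
  have hsg := fun i y => hsin ε β (Q i) y h0 h1 hβ1.le (hQ i) e1
  have hexp1 : ∀ z : Euc N, exp (-(1 / 2 * ‖z‖)) ≤ 1 := fun z => exp_le_one_iff.2 (by linarith [norm_nonneg z])
  have hUnear : ∀ y, ‖ε • y‖ < 1 → Uf χ w τ ε Q y = ∑ i, τ i * w (y - Q i) := fun y hy => by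
    unfold Uf
    exact Finset.sum_congr rfl fun i _ => by rw [Ff, hχ1 _ hy, one_mul]
  refine ⟨fun T hT => ⟨hT, Uf_c2 g hχ τ ε Q, fun y => (hU ε Q y).trans (hsumC Q y), fun i n => Yf_c2 g hχ ε (Q i) n,
    fun i n y => rfl, fun i n y => ?_, fun i n y => ?_, fun y => ?_, fun i y hy => ?_⟩,
    fun i j hij => (le_max_left _ _).trans (hsep i j hij), fun y => ?_⟩
  · refine ((hsg i y).1 n).trans ?_
    calc _ ≤ δ * 1 := mul_le_mul e2 (hexp1 _) (exp_pos _).le hδ.le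
      _ = δ := mul_one δ
  · refine ((hsg i y).2.1 n).trans ?_
    gcongr
  · rcases lt_or_ge ‖ε • y‖ 1 with hy | hy
    · rw [hUnear y hy]
      haveI : Nonempty (Fin ℓ) := ⟨⟨0, hℓ⟩⟩
      obtain ⟨k, hk⟩ := Finite.exists_max (fun i => w (y - Q i))
      refine (hI (fun i => w (y - Q i)) τ k (fun i => ⟨g.pos _, hwC _⟩) hτ hk).2.trans ?_
      have hS0 : 0 ≤ ∑ i ∈ Finset.univ.erase k, w (y - Q i) := Finset.sum_nonneg fun i _ => (g.pos _).le
      have hSt : ∑ i ∈ Finset.univ.erase k, w (y - Q i) ≤ t := by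
        calc _ ≤ ∑ i ∈ Finset.univ.erase k, t / ℓ := Finset.sum_le_sum fun i hi => by
              have hik : i ≠ k := Finset.ne_of_mem_erase hi
              have hd := (le_max_right D D').trans (hsep i k hik)
              have p1 := g.pos (y - Q i)
              have p3 : w (y - Q i) * w (y - Q k) ≤ (Cw * exp (-(1 / 2 * D'))) ^ 2 := by
                calc _ ≤ (Cw * exp (-‖y - Q i‖)) * (Cw * exp (-‖y - Q k‖)) :=
                      mul_le_mul (hw _) (hw _) (g.pos _).le (by positivity)
                  _ = Cw ^ 2 * exp (-‖y - Q i‖ + -‖y - Q k‖) := by rw [exp_add]; ring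
                  _ ≤ Cw ^ 2 * exp (-(1 / 2 * D') + -(1 / 2 * D')) := by
                    refine mul_le_mul_of_nonneg_left (exp_le_exp.2 ?_) (by positivity)
                    linarith [tri_Q y (Q i) (Q k)]
                  _ = _ := by rw [exp_add]; ring
              have p4 : w (y - Q i) ^ 2 ≤ (Cw * exp (-(1 / 2 * D'))) ^ 2 := by
                refine le_trans ?_ p3
                rw [sq]
                exact mul_le_mul_of_nonneg_left (hk i) p1.le
              have p5 := abs_le_of_sq_le_sq' p4 (by positivity) |>.2
              refine p5.trans ?_
              calc _ ≤ Cw * (t / (ℓ * Cw)) := by gcongr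
                _ = t / ℓ := by field_simp
          _ ≤ ∑ _i : Fin ℓ, t / ℓ := Finset.sum_le_sum_of_subset_of_nonneg (Finset.erase_subset _ _) fun i _ _ => by positivity
          _ = t := by simp; field_simp
      refine le_trans ?_ (hsm _ hS0 hSt)
      gcongr
      have : 0 ≤ Cf * (ℓ + 1) := by positivity
      linarith
    · have hsm2 : ∑ i, w (y - Q i) ≤ t := by
        calc _ ≤ ∑ _i : Fin ℓ, C * ε ^ (2 * β) := Finset.sum_le_sum fun i _ => by
              have := (hsg i y).2.2.2 hy
              have h3 : C * ε ^ (2 * β) * exp (-(1 / 2 * ‖y - Q i‖)) ≤ C * ε ^ (2 * β) * 1 := by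
                gcongr
                exact hexp1 _
              linarith [abs_nonneg (lap (Ff χ w ε (Q i)) y - V (ε • y) * Ff χ w ε (Q i) y)]
          _ = ℓ * C * ε ^ (2 * β) := by simp; ring
          _ ≤ t := e3
      set S := ∑ i, w (y - Q i) with hS
      have hS0 : 0 ≤ S := Finset.sum_nonneg fun i _ => (g.pos _).le
      refine le_trans ?_ (hsm _ hS0 hsm2)
      have t1 : |deriv f (Uf χ w τ ε Q y)| ≤ Cf * S ^ σ := by
        refine (f2 _ ((hU ε Q y).trans (hsumC Q y))).trans ?_
        gcongr
        exact hU ε Q y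
      have t2 : |∑ i, deriv f (w (y - Q i))| ≤ ℓ * (Cf * S ^ σ) := by
        calc _ ≤ ∑ i, |deriv f (w (y - Q i))| := Finset.abs_sum_le_sum_abs _ _
          _ ≤ ∑ _i : Fin ℓ, Cf * S ^ σ := Finset.sum_le_sum fun i _ => by
            have hle : w (y - Q i) ≤ S := Finset.single_le_sum (f := fun i => w (y - Q i)) (fun j _ => (g.pos _).le) (Finset.mem_univ i)
            refine (f2 _ ?_).trans ?_
            · rw [abs_of_pos (g.pos _)]; exact hle.trans (hsumC Q y)
            · rw [abs_of_pos (g.pos _)]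
              have := (g.pos (y - Q i)).le
              gcongr
          _ = _ := by simp
      refine (abs_sub _ _).trans ?_
      have : 0 ≤ CI * S ^ σ := by positivity
      have e : (Cf * (ℓ + 1) + CI) * S ^ σ = Cf * S ^ σ + ℓ * (Cf * S ^ σ) + CI * S ^ σ := by ring
      linarith
  · have hy1 : ‖ε • y‖ ≤ (|r| + CP) * ε ^ β := by
      have : ε • y = ε • (y - Q i) + ε • Q i := by rw [← smul_add, sub_add_cancel]
      rw [this]
      refine (norm_add_le _ _).trans ?_
      rw [norm_smul, Real.norm_eq_abs, abs_of_pos h0]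
      have h5 := eps_le h0 h1 hβ1.le
      have h6 : ε * ‖y - Q i‖ ≤ ε ^ β * |r| := by
        have := hy.trans (le_abs_self r)
        gcongr
      linarith [hQ i]
    refine (hV _ (hy1.trans e4)).trans ?_
    have h7 : ‖ε • y‖ ^ 2 ≤ ‖ε • y‖ := by nlinarith [norm_nonneg (ε • y)]
    calc _ ≤ C₁ * ((|r| + CP) * ε ^ β) := by
          have := h7.trans hy1
          gcongr
      _ ≤ δ := by linarith
  · set η := β ^ 2 * (1 + σ) with hη
    have hηβ : ε ^ (2 * β) ≤ ε ^ η := rpow_le_rpow_of_exponent_ge h0 h1 (by rw [hη]; nlinarith)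
    have hrate : ∀ i, exp (-(1 / 2 * ‖y - Q i‖)) ≤ exp (-(μ₀ * ‖y - Q i‖)) := fun i => exp_mono_rate hμ2 _
    have hterm : ∀ i, C * ε ^ (2 * β) * exp (-(1 / 2 * ‖y - Q i‖)) ≤ C * ε ^ η * exp (-(μ₀ * ‖y - Q i‖)) := fun i => by
      gcongr
    set X := ε ^ η * ∑ i, exp (-(μ₀ * ‖y - Q i‖)) with hX
    have hXe : 0 ≤ X := by positivity
    have hsumX : ∑ i, C * ε ^ (2 * β) * exp (-(1 / 2 * ‖y - Q i‖)) ≤ C * X := by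
      calc _ ≤ ∑ i, C * ε ^ η * exp (-(μ₀ * ‖y - Q i‖)) := Finset.sum_le_sum fun i _ => hterm i
        _ = _ := by rw [← Finset.mul_sum, hX]; ring
    rw [mul_assoc, ← hX, lap_Uf g hχ]
    rcases lt_or_ge ‖ε • y‖ 1 with hy | hy
    · have hdec : (∑ i, τ i * lap (Ff χ w ε (Q i)) y) - V (ε • y) * Uf χ w τ ε Q y + f (Uf χ w τ ε Q y)
        = (∑ i, τ i * (lap (Ff χ w ε (Q i)) y - V (ε • y) * Ff χ w ε (Q i) y + f (w (y - Q i))))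
          + (f (∑ i, τ i * w (y - Q i)) - ∑ i, τ i * f (w (y - Q i))) := by
        rw [hUnear y hy]
        have : V (ε • y) * ∑ i, τ i * w (y - Q i) = ∑ i, τ i * (V (ε • y) * Ff χ w ε (Q i) y) := by
          rw [Finset.mul_sum]
          exact Finset.sum_congr rfl fun i _ => by rw [Ff, hχ1 _ hy]; ring
        rw [this]
        simp only [mul_add, mul_sub, Finset.sum_add_distrib, Finset.sum_sub_distrib]
        ring
      rw [hdec]
      have t1 : |∑ i, τ i * (lap (Ff χ w ε (Q i)) y - V (ε • y) * Ff χ w ε (Q i) y + f (w (y - Q i)))| ≤ C * X := by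
        refine ((Finset.abs_sum_le_sum_abs _ _).trans (Finset.sum_le_sum fun i _ => ?_)).trans hsumX
        rw [abs_mul, abs_sign (hτ i), one_mul]
        exact (hsg i y).2.2.1 hy
      haveI : Nonempty (Fin ℓ) := ⟨⟨0, hℓ⟩⟩
      obtain ⟨k, hk⟩ := Finite.exists_max (fun i => w (y - Q i))
      have t2 := (hI (fun i => w (y - Q i)) τ k (fun i => ⟨g.pos _, hwC _⟩) hτ hk).1
      have hkX : ε ^ η * exp (-(μ₀ * ‖y - Q k‖)) ≤ X := by
        rw [hX]
        gcongr
        exact Finset.single_le_sum (f := fun i => exp (-(μ₀ * ‖y - Q i‖))) (fun j _ => (exp_pos _).le) (Finset.mem_univ k)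
      have t3 : ∑ i ∈ Finset.univ.erase k, w (y - Q i) ^ ((1 + σ) / 2) * w (y - Q k) ^ ((1 + σ) / 2) ≤ ℓ * (Cp * X) := by
        calc _ ≤ ∑ i ∈ Finset.univ.erase k, Cp * X := Finset.sum_le_sum fun i hi => by
              refine (hpair ε (Q i) (Q k) y h0 (hwQ i k (Finset.ne_of_mem_erase hi))).trans ?_
              rw [mul_assoc]
              gcongr
          _ ≤ ∑ _i : Fin ℓ, Cp * X := Finset.sum_le_sum_of_subset_of_nonneg (Finset.erase_subset _ _) fun i _ _ => by positivity
          _ = _ := by simp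
      have t4 : CI * ∑ i ∈ Finset.univ.erase k, w (y - Q i) ^ ((1 + σ) / 2) * w (y - Q k) ^ ((1 + σ) / 2)
        ≤ CI * (ℓ * (Cp * X)) := by gcongr
      refine (abs_add_le _ _).trans ((add_le_add t1 (t2.trans t4)).trans ?_)
      have : 0 ≤ C * Cf * X := by positivity
      linarith
    · have hdec : (∑ i, τ i * lap (Ff χ w ε (Q i)) y) - V (ε • y) * Uf χ w τ ε Q y + f (Uf χ w τ ε Q y)
        = (∑ i, τ i * (lap (Ff χ w ε (Q i)) y - V (ε • y) * Ff χ w ε (Q i) y)) + f (Uf χ w τ ε Q y) := by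
        have : V (ε • y) * Uf χ w τ ε Q y = ∑ i, τ i * (V (ε • y) * Ff χ w ε (Q i) y) := by
          rw [Uf, Finset.mul_sum]
          exact Finset.sum_congr rfl fun i _ => by ring
        rw [this]
        simp only [mul_sub, Finset.sum_sub_distrib]
      rw [hdec]
      have hfar := fun i => (hsg i y).2.2.2 hy
      have t1 : |∑ i, τ i * (lap (Ff χ w ε (Q i)) y - V (ε • y) * Ff χ w ε (Q i) y)| ≤ C * X := by
        refine ((Finset.abs_sum_le_sum_abs _ _).trans (Finset.sum_le_sum fun i _ => ?_)).trans hsumX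
        rw [abs_mul, abs_sign (hτ i), one_mul]
        linarith [hfar i, g.pos (y - Q i)]
      have t2 : ∑ i, w (y - Q i) ≤ C * X := by
        refine (Finset.sum_le_sum fun i _ => ?_).trans hsumX
        linarith [hfar i, abs_nonneg (lap (Ff χ w ε (Q i)) y - V (ε • y) * Ff χ w ε (Q i) y)]
      have t3 : |f (Uf χ w τ ε Q y)| ≤ Cf * (C * X) := by
        have := f4 (Uf χ w τ ε Q y) 0 ((hU ε Q y).trans (hsumC Q y)) (by rw [abs_zero]; exact hCUp.le)
        rw [g.f0, sub_zero, sub_zero] at this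
        refine this.trans ?_
        have := (hU ε Q y).trans t2
        gcongr
      refine (abs_add_le _ _).trans ((add_le_add t1 t3).trans ?_)
      have : 0 ≤ CI * Cp * ℓ * X := by positivity
      linarith

end gs
end LS

namespace LS
open scoped ContDiff BoundedContinuousFunction
variable {N ℓ : ℕ}

/-- Exponential decay by comparison with a sum of explicit barriers (one-sided version). -/
lemma decay_one (hN : 1 ≤ N) {c μ B B₀ : ℝ} (hc : 0 < c) (hμ : 0 ≤ μ) (hμc : μ ^ 2 ≤ c / 4) (hB : 0 ≤ B)
    {V ψ : Euc N → ℝ} (hV : ∀ y, c ≤ V y) (hψ : ContDiff ℝ 2 ψ) (hψB : ∀ y, ψ y ≤ B₀) (Q : Fin ℓ → Euc N)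
    (h : ∀ y, 0 < ψ y → -lap ψ y + V y * ψ y ≤ c / 4 * ψ y + B * ∑ i, exp (-(μ * ‖y - Q i‖))) (y : Euc N) :
    ψ y ≤ 2 / c * exp μ * B * ∑ i, exp (-(μ * ‖y - Q i‖)) := by
  set K := 2 / c * exp μ * B with hK
  have hK0 : 0 ≤ K := by positivity
  have hrc : ContDiff ℝ 2 (fun y => ∑ i, rho μ (Q i) y) := ContDiff.sum fun i _ => contDiff_rho μ (Q i)
  have hbc : ContDiff ℝ 2 (fun y => K * ∑ i, rho μ (Q i) y) := contDiff_const.mul hrc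
  have hS0 : ∀ y, 0 ≤ ∑ i, rho μ (Q i) y := fun y => Finset.sum_nonneg fun i _ => (rho_pos _ _ _).le
  have key := mp_le (u := fun y => ψ y - K * ∑ i, rho μ (Q i) y) (V := fun y => V y - c / 4) (hψ.sub hbc)
    (B := B₀) (fun x => by have := hψB x; have := mul_nonneg hK0 (hS0 x); linarith) (c := 3 * c / 4) (m := 0)
    (by linarith) (fun x => by have := hV x; linarith) le_rfl (fun x hx => by
      have hKS := mul_nonneg hK0 (hS0 x)
      have hx' : K * ∑ i, rho μ (Q i) x < ψ x := by linarith
      have h1 := h x (by linarith)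
      rw [lap_sub hψ hbc, lap_cmul hrc, lap_sum Finset.univ (u := fun i => rho μ (Q i)) fun i => contDiff_rho μ (Q i)]
      have h2 : ∑ i, lap (rho μ (Q i)) x ≤ μ ^ 2 * ∑ i, rho μ (Q i) x := by
        rw [Finset.mul_sum]
        exact Finset.sum_le_sum fun i _ => lap_rho_le hN hμ _ _
      have h3 : ∑ i, exp (-(μ * ‖x - Q i‖)) ≤ exp μ * ∑ i, rho μ (Q i) x := by
        rw [Finset.mul_sum]
        exact Finset.sum_le_sum fun i _ => exp_le_rho hμ _ _
      set S := ∑ i, rho μ (Q i) x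
      have hS := hS0 x
      have h4 : K * ∑ i, lap (rho μ (Q i)) x ≤ c / 4 * (K * S) := by
        calc _ ≤ K * (μ ^ 2 * S) := by gcongr
          _ ≤ K * (c / 4 * S) := by gcongr
          _ = _ := by ring
      have h5 : B * ∑ i, exp (-(μ * ‖x - Q i‖)) ≤ c / 2 * (K * S) := by
        calc _ ≤ B * (exp μ * S) := by gcongr
          _ = _ := by rw [hK]; field_simp
      have h6 : c * (K * S) ≤ V x * (K * S) := mul_le_mul_of_nonneg_right (hV x) hKS
      nlinarith)
  have := key y
  have h7 : ∑ i, rho μ (Q i) y ≤ ∑ i, exp (-(μ * ‖y - Q i‖)) := Finset.sum_le_sum fun i _ => rho_le_exp hμ _ _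
  have := mul_le_mul_of_nonneg_left h7 hK0
  linarith

lemma decay_abs (hN : 1 ≤ N) {c μ B B₀ : ℝ} (hc : 0 < c) (hμ : 0 ≤ μ) (hμc : μ ^ 2 ≤ c / 4) (hB : 0 ≤ B)
    {V ψ : Euc N → ℝ} (hV : ∀ y, c ≤ V y) (hψ : ContDiff ℝ 2 ψ) (hψB : ∀ y, |ψ y| ≤ B₀) (Q : Fin ℓ → Euc N)
    (h : ∀ y, |-lap ψ y + V y * ψ y| ≤ c / 4 * |ψ y| + B * ∑ i, exp (-(μ * ‖y - Q i‖))) (y : Euc N) :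
    |ψ y| ≤ 2 / c * exp μ * B * ∑ i, exp (-(μ * ‖y - Q i‖)) := by
  rw [abs_le']
  refine ⟨decay_one hN hc hμ hμc hB hV hψ (fun y => (le_abs_self _).trans (hψB y)) Q (fun y hy => ?_) y,
    decay_one (ψ := fun y => - ψ y) hN hc hμ hμc hB hV hψ.neg (fun y => (neg_le_abs _).trans (hψB y)) Q (fun y hy => ?_) y⟩
  · have := (le_abs_self _).trans (h y)
    rwa [abs_of_pos hy] at this
  · have := (neg_le_abs _).trans (h y)
    rw [abs_of_neg (by linarith)] at this
    rw [lap_neg hψ]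
    linarith

/-- Energy bound from pointwise exponential bounds. -/
lemma energy (N ℓ : ℕ) {μ : ℝ} (hμ : 0 < μ) : ∃ C > 0, ∀ (Q : Fin ℓ → Euc N) (V ψ : Euc N → ℝ) (a : ℝ),
    Continuous V → (∀ y, 0 ≤ V y) → ContDiff ℝ 2 ψ → 0 ≤ a →
    (∀ y, |ψ y| ≤ a * ∑ i, exp (-(μ * ‖y - Q i‖))) →
    (∀ y, |-lap ψ y + V y * ψ y| ≤ a * ∑ i, exp (-(μ * ‖y - Q i‖))) →
    Integrable (fun y => ‖fderiv ℝ ψ y‖ ^ 2 + V y * ψ y ^ 2) ∧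
      ∫ y, (‖fderiv ℝ ψ y‖ ^ 2 + V y * ψ y ^ 2) ≤ C * a ^ 2 := by
  obtain ⟨θ, B, hB, hθc, hθs, hθ01, -, hθl, hθ1⟩ := cut_seq N
  set I := ∫ x : Euc N, exp (-(μ * ‖x - 0‖)) with hI
  have hI0 : 0 ≤ I := integral_nonneg fun x => (exp_pos _).le
  refine ⟨(1 + B) * (ℓ * (ℓ * I)) + 1, by positivity, fun Q V ψ a hVc hV0 hψ ha h1 h2 => ?_⟩
  set F := fun y => ‖fderiv ℝ ψ y‖ ^ 2 + V y * ψ y ^ 2 with hF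
  have hF0 : ∀ y, 0 ≤ F y := fun y => by have := hV0 y; simp only [hF]; positivity
  have hFc : Continuous F := by
    have : F = fun y => (∑ n, pd n ψ y ^ 2) + V y * ψ y ^ 2 := by
      funext y
      simp only [hF, norm_fderiv_sq]
    rw [this]
    exact (continuous_finsetSum _ fun n _ => (c0_pd (c21 hψ) n).pow 2).add (hVc.mul (hψ.continuous.pow 2))
  set E := fun y => ∑ i, exp (-(μ * ‖y - Q i‖)) with hE
  have hE0 : ∀ y, 0 ≤ E y := fun y => Finset.sum_nonneg fun i _ => (exp_pos _).le
  have hEl : ∀ y, E y ≤ ℓ := fun y => by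
    calc E y ≤ ∑ _i : Fin ℓ, (1:ℝ) := Finset.sum_le_sum fun i _ => exp_le_one_iff.2 (by
          have := norm_nonneg (y - Q i)
          have := mul_nonneg hμ.le this
          linarith)
      _ = ℓ := by simp
  have hEi : Integrable E := integrable_finsetSum _ fun i _ => int_exp hμ (Q i)
  have hEI : ∫ y, E y = ℓ * I := by
    rw [hE, integral_finsetSum _ fun i _ => int_exp hμ (Q i)]
    have : ∀ i, ∫ y, exp (-(μ * ‖y - Q i‖)) = I := fun i => by
      rw [hI]
      simp only [sub_zero]
      exact integral_sub_right_eq_self (fun x : Euc N => exp (-(μ * ‖x‖))) (Q i)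
    simp [this]
  have hψ2 : ContDiff ℝ 2 (fun y => ψ y * ψ y) := hψ.mul hψ
  have hFe : ∀ y, F y = 1 / 2 * lap (fun y => ψ y * ψ y) y + ψ y * (-lap ψ y + V y * ψ y) := fun y => by
    have e := lap_mul hψ hψ y
    simp only [hF, norm_fderiv_sq, e]
    have : ∑ n, pd n ψ y * pd n ψ y = ∑ n, pd n ψ y ^ 2 := Finset.sum_congr rfl fun n _ => by ring
    rw [this]
    ring
  have hbd : ∀ k, ∫ y, θ k y * F y ≤ (1 + B) * (a ^ 2 * ℓ) * (ℓ * I) := fun k => by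
    have hθ2 : ContDiff ℝ 2 (θ k) := (hθc k).of_le two_le_inf
    have hg := green_cs hψ2 hθ2 (hθs k)
    have hGc : Continuous (fun y => -lap ψ y + V y * ψ y) := (continuous_lap hψ).neg.add (hVc.mul hψ.continuous)
    have i1 : Integrable (fun y => θ k y * lap (fun y => ψ y * ψ y) y) :=
      ((hθc k).continuous.mul (continuous_lap hψ2)).integrable_of_hasCompactSupport (hθs k).mul_right
    have i2 : Integrable (fun y => θ k y * (ψ y * (-lap ψ y + V y * ψ y))) :=
      ((hθc k).continuous.mul (hψ.continuous.mul hGc)).integrable_of_hasCompactSupport (hθs k).mul_right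
    have e1 : ∫ y, θ k y * F y = 1 / 2 * (∫ y, ψ y * ψ y * lap (θ k) y) + ∫ y, θ k y * (ψ y * (-lap ψ y + V y * ψ y)) := by
      rw [hg, ← integral_const_mul, ← integral_add (i1.const_mul _) i2]
      congr 1
      funext y
      rw [hFe]
      ring
    have hsq : ∀ y, a * E y * (a * E y) ≤ a ^ 2 * ℓ * E y := fun y => by
      have h3 := mul_le_mul_of_nonneg_right (hEl y) (hE0 y)
      have h4 := mul_le_mul_of_nonneg_left h3 (sq_nonneg a)
      nlinarith
    have hBk : B / ((k : ℝ) + 1) ≤ B := div_le_self hB (by have : (0:ℝ) ≤ k := Nat.cast_nonneg k; linarith)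
    have b1 : ∫ y, ψ y * ψ y * lap (θ k) y ≤ ∫ y, B * (a ^ 2 * ℓ) * E y := by
      refine (le_abs_self _).trans ?_
      rw [← Real.norm_eq_abs]
      refine norm_integral_le_of_norm_le (hEi.const_mul _) (Eventually.of_forall fun y => ?_)
      rw [Real.norm_eq_abs, abs_mul, abs_mul]
      have h5 : |ψ y| * |ψ y| ≤ a ^ 2 * ℓ * E y :=
        (mul_le_mul (h1 y) (h1 y) (abs_nonneg _) (mul_nonneg ha (hE0 y))).trans (hsq y)
      calc _ ≤ a ^ 2 * ℓ * E y * B := mul_le_mul h5 ((hθl k y).trans hBk) (abs_nonneg _) (mul_nonneg (by positivity) (hE0 y))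
        _ = _ := by ring
    have b2 : ∫ y, θ k y * (ψ y * (-lap ψ y + V y * ψ y)) ≤ ∫ y, a ^ 2 * ℓ * E y := by
      refine (le_abs_self _).trans ?_
      rw [← Real.norm_eq_abs]
      refine norm_integral_le_of_norm_le (hEi.const_mul _) (Eventually.of_forall fun y => ?_)
      rw [Real.norm_eq_abs, abs_mul, abs_mul, abs_of_nonneg (hθ01 k y).1]
      have h5 : |ψ y| * |-lap ψ y + V y * ψ y| ≤ a ^ 2 * ℓ * E y :=
        (mul_le_mul (h1 y) (h2 y) (abs_nonneg _) (mul_nonneg ha (hE0 y))).trans (hsq y)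
      exact (mul_le_of_le_one_left (by positivity) (hθ01 k y).2).trans h5
    rw [integral_const_mul, hEI] at b1 b2
    rw [e1]
    have : 0 ≤ B * (a ^ 2 * ℓ) * (ℓ * I) := by positivity
    linarith
  set M := (1 + B) * (a ^ 2 * ℓ) * (ℓ * I) with hM
  have hM0 : 0 ≤ M := by positivity
  have hl : ∫⁻ y, ENNReal.ofReal (F y) ≤ ENNReal.ofReal M := by
    calc ∫⁻ y, ENNReal.ofReal (F y) = ∫⁻ y, liminf (fun k => ENNReal.ofReal (θ k y * F y)) atTop := by
          refine lintegral_congr fun y => ?_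
          refine (Tendsto.liminf_eq ?_).symm
          refine tendsto_const_nhds.congr' ?_
          filter_upwards [hθ1 y] with k hk
          rw [hk, one_mul]
      _ ≤ liminf (fun k => ∫⁻ y, ENNReal.ofReal (θ k y * F y)) atTop :=
          lintegral_liminf_le fun k => ((hθc k).continuous.mul hFc).measurable.ennreal_ofReal
      _ ≤ liminf (fun _ : ℕ => ENNReal.ofReal M) atTop := by
          refine liminf_le_liminf (Eventually.of_forall fun k => ?_)
          have i0 : Integrable (fun y => θ k y * F y) :=
            ((hθc k).continuous.mul hFc).integrable_of_hasCompactSupport (hθs k).mul_right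
          rw [← ofReal_integral_eq_lintegral_ofReal i0 (Eventually.of_forall fun y => mul_nonneg (hθ01 k y).1 (hF0 y))]
          exact ENNReal.ofReal_le_ofReal (hbd k)
      _ = _ := by simp
  have hIntg : Integrable F := ⟨hFc.aestronglyMeasurable, by
    rw [hasFiniteIntegral_iff_ofReal (Eventually.of_forall hF0)]
    exact hl.trans_lt ENNReal.ofReal_lt_top⟩
  refine ⟨hIntg, ?_⟩
  have : ∫ y, F y ≤ M := by
    rw [integral_eq_lintegral_of_nonneg_ae (Eventually.of_forall hF0) hFc.aestronglyMeasurable]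
    exact ENNReal.toReal_le_of_le_ofReal hM0 hl
  refine this.trans ?_
  rw [hM]
  nlinarith [sq_nonneg a]

section gs
variable {f : ℝ → ℝ} {σ A : ℝ} {w : Euc N → ℝ}

/-- The nonlinear increment is a small multiple of the correction plus a localised term. -/
lemma GS.incr (g : GS N f σ A w) {c CU : ℝ} (hc : 0 < c) (hCU : 0 < CU) : ∃ t₀ > 0, ∃ C > 0,
    ∀ (u s t S : ℝ), |u| ≤ CU → |u| ≤ CU * S → |s| ≤ t → t ≤ t₀ →
      |f (u + s) - f u| ≤ c / 4 * |s| + C * t * S := by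
  obtain ⟨C, hC, -, -, -, hL⟩ := g.fb (CU + 1) (by linarith)
  have hd : ∃ d > 0, ∀ x, |x| ≤ d → |deriv f x| ≤ c / 4 := by
    have h := Metric.continuous_iff.1 g.f'c 0 (c / 4) (by linarith)
    obtain ⟨d, hd, h⟩ := h
    refine ⟨d / 2, by linarith, fun x hx => ?_⟩
    have := h x (by rw [Real.dist_eq, sub_zero]; linarith)
    rw [g.f'0, Real.dist_eq, sub_zero] at this
    exact this.le
  obtain ⟨d, hd, hd'⟩ := hd
  refine ⟨min 1 (d / 2), by positivity, 2 * C * CU / d, by positivity, fun u s t S h1 h2 h3 h4 => ?_⟩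
  have ht1 := h4.trans (min_le_left _ _)
  have ht2 := h4.trans (min_le_right _ _)
  have ht0 : 0 ≤ t := (abs_nonneg _).trans h3
  have hS : 0 ≤ S := by
    by_contra hS
    push Not at hS
    have := mul_neg_of_pos_of_neg hCU hS
    linarith [abs_nonneg u]
  rcases le_or_gt |u| (d / 2) with hu | hu
  · have hus : |u + s| ≤ d := (abs_add_le _ _).trans (by linarith)
    have := mv g.fd (a := u) (b := u + s) (m := 0) (K := c / 4) (fun x hx => by
      rw [sub_zero]
      exact hd' x (abs_le_of_mem_uIcc (by linarith) hus hx))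
    rw [zero_mul, sub_zero, add_sub_cancel_left] at this
    have : 0 ≤ 2 * C * CU / d * t * S := by positivity
    linarith
  · have h5 := hL (u + s) u ((abs_add_le _ _).trans (by linarith)) (by linarith)
    rw [add_sub_cancel_left] at h5
    have h6 : d / 2 ≤ CU * S := by linarith
    have h7 : C * t ≤ 2 * C * CU / d * t * S := by
      calc C * t = 2 / d * (C * t) * (d / 2) := by field_simp
        _ ≤ 2 / d * (C * t) * (CU * S) := by gcongr
        _ = _ := by ring
    have h8 : C * |s| ≤ C * t := by gcongr
    have : 0 ≤ c / 4 * |s| := by positivity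
    linarith

/-- Decay and energy of the correction produced by the reduction. -/
lemma GS.energy (g : GS N f σ A w) {c CU K μ₀ : ℝ} (hc : 0 < c) (hCU : 0 < CU) (hK : 0 < K) (hμ₀ : 0 < μ₀)
    (hμ₂ : μ₀ ≤ 1 / 2) (ℓ : ℕ) : ∃ t₀ > 0, ∃ C > 0, ∀ (V : Euc N → ℝ) (T : XX N →L[ℝ] XX N) (Q : Fin ℓ → Euc N)
      (U : Euc N → ℝ) (Y Yt : Fin ℓ → Fin N → Euc N → ℝ) (δ r e : ℝ) (ψ : XX N) (a : Fin ℓ → Fin N → ℝ),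
      δ ≤ 1 → Apx f w c CU δ r V T Q U Y Yt → (∀ y, |U y| ≤ CU * ∑ i, exp (-‖y - Q i‖)) →
      (∀ y, |lap U y - V y * U y + f (U y)| ≤ e * ∑ i, exp (-(μ₀ * ‖y - Q i‖))) → 0 ≤ e →
      ContDiff ℝ 2 ψ → ‖ψ‖ ≤ K * e → K * e ≤ t₀ → (∀ i n, |a i n| ≤ K * e) →
      (∀ y, lap (fun y => U y + ψ y) y - V y * (U y + ψ y) + f (U y + ψ y) = ∑ i, ∑ n, a i n * Yt i n y) →
      Integrable (fun y => ‖fderiv ℝ ψ y‖ ^ 2 + V y * ψ y ^ 2) ∧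
      ∫ y, (‖fderiv ℝ ψ y‖ ^ 2 + V y * ψ y ^ 2) ≤ C * e ^ 2 := by
  obtain ⟨t₀, ht₀, C₁, hC₁, hinc⟩ := g.incr hc hCU
  obtain ⟨C₂, hC₂, hYt⟩ := Apx.Yt_bound g
  set μ := min μ₀ (√c / 2) with hμ
  have hμ0 : 0 < μ := by positivity
  have hμc : μ ^ 2 ≤ c / 4 := by
    have h1 : μ ≤ √c / 2 := min_le_right _ _
    have h2 : μ ^ 2 ≤ (√c / 2) ^ 2 := by gcongr
    rw [div_pow, sq_sqrt hc.le] at h2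
    linarith
  have hμμ : μ ≤ μ₀ := min_le_left _ _
  obtain ⟨C₃, hC₃, hen⟩ := LS.energy N ℓ hμ0
  set B := 1 + C₁ * K + K * N * C₂ with hB
  have hB0 : 0 < B := by positivity
  set a₁ := 2 / c * exp μ * B with ha₁
  have ha₁0 : 0 < a₁ := by positivity
  refine ⟨t₀, ht₀, C₃ * (a₁ + (c / 4 * a₁ + B)) ^ 2, by positivity, ?_⟩
  intro V T Q U Y Yt δ r e ψ a hδ D hU hE he hψ hψe het ha heq
  obtain ⟨hYt1, -⟩ := hYt hδ D
  obtain ⟨-, hV, hV1, -⟩ := D.op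
  set S := fun y => ∑ i, exp (-(μ * ‖y - Q i‖)) with hS
  have hS0 : ∀ y, 0 ≤ S y := fun y => Finset.sum_nonneg fun i _ => (exp_pos _).le
  have hmono : ∀ (b : ℝ) (_ : μ ≤ b) y, ∑ i, exp (-(b * ‖y - Q i‖)) ≤ S y := fun b hb y =>
    Finset.sum_le_sum fun i _ => exp_mono_rate hb _
  have hG : ∀ y, |-lap ψ y + V y * ψ y| ≤ c / 4 * |ψ y| + B * e * S y := fun y => by
    have e1 := heq y
    rw [lap_add D.U2 hψ] at e1
    have e2 : -lap ψ y + V y * ψ y = (lap U y - V y * U y + f (U y)) + (f (U y + ψ y) - f (U y))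
        - ∑ i, ∑ n, a i n * Yt i n y := by rw [← e1]; ring
    have b1 : |lap U y - V y * U y + f (U y)| ≤ e * S y :=
      (hE y).trans (mul_le_mul_of_nonneg_left (hmono _ hμμ y) he)
    have hs1 : ∑ i, exp (-‖y - Q i‖) ≤ S y := by
      have := hmono 1 (by linarith) y
      simpa using this
    have b2 := hinc (U y) (ψ y) (K * e) (S y) (D.Ub y) ((hU y).trans (by gcongr)) ((xabs ψ y).trans hψe) het
    have b3 : |∑ i, ∑ n, a i n * Yt i n y| ≤ K * N * C₂ * e * S y := by
      calc _ ≤ ∑ i, ∑ n, |a i n * Yt i n y| := (Finset.abs_sum_le_sum_abs _ _).trans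
            (Finset.sum_le_sum fun i _ => Finset.abs_sum_le_sum_abs _ _)
        _ ≤ ∑ i, ∑ _n : Fin N, K * e * (C₂ * exp (-(1 / 2 * ‖y - Q i‖))) :=
            Finset.sum_le_sum fun i _ => Finset.sum_le_sum fun n _ => by
              rw [abs_mul]
              exact mul_le_mul (ha i n) (hYt1 i n y) (abs_nonneg _) (by positivity)
        _ = K * N * C₂ * e * ∑ i, exp (-(1 / 2 * ‖y - Q i‖)) := by
            simp only [Finset.sum_const, Finset.card_univ, Fintype.card_fin, nsmul_eq_mul]
            rw [Finset.mul_sum]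
            exact Finset.sum_congr rfl fun i _ => by ring
        _ ≤ _ := mul_le_mul_of_nonneg_left (hmono _ (by linarith) y) (by positivity)
    rw [e2]
    refine (abs_sub _ _).trans ?_
    have b4 := abs_add_le (lap U y - V y * U y + f (U y)) (f (U y + ψ y) - f (U y))
    have : B * e * S y = e * S y + C₁ * (K * e) * S y + K * N * C₂ * e * S y := by rw [hB]; ring
    linarith
  have hdec := decay_abs g.hN hc hμ0.le hμc (by positivity : 0 ≤ B * e) hV hψ (fun y => xabs ψ y) Q hG
  have hdec' : ∀ y, |ψ y| ≤ a₁ * e * S y := fun y => (hdec y).trans (le_of_eq (by rw [ha₁]; ring))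
  have := hen Q V ψ ((a₁ + (c / 4 * a₁ + B)) * e) hV1.continuous (fun y => hc.le.trans (hV y)) hψ (by positivity)
    (fun y => (hdec' y).trans (by
      have : 0 ≤ (c / 4 * a₁ + B) * e * S y := mul_nonneg (by positivity) (hS0 y)
      have e3 : (a₁ + (c / 4 * a₁ + B)) * e * S y = a₁ * e * S y + (c / 4 * a₁ + B) * e * S y := by ring
      rw [e3]; linarith))
    (fun y => (hG y).trans (by
      have h9 := mul_le_mul_of_nonneg_left (hdec' y) (by positivity : 0 ≤ c / 4)
      have : 0 ≤ a₁ * e * S y := mul_nonneg (by positivity) (hS0 y)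
      have e3 : (a₁ + (c / 4 * a₁ + B)) * e * S y = a₁ * e * S y + (c / 4 * (a₁ * e * S y) + B * e * S y) := by ring
      rw [e3]; linarith))
  refine ⟨this.1, this.2.trans (le_of_eq (by ring))⟩

end gs

end LS

namespace LS
open scoped ContDiff BoundedContinuousFunction
variable {N ℓ : ℕ}

section gs
variable {f : ℝ → ℝ} {σ A : ℝ} {w : Euc N → ℝ} {χ V : Euc N → ℝ}

lemma Ff_unscale {ε : ℝ} (hε : ε ≠ 0) (P : Euc N) :
    (fun z => χ z * w (ε⁻¹ • (z - P))) = fun z => Ff χ w ε (ε⁻¹ • P) (ε⁻¹ • z) := by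
  funext z
  rw [Ff, smul_inv_smul₀ hε, smul_sub]

lemma Uf_unscale {ε : ℝ} (hε : ε ≠ 0) (τ : Fin ℓ → ℝ) (P : Fin ℓ → Euc N) (x : Euc N) :
    χ x * (∑ i, τ i * w (ε⁻¹ • (x - P i))) = Uf χ w τ ε (fun i => ε⁻¹ • P i) (ε⁻¹ • x) := by
  rw [Uf, Finset.mul_sum]
  refine Finset.sum_congr rfl fun i _ => ?_
  rw [← congrFun (Ff_unscale (χ := χ) (w := w) hε (P i)) x]
  ring

lemma Zf_unscale (g : GS N f σ A w) (hχ : ContDiff ℝ ∞ χ) {ε : ℝ} (hε : ε ≠ 0) (P : Euc N) (n : Fin N) (x : Euc N) :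
    V x * lineDeriv ℝ (fun y => χ y * w (ε⁻¹ • (y - P))) x (EuclideanSpace.single n 1)
      - ε ^ 2 * lap (fun y => lineDeriv ℝ (fun z => χ z * w (ε⁻¹ • (z - P))) y (EuclideanSpace.single n 1)) x
    = ε⁻¹ * Ytf V χ w ε (ε⁻¹ • P) n (ε⁻¹ • x) := by
  have hF := Ff_c2 g hχ ε (ε⁻¹ • P)
  have hY := Yf_c2 g hχ ε (ε⁻¹ • P) n
  have e : (fun y => lineDeriv ℝ (fun z => χ z * w (ε⁻¹ • (z - P))) y (EuclideanSpace.single n 1))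
      = fun y => ε⁻¹ * Yf χ w ε (ε⁻¹ • P) n (ε⁻¹ • y) := by
    rw [Ff_unscale hε, lineDeriv_fun_eq (dif2 (c_smul hF _)), pd_smul (dif2 hF)]
    rfl
  rw [congrFun e x, e, lap_cmul (c_smul hY _), lap_smul hY, Ytf, smul_inv_smul₀ hε]
  field_simp

/-- Undoing the scaling. -/
lemma unscale (g : GS N f σ A w) (hχ : ContDiff ℝ ∞ χ) {ε c : ℝ} (hε : 0 < ε) (hc : 0 < c) (hVc : Continuous V)
    (hV : ∀ x, c ≤ V x)
    (τ : Fin ℓ → ℝ) (P : Fin ℓ → Euc N) (ψ : Euc N → ℝ) (a : Fin ℓ → Fin N → ℝ) (hψ : ContDiff ℝ 2 ψ)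
    (hU2 : ContDiff ℝ 2 (Uf χ w τ ε fun i => ε⁻¹ • P i))
    (horth : ∀ i n, ∫ y, ψ y * Ytf V χ w ε (ε⁻¹ • P i) n y = 0)
    (heq : ∀ y, lap (fun y => Uf χ w τ ε (fun i => ε⁻¹ • P i) y + ψ y) y
      - V (ε • y) * (Uf χ w τ ε (fun i => ε⁻¹ • P i) y + ψ y)
      + f (Uf χ w τ ε (fun i => ε⁻¹ • P i) y + ψ y) = ∑ i, ∑ n, a i n * Ytf V χ w ε (ε⁻¹ • P i) n y)
    (hIntg : Integrable (fun y => ‖fderiv ℝ ψ y‖ ^ 2 + V (ε • y) * ψ y ^ 2)) :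
    ContDiff ℝ 2 (fun x => ψ (ε⁻¹ • x)) ∧
    Integrable (fun x => (ψ (ε⁻¹ • x)) ^ 2) ∧
    Integrable (fun x => ‖fderiv ℝ (fun x => ψ (ε⁻¹ • x)) x‖ ^ 2) ∧
    (∀ x : Euc N,
          ε ^ 2 * lap (fun y => χ y * (∑ i, τ i * w (ε⁻¹ • (y - P i))) + ψ (ε⁻¹ • y)) x
            - V x * (χ x * (∑ i, τ i * w (ε⁻¹ • (x - P i))) + ψ (ε⁻¹ • x))
            + f (χ x * (∑ i, τ i * w (ε⁻¹ • (x - P i))) + ψ (ε⁻¹ • x))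
          = ∑ i, ∑ n, ε * a i n *
              (V x * lineDeriv ℝ (fun y => χ y * w (ε⁻¹ • (y - P i))) x
                  (EuclideanSpace.single n 1)
                - ε ^ 2 * lap (fun y => lineDeriv ℝ
                    (fun z => χ z * w (ε⁻¹ • (z - P i))) y
                    (EuclideanSpace.single n 1)) x)) ∧
    (∀ i n, ∫ x : Euc N, ψ (ε⁻¹ • x) *
            (V x * lineDeriv ℝ (fun y => χ y * w (ε⁻¹ • (y - P i))) x
                (EuclideanSpace.single n 1)
              - ε ^ 2 * lap (fun y => lineDeriv ℝ
                  (fun z => χ z * w (ε⁻¹ • (z - P i))) y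
                  (EuclideanSpace.single n 1)) x) = 0) ∧
    (∫ x : Euc N, (ε ^ 2 * ‖fderiv ℝ (fun x => ψ (ε⁻¹ • x)) x‖ ^ 2 + V x * (ψ (ε⁻¹ • x)) ^ 2))
      = ε ^ (N : ℝ) * ∫ y, (‖fderiv ℝ ψ y‖ ^ 2 + V (ε • y) * ψ y ^ 2) := by
  have hε0 := hε.ne'
  have hεi : ε⁻¹ ≠ 0 := inv_ne_zero hε0
  have hgrad : ∀ x, ‖fderiv ℝ (fun x => ψ (ε⁻¹ • x)) x‖ ^ 2 = ε⁻¹ ^ 2 * ‖fderiv ℝ ψ (ε⁻¹ • x)‖ ^ 2 := fun x => by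
    rw [norm_fderiv_sq, norm_fderiv_sq, Finset.mul_sum]
    refine Finset.sum_congr rfl fun n _ => ?_
    rw [pd_smul (dif2 hψ)]
    ring
  have hgc : Continuous (fun y => ‖fderiv ℝ ψ y‖ ^ 2) := by
    simp only [norm_fderiv_sq]
    exact continuous_finsetSum _ fun n _ => (c0_pd (c21 hψ) n).pow 2
  have hV' : ∀ y, c * ψ y ^ 2 ≤ V (ε • y) * ψ y ^ 2 := fun y => mul_le_mul_of_nonneg_right (hV _) (sq_nonneg _)
  have hcψ : ∀ y, 0 ≤ c * ψ y ^ 2 := fun y => by positivity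
  have i1 : Integrable (fun y => ‖fderiv ℝ ψ y‖ ^ 2) := by
    refine hIntg.mono' hgc.aestronglyMeasurable (Eventually.of_forall fun y => ?_)
    rw [Real.norm_eq_abs, abs_of_nonneg (by positivity)]
    linarith [hV' y, hcψ y]
  have i2 : Integrable (fun y => ψ y ^ 2) := by
    refine (hIntg.const_mul c⁻¹).mono' (hψ.continuous.pow 2).aestronglyMeasurable (Eventually.of_forall fun y => ?_)
    rw [Real.norm_eq_abs, abs_of_nonneg (by positivity)]
    have h1 : c * ψ y ^ 2 ≤ ‖fderiv ℝ ψ y‖ ^ 2 + V (ε • y) * ψ y ^ 2 := by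
      have := sq_nonneg ‖fderiv ℝ ψ y‖
      linarith [hV' y]
    calc ψ y ^ 2 = c⁻¹ * (c * ψ y ^ 2) := by field_simp
      _ ≤ _ := by gcongr
  refine ⟨c_smul hψ _, i2.comp_smul hεi, ?_, fun x => ?_, fun i n => ?_, ?_⟩
  · simp only [hgrad]
    exact (i1.comp_smul hεi).const_mul _
  · simp only [Zf_unscale g hχ hε0, Uf_unscale hε0]
    have hS : ContDiff ℝ 2 (fun y => Uf χ w τ ε (fun i => ε⁻¹ • P i) y + ψ y) := hU2.add hψ
    have e1 := lap_smul hS ε⁻¹ x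
    have e2 := heq (ε⁻¹ • x)
    rw [smul_inv_smul₀ hε0] at e2
    rw [e1, inv_pow, mul_inv_cancel_left₀ (pow_ne_zero 2 hε0), e2]
    refine Finset.sum_congr rfl fun i _ => Finset.sum_congr rfl fun n _ => ?_
    field_simp
  · simp only [Zf_unscale g hχ hε0]
    have := Measure.integral_comp_smul (volume : Measure (Euc N))
      (fun y => ψ y * (ε⁻¹ * Ytf V χ w ε (ε⁻¹ • P i) n y)) ε⁻¹
    rw [this]
    have e3 : ∫ y, ψ y * (ε⁻¹ * Ytf V χ w ε (ε⁻¹ • P i) n y) = ε⁻¹ * ∫ y, ψ y * Ytf V χ w ε (ε⁻¹ • P i) n y := by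
      rw [← integral_const_mul]
      congr 1
      funext y
      ring
    rw [e3, horth, mul_zero, smul_zero]
  · have := Measure.integral_comp_smul (volume : Measure (Euc N))
      (fun y => ‖fderiv ℝ ψ y‖ ^ 2 + V (ε • y) * ψ y ^ 2) ε⁻¹
    have e4 : (fun x : Euc N => ε ^ 2 * ‖fderiv ℝ (fun x => ψ (ε⁻¹ • x)) x‖ ^ 2 + V x * (ψ (ε⁻¹ • x)) ^ 2)
        = fun x => ‖fderiv ℝ ψ (ε⁻¹ • x)‖ ^ 2 + V (ε • ε⁻¹ • x) * ψ (ε⁻¹ • x) ^ 2 := by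
      funext x
      rw [hgrad, smul_inv_smul₀ hε0]
      field_simp
    rw [e4, this, finrank_euclideanSpace_fin, smul_eq_mul, inv_pow, inv_inv, abs_of_pos (by positivity), rpow_natCast]

end gs

/-- The main theorem in terms of the bundled ground state data. -/
lemma main {f : ℝ → ℝ} {σ A : ℝ} {w : Euc N → ℝ} {χ V : Euc N → ℝ} (g : GS N f σ A w) (hV_C2 : ContDiff ℝ 2 V)
    (hV_pos : ∃ c > 0, ∀ x, c ≤ V x) (hV0 : V 0 = 1) (hV_crit : fderiv ℝ V 0 = 0)
    (lam : Fin N → ℝ) (hlam : ∀ n, lam n ≠ 0) (hℓ : 2 ≤ ℓ)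
    (τ : Fin ℓ → ℝ) (hτ : ∀ i, τ i = 1 ∨ τ i = -1) {β : ℝ} (hβ0 : 0 < β) (hβ1 : β < 1)
    (hχ : ContDiff ℝ ∞ χ) (hχ_supp : HasCompactSupport χ)
    (hχ_range : ∀ x, χ x ∈ Icc (0 : ℝ) 1) (hχ_one : ∀ x : Euc N, ‖x‖ < 1 → χ x = 1) :
    ∃ C > (0 : ℝ), ∃ ε₀ > (0 : ℝ), ∀ ε ∈ Ioo (0 : ℝ) ε₀, ∀ P : Fin ℓ → Euc N,
      (∀ i, ∑ n, |lam n| * (P i n) ^ 2 < ε ^ (2 * β)) →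
      (∀ i j, i ≠ j → w (ε⁻¹ • (P i - P j)) < ε ^ (2 * β)) →
      ∃ (φ : Euc N → ℝ) (α : Fin ℓ → Fin N → ℝ),
        ContDiff ℝ 2 φ ∧
        Integrable (fun x => (φ x) ^ 2) ∧
        Integrable (fun x => ‖fderiv ℝ φ x‖ ^ 2) ∧
        (∀ x : Euc N,
          ε ^ 2 * lap (fun y => χ y * (∑ i, τ i * w (ε⁻¹ • (y - P i))) + φ y) x
            - V x * (χ x * (∑ i, τ i * w (ε⁻¹ • (x - P i))) + φ x)
            + f (χ x * (∑ i, τ i * w (ε⁻¹ • (x - P i))) + φ x)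
          = ∑ i, ∑ n, α i n *
              (V x * lineDeriv ℝ (fun y => χ y * w (ε⁻¹ • (y - P i))) x
                  (EuclideanSpace.single n 1)
                - ε ^ 2 * lap (fun y => lineDeriv ℝ
                    (fun z => χ z * w (ε⁻¹ • (z - P i))) y
                    (EuclideanSpace.single n 1)) x)) ∧
        (∀ i n, ∫ x : Euc N, φ x *
            (V x * lineDeriv ℝ (fun y => χ y * w (ε⁻¹ • (y - P i))) x
                (EuclideanSpace.single n 1)
              - ε ^ 2 * lap (fun y => lineDeriv ℝ
                  (fun z => χ z * w (ε⁻¹ • (z - P i))) y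
                  (EuclideanSpace.single n 1)) x) = 0) ∧
        (∀ x, |φ x| ≤ C * ε ^ (β ^ 2 * (1 + σ))) ∧
        ((∫ x : Euc N, (ε ^ 2 * ‖fderiv ℝ φ x‖ ^ 2 + V x * (φ x) ^ 2))
          ≤ C * ε ^ ((N : ℝ) + 2 * (β ^ 2 * (1 + σ)))) ∧
        (∀ i n, |α i n| ≤ C * ε ^ (1 + β ^ 2 * (1 + σ))) := by
  obtain ⟨c, hc, hV⟩ := hV_pos
  obtain ⟨C₁, hC₁, hVt⟩ := V_taylor hV_C2 hV0 hV_crit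
  obtain ⟨CP, hCP, hP⟩ := P_small hlam
  obtain ⟨R, m, d, h, M⟩ := g.mod_exists
  have hℓ0 : 0 < ℓ := by omega
  obtain ⟨CU, hCU, CE, hCE, μ₀, hμ₀, hμ₂, -, hUe, happ⟩ :=
    g.approx hχ hχ_supp hχ_range hχ_one hV_C2.continuous hC₁ hCP hVt hβ0 hβ1 hℓ0 hτ
  obtain ⟨δ₁, hδ₁, hδ1, r₁, hr₁, D₁, K, hK, κ₁, hκ₁, hcore⟩ := M.core g ℓ hc hCU
  have hℓr : (0:ℝ) < ℓ := by exact_mod_cast hℓ0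
  obtain ⟨t₀, ht₀, C₄, hC₄, hener⟩ := g.energy hc hCU (by positivity : 0 < K * ℓ) hμ₀ hμ₂ ℓ
  set η := β ^ 2 * (1 + σ) with hη
  have hη0 : 0 < η := by have := g.σ0; positivity
  have ev := (happ c δ₁ r₁ D₁ hδ₁).and ((eps_small hη0 (by positivity : 0 < CE * ℓ) hκ₁).and
    (eps_small hη0 (by positivity : 0 < K * ℓ * CE) ht₀))
  obtain ⟨ε₀, hε₀, hsub⟩ := mem_nhdsGT_iff_exists_Ioo_subset.1 ev
  refine ⟨K * ℓ * CE + C₄ * CE ^ 2, by positivity, ε₀, hε₀, fun ε hε P hP1 hP2 => ?_⟩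
  have h0 : 0 < ε := hε.1
  obtain ⟨h1, h2, h3⟩ := hsub hε
  have hee : 0 < ε ^ η := rpow_pos_of_pos h0 _
  obtain ⟨hA, hD, hEr⟩ := h1 (fun i => ε⁻¹ • P i) (fun i => by
      rw [smul_inv_smul₀ h0.ne']
      exact hP ε β (P i) h0 (hP1 i)) (fun i j hij => by
      rw [← smul_sub]
      exact hP2 i j hij)
  obtain ⟨T, hT⟩ := op_exists g.hN hc (c_smul (c21 hV_C2) ε) (fun y => hV (ε • y))
  have D := hA T hT
  obtain ⟨ψ, a, hψ, -, hψK, haK, horth, heq⟩ := hcore _ T _ _ _ _ (CE * ℓ * ε ^ η) D hD h2 (fun y => by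
    refine (hEr y).trans ?_
    have : ∑ i, exp (-(μ₀ * ‖y - ε⁻¹ • P i‖)) ≤ ℓ := by
      calc _ ≤ ∑ _i : Fin ℓ, (1:ℝ) := Finset.sum_le_sum fun i _ => exp_le_one_iff.2 (by
            have := mul_nonneg hμ₀.le (norm_nonneg (y - ε⁻¹ • P i))
            linarith)
        _ = ℓ := by simp
    calc _ ≤ CE * ε ^ η * ℓ := mul_le_mul_of_nonneg_left this (by positivity)
      _ = _ := by ring)
  have hKe : K * (CE * ℓ * ε ^ η) = K * ℓ * (CE * ε ^ η) := by ring
  rw [hKe] at hψK haK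
  obtain ⟨hIntg, hib⟩ := hener _ T _ _ _ _ δ₁ r₁ (CE * ε ^ η) ψ a hδ1 D (fun y => hUe _ _ y) hEr (by positivity) hψ hψK
    (by linarith) haK heq
  obtain ⟨r1, r2, r3, r4, r5, r6⟩ := unscale g hχ h0 hc hV_C2.continuous hV τ P ψ a hψ D.U2 horth heq hIntg
  refine ⟨fun x => ψ (ε⁻¹ • x), fun i n => ε * a i n, r1, r2, r3, r4, r5, fun x => ?_, ?_, fun i n => ?_⟩
  · refine (xabs ψ _).trans (hψK.trans ?_)
    have : 0 ≤ C₄ * CE ^ 2 * ε ^ η := by positivity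
    linarith
  · rw [r6, rpow_add h0]
    have e1 : ε ^ (2 * η) = (ε ^ η) ^ 2 := eps_sq h0
    rw [e1]
    calc _ ≤ ε ^ (N:ℝ) * (C₄ * (CE * ε ^ η) ^ 2) := mul_le_mul_of_nonneg_left hib (by positivity)
      _ = C₄ * CE ^ 2 * (ε ^ (N:ℝ) * (ε ^ η) ^ 2) := by ring
      _ ≤ _ := by
        refine mul_le_mul_of_nonneg_right ?_ (by positivity)
        have : 0 ≤ K * ℓ * CE := by positivity
        linarith
  · rw [abs_mul, abs_of_pos h0, rpow_add h0, rpow_one]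
    calc _ ≤ ε * (K * ℓ * (CE * ε ^ η)) := mul_le_mul_of_nonneg_left (haK i n) h0.le
      _ = K * ℓ * CE * (ε * ε ^ η) := by ring
      _ ≤ _ := by
        refine mul_le_mul_of_nonneg_right ?_ (by positivity)
        have : 0 ≤ C₄ * CE ^ 2 := by positivity
        linarith

end LS

theorem lyapunov_schmidt_reduction
    (N : ℕ) (hN : 2 ≤ N)
    -- the nonlinearity f
    (f : ℝ → ℝ) (σ p : ℝ)
    (hσ : Real.sqrt 2 - 1 < σ ∧ σ < 1)
    (hf_odd : ∀ t, f (-t) = - f t)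
    (hf0 : f 0 = 0) (hf'0 : deriv f 0 = 0)
    (hf_C1 : ContDiff ℝ 1 f)
    (hf_holder : ∀ R > 0, ∃ C > 0, ∀ s t : ℝ, |s| ≤ R → |t| ≤ R →
      |deriv f s - deriv f t| ≤ C * |s - t| ^ σ)
    (hp : 2 < p) (hpN : 3 ≤ N → p < 2 * N / (N - 2))
    (hf_growth : (fun t => f t) =O[atTop] fun t => t ^ (p - 1))
    -- the ground state w
    (w : Euc N → ℝ)
    (hw_pos : ∀ x, 0 < w x) (hw_C2 : ContDiff ℝ 2 w)
    (hw_eq : ∀ x, lap w x - w x + f (w x) = 0)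
    (hw_decay : Tendsto w (Filter.comap norm atTop) (nhds 0))
    (W : ℝ → ℝ) (hwW : ∀ x, w x = W ‖x‖)
    (hW_anti : StrictAntiOn W (Ici 0))
    (A : ℝ) (hA : 0 < A)
    (hw_asym : Tendsto (fun x : Euc N =>
        w x * ‖x‖ ^ (((N : ℝ) - 1) / 2) * Real.exp ‖x‖) (Filter.comap norm atTop) (nhds A))
    (hw_nondeg : ∀ u : Euc N → ℝ, ContDiff ℝ 2 u →
      (∃ C, ∀ x, |u x| ≤ C) → Tendsto u (Filter.comap norm atTop) (nhds 0) →
      (∀ x, lap u x - u x + deriv f (w x) * u x = 0) →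
      ∃ c : Fin N → ℝ, ∀ x, u x = ∑ n, c n * lineDeriv ℝ w x (EuclideanSpace.single n 1))
    -- the potential V
    (V : Euc N → ℝ) (hV_C2 : ContDiff ℝ 2 V)
    (hV_pos : ∃ c > 0, ∀ x, c ≤ V x)
    (hV0 : V 0 = 1) (hV_crit : fderiv ℝ V 0 = 0)
    (lam : Fin N → ℝ) (hlam : ∀ n, lam n ≠ 0)
    (hV_hess : ∀ u v : Euc N,
      fderiv ℝ (fun x => fderiv ℝ V x v) 0 u = ∑ n, lam n * u n * v n)
    -- number of peaks, signs, and the exponent β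
    (ℓ : ℕ) (hℓ : 2 ≤ ℓ)
    (τ : Fin ℓ → ℝ) (hτ : ∀ i, τ i = 1 ∨ τ i = -1)
    (β : ℝ) (hβ : σ < β ∧ β < 1)
    -- the cut-off function χ
    (χ : Euc N → ℝ) (hχ_smooth : ContDiff ℝ (⊤ : ℕ∞) χ) (hχ_supp : HasCompactSupport χ)
    (hχ_range : ∀ x, χ x ∈ Icc (0 : ℝ) 1) (hχ_one : ∀ x : Euc N, ‖x‖ < 1 → χ x = 1) :
    ∃ C > (0 : ℝ), ∃ ε₀ > (0 : ℝ), ∀ ε ∈ Ioo (0 : ℝ) ε₀, ∀ P : Fin ℓ → Euc N,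
      (∀ i, ∑ n, |lam n| * (P i n) ^ 2 < ε ^ (2 * β)) →
      (∀ i j, i ≠ j → w (ε⁻¹ • (P i - P j)) < ε ^ (2 * β)) →
      ∃ (φ : Euc N → ℝ) (α : Fin ℓ → Fin N → ℝ),
        ContDiff ℝ 2 φ ∧
        Integrable (fun x => (φ x) ^ 2) ∧
        Integrable (fun x => ‖fderiv ℝ φ x‖ ^ 2) ∧
        -- (a) the equation, with right-hand side spanned by the Z's
        (∀ x : Euc N,
          ε ^ 2 * lap (fun y => χ y * (∑ i, τ i * w (ε⁻¹ • (y - P i))) + φ y) x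
            - V x * (χ x * (∑ i, τ i * w (ε⁻¹ • (x - P i))) + φ x)
            + f (χ x * (∑ i, τ i * w (ε⁻¹ • (x - P i))) + φ x)
          = ∑ i, ∑ n, α i n *
              (V x * lineDeriv ℝ (fun y => χ y * w (ε⁻¹ • (y - P i))) x
                  (EuclideanSpace.single n 1)
                - ε ^ 2 * lap (fun y => lineDeriv ℝ
                    (fun z => χ z * w (ε⁻¹ • (z - P i))) y
                    (EuclideanSpace.single n 1)) x)) ∧
        -- (b) orthogonality
        (∀ i n, ∫ x : Euc N, φ x *
            (V x * lineDeriv ℝ (fun y => χ y * w (ε⁻¹ • (y - P i))) x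
                (EuclideanSpace.single n 1)
              - ε ^ 2 * lap (fun y => lineDeriv ℝ
                  (fun z => χ z * w (ε⁻¹ • (z - P i))) y
                  (EuclideanSpace.single n 1)) x) = 0) ∧
        -- (c) uniform smallness
        (∀ x, |φ x| ≤ C * ε ^ (β ^ 2 * (1 + σ))) ∧
        -- (d) smallness in the weighted energy norm
        ((∫ x : Euc N, (ε ^ 2 * ‖fderiv ℝ φ x‖ ^ 2 + V x * (φ x) ^ 2))
          ≤ C * ε ^ ((N : ℝ) + 2 * (β ^ 2 * (1 + σ)))) ∧
        -- (e) smallness of the multipliers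
        (∀ i n, |α i n| ≤ C * ε ^ (1 + β ^ 2 * (1 + σ))) := by
  have h2 : (1:ℝ) < Real.sqrt 2 := Real.lt_sqrt_of_sq_lt (by norm_num)
  have hσ0 : 0 < σ := by linarith [hσ.1]
  have g : LS.GS N f σ A w := ⟨by omega, hσ0, hσ.2, hf_odd, hf0, hf'0, hf_C1, hf_holder, hw_pos, hw_C2, hw_eq, hA,
    hw_asym, hw_nondeg⟩
  exact LS.main g hV_C2 hV_pos hV0 hV_crit lam hlam hℓ τ hτ (hσ0.trans hβ.1) hβ.2 hχ_smooth hχ_supp hχ_range hχ_one
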